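/- There exist constants c > 0, C ≥ 1, ε > 0 and N₀ (depending only on h and the choice of the roots z_p) such that the following holds. Let N ≥ N₀ be an integer, let d ≤ N^ρ be a positive integer, and let A ⊆ {1,…,N} be h_d-free with density σ = |A|/N ≥ (log N)^{−ε·log log log N}. Set ν = (log N)^{−1/2}·exp( −c·log(1/σ)/log log(1/σ) ). Then there exist a positive integer N* ≥ c·σ^C·N/(log N)^{1/2}, an integer q with 1 ≤ q ≤ C·σ^{−C}, and an h_{qd}-free subset A* ⊆ {1,…,N*} whose density σ* = |A*|/N* satisfies σ* ≥ (1 + ν/73)·σ. -/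

import Mathlib

open Finset

theorem vin_small (e X : ℕ) (hX : 2 ≤ X) : 4 * X ^ e ≤ X ^ (e+2) := by
  rw [pow_add, mul_comm]; exact Nat.mul_le_mul_left _ (by nlinarith)

/-- two elements of the fibre far apart -/
theorem exists_far (G : Finset ℕ) (hG : G.Nonempty) :
    ∃ a ∈ G, ∃ b ∈ G, a ≤ b ∧ G.card ≤ b - a + 1 := by
  refine ⟨G.min' hG, G.min'_mem hG, G.max' hG, G.max'_mem hG, G.min'_le_max' hG, ?_⟩
  have : G ⊆ Finset.Icc (G.min' hG) (G.max' hG) := fun x hx =>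
    Finset.mem_Icc.2 ⟨G.min'_le x hx, G.le_max' x hx⟩
  have h2 := Finset.card_le_card this
  rw [Nat.card_Icc] at h2
  have := G.min'_le_max' hG
  omega

theorem vinogradov (e : ℕ) : ∃ E : ℕ, ∀ X : ℕ, 2 ≤ X → ∀ M : ℕ, 1 ≤ M → ∀ φ κ : ℝ,
    ∀ G : Finset ℕ, G ⊆ Finset.Ico 1 M → M ≤ X ^ e * G.card →
    (∀ h ∈ G, ∃ a : ℤ, |φ * h - a| ≤ κ) → κ * M ≤ X ^ e →
    ∃ q : ℕ, 1 ≤ q ∧ q ≤ X ^ E ∧ ∃ a : ℤ, |q * φ - a| * M ≤ X ^ E * κ := by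
  refine ⟨4 * e + 20, ?_⟩
  intro X hX M hM φ κ G hG hcard hgood hκM
  have hX1 : 1 ≤ X := by omega
  have hXR : (2:ℝ) ≤ X := by exact_mod_cast hX
  have hGne : G.Nonempty := by
    rw [← Finset.card_pos]; by_contra hh
    have : G.card = 0 := by omega
    rw [this] at hcard; omega
  have hκ0 : 0 ≤ κ := by
    obtain ⟨h, hh⟩ := hGne
    obtain ⟨a, ha⟩ := hgood h hh
    exact (abs_nonneg _).trans ha
  have hMR : (1:ℝ) ≤ M := by exact_mod_cast hM
  have hpw : ∀ {i j : ℕ}, i ≤ j → (X:ℝ)^i ≤ (X:ℝ)^j := fun h => pow_le_pow_right₀ (by linarith) h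
  have hpwN : ∀ {i j : ℕ}, i ≤ j → X^i ≤ X^j := fun h => Nat.pow_le_pow_right (by omega) h
  by_cases hMs : M ≤ X ^ (3 * e + 12)
  · obtain ⟨h, hh⟩ := hGne
    obtain ⟨a, ha⟩ := hgood h hh
    have h1 := Finset.mem_Ico.1 (hG hh)
    refine ⟨h, h1.1, (h1.2.le.trans hMs).trans (hpwN (by omega)), a, ?_⟩
    rw [mul_comm (h:ℝ) φ, mul_comm]
    apply mul_le_mul _ ha (abs_nonneg _) (by positivity)
    calc (M:ℝ) ≤ ((X ^ (3*e+12) : ℕ) : ℝ) := by exact_mod_cast hMs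
      _ ≤ _ := by push_cast; exact hpw (by omega)
  push Not at hMs
  -- first pigeonhole
  have hXe := vin_small e X hX
  have hXe0 : 1 ≤ X ^ e := Nat.one_le_pow _ _ (by omega)
  obtain ⟨x, hx, y, hy, hxy, hlt⟩ : ∃ x ∈ G, ∃ y ∈ G, x < y ∧ y - x ≤ X ^ (e+2) := by
    have hmap : ∀ h ∈ G, h / X ^ (e+2) ∈ Finset.range (M / X ^ (e+2) + 1) := by
      intro h hh
      have h1 := Finset.mem_Ico.1 (hG hh)
      exact Finset.mem_range.2 (Nat.lt_succ_of_le (Nat.div_le_div_right h1.2.le))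
    have hc : (Finset.range (M / X ^ (e+2) + 1)).card < G.card := by
      rw [Finset.card_range]
      have h2 : M / X ^ (e+2) * (4 * X ^ e) ≤ M :=
        (Nat.mul_le_mul_left _ hXe).trans (Nat.div_mul_le_self _ _)
      have h3 : X ^ (e + 2) ≤ X ^ (3*e+12) := hpwN (by omega)
      by_contra hcon
      push Not at hcon
      have h4 : X ^ e * G.card ≤ X ^ e * (M / X ^ (e+2) + 1) := Nat.mul_le_mul_left _ hcon
      nlinarith
    obtain ⟨x, hx, y, hy, hne, heq⟩ := Finset.exists_ne_map_eq_of_card_lt_of_maps_to hc hmap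
    have hpos : 0 < X ^ (e+2) := by positivity
    rcases lt_or_gt_of_ne hne with hl | hl
    · refine ⟨x, hx, y, hy, hl, ?_⟩
      have h1 := Nat.div_add_mod x (X^(e+2))
      have h2 := Nat.div_add_mod y (X^(e+2))
      have h3 := Nat.mod_lt y hpos
      rw [heq] at h1
      generalize x % X^(e+2) = s1 at *
      generalize y % X^(e+2) = s2 at *
      omega
    · refine ⟨y, hy, x, hx, hl, ?_⟩
      have h1 := Nat.div_add_mod x (X^(e+2))
      have h2 := Nat.div_add_mod y (X^(e+2))
      have h3 := Nat.mod_lt x hpos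
      rw [heq] at h1
      generalize x % X^(e+2) = s1 at *
      generalize y % X^(e+2) = s2 at *
      omega
  obtain ⟨q, hq⟩ : ∃ q, q = y - x := ⟨_, rfl⟩
  have hq1 : 1 ≤ q := by omega
  have hqX : q ≤ X ^ (e+2) := by omega
  choose! av hav using hgood
  set a : ℤ := av y - av x with ha
  have hγ : |(q:ℝ) * φ - a| ≤ 2 * κ := by
    have e1 : (q:ℝ) * φ - a = (φ * y - av y) - (φ * x - av x) := by
      rw [hq, Nat.cast_sub hxy.le, ha]; push_cast; ring
    rw [e1]
    exact (abs_sub _ _).trans (by linarith [hav x hx, hav y hy])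
  have hqR : (q:ℝ) ≤ (X:ℝ)^(e+2) := by exact_mod_cast hqX
  have hκ1 : κ ≤ X ^ e := le_trans (by nlinarith) hκM
  set T : ℕ := X ^ (2*e+4) with hT
  have hTb : ∀ h ∈ G, (q:ℤ) * av h - a * h ∈ Finset.Icc (-(T:ℤ)) T := by
    intro h hh
    have h1 := Finset.mem_Ico.1 (hG hh)
    have hhM : (h:ℝ) ≤ M := by exact_mod_cast h1.2.le
    have e1 : (((q:ℤ) * av h - a * h : ℤ) : ℝ) = h * (q * φ - a) - q * (φ * h - av h) := by
      push_cast; ring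
    have b1 : |(((q:ℤ) * av h - a * h : ℤ) : ℝ)| ≤ T := by
      rw [e1]
      have t1 : |(h:ℝ) * (q * φ - a)| ≤ 2 * X ^ e := by
        rw [abs_mul, Nat.abs_cast]
        calc (h:ℝ) * |q * φ - a| ≤ M * (2 * κ) := by
              apply mul_le_mul hhM hγ (abs_nonneg _) (by positivity)
          _ ≤ _ := by linarith
      have t2 : |(q:ℝ) * (φ * h - av h)| ≤ X ^ (e+2) * X ^ e := by
        rw [abs_mul, Nat.abs_cast]
        exact mul_le_mul hqR ((hav h hh).trans hκ1) (abs_nonneg _) (by positivity)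
      have t3 : 2 * (X:ℝ) ^ e + X ^ (e+2) * X ^ e ≤ X ^ (2*e+4) := by
        have : (X:ℝ)^(2*e+4) = X^e * X^e * (X*X) * (X*X) := by ring
        rw [this]
        have : (X:ℝ)^(e+2) * X^e = X^e * X^e * (X*X) := by ring
        rw [this]
        have g1 : (1:ℝ) ≤ X^e := one_le_pow₀ (by linarith)
        have g2 : (4:ℝ) ≤ X * X := by nlinarith
        have g3 : (X:ℝ)^e ≤ X^e * X^e * (X*X) := by nlinarith [mul_nonneg (by linarith : (0:ℝ) ≤ X^e) (by linarith : (0:ℝ) ≤ X^e)]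
        nlinarith [mul_nonneg (by linarith : (0:ℝ) ≤ X^e) (by linarith : (0:ℝ) ≤ X^e)]
      refine (abs_sub _ _).trans ?_
      rw [hT]; push_cast; linarith
    rw [← Int.cast_abs] at b1
    have b2 : |(q:ℤ) * av h - a * h| ≤ T := by exact_mod_cast b1
    exact Finset.mem_Icc.2 (abs_le.1 b2)
  -- second pigeonhole
  obtain ⟨t, ht, hfib⟩ : ∃ t ∈ Finset.Icc (-(T:ℤ)) T,
      G.card ≤ (2*T+1) * (G.filter (fun h => (q:ℤ) * av h - a * h = t)).card := by
    by_contra hcon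
    push Not at hcon
    have h1 := Finset.card_eq_sum_card_fiberwise hTb
    have h2 : ∑ t ∈ Finset.Icc (-(T:ℤ)) T, (2*T+1) * (G.filter (fun h => (q:ℤ) * av h - a * h = t)).card < ∑ t ∈ Finset.Icc (-(T:ℤ)) T, G.card :=
      Finset.sum_lt_sum_of_nonempty ⟨0, Finset.mem_Icc.2 (by constructor <;> omega)⟩ hcon
    rw [← Finset.mul_sum, Finset.sum_const, ← h1, Int.card_Icc] at h2
    have : ((T:ℤ) + 1 - -(T:ℤ)).toNat = 2*T+1 := by omega
    rw [this, smul_eq_mul] at h2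
    exact lt_irrefl _ h2
  set F := G.filter (fun h => (q:ℤ) * av h - a * h = t)
  have hT2 : 2 * T + 1 ≤ X ^ (2*e+6) := by
    have := vin_small (2*e+4) X hX
    have hT1 : 1 ≤ T := Nat.one_le_pow _ _ (by omega)
    have e1 : 2*e+6 = 2*e+4+2 := by ring
    rw [e1]; omega
  have hMF : M ≤ X ^ (3*e+6) * F.card := by
    calc M ≤ X ^ e * G.card := hcard
      _ ≤ X ^ e * ((2*T+1) * F.card) := Nat.mul_le_mul_left _ hfib
      _ ≤ X ^ e * (X ^ (2*e+6) * F.card) := by gcongr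
      _ = _ := by ring
  have hFne : F.Nonempty := by
    rw [← Finset.card_pos]; by_contra hh
    have : F.card = 0 := by omega
    rw [this] at hMF; omega
  obtain ⟨u, hu, v, hv, huv, hfar⟩ := exists_far F hFne
  have hu' := Finset.mem_filter.1 hu
  have hv' := Finset.mem_filter.1 hv
  have hdist : M ≤ 2 * X ^ (3*e+6) * (v - u) := by
    have h1 : X ^ (3*e+6) * F.card ≤ X ^ (3*e+6) * (v - u + 1) := Nat.mul_le_mul_left _ hfar
    have h2 : 4 * X ^ (3*e+6) ≤ X ^ (3*e+12) := (vin_small _ X hX).trans (hpwN (by omega))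
    nlinarith
  refine ⟨q, hq1, hqX.trans (hpwN (by omega)), a, ?_⟩
  have e2 : ((v:ℝ) - u) * (q * φ - a) = q * ((φ * v - av v) - (φ * u - av u)) := by
    have : ((q:ℝ) * av u - a * u) = (q * av v - a * v) := by
      exact_mod_cast hu'.2.trans hv'.2.symm
    linear_combination -this
  have e3 : ((v - u : ℕ) : ℝ) * |q * φ - a| ≤ X ^ (e+2) * (2 * κ) := by
    rw [Nat.cast_sub huv]
    have huvR : (u:ℝ) ≤ v := by exact_mod_cast huv
    rw [← abs_of_nonneg (sub_nonneg.2 huvR), ← abs_mul, e2, abs_mul, Nat.abs_cast]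
    apply mul_le_mul hqR _ (abs_nonneg _) (by positivity)
    exact (abs_sub _ _).trans (by linarith [hav u hu'.1, hav v hv'.1])
  have hdR : (M:ℝ) ≤ 2 * X ^ (3*e+6) * ((v - u : ℕ) : ℝ) := by exact_mod_cast hdist
  calc |(q:ℝ) * φ - a| * M ≤ |(q:ℝ) * φ - a| * (2 * X ^ (3*e+6) * ((v - u : ℕ) : ℝ)) := by gcongr
    _ = 2 * X ^ (3*e+6) * (((v - u : ℕ) : ℝ) * |q * φ - a|) := by ring
    _ ≤ 2 * X ^ (3*e+6) * (X ^ (e+2) * (2 * κ)) := by gcongr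
    _ = 4 * X ^ (4*e+8) * κ := by ring
    _ ≤ X ^ (4*e+10) * κ := by
        apply mul_le_mul_of_nonneg_right _ hκ0
        exact_mod_cast vin_small (4*e+8) X hX
    _ ≤ _ := by
        apply mul_le_mul_of_nonneg_right (hpw (by omega)) hκ0

open Finset

noncomputable def ee (x : ℝ) : ℂ := Complex.exp (2 * Real.pi * x * Complex.I)

theorem ee_eq (x : ℝ) : ee x = Complex.exp (((2 * Real.pi * x : ℝ) : ℂ) * Complex.I) := by
  unfold ee; push_cast; rfl
theorem ee_add (x y : ℝ) : ee (x + y) = ee x * ee y := by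
  unfold ee; rw [← Complex.exp_add]; congr 1; push_cast; ring
theorem ee_zero : ee 0 = 1 := by unfold ee; simp
theorem norm_ee (x : ℝ) : ‖ee x‖ = 1 := by
  rw [ee_eq, Complex.norm_exp_ofReal_mul_I]
theorem ee_int (n : ℤ) : ee n = 1 := by
  unfold ee
  rw [Complex.exp_eq_one_iff]
  exact ⟨n, by push_cast; ring⟩
theorem ee_add_int (x : ℝ) (n : ℤ) : ee (x + n) = ee x := by rw [ee_add, ee_int, mul_one]
theorem ee_neg (x : ℝ) : ee (-x) = (starRingEnd ℂ) (ee x) := by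
  unfold ee
  rw [← Complex.exp_conj]; congr 1
  simp only [map_mul, Complex.conj_ofReal, Complex.conj_I, map_ofNat]
  push_cast; ring
theorem ee_sub (x y : ℝ) : ee (x - y) = ee x * (starRingEnd ℂ) (ee y) := by
  rw [sub_eq_add_neg, ee_add, ee_neg]
theorem ee_nsmul (x : ℝ) (n : ℕ) : ee (n * x) = ee x ^ n := by
  induction n with
  | zero => simp [ee_zero]
  | succ n ih => rw [pow_succ, ← ih, ← ee_add]; congr 1; push_cast; ring
theorem norm_ee_sub_one (x : ℝ) : ‖ee x - 1‖ = 2 * |Real.sin (Real.pi * x)| := by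
  rw [ee_eq, mul_comm, Complex.norm_exp_I_mul_ofReal_sub_one, Real.norm_eq_abs, abs_mul]
  rw [abs_of_pos (by norm_num : (0:ℝ) < 2)]
  congr 3; ring
theorem norm_ee_sub_one_le (x : ℝ) : ‖ee x - 1‖ ≤ 7 * |x| := by
  rw [norm_ee_sub_one]
  have h1 : |Real.sin (Real.pi * x)| ≤ |Real.pi * x| := Real.abs_sin_le_abs
  rw [abs_mul, abs_of_pos Real.pi_pos] at h1
  have := Real.pi_lt_d2
  nlinarith [abs_nonneg x]
theorem norm_ee_sub_one_ge (x : ℝ) (hx : |x| ≤ 1/2) : 4 * |x| ≤ ‖ee x - 1‖ := by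
  rw [norm_ee_sub_one]
  have h2 : ∀ y : ℝ, 0 ≤ y → y ≤ 1/2 → 2 * y ≤ Real.sin (Real.pi * y) := by
    intro y hy hy2
    have := Real.mul_le_sin (x := Real.pi * y) (by positivity) (by nlinarith [Real.pi_pos])
    have e : 2 / Real.pi * (Real.pi * y) = 2 * y := by field_simp
    linarith
  have h3 : |Real.sin (Real.pi * x)| = |Real.sin (Real.pi * |x|)| := by
    rcases abs_cases x with ⟨h, _⟩ | ⟨h, _⟩ <;> rw [h]
    rw [mul_neg, Real.sin_neg, abs_neg]
  rw [h3]
  have := h2 |x| (abs_nonneg x) hx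
  linarith [le_abs_self (Real.sin (Real.pi * |x|))]
theorem norm_ee_sub_ee_le (x y : ℝ) : ‖ee x - ee y‖ ≤ 7 * |x - y| := by
  have : ee x - ee y = ee y * (ee (x - y) - 1) := by
    rw [mul_sub, mul_one, ← ee_add]; congr 2; ring
  rw [this, norm_mul, norm_ee, one_mul]; exact norm_ee_sub_one_le _

/-- geometric sum -/
theorem geom_ee (δ β : ℝ) (M : ℕ) (hδ : |δ| ≤ 1/2) :
    ‖∑ n ∈ range M, ee (δ * n + β)‖ * (2 * |δ|) ≤ 1 := by
  have h1 : ∑ n ∈ range M, ee (δ * n + β) = ee β * ∑ n ∈ range M, ee δ ^ n := by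
    rw [mul_sum]; refine sum_congr rfl fun n _ => ?_
    rw [← ee_nsmul, ← ee_add]; congr 1; ring
  have h2 := geom_sum_mul (ee δ) M
  have h3 : ‖∑ n ∈ range M, ee (δ * n + β)‖ * ‖ee δ - 1‖ ≤ 2 := by
    rw [h1, norm_mul, norm_ee, one_mul, ← norm_mul, h2]
    refine (norm_sub_le _ _).trans ?_
    rw [norm_pow, norm_ee]; norm_num
  have h4 := norm_ee_sub_one_ge δ hδ
  nlinarith [norm_nonneg (∑ n ∈ range M, ee (δ * n + β))]

theorem abs_sub_round_le (x : ℝ) : |x - round x| ≤ 1/2 := abs_sub_round x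

theorem sum_tri (u : ℕ → ℂ) (M : ℕ) :
    ∑ n ∈ range M, ∑ m ∈ range n, u n * (starRingEnd ℂ) (u m) =
    ∑ h ∈ Ico 1 M, ∑ n ∈ range (M - h), u (n + h) * (starRingEnd ℂ) (u n) := by
  rw [sum_sigma', sum_sigma']
  refine sum_bij' (fun p _ => ⟨p.1 - p.2, p.2⟩) (fun p _ => ⟨p.2 + p.1, p.2⟩) ?_ ?_ ?_ ?_ ?_
  · rintro ⟨a, b⟩ h; simp only [mem_sigma, mem_range, mem_Ico] at h ⊢; omega
  · rintro ⟨a, b⟩ h; simp only [mem_sigma, mem_range, mem_Ico] at h ⊢; omega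
  · rintro ⟨a, b⟩ h; simp only [mem_sigma, mem_range] at h
    simp only [Sigma.mk.injEq, heq_eq_eq, and_true]; omega
  · rintro ⟨a, b⟩ h; simp only [mem_sigma, mem_range, mem_Ico] at h
    simp only [Sigma.mk.injEq, heq_eq_eq, and_true]; omega
  · rintro ⟨a, b⟩ h; simp only [mem_sigma, mem_range] at h
    have : b + (a - b) = a := by omega
    simp only [this]

theorem normSq_sum (u : ℕ → ℂ) (hu : ∀ n, ‖u n‖ = 1) (M : ℕ) :
    ‖∑ n ∈ range M, u n‖ ^ 2 = M + 2 * (∑ n ∈ range M, ∑ m ∈ range n, u n * (starRingEnd ℂ) (u m)).re := by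
  induction M with
  | zero => simp
  | succ M ih =>
    rw [sum_range_succ, sum_range_succ, ← Complex.normSq_eq_norm_sq, Complex.normSq_add,
      Complex.normSq_eq_norm_sq, Complex.normSq_eq_norm_sq, ih, hu, Complex.add_re, ← mul_sum, ← map_sum]
    have : ((∑ n ∈ range M, u n) * (starRingEnd ℂ) (u M)).re = (u M * (starRingEnd ℂ) (∑ n ∈ range M, u n)).re := by
      rw [← Complex.conj_re]; congr 1; simp [mul_comm]
    rw [this]; push_cast; ring

theorem vdc (u : ℕ → ℂ) (hu : ∀ n, ‖u n‖ = 1) (M : ℕ) :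
    ‖∑ n ∈ range M, u n‖ ^ 2 ≤ M + 2 * ∑ h ∈ Ico 1 M, ‖∑ n ∈ range (M - h), u (n + h) * (starRingEnd ℂ) (u n)‖ := by
  rw [normSq_sum u hu, sum_tri]
  have := (Complex.re_le_norm (∑ h ∈ Ico 1 M, ∑ n ∈ range (M - h), u (n + h) * (starRingEnd ℂ) (u n))).trans (norm_sum_le _ _)
  linarith

open Finset

theorem taylor_coeff_eval {R : Type*} [CommRing R] (P : Polynomial R) (k : ℕ) (hP : P.natDegree ≤ k + 1) (h : R) (i : ℕ) :
    (Polynomial.taylor h P).coeff (k + i) = ∑ j ∈ range 2, (j + (k+i)).choose (k+i) * P.coeff (j + (k+i)) * h ^ j := by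
  rw [Polynomial.taylor_coeff, Polynomial.eval_eq_sum_range' (n := 2)]
  · refine sum_congr rfl fun j _ => ?_
    rw [Polynomial.hasseDeriv_coeff]
  · refine lt_of_le_of_lt (Polynomial.natDegree_hasseDeriv_le P (k+i)) (by omega)

theorem delta_natDegree {R : Type*} [CommRing R] (P : Polynomial R) (k : ℕ) (hP : P.natDegree ≤ k + 1) (h : R) :
    (Polynomial.taylor h P - P).natDegree ≤ k := by
  rw [Polynomial.natDegree_le_iff_coeff_eq_zero]
  intro N hN
  obtain ⟨i, rfl⟩ : ∃ i, N = k + (i + 1) := ⟨N - k - 1, by omega⟩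
  rw [Polynomial.coeff_sub, taylor_coeff_eval P k hP, sum_range_succ, sum_range_one]
  have : P.coeff (1 + (k + (i+1))) = 0 := Polynomial.coeff_eq_zero_of_natDegree_lt (by omega)
  rw [this]; simp

theorem delta_coeff {R : Type*} [CommRing R] (P : Polynomial R) (k : ℕ) (hP : P.natDegree ≤ k + 1) (h : R) :
    (Polynomial.taylor h P - P).coeff k = (k+1) * h * P.coeff (k+1) := by
  have := taylor_coeff_eval P k hP h 0
  rw [add_zero] at this
  rw [Polynomial.coeff_sub, this, sum_range_succ, sum_range_one]
  have e : (1 + k).choose k = k + 1 := by rw [add_comm 1 k, Nat.choose_succ_self_right]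
  rw [e, add_comm 1 k]; push_cast; simp; ring

theorem lead_base : ∀ X : ℕ, 2 ≤ X → ∀ M : ℕ, 1 ≤ M → ∀ P : Polynomial ℝ, P.natDegree ≤ 1 →
    (M:ℝ) ≤ X * ‖∑ n ∈ range M, ee (P.eval (n:ℝ))‖ →
    ∃ q : ℕ, 1 ≤ q ∧ q ≤ X ^ 1 ∧ ∃ a : ℤ, |q * P.coeff 1 - a| * (M:ℝ) ^ 1 ≤ X ^ 1 := by
  intro X hX M hM P hP hS
  refine ⟨1, le_refl _, by rw [pow_one]; omega, round (P.coeff 1), ?_⟩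
  have e : ∑ n ∈ range M, ee (P.eval (n:ℝ)) =
      ∑ n ∈ range M, ee ((P.coeff 1 - round (P.coeff 1)) * n + P.coeff 0) := by
    refine sum_congr rfl fun n _ => ?_
    rw [Polynomial.eval_eq_sum_range' (n := 2) (by omega), sum_range_succ, sum_range_one]
    rw [← ee_add_int ((P.coeff 1 - round (P.coeff 1)) * n + P.coeff 0) (round (P.coeff 1) * n)]
    congr 1; push_cast; ring
  have h1 := geom_ee (P.coeff 1 - round (P.coeff 1)) (P.coeff 0) M (abs_sub_round_le _)
  rw [← e] at h1
  set S := ‖∑ n ∈ range M, ee (P.eval (n:ℝ))‖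
  have hX' : (2:ℝ) ≤ X := by exact_mod_cast hX
  have := abs_nonneg (P.coeff 1 - round (P.coeff 1))
  rw [Nat.cast_one, one_mul, pow_one, pow_one]
  calc |P.coeff 1 - round (P.coeff 1)| * (M:ℝ) ≤ |P.coeff 1 - round (P.coeff 1)| * (X * S) := by gcongr
    _ = X * (S * |P.coeff 1 - round (P.coeff 1)|) := by ring
    _ ≤ X * 1 := by apply mul_le_mul_of_nonneg_left _ (by linarith); linarith
    _ = X := mul_one _

theorem pigeon_fiber {α : Type*} [DecidableEq α] (G : Finset α) (f : α → ℕ) (R : ℕ) (hR : 1 ≤ R)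
    (hf : ∀ x ∈ G, f x ∈ Icc 1 R) : ∃ q ∈ Icc 1 R, G.card ≤ R * (G.filter (fun x => f x = q)).card := by
  by_contra hcon
  push Not at hcon
  have h1 := Finset.card_eq_sum_card_fiberwise hf
  have h2 : ∑ t ∈ Icc 1 R, R * (G.filter (fun x => f x = t)).card < ∑ t ∈ Icc 1 R, G.card :=
    Finset.sum_lt_sum_of_nonempty ⟨1, Finset.mem_Icc.2 ⟨le_refl _, hR⟩⟩ hcon
  rw [← Finset.mul_sum, Finset.sum_const, ← h1, Nat.card_Icc, smul_eq_mul] at h2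
  simp at h2

theorem lead_step (k : ℕ) (hk : 1 ≤ k)
    (ih : ∃ E : ℕ, ∀ X : ℕ, 2 ≤ X → ∀ M : ℕ, 1 ≤ M → ∀ P : Polynomial ℝ, P.natDegree ≤ k →
    (M:ℝ) ≤ X * ‖∑ n ∈ range M, ee (P.eval (n:ℝ))‖ →
    ∃ q : ℕ, 1 ≤ q ∧ q ≤ X ^ E ∧ ∃ a : ℤ, |q * P.coeff k - a| * (M:ℝ) ^ k ≤ X ^ E) :
    ∃ E : ℕ, ∀ X : ℕ, 2 ≤ X → ∀ M : ℕ, 1 ≤ M → ∀ P : Polynomial ℝ, P.natDegree ≤ k + 1 →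
    (M:ℝ) ≤ X * ‖∑ n ∈ range M, ee (P.eval (n:ℝ))‖ →
    ∃ q : ℕ, 1 ≤ q ∧ q ≤ X ^ E ∧ ∃ a : ℤ, |q * P.coeff (k+1) - a| * (M:ℝ) ^ (k+1) ≤ X ^ E := by
  obtain ⟨E₁, hE₁⟩ := ih
  obtain ⟨E₂, hE₂⟩ := vinogradov (5 * E₁ + 5 * k + 5)
  refine ⟨E₂ + (5 * E₁ + 5 * k) + 10 * (k+1), ?_⟩
  intro X hX M hM P hP hS
  have hXR : (2:ℝ) ≤ X := by exact_mod_cast hX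
  have hMR : (1:ℝ) ≤ M := by exact_mod_cast hM
  have hpw : ∀ {i j : ℕ}, i ≤ j → (X:ℝ)^i ≤ (X:ℝ)^j := fun h => pow_le_pow_right₀ (by linarith) h
  have hpwN : ∀ {i j : ℕ}, i ≤ j → X^i ≤ X^j := fun h => Nat.pow_le_pow_right (by omega) h
  by_cases hMs : M ≤ X ^ 3
  · refine ⟨1, le_refl _, Nat.one_le_pow _ _ (by omega), round (P.coeff (k+1)), ?_⟩
    rw [Nat.cast_one, one_mul]
    have h1 := abs_sub_round_le (P.coeff (k+1))
    have h2 : (M:ℝ) ^ (k+1) ≤ (X ^ 3)^(k+1) := by gcongr; exact_mod_cast hMs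
    rw [← pow_mul] at h2
    have h3 : (X:ℝ) ^ (3 * (k+1)) ≤ X ^ (E₂ + (5 * E₁ + 5 * k) + 10 * (k+1)) := hpw (by omega)
    have : 0 ≤ (M:ℝ)^(k+1) := by positivity
    nlinarith
  push Not at hMs
  have hMsR : (X:ℝ)^3 ≤ M := by exact_mod_cast hMs.le
  set u : ℕ → ℂ := fun n => ee (P.eval (n:ℝ)) with hu
  set Tn : ℕ → ℝ := fun h => ‖∑ n ∈ range (M - h), u (n + h) * (starRingEnd ℂ) (u n)‖ with hTn
  have hT : ∀ h, Tn h = ‖∑ n ∈ range (M - h), ee ((Polynomial.taylor (h:ℝ) P - P).eval (n:ℝ))‖ := by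
    intro h
    simp only [hTn, hu]
    congr 1; refine sum_congr rfl fun n _ => ?_
    rw [← ee_sub, Polynomial.eval_sub, Polynomial.taylor_eval]; push_cast; rfl
  have hTle : ∀ h, Tn h ≤ M - h ∨ M ≤ h := by
    intro h
    by_cases hh : M ≤ h
    · exact Or.inr hh
    left
    rw [hT]; refine (norm_sum_le _ _).trans ?_
    simp only [norm_ee, sum_const, card_range, nsmul_eq_mul, mul_one]
    rw [Nat.cast_sub (by omega)]
  have hv := vdc u (fun n => norm_ee _) M
  have hsq : (M:ℝ)^2 ≤ X^2 * ‖∑ n ∈ range M, u n‖^2 := by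
    rw [← mul_pow]; gcongr
  have hsum : (M:ℝ)^2 ≤ 4 * X^2 * ∑ h ∈ Ico 1 M, Tn h := by
    have : (M:ℝ)^2 ≤ X^2 * (M + 2 * ∑ h ∈ Ico 1 M, Tn h) := hsq.trans (by gcongr)
    have h2 : 2 * (X:ℝ)^2 * M ≤ M^2 := by
      have : 2 * (X:ℝ)^2 ≤ X^3 := by nlinarith [sq_nonneg (X:ℝ)]
      nlinarith
    linarith
  -- good set
  set G := (Ico 1 M).filter (fun h => (M:ℝ) ≤ 8 * X^2 * Tn h) with hG
  have hGcard : (M:ℝ) ≤ 8 * X^2 * G.card := by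
    have h1 : ∑ h ∈ Ico 1 M, Tn h ≤ ∑ h ∈ Ico 1 M, ((M:ℝ) / (8 * X^2) + if h ∈ G then (M:ℝ) else 0) := by
      refine sum_le_sum fun h hh => ?_
      by_cases hg : h ∈ G
      · rw [if_pos hg]
        have h2 : 0 ≤ (M:ℝ) / (8 * X^2) := by positivity
        rcases hTle h with h3 | h3
        · have : (0:ℝ) ≤ h := by positivity
          linarith
        · exact absurd (mem_Ico.1 hh).2 (by omega)
      · rw [if_neg hg, add_zero, le_div_iff₀ (by positivity)]
        have : ¬ ((M:ℝ) ≤ 8 * X^2 * Tn h) := fun h3 => hg (mem_filter.2 ⟨hh, h3⟩)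
        push Not at this; linarith
    rw [sum_add_distrib, sum_const, Nat.card_Ico, sum_ite_mem, nsmul_eq_mul] at h1
    have h2 : (Ico 1 M) ∩ G = G := by rw [inter_eq_right]; exact filter_subset _ _
    rw [h2, sum_const, nsmul_eq_mul] at h1
    have h3 : ((M - 1 : ℕ):ℝ) * (M / (8 * X^2)) ≤ M * (M / (8 * X^2)) := by
      gcongr; omega
    have h4 : (M:ℝ)^2 ≤ 4 * X^2 * (M * (M / (8 * X^2)) + G.card * M) := hsum.trans (by gcongr; linarith)
    have h5 : 4 * (X:ℝ)^2 * (M * (M / (8 * X^2)) + G.card * M) = M^2 / 2 + 4 * X^2 * G.card * M := by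
      field_simp; ring
    rw [h5] at h4
    have h6 : (M:ℝ) * M ≤ (8 * X^2 * G.card) * M := by nlinarith
    exact le_of_mul_le_mul_right h6 (by linarith)
  have h8 : 8 * (X:ℝ)^2 ≤ X^5 := by
    have : (8:ℝ) ≤ X^3 := by
      calc (8:ℝ) = 2^3 := by norm_num
        _ ≤ _ := by gcongr
    nlinarith [sq_nonneg (X:ℝ)]
  -- apply ih
  have hq : ∀ h ∈ G, ∃ q : ℕ, (1 ≤ q ∧ q ≤ X ^ (5 * E₁)) ∧ ∃ a : ℤ,
      |q * ((k+1) * P.coeff (k+1)) * h - a| * (M:ℝ)^k ≤ X ^ (5 * E₁ + 5 * k) := by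
    intro h hh
    obtain ⟨hh1, hh2⟩ := mem_filter.1 hh
    have hh3 := mem_Ico.1 hh1
    have hTh : Tn h ≤ (M - h : ℕ) := by
      rcases hTle h with h3 | h3
      · rw [Nat.cast_sub (by omega)]; exact h3
      · omega
    have hT0 : 0 ≤ Tn h := norm_nonneg _
    have h9 : (M:ℝ) ≤ X^5 * Tn h := hh2.trans (by gcongr)
    have := hE₁ (X^5) (by calc 2 ≤ X := hX
                            _ = X^1 := (pow_one X).symm
                            _ ≤ X^5 := hpwN (by norm_num)) (M - h) (by omega)
      (Polynomial.taylor (h:ℝ) P - P) (delta_natDegree P k hP h) (by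
        rw [← hT]; push_cast
        refine le_trans ?_ h9
        exact_mod_cast Nat.sub_le M h)
    obtain ⟨q, hq1, hq2, a, ha⟩ := this
    refine ⟨q, ⟨hq1, by rw [pow_mul]; exact hq2⟩, a, ?_⟩
    rw [delta_coeff P k hP] at ha
    have e1 : (q:ℝ) * ((k+1) * h * P.coeff (k+1)) = q * ((k+1) * P.coeff (k+1)) * h := by ring
    rw [e1] at ha
    have h10 : (M:ℝ) ≤ X^5 * ((M - h : ℕ):ℝ) := h9.trans (by gcongr)
    calc |q * ((k+1) * P.coeff (k+1)) * h - a| * (M:ℝ)^k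
        ≤ |q * ((k+1) * P.coeff (k+1)) * h - a| * (X^5 * ((M - h : ℕ):ℝ))^k := by gcongr
      _ = (|q * ((k+1) * P.coeff (k+1)) * h - a| * ((M - h : ℕ):ℝ)^k) * X^(5 * k) := by
          rw [mul_pow, ← pow_mul]; ring
      _ ≤ X^(5*E₁) * X^(5*k) := by
          gcongr; rw [pow_mul]; exact_mod_cast ha
      _ = _ := by rw [← pow_add]
  choose! qf hqf af haf using hq
  obtain ⟨q₀, hq₀, hfib⟩ := pigeon_fiber G qf (X ^ (5*E₁)) (Nat.one_le_pow _ _ (by omega))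
    (fun h hh => mem_Icc.2 (hqf h hh))
  have hq₀' := mem_Icc.1 hq₀
  set F := G.filter (fun x => qf x = q₀)
  have hMk : (0:ℝ) < (M:ℝ)^k := by positivity
  obtain ⟨q₁, hq₁, hq₁', a, ha⟩ := hE₂ X hX M hM (q₀ * ((k+1) * P.coeff (k+1)))
    (X ^ (5 * E₁ + 5 * k) / (M:ℝ)^k) F
    ((filter_subset _ _).trans (filter_subset _ _)) (by
      have h1 : M ≤ X^5 * G.card := by
        have : (M:ℝ) ≤ X^5 * G.card := hGcard.trans (by gcongr)
        exact_mod_cast this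
      calc M ≤ X^5 * G.card := h1
        _ ≤ X^5 * (X^(5*E₁) * F.card) := by gcongr
        _ = X^(5 + 5*E₁) * F.card := by rw [pow_add]; ring
        _ ≤ _ := Nat.mul_le_mul_right _ (hpwN (by omega)))
    (by
      intro h hh
      obtain ⟨hh1, hh2⟩ := mem_filter.1 hh
      refine ⟨af h, ?_⟩
      have := haf h hh1
      rw [hh2] at this
      rw [le_div_iff₀ hMk]; exact this)
    (by
      rw [div_mul_eq_mul_div, div_le_iff₀ hMk]
      have h1 : (M:ℝ) ≤ M^k := by
        calc (M:ℝ) = M^1 := (pow_one _).symm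
          _ ≤ M^k := pow_le_pow_right₀ hMR hk
      exact mul_le_mul (hpw (by omega)) h1 (by linarith) (by positivity))
  have hk1 : k + 1 ≤ X ^ (k+1) := (Nat.lt_two_pow_self).le.trans (Nat.pow_le_pow_left hX _)
  refine ⟨q₁ * (q₀ * (k+1)), ?_, ?_, a, ?_⟩
  · exact Nat.mul_pos hq₁ (Nat.mul_pos hq₀'.1 (by omega))
  · calc q₁ * (q₀ * (k+1)) ≤ X^E₂ * (X^(5*E₁) * X^(k+1)) := by
          gcongr; exact hq₀'.2
      _ = X^(E₂ + (5*E₁ + (k+1))) := by ring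
      _ ≤ _ := hpwN (by omega)
  · have e1 : ((q₁ * (q₀ * (k+1)) : ℕ):ℝ) * P.coeff (k+1) = q₁ * (q₀ * ((k+1) * P.coeff (k+1))) := by
      push_cast; ring
    rw [e1, pow_succ, mul_comm ((M:ℝ)^k), ← mul_assoc]
    calc _ ≤ (X^E₂ * (X ^ (5 * E₁ + 5 * k) / (M:ℝ)^k)) * M^k := by gcongr
      _ = X^(E₂ + (5*E₁ + 5*k)) := by field_simp; rw [← pow_add]
      _ ≤ _ := hpw (by omega)

theorem lead (k : ℕ) (hk : 1 ≤ k) :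
    ∃ E : ℕ, ∀ X : ℕ, 2 ≤ X → ∀ M : ℕ, 1 ≤ M → ∀ P : Polynomial ℝ, P.natDegree ≤ k →
    (M:ℝ) ≤ X * ‖∑ n ∈ range M, ee (P.eval (n:ℝ))‖ →
    ∃ q : ℕ, 1 ≤ q ∧ q ≤ X ^ E ∧ ∃ a : ℤ, |q * P.coeff k - a| * (M:ℝ) ^ k ≤ X ^ E := by
  induction k, hk using Nat.le_induction with
  | base => exact ⟨1, lead_base⟩
  | succ k hk ih => exact lead_step k hk ih

open Finset

def ZZ : Subring ℝ := (Int.castRingHom ℝ).range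
theorem int_mem_ZZ (n : ℤ) : (n:ℝ) ∈ ZZ := ⟨n, rfl⟩
theorem nat_mem_ZZ (n : ℕ) : (n:ℝ) ∈ ZZ := ⟨n, by simp⟩
theorem mem_ZZ {x : ℝ} : x ∈ ZZ ↔ ∃ n : ℤ, x = n := by
  constructor
  · rintro ⟨n, rfl⟩; exact ⟨n, rfl⟩
  · rintro ⟨n, rfl⟩; exact int_mem_ZZ n
theorem ee_of_sub_mem {x y : ℝ} (h : x - y ∈ ZZ) : ee x = ee y := by
  obtain ⟨n, hn⟩ := mem_ZZ.1 h
  rw [← ee_add_int y n]; congr 1; linarith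

theorem sum_range_mul_split {β : Type*} [AddCommMonoid β] (f : ℕ → β) (B T : ℕ) :
    ∑ n ∈ range (B * T), f n = ∑ t ∈ range T, ∑ j ∈ range B, f (j + B * t) := by
  induction T with
  | zero => simp
  | succ T ih =>
    rw [Nat.mul_succ, sum_range_add, ih, sum_range_succ]
    congr 1; refine sum_congr rfl fun j _ => ?_; rw [add_comm]

theorem zz_iter (P : Polynomial ℝ) (B : ℕ) (hB : ∀ n : ℤ, P.eval ((n + B : ℤ) : ℝ) - P.eval (n:ℝ) ∈ ZZ)
    (t : ℕ) (n : ℤ) : P.eval ((n + B * t : ℤ) : ℝ) - P.eval (n:ℝ) ∈ ZZ := by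
  induction t with
  | zero => simp [ZZ.zero_mem]
  | succ t ih =>
    have := ZZ.add_mem (hB (n + B * t)) ih
    rw [sub_add_sub_cancel] at this
    convert this using 3; push_cast; ring

theorem lead_rat (k : ℕ) : ∃ E : ℕ, ∀ X : ℕ, 2 ≤ X → ∀ B : ℕ, 1 ≤ B → ∀ P : Polynomial ℝ,
    P.natDegree ≤ k + 1 → (∀ n : ℤ, P.eval ((n + B : ℤ) : ℝ) - P.eval (n:ℝ) ∈ ZZ) →
    (B:ℝ) ≤ X * ‖∑ n ∈ range B, ee (P.eval (n:ℝ))‖ →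
    ∃ q : ℕ, 1 ≤ q ∧ q ≤ X ^ E ∧ q * P.coeff (k+1) ∈ ZZ := by
  obtain ⟨E, hE⟩ := lead (k+1) (by omega)
  refine ⟨E, fun X hX B hB P hP hper hS => ?_⟩
  by_contra hcon
  push Not at hcon
  set f : ℕ → ℝ := fun q => |q * P.coeff (k+1) - round (q * P.coeff (k+1))| with hf
  have hfpos : ∀ q ∈ Icc 1 (X^E), 0 < f q := by
    intro q hq
    have := hcon q (mem_Icc.1 hq).1 (mem_Icc.1 hq).2
    apply abs_pos.2
    intro h0
    exact this (mem_ZZ.2 ⟨_, sub_eq_zero.1 h0⟩)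
  obtain ⟨q₀, hq₀, hmin⟩ := exists_min_image (Icc 1 (X^E)) f ⟨1, mem_Icc.2 ⟨le_refl _, Nat.one_le_pow _ _ (by omega)⟩⟩
  obtain ⟨T, hT⟩ := exists_nat_gt ((X:ℝ)^E / f q₀)
  have hT0 : 0 < (T:ℝ) := lt_of_le_of_lt (div_nonneg (by positivity) (hfpos q₀ hq₀).le) hT
  have hT1 : 1 ≤ T := by exact_mod_cast hT0
  obtain ⟨q, hq1, hq2, a, ha⟩ := hE X hX (B * T) (Nat.mul_pos hB hT1) P hP (by
    rw [sum_range_mul_split]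
    have : ∀ t ∈ range T, ∑ j ∈ range B, ee (P.eval (((j + B * t : ℕ)):ℝ)) = ∑ j ∈ range B, ee (P.eval (j:ℝ)) := by
      intro t _
      refine sum_congr rfl fun j _ => ee_of_sub_mem ?_
      have := zz_iter P B hper t j
      exact_mod_cast this
    rw [sum_congr rfl this, sum_const, card_range, nsmul_eq_mul, norm_mul, Complex.norm_natCast]
    push_cast; nlinarith)
  have h1 := hmin q (mem_Icc.2 ⟨hq1, hq2⟩)
  have h2 : f q ≤ |q * P.coeff (k+1) - a| := round_le _ _
  have h3 : (T:ℝ) ≤ (((B * T : ℕ)):ℝ)^(k+1) := by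
    have : T ≤ (B*T)^(k+1) := by
      calc T ≤ B * T := Nat.le_mul_of_pos_left _ hB
        _ ≤ (B*T)^(k+1) := Nat.le_self_pow (by omega) _
    exact_mod_cast this
  rw [div_lt_iff₀ (hfpos q₀ hq₀)] at hT
  have h4 : f q₀ * T ≤ |q * P.coeff (k+1) - a| * (((B * T : ℕ)):ℝ)^(k+1) := by
    apply mul_le_mul (h1.trans h2) h3 hT0.le (abs_nonneg _)
  linarith

theorem complete_sum (k : ℕ) : ∃ E : ℕ, ∀ X : ℕ, 2 ≤ X → ∀ B : ℕ, 1 ≤ B → ∀ P : Polynomial ℝ,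
    P.natDegree ≤ k → (∀ n : ℤ, P.eval ((n + B : ℤ) : ℝ) - P.eval (n:ℝ) ∈ ZZ) →
    (B:ℝ) ≤ X * ‖∑ n ∈ range B, ee (P.eval (n:ℝ))‖ →
    ∃ q : ℕ, 1 ≤ q ∧ q ≤ X ^ E ∧ ∃ n₀ : ℤ, ∀ x : ℤ,
      P.eval ((n₀ + q * x : ℤ) : ℝ) - P.eval (n₀:ℝ) ∈ ZZ := by
  induction k with
  | zero =>
    refine ⟨0, fun X hX B hB P hP hper hS => ⟨1, le_refl _, by simp, 0, fun x => ?_⟩⟩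
    rw [Polynomial.eq_C_of_natDegree_le_zero hP]; simp [ZZ.zero_mem]
  | succ k ih =>
    obtain ⟨E₁, hE₁⟩ := lead_rat k
    obtain ⟨E₂, hE₂⟩ := ih
    refine ⟨E₁ + E₂, fun X hX B hB P hP hper hS => ?_⟩
    obtain ⟨q, hq1, hq2, hqc⟩ := hE₁ X hX B hB P hP hper hS
    have hsplit : ∑ n ∈ range q, ∑ l ∈ range B, ee (P.eval (((n + q * l : ℕ)):ℝ)) =
        q * ∑ j ∈ range B, ee (P.eval (j:ℝ)) := by
      rw [sum_comm, ← sum_range_mul_split (fun n => ee (P.eval (n:ℝ))), mul_comm, sum_range_mul_split]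
      have : ∀ t ∈ range q, ∑ j ∈ range B, ee (P.eval (((j + B * t : ℕ)):ℝ)) = ∑ j ∈ range B, ee (P.eval (j:ℝ)) := by
        intro t _
        refine sum_congr rfl fun j _ => ee_of_sub_mem ?_
        have := zz_iter P B hper t j
        exact_mod_cast this
      rw [sum_congr rfl this, sum_const, card_range, nsmul_eq_mul]
    obtain ⟨n₀, hn₀, hn₀S⟩ : ∃ n ∈ range q, ‖∑ j ∈ range B, ee (P.eval (j:ℝ))‖ ≤
        ‖∑ l ∈ range B, ee (P.eval (((n + q * l : ℕ)):ℝ))‖ := by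
      by_contra hcon
      push Not at hcon
      have h1 := sum_lt_sum_of_nonempty ⟨0, mem_range.2 hq1⟩ hcon
      have h2 := norm_sum_le (range q) (fun n => ∑ l ∈ range B, ee (P.eval (((n + q * l : ℕ)):ℝ)))
      rw [hsplit, norm_mul, Complex.norm_natCast] at h2
      rw [sum_const, card_range, nsmul_eq_mul] at h1
      linarith
    set Q : Polynomial ℝ := P.comp (Polynomial.C (n₀:ℝ) + Polynomial.C (q:ℝ) * Polynomial.X) with hQ
    have hQe : ∀ x : ℝ, Q.eval x = P.eval (n₀ + q * x) := by intro x; simp [hQ]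
    have hlin : (Polynomial.C (n₀:ℝ) + Polynomial.C (q:ℝ) * Polynomial.X).natDegree = 1 := by
      rw [add_comm]; exact Polynomial.natDegree_linear (by exact_mod_cast (by omega : q ≠ 0))
    have hlinl : (Polynomial.C (n₀:ℝ) + Polynomial.C (q:ℝ) * Polynomial.X).leadingCoeff = (q:ℝ) := by
      rw [add_comm]; exact Polynomial.leadingCoeff_linear (by exact_mod_cast (by omega : q ≠ 0))
    have hQd : Q.natDegree ≤ k + 1 := by
      rw [hQ, Polynomial.natDegree_comp, hlin, mul_one]; exact hP
    have hQc : Q.coeff (k+1) = P.coeff (k+1) * q^(k+1) := by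
      rcases hP.lt_or_eq with hlt | heq
      · rw [Polynomial.coeff_eq_zero_of_natDegree_lt hlt, zero_mul]
        apply Polynomial.coeff_eq_zero_of_natDegree_lt
        rw [hQ, Polynomial.natDegree_comp, hlin, mul_one]; exact hlt
      · have h1 : Q.natDegree = k+1 := by
          rw [hQ, Polynomial.natDegree_comp, hlin, mul_one]; exact heq
        have h2 := Polynomial.leadingCoeff_comp (p := P) (q := (Polynomial.C (n₀:ℝ) + Polynomial.C (q:ℝ) * Polynomial.X)) (by rw [hlin]; norm_num)
        rw [← hQ, hlinl] at h2
        unfold Polynomial.leadingCoeff at h2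
        rw [h1, heq] at h2; exact h2
    have hQcZ : Q.coeff (k+1) ∈ ZZ := by
      rw [hQc, pow_succ]
      have := ZZ.mul_mem hqc (ZZ.pow_mem (nat_mem_ZZ q) k)
      convert this using 1; ring
    set Q₁ : Polynomial ℝ := Q - Polynomial.monomial (k+1) (Q.coeff (k+1)) with hQ₁
    have hQ₁d : Q₁.natDegree ≤ k := by
      rw [Polynomial.natDegree_le_iff_coeff_eq_zero]
      intro N hN
      rw [hQ₁, Polynomial.coeff_sub, Polynomial.coeff_monomial]
      split_ifs with hh
      · rw [hh, sub_self]
      · rw [sub_zero]; exact Polynomial.coeff_eq_zero_of_natDegree_lt (by omega)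
    have hQQ : ∀ x : ℤ, Q.eval (x:ℝ) - Q₁.eval (x:ℝ) ∈ ZZ := by
      intro x
      have : Q.eval (x:ℝ) - Q₁.eval (x:ℝ) = Q.coeff (k+1) * (x:ℝ)^(k+1) := by
        rw [hQ₁, Polynomial.eval_sub, Polynomial.eval_monomial]; ring
      rw [this]; exact ZZ.mul_mem hQcZ (ZZ.pow_mem (int_mem_ZZ x) _)
    obtain ⟨q', hq1', hq2', n₁, hn₁⟩ := hE₂ X hX B hB Q₁ hQ₁d (by
      intro n
      have h1 : Q.eval ((n + B : ℤ):ℝ) - Q.eval (n:ℝ) ∈ ZZ := by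
        rw [hQe, hQe]
        have := zz_iter P B hper q (n₀ + q * n)
        convert this using 3 <;> push_cast <;> ring
      have := ZZ.add_mem (ZZ.sub_mem h1 (hQQ (n+B))) (hQQ n)
      convert this using 1; ring) (by
      refine hS.trans (mul_le_mul_of_nonneg_left (hn₀S.trans (le_of_eq ?_)) (by positivity))
      congr 1; refine sum_congr rfl fun l _ => ee_of_sub_mem ?_
      have := hQQ l
      rw [hQe] at this
      exact_mod_cast this)
    refine ⟨q * q', Nat.mul_pos hq1 hq1', by rw [pow_add]; exact Nat.mul_le_mul hq2 hq2', n₀ + q * n₁, fun x => ?_⟩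
    have := ZZ.add_mem (ZZ.add_mem (hn₁ x) (hQQ (n₁ + q' * x))) (ZZ.neg_mem (hQQ n₁))
    have e : Q.eval ((n₁ + q' * x : ℤ):ℝ) - Q.eval (n₁:ℝ) ∈ ZZ := by
      convert this using 1; ring
    rw [hQe, hQe] at e
    convert e using 3 <;> push_cast <;> ring

open Finset

theorem clear_den (u : Polynomial ℚ) : ∃ D : ℤ, D ≠ 0 ∧ ∃ U : Polynomial ℤ,
    U.map (algebraMap ℤ ℚ) = Polynomial.C (D:ℚ) * u := by
  obtain ⟨b, hb, h⟩ := IsLocalization.integerNormalization_spec (nonZeroDivisors ℤ) u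
  refine ⟨b, nonZeroDivisors.ne_zero hb, _, h.trans ?_⟩
  rw [← Polynomial.smul_eq_C_mul]
  exact (Int.cast_smul_eq_zsmul ℚ b u).symm

theorem aeval_int_coe (p : ℕ) [Fact p.Prime] (w : ℤ_[p]) (U : Polynomial ℤ) :
    Polynomial.aeval (w:ℚ_[p]) (U.map (algebraMap ℤ ℚ)) = ((Polynomial.aeval w U : ℤ_[p]) : ℚ_[p]) := by
  rw [Polynomial.aeval_map_algebraMap]
  have := Polynomial.hom_eval₂ U (algebraMap ℤ ℤ_[p]) (PadicInt.Coe.ringHom (p := p)) w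
  rw [Polynomial.aeval_def, Polynomial.aeval_def]
  rw [show ((Polynomial.eval₂ (algebraMap ℤ ℤ_[p]) w U : ℤ_[p]) : ℚ_[p]) = PadicInt.Coe.ringHom (Polynomial.eval₂ (algebraMap ℤ ℤ_[p]) w U) from rfl, this]
  congr 1

theorem root_div (f h : Polynomial ℚ) : h ≠ 0 → ∃ D : ℤ, D ≠ 0 ∧ ∀ (p : ℕ) [Fact p.Prime], ∀ w : ℤ_[p],
    Polynomial.aeval (w:ℚ_[p]) h = 0 → Polynomial.aeval (w:ℚ_[p]) f = 0 ∨
      ∃ v : ℤ_[p], (D:ℚ_[p]) = Polynomial.aeval (w:ℚ_[p]) f * v := by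
  refine UniqueFactorizationMonoid.induction_on_prime (P := fun h => h ≠ 0 → ∃ D : ℤ, D ≠ 0 ∧ ∀ (p : ℕ) [Fact p.Prime], ∀ w : ℤ_[p],
    Polynomial.aeval (w:ℚ_[p]) h = 0 → Polynomial.aeval (w:ℚ_[p]) f = 0 ∨
      ∃ v : ℤ_[p], (D:ℚ_[p]) = Polynomial.aeval (w:ℚ_[p]) f * v) h ?_ ?_ ?_
  · intro h; exact absurd rfl h
  · intro x hx _
    refine ⟨1, one_ne_zero, fun p _ w hw => ?_⟩
    have := hx.map (Polynomial.aeval (w:ℚ_[p]))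
    rw [hw] at this
    exact absurd this not_isUnit_zero
  · intro a π ha hπ ih _
    obtain ⟨D₁, hD₁, h₁⟩ := ih ha
    by_cases hd : π ∣ f
    · refine ⟨D₁, hD₁, fun p _ w hw => ?_⟩
      rw [map_mul, mul_eq_zero] at hw
      rcases hw with hw | hw
      · left; obtain ⟨c, rfl⟩ := hd; rw [map_mul, hw, zero_mul]
      · exact h₁ p w hw
    · have hcop : IsCoprime π f := (hπ.irreducible.coprime_iff_not_dvd).2 hd
      obtain ⟨s, t, hst⟩ := hcop
      obtain ⟨D₂, hD₂, U, hU⟩ := clear_den t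
      refine ⟨D₁ * D₂, mul_ne_zero hD₁ hD₂, fun p _ w hw => ?_⟩
      rw [map_mul, mul_eq_zero] at hw
      rcases hw with hw | hw
      · right
        refine ⟨Polynomial.aeval w U * D₁, ?_⟩
        have h2 := congrArg (Polynomial.aeval (w:ℚ_[p])) hst
        rw [map_add, map_mul, map_mul, hw, mul_zero, zero_add, map_one] at h2
        have h3 := aeval_int_coe p w U
        rw [hU, map_mul, Polynomial.aeval_C] at h3
        have h4 : algebraMap ℚ ℚ_[p] (D₂:ℚ) = (D₂:ℚ_[p]) := by simp
        rw [h4] at h3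
        push_cast
        rw [← h3]
        linear_combination -(D₁:ℚ_[p]) * (D₂:ℚ_[p]) * h2
      · rcases h₁ p w hw with h5 | ⟨v, hv⟩
        · exact Or.inl h5
        · right; refine ⟨v * D₂, ?_⟩
          push_cast; rw [hv]; ring

theorem root_div_int (f h : Polynomial ℤ) (hh : h ≠ 0) : ∃ D : ℤ, D ≠ 0 ∧ ∀ (p : ℕ) [Fact p.Prime], ∀ w : ℤ_[p],
    Polynomial.aeval w h = 0 → Polynomial.aeval w f = 0 ∨ Polynomial.aeval w f ∣ (D:ℤ_[p]) := by
  obtain ⟨D, hD, hD2⟩ := root_div (f.map (algebraMap ℤ ℚ)) (h.map (algebraMap ℤ ℚ))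
    ((Polynomial.map_ne_zero_iff (FaithfulSMul.algebraMap_injective ℤ ℚ)).2 hh)
  refine ⟨D, hD, fun p _ w hw => ?_⟩
  rcases hD2 p w (by rw [aeval_int_coe, hw]; rfl) with h1 | ⟨v, hv⟩
  · left; rw [aeval_int_coe] at h1; exact PadicInt.ext h1
  · right; refine ⟨v, ?_⟩
    rw [aeval_int_coe] at hv
    apply PadicInt.ext
    push_cast; exact hv

/-- content from values -/
theorem content_lead (k : ℕ) : ∀ (G : Polynomial ℤ) (B : ℤ), G.natDegree ≤ k → (∀ x : ℤ, B ∣ G.eval x) →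
    B ∣ (k.factorial : ℤ) * G.coeff k := by
  induction k with
  | zero =>
    intro G B hG hB
    have := hB 0
    rw [Polynomial.eq_C_of_natDegree_le_zero hG] at this ⊢
    simpa using this
  | succ k ih =>
    intro G B hG hB
    have := ih (Polynomial.taylor 1 G - G) B (delta_natDegree G k hG 1) (fun x => by
      rw [Polynomial.eval_sub, Polynomial.taylor_eval]; exact dvd_sub (hB _) (hB _))
    rw [delta_coeff G k hG 1] at this
    rw [Nat.factorial_succ]; convert this using 1; push_cast; ring

theorem content_all (k : ℕ) : ∃ F : ℕ, 1 ≤ F ∧ ∀ (G : Polynomial ℤ) (B : ℤ), G.natDegree ≤ k → (∀ x : ℤ, B ∣ G.eval x) →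
    ∀ j, B ∣ (F : ℤ) * G.coeff j := by
  induction k with
  | zero =>
    refine ⟨1, le_refl _, fun G B hG hB j => ?_⟩
    have := hB 0
    rw [Polynomial.eq_C_of_natDegree_le_zero hG] at this ⊢
    rw [Polynomial.coeff_C]
    split_ifs
    · simpa using this
    · simp
  | succ k ih =>
    obtain ⟨F, hF, hF2⟩ := ih
    refine ⟨F * (k+1).factorial, Nat.mul_pos hF (Nat.factorial_pos _), fun G B hG hB j => ?_⟩
    have hl := content_lead (k+1) G B hG hB
    set G' : Polynomial ℤ := Polynomial.C ((k+1).factorial:ℤ) * (G - Polynomial.monomial (k+1) (G.coeff (k+1))) with hG'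
    have := hF2 G' B (by
      rw [Polynomial.natDegree_le_iff_coeff_eq_zero]
      intro N hN
      rw [hG', Polynomial.coeff_C_mul, Polynomial.coeff_sub, Polynomial.coeff_monomial]
      split_ifs with hh
      · rw [hh, sub_self, mul_zero]
      · rw [sub_zero, Polynomial.coeff_eq_zero_of_natDegree_lt (by omega), mul_zero]) (fun x => by
      rw [hG', Polynomial.eval_mul, Polynomial.eval_C, Polynomial.eval_sub, Polynomial.eval_monomial, mul_sub, ← mul_assoc]
      exact dvd_sub (Dvd.dvd.mul_left (hB x) _) (Dvd.dvd.mul_right hl _)) j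
    by_cases hj : j = k + 1
    · rw [hj]; push_cast; rw [mul_assoc]; exact Dvd.dvd.mul_left hl _
    · rw [hG', Polynomial.coeff_C_mul, Polynomial.coeff_sub, Polynomial.coeff_monomial, if_neg (fun h => hj h.symm), sub_zero] at this
      push_cast; rw [mul_assoc]; exact this

open Finset

structure Dat (k : ℕ) (h : Polynomial ℤ) (z : ∀ (p : ℕ) [Fact p.Prime], ℤ_[p]) (lam : ℕ → ℕ)
    (r : ℕ → ℤ) (H : ℕ → Polynomial ℤ) : Prop where
  hk : 0 < k
  hdeg : h.natDegree = k
  hlead : 0 < h.leadingCoeff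
  hz : ∀ (p : ℕ) [Fact p.Prime], Polynomial.aeval (z p) h = 0
  hlam1 : lam 1 = 1
  hlamMul : ∀ a b : ℕ, lam (a * b) = lam a * lam b
  hlamP : ∀ (p : ℕ) [Fact p.Prime],
      lam p = p ^ Polynomial.rootMultiplicity (z p) (h.map (algebraMap ℤ ℤ_[p]))
  hr : ∀ d : ℕ, 0 < d → -(d : ℤ) < r d ∧ r d ≤ 0
  hrz : ∀ d : ℕ, 0 < d → ∀ (p : ℕ) [Fact p.Prime], ∀ α : ℕ, p ^ α ∣ d →
      (p : ℤ_[p]) ^ α ∣ (z p - (r d : ℤ_[p]))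
  hH : ∀ d : ℕ, 0 < d →
      Polynomial.C (lam d : ℤ) * H d =
        h.comp (Polynomial.C (r d) + Polynomial.C (d : ℤ) * Polynomial.X)

namespace Dat
variable {k : ℕ} {h : Polynomial ℤ} {z : ∀ (p : ℕ) [Fact p.Prime], ℤ_[p]} {lam : ℕ → ℕ}
    {r : ℕ → ℤ} {H : ℕ → Polynomial ℤ}

theorem h_ne (D : Dat k h z lam r H) : h ≠ 0 := by
  intro hh; have := D.hlead; rw [hh] at this; simp at this

theorem map_ne (D : Dat k h z lam r H) (p : ℕ) [Fact p.Prime] : h.map (algebraMap ℤ ℤ_[p]) ≠ 0 :=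
  (Polynomial.map_ne_zero_iff (RingHom.injective_int _)).2 D.h_ne

theorem mult_pos (D : Dat k h z lam r H) (p : ℕ) [Fact p.Prime] :
    1 ≤ Polynomial.rootMultiplicity (z p) (h.map (algebraMap ℤ ℤ_[p])) := by
  rw [Nat.one_le_iff_ne_zero, Ne, Polynomial.rootMultiplicity_eq_zero_iff]
  intro hh
  exact D.map_ne p (hh (by rw [Polynomial.IsRoot, Polynomial.eval_map_algebraMap]; exact D.hz p))

theorem mult_le (D : Dat k h z lam r H) (p : ℕ) [Fact p.Prime] :
    Polynomial.rootMultiplicity (z p) (h.map (algebraMap ℤ ℤ_[p])) ≤ k := by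
  have h1 := Polynomial.pow_rootMultiplicity_dvd (h.map (algebraMap ℤ ℤ_[p])) (z p)
  have h2 := Polynomial.natDegree_le_of_dvd h1 (D.map_ne p)
  rw [Polynomial.natDegree_pow, Polynomial.natDegree_X_sub_C, mul_one] at h2
  exact h2.trans (Polynomial.natDegree_map_le.trans D.hdeg.le)

theorem lam_props (D : Dat k h z lam r H) (d : ℕ) : 0 < d → 0 < lam d ∧ d ∣ lam d ∧ lam d ∣ d ^ k := by
  induction d using induction_on_primes with
  | zero => intro h; omega
  | one => intro _; rw [D.hlam1]; simp
  | prime_mul p a hp ih =>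
    intro hpa
    have ha : 0 < a := Nat.pos_of_mul_pos_left hpa
    obtain ⟨h1, h2, h3⟩ := ih ha
    have := Fact.mk hp
    have hm1 := D.mult_pos p
    have hm2 := D.mult_le p
    rw [D.hlamMul, D.hlamP p]
    refine ⟨Nat.mul_pos (pow_pos hp.pos _) h1, Nat.mul_dvd_mul (dvd_pow_self _ (by omega)) h2, ?_⟩
    rw [mul_pow]
    exact Nat.mul_dvd_mul (pow_dvd_pow _ hm2) h3

theorem lam_le (D : Dat k h z lam r H) (d : ℕ) (hd : 0 < d) : lam d ≤ d ^ k :=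
  Nat.le_of_dvd (pow_pos hd _) (D.lam_props d hd).2.2

theorem lam_eval (D : Dat k h z lam r H) (d : ℕ) (hd : 0 < d) (n : ℤ) :
    (lam d : ℤ) * (H d).eval n = h.eval (r d + d * n) := by
  have := congrArg (Polynomial.eval n) (D.hH d hd)
  simpa using this

theorem r_congr (D : Dat k h z lam r H) (q d : ℕ) (hq : 0 < q) (hd : 0 < d) : (d:ℤ) ∣ r (q * d) - r d := by
  have hqd : 0 < q * d := Nat.mul_pos hq hd
  rw [← Int.dvd_natAbs, Int.natCast_dvd_natCast]
  rw [Nat.dvd_iff_prime_pow_dvd_dvd]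
  intro p α hp hpd
  have := Fact.mk hp
  have h1 := D.hrz d hd p α hpd
  have h2 := D.hrz (q * d) hqd p α (Dvd.dvd.mul_left hpd q)
  have h3 := dvd_sub h1 h2
  rw [sub_sub_sub_cancel_left] at h3
  have h4 : (p:ℤ_[p])^α ∣ ((r (q*d) - r d : ℤ) : ℤ_[p]) := by push_cast; exact h3
  rw [PadicInt.pow_p_dvd_int_iff] at h4
  rw [← Int.natCast_dvd_natCast, Int.dvd_natAbs]
  exact_mod_cast h4

/-- the descent relation -/
theorem descent (D : Dat k h z lam r H) (q d : ℕ) (hq : 0 < q) (hd : 0 < d) (n : ℕ) (hn : 0 < n) :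
    ∃ m : ℕ, 0 < m ∧ (H d).eval (m:ℤ) = (lam q : ℤ) * (H (q*d)).eval (n:ℤ) := by
  have hqd : 0 < q * d := Nat.mul_pos hq hd
  obtain ⟨s, hs⟩ := D.r_congr q d hq hd
  obtain ⟨a1, a2⟩ := D.hr d hd
  obtain ⟨b1, b2⟩ := D.hr (q*d) hqd
  have hpos : 0 < s + q * n := by
    have e : (d:ℤ) * (s + q * n) = r (q*d) - r d + (q * d : ℕ) * n := by rw [hs]; push_cast; ring
    have : 0 < (d:ℤ) * (s + q * n) := by
      rw [e]
      have : ((q*d:ℕ):ℤ) ≤ ((q*d:ℕ):ℤ) * n := le_mul_of_one_le_right (by positivity) (by exact_mod_cast hn)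
      linarith
    exact pos_of_mul_pos_right this (by positivity)
  refine ⟨(s + q * n).toNat, by omega, ?_⟩
  rw [Int.toNat_of_nonneg hpos.le]
  have hl : (lam d : ℤ) ≠ 0 := by exact_mod_cast (D.lam_props d hd).1.ne'
  apply mul_left_cancel₀ hl
  rw [D.lam_eval d hd, ← mul_assoc]
  have : (lam d : ℤ) * lam q = lam (q * d) := by rw [D.hlamMul]; push_cast; ring
  rw [this, D.lam_eval (q*d) hqd]
  congr 1; push_cast; linear_combination -hs

theorem H_lead (D : Dat k h z lam r H) (d : ℕ) (hd : 0 < d) :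
    (H d).natDegree = k ∧ (lam d : ℤ) * (H d).coeff k = h.leadingCoeff * d ^ k := by
  have hl : (lam d : ℤ) ≠ 0 := by exact_mod_cast (D.lam_props d hd).1.ne'
  have hd0 : (d:ℤ) ≠ 0 := by exact_mod_cast hd.ne'
  have hlin : (Polynomial.C (r d) + Polynomial.C (d:ℤ) * Polynomial.X).natDegree = 1 := by
    rw [add_comm]; exact Polynomial.natDegree_linear hd0
  have hlinl : (Polynomial.C (r d) + Polynomial.C (d:ℤ) * Polynomial.X).leadingCoeff = (d:ℤ) := by
    rw [add_comm]; exact Polynomial.leadingCoeff_linear hd0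
  have h1 := congrArg Polynomial.natDegree (D.hH d hd)
  rw [Polynomial.natDegree_C_mul hl, Polynomial.natDegree_comp, hlin, mul_one, D.hdeg] at h1
  refine ⟨h1, ?_⟩
  have h2 := congrArg Polynomial.leadingCoeff (D.hH d hd)
  rw [Polynomial.leadingCoeff_mul, Polynomial.leadingCoeff_C, Polynomial.leadingCoeff_comp (by rw [hlin]; norm_num), hlinl, D.hdeg] at h2
  rw [← h2, Polynomial.leadingCoeff, h1]

theorem b_pos (D : Dat k h z lam r H) (d : ℕ) (hd : 0 < d) : 0 < (H d).coeff k := by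
  have h1 := (D.H_lead d hd).2
  have h2 : 0 < h.leadingCoeff * (d:ℤ)^k := mul_pos D.hlead (by positivity)
  rw [← h1] at h2
  exact pos_of_mul_pos_right h2 (by positivity)

theorem b_le (D : Dat k h z lam r H) (d : ℕ) (hd : 0 < d) : (H d).coeff k ≤ h.leadingCoeff * d ^ k := by
  rw [← (D.H_lead d hd).2]
  exact le_mul_of_one_le_left (D.b_pos d hd).le (by exact_mod_cast (D.lam_props d hd).1)

/-- size of the values -/
theorem H_size (D : Dat k h z lam r H) : ∃ K : ℕ, 1 ≤ K ∧ ∀ d : ℕ, 0 < d → ∀ n : ℕ, 1 ≤ n →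
    |(H d).eval (n:ℤ)| ≤ K * (H d).coeff k * n ^ k := by
  refine ⟨∑ i ∈ range (k+1), (h.coeff i).natAbs + 1, by omega, fun d hd n hn => ?_⟩
  have hl : (0:ℤ) < lam d := by exact_mod_cast (D.lam_props d hd).1
  obtain ⟨a1, a2⟩ := D.hr d hd
  have hn' : (1:ℤ) ≤ n := by exact_mod_cast hn
  have hd' : (1:ℤ) ≤ d := by exact_mod_cast hd
  have hx1 : 0 < r d + d * n := by nlinarith
  have hx2 : r d + d * n ≤ d * n := by linarith
  have hdn : 1 ≤ (d:ℤ) * n := by nlinarith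
  have h1 : |h.eval (r d + d * n)| ≤ (∑ i ∈ range (k+1), |h.coeff i|) * (d * n)^k := by
    rw [Polynomial.eval_eq_sum_range, D.hdeg, sum_mul]
    refine (abs_sum_le_sum_abs _ _).trans (sum_le_sum fun i hi => ?_)
    rw [abs_mul, abs_of_pos (pow_pos hx1 i)]
    apply mul_le_mul_of_nonneg_left _ (abs_nonneg _)
    calc (r d + d * n)^i ≤ (d*n)^i := pow_le_pow_left₀ hx1.le hx2 i
      _ ≤ (d*n)^k := pow_le_pow_right₀ hdn (by have := mem_range.1 hi; omega)
  rw [← D.lam_eval d hd, abs_mul, abs_of_pos hl] at h1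
  have h2 := (D.H_lead d hd).2
  have hL : 1 ≤ h.leadingCoeff := D.hlead
  have hdk : (0:ℤ) ≤ (d:ℤ)^k * n^k := by positivity
  have hsum : (0:ℤ) ≤ ∑ i ∈ range (k+1), |h.coeff i| := sum_nonneg fun i _ => abs_nonneg _
  have hcast : ((∑ i ∈ range (k+1), (h.coeff i).natAbs + 1 : ℕ) : ℤ) = ∑ i ∈ range (k+1), |h.coeff i| + 1 := by
    push_cast; simp
  rw [hcast]
  refine le_of_mul_le_mul_left ?_ hl
  calc (lam d : ℤ) * |(H d).eval (n:ℤ)| ≤ (∑ i ∈ range (k+1), |h.coeff i|) * (d * n)^k := h1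
    _ ≤ (∑ i ∈ range (k+1), |h.coeff i| + 1) * (h.leadingCoeff * (d * n)^k) := by
        apply mul_le_mul (by linarith) _ (by positivity) (by linarith)
        exact le_mul_of_one_le_left (by positivity) hL
    _ = (lam d : ℤ) * ((∑ i ∈ range (k+1), |h.coeff i| + 1) * (H d).coeff k * n^k) := by
        rw [mul_pow]; linear_combination -(∑ i ∈ range (k+1), |h.coeff i| + 1) * (n:ℤ)^k * h2
end Dat

open Finset

theorem unit_of_not_dvd (p : ℕ) [hp : Fact p.Prime] (n : ℕ) (hn : ¬ p ∣ n) : IsUnit (n : ℤ_[p]) := by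
  rw [PadicInt.isUnit_iff, PadicInt.norm_natCast_eq_one_iff]
  exact (Nat.Prime.coprime_iff_not_dvd hp.out).2 hn

theorem hasse_map {R S : Type*} [CommRing R] [CommRing S] (f : R →+* S) (P : Polynomial R) (m : ℕ) :
    Polynomial.hasseDeriv m (P.map f) = (Polynomial.hasseDeriv m P).map f := by
  ext n
  simp [Polynomial.hasseDeriv_coeff, Polynomial.coeff_map]

namespace Dat
variable {k : ℕ} {h : Polynomial ℤ} {z : ∀ (p : ℕ) [Fact p.Prime], ℤ_[p]} {lam : ℕ → ℕ}
    {r : ℕ → ℤ} {H : ℕ → Polynomial ℤ}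

theorem lam_assoc (D : Dat k h z lam r H) (p : ℕ) [hp : Fact p.Prime] (d : ℕ) : 0 < d →
    Associated (lam d : ℤ_[p]) ((d:ℤ_[p]) ^ Polynomial.rootMultiplicity (z p) (h.map (algebraMap ℤ ℤ_[p]))) := by
  induction d using induction_on_primes with
  | zero => intro h; omega
  | one => intro _; rw [D.hlam1]; simp
  | prime_mul l a hl ih =>
    intro hpa
    have ha : 0 < a := Nat.pos_of_mul_pos_left hpa
    have h1 := ih ha
    rw [D.hlamMul]; push_cast; rw [mul_pow]
    refine Associated.mul_mul ?_ h1
    by_cases hlp : l = p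
    · subst hlp
      rw [D.hlamP l]; push_cast; rfl
    · have := Fact.mk hl
      rw [D.hlamP l]; push_cast
      have hu : IsUnit (l : ℤ_[p]) := unit_of_not_dvd p l (fun hd => hlp ((Nat.prime_dvd_prime_iff_eq hp.out hl).1 hd).symm)
      exact (associated_one_iff_isUnit.2 (hu.pow _)).trans (associated_one_iff_isUnit.2 (hu.pow _)).symm

theorem d_dvd (D : Dat k h z lam r H) (p : ℕ) [hp : Fact p.Prime] (d : ℕ) (hd : 0 < d) :
    (d:ℤ_[p]) ∣ z p - (r d : ℤ_[p]) := by
  obtain ⟨v, d', hd', he⟩ := Nat.exists_eq_pow_mul_and_not_dvd hd.ne' p hp.out.ne_one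
  have h1 := D.hrz d hd p v ⟨d', he⟩
  have hu := unit_of_not_dvd p d' hd'
  have : (d:ℤ_[p]) = (p:ℤ_[p])^v * d' := by rw [he]; push_cast; rfl
  rw [this]
  exact (hu.mul_right_dvd).2 h1

theorem content_coeff (D : Dat k h z lam r H) : ∃ D₀ : ℤ, D₀ ≠ 0 ∧ ∀ (p : ℕ) [Fact p.Prime] (d : ℕ), 0 < d →
    ∃ (m : ℕ) (u : ℤ_[p]), 1 ≤ m ∧
      (Polynomial.taylor u ((H d).map (algebraMap ℤ ℤ_[p]))).coeff m ∣ (D₀ : ℤ_[p]) := by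
  choose Dj hDj hDj2 using fun j => root_div_int (Polynomial.hasseDeriv j h) h D.h_ne
  refine ⟨∏ j ∈ range (k+1), Dj j, prod_ne_zero_iff.2 fun j _ => hDj j, fun p _ d hd => ?_⟩
  obtain ⟨u, hu⟩ := D.d_dvd p d hd
  set m := Polynomial.rootMultiplicity (z p) (h.map (algebraMap ℤ ℤ_[p])) with hm
  set hp := h.map (algebraMap ℤ ℤ_[p]) with hhp
  refine ⟨m, u, D.mult_pos p, ?_⟩
  set c := (Polynomial.taylor u ((H d).map (algebraMap ℤ ℤ_[p]))).coeff m with hc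
  set g := (Polynomial.taylor (z p) hp).coeff m with hg
  have hg0 : g ≠ 0 := by
    have e := Polynomial.pow_mul_divByMonic_rootMultiplicity_eq hp (z p)
    rw [hg, ← e, Polynomial.taylor_mul, Polynomial.taylor_pow, map_sub, Polynomial.taylor_X, Polynomial.taylor_C, add_sub_cancel_right, ← hm, mul_comm,
      Polynomial.coeff_mul_X_pow', if_pos (le_refl _), Nat.sub_self, Polynomial.taylor_coeff_zero]
    exact Polynomial.eval_divByMonic_pow_rootMultiplicity_ne_zero _ (D.map_ne p)
  have hge : g = Polynomial.aeval (z p) (Polynomial.hasseDeriv m h) := by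
    rw [hg, Polynomial.taylor_coeff, hhp, hasse_map, Polynomial.eval_map_algebraMap]
  have hgD : g ∣ ((∏ j ∈ range (k+1), Dj j : ℤ) : ℤ_[p]) := by
    rcases hDj2 m p (z p) (D.hz p) with h1 | h1
    · exact absurd (hge.trans h1) hg0
    · rw [← hge] at h1
      refine h1.trans ?_
      push_cast
      exact dvd_prod_of_mem _ (mem_range.2 (by have := D.mult_le p; omega))
  refine dvd_trans ?_ hgD
  have key : (lam d : ℤ_[p]) * c = g * (d:ℤ_[p])^m := by
    have e1 := congrArg (fun P => (Polynomial.taylor u (P.map (algebraMap ℤ ℤ_[p]))).coeff m) (D.hH d hd)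
    simp only [Polynomial.map_mul, Polynomial.map_C, Polynomial.taylor_mul, Polynomial.taylor_C, Polynomial.coeff_C_mul,
      Polynomial.map_comp, Polynomial.map_add, Polynomial.map_X] at e1
    rw [← hc, ← hhp] at e1
    have e2 : Polynomial.taylor u (hp.comp (Polynomial.C ((algebraMap ℤ ℤ_[p]) (r d)) + Polynomial.C ((algebraMap ℤ ℤ_[p]) (d:ℤ)) * Polynomial.X))
        = (Polynomial.taylor (z p) hp).comp (Polynomial.C (d:ℤ_[p]) * Polynomial.X) := by
      rw [Polynomial.taylor_apply, Polynomial.taylor_apply, Polynomial.comp_assoc, Polynomial.comp_assoc]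
      congr 1
      simp only [Polynomial.add_comp, Polynomial.mul_comp, Polynomial.C_comp, Polynomial.X_comp]
      have : z p = (r d : ℤ_[p]) + d * u := by linear_combination hu
      rw [this]
      simp only [Polynomial.C_add, Polynomial.C_mul, eq_intCast, Int.cast_natCast]
      ring
    rw [e2, Polynomial.comp_C_mul_X_coeff] at e1
    simpa using e1
  obtain ⟨w, hw⟩ := D.lam_assoc p d hd
  rw [← hm] at hw
  rw [← hw] at key
  have hl : (lam d : ℤ_[p]) ≠ 0 := by exact_mod_cast (D.lam_props d hd).1.ne'
  have : c = g * w := by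
    apply mul_left_cancel₀ hl; rw [key]; ring
  rw [this]
  exact (Units.isUnit w).mul_right_dvd.2 (dvd_refl _)

theorem content (D : Dat k h z lam r H) : ∃ D₀ : ℕ, 1 ≤ D₀ ∧ ∀ d q : ℕ, 0 < d → 0 < q → ∀ (n₁ : ℤ) (B : ℕ),
    (∀ x : ℤ, (B:ℤ) ∣ (H d).eval (n₁ + q * x) - (H d).eval n₁) → B ∣ D₀ * q ^ k := by
  obtain ⟨F, hF, hF2⟩ := content_all k
  obtain ⟨D₁, hD₁, hD₁2⟩ := D.content_coeff
  refine ⟨F * D₁.natAbs, Nat.mul_pos hF (Int.natAbs_pos.2 hD₁), fun d q hd hq n₁ B hB => ?_⟩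
  set t := Polynomial.taylor n₁ (H d) with ht
  have htd : t.natDegree = k := by rw [ht, Polynomial.natDegree_taylor]; exact (D.H_lead d hd).1
  set G := t.comp (Polynomial.C (q:ℤ) * Polynomial.X) - Polynomial.C (t.coeff 0) with hG
  have hcf := hF2 G B (by
      refine (Polynomial.natDegree_sub_le _ _).trans (max_le ?_ (by simp))
      refine Polynomial.natDegree_comp_le.trans ?_
      rw [htd]
      have : (Polynomial.C (q:ℤ) * Polynomial.X).natDegree ≤ 1 := (Polynomial.natDegree_C_mul_le _ _).trans Polynomial.natDegree_X_le
      nlinarith) (fun x => by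
      have := hB x
      rw [hG, Polynomial.eval_sub, Polynomial.eval_comp, ht, Polynomial.taylor_eval, Polynomial.eval_C, Polynomial.taylor_coeff_zero]
      simpa [add_comm] using this)
  have hdv : Polynomial.C (B:ℤ) ∣ Polynomial.C ((F:ℤ) * q^k) * (t - Polynomial.C (t.coeff 0)) := by
    rw [Polynomial.C_dvd_iff_dvd_coeff]
    intro j
    rw [Polynomial.coeff_C_mul, Polynomial.coeff_sub, Polynomial.coeff_C]
    split_ifs with hj
    · rw [hj, sub_self, mul_zero]; exact dvd_zero _
    · rw [sub_zero]
      by_cases hjk : j ≤ k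
      · have := hcf j
        rw [hG, Polynomial.coeff_sub, Polynomial.comp_C_mul_X_coeff, Polynomial.coeff_C, if_neg hj, sub_zero] at this
        have e : (F:ℤ) * q^k * t.coeff j = (F * (t.coeff j * q^j)) * q^(k-j) := by
          have : (q:ℤ)^k = q^j * q^(k-j) := by rw [← pow_add]; congr 1; omega
          rw [this]; ring
        rw [e]; exact Dvd.dvd.mul_right this _
      · rw [Polynomial.coeff_eq_zero_of_natDegree_lt (by omega), mul_zero]; exact dvd_zero _
  obtain ⟨R, hR⟩ := hdv
  rw [Nat.dvd_iff_prime_pow_dvd_dvd]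
  intro p α hp hpB
  have := Fact.mk hp
  obtain ⟨m, u, hm, hc⟩ := hD₁2 p d hd
  have h1 := congrArg (fun P => (Polynomial.taylor (u - (n₁:ℤ_[p])) (P.map (algebraMap ℤ ℤ_[p]))).coeff m) hR
  have e1 : Polynomial.taylor (u - (n₁:ℤ_[p])) (t.map (algebraMap ℤ ℤ_[p])) =
      Polynomial.taylor u ((H d).map (algebraMap ℤ ℤ_[p])) := by
    rw [ht, Polynomial.map_taylor, Polynomial.taylor_taylor]
    congr 1; congr 1; simp
  simp only [Polynomial.map_mul, Polynomial.map_C, Polynomial.taylor_mul, Polynomial.taylor_C, Polynomial.coeff_C_mul,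
    Polynomial.map_sub, map_sub, Polynomial.coeff_sub] at h1
  rw [e1, Polynomial.coeff_C, if_neg (by omega), sub_zero] at h1
  have h2 : (B:ℤ_[p]) ∣ (((F:ℤ) * q^k : ℤ) : ℤ_[p]) * (D₁ : ℤ_[p]) := by
    refine dvd_trans ⟨(Polynomial.taylor (u - (n₁:ℤ_[p])) (R.map (algebraMap ℤ ℤ_[p]))).coeff m, ?_⟩ (mul_dvd_mul_left _ hc)
    simpa using h1
  have h3 : (p:ℤ_[p])^α ∣ (((F:ℤ) * q^k * D₁ : ℤ) : ℤ_[p]) := by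
    refine dvd_trans ?_ (by push_cast at h2 ⊢; exact h2)
    exact_mod_cast (Nat.cast_dvd_cast (α := ℤ_[p]) hpB)
  rw [PadicInt.pow_p_dvd_int_iff] at h3
  have h4 := Int.natAbs_dvd_natAbs.2 h3
  rw [Int.natAbs_pow, Int.natAbs_mul, Int.natAbs_mul, Int.natAbs_pow] at h4
  simp only [Int.natAbs_natCast] at h4
  convert h4 using 1; ring
end Dat

open Finset

theorem pow_sub_pow_bd (x y L : ℤ) (hx : 0 ≤ x) (hxy : x ≤ y) (hyL : y ≤ L) (i : ℕ) :
    y ^ i - x ^ i ≤ i * L ^ (i-1) * (y - x) := by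
  induction i with
  | zero => simp
  | succ i ih =>
    have e : y^(i+1) - x^(i+1) = y^i * (y - x) + x * (y^i - x^i) := by ring
    rw [e]
    have h1 : y^i ≤ L^i := pow_le_pow_left₀ (hx.trans hxy) hyL i
    have h2 : x * (y^i - x^i) ≤ L * (i * L^(i-1) * (y - x)) := by
      apply mul_le_mul (hxy.trans hyL) ih (sub_nonneg.2 (pow_le_pow_left₀ hx hxy i)) (hx.trans (hxy.trans hyL))
    have h3 : L * (i * L^(i-1) * (y-x)) = i * L^i * (y - x) := by
      rcases Nat.eq_zero_or_pos i with hi | hi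
      · simp [hi]
      · have : L^i = L * L^(i-1) := by rw [← pow_succ']; congr 1; omega
        rw [this]; ring
    have h4 : y^i * (y-x) ≤ L^i * (y-x) := mul_le_mul_of_nonneg_right h1 (by linarith)
    rw [Nat.add_sub_cancel]; push_cast; linarith

theorem shift_sum_bd (g : ℕ → ℂ) (hg : ∀ n, ‖g n‖ ≤ 1) (M j : ℕ) :
    ‖∑ n ∈ range M, g n - ∑ n ∈ range M, g (n + j)‖ ≤ 2 * j := by
  induction j with
  | zero => simp
  | succ j ih =>
    have h1 : ∑ n ∈ range M, g (n + j) - ∑ n ∈ range M, g (n + (j+1)) = g j - g (M + j) := by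
      have := sum_range_sub' (fun n => g (n + j)) M
      rw [sum_sub_distrib] at this
      simp only [zero_add] at this
      rw [← this]
      congr 1; refine sum_congr rfl fun n _ => by congr 1; ring
    have e : ∑ n ∈ range M, g n - ∑ n ∈ range M, g (n + (j+1)) =
      (∑ n ∈ range M, g n - ∑ n ∈ range M, g (n + j)) + (g j - g (M + j)) := by rw [← h1]; ring
    rw [e]
    refine (norm_add_le _ _).trans ?_
    have := norm_sub_le (g j) (g (M+j))
    push_cast
    linarith [hg j, hg (M+j)]

theorem exists_block (g : ℕ → ℂ) (hg : ∀ n, ‖g n‖ ≤ 1) (M B : ℕ) (hM : 1 ≤ M) :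
    ∃ n ∈ range M, (B:ℝ) * ‖∑ n ∈ range M, g n‖ - 2 * B^2 ≤ M * ‖∑ j ∈ range B, g (n + j)‖ := by
  by_contra hcon
  push Not at hcon
  have h1 := sum_lt_sum_of_nonempty ⟨0, mem_range.2 hM⟩ hcon
  rw [← mul_sum, sum_const, card_range, nsmul_eq_mul] at h1
  have hM' : (0:ℝ) < M := by exact_mod_cast hM
  have h2 := lt_of_mul_lt_mul_left h1 hM'.le
  have h3 : ‖∑ j ∈ range B, ∑ n ∈ range M, g n - ∑ n ∈ range M, ∑ j ∈ range B, g (n + j)‖ ≤ 2 * B^2 := by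
    rw [sum_comm (s := range M), ← sum_sub_distrib]
    refine (norm_sum_le _ _).trans ?_
    calc _ ≤ ∑ j ∈ range B, (2 * (B:ℝ)) := sum_le_sum fun j hj => (shift_sum_bd g hg M j).trans (by
            have : (j:ℝ) ≤ B := by exact_mod_cast (mem_range.1 hj).le
            linarith)
      _ = _ := by rw [sum_const, card_range, nsmul_eq_mul]; ring
  have h4 := norm_sum_le (range M) (fun n => ∑ j ∈ range B, g (n + j))
  rw [sum_const, card_range, nsmul_eq_mul] at h3
  have h5 := norm_sub_norm_le ((B:ℂ) * ∑ n ∈ range M, g n) (∑ n ∈ range M, ∑ j ∈ range B, g (n + j))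
  rw [norm_mul, Complex.norm_natCast] at h5
  linarith

namespace Dat
variable {k : ℕ} {h : Polynomial ℤ} {z : ∀ (p : ℕ) [Fact p.Prime], ℤ_[p]} {lam : ℕ → ℕ}
    {r : ℕ → ℤ} {H : ℕ → Polynomial ℤ}

theorem H_lip (D : Dat k h z lam r H) : ∃ K : ℕ, 1 ≤ K ∧ ∀ d : ℕ, 0 < d → ∀ n n' L : ℕ, 1 ≤ n → n ≤ n' → n' ≤ L →
    |(H d).eval (n':ℤ) - (H d).eval (n:ℤ)| ≤ K * (H d).coeff k * L ^ (k-1) * (n' - n) := by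
  refine ⟨(∑ i ∈ range (k+1), (h.coeff i).natAbs + 1) * k, Nat.mul_pos (by omega) D.hk, fun d hd n n' L hn hnn hL => ?_⟩
  have hl : (0:ℤ) < lam d := by exact_mod_cast (D.lam_props d hd).1
  obtain ⟨a1, a2⟩ := D.hr d hd
  have hn' : (1:ℤ) ≤ n := by exact_mod_cast hn
  have hnn' : (n:ℤ) ≤ n' := by exact_mod_cast hnn
  have hL' : (n':ℤ) ≤ L := by exact_mod_cast hL
  have hd' : (1:ℤ) ≤ d := by exact_mod_cast hd
  have hx1 : 0 < r d + d * n := by nlinarith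
  have hx2 : r d + d * n ≤ r d + d * n' := by nlinarith
  have hx3 : r d + d * n' ≤ d * L := by nlinarith
  have hdL : 1 ≤ (d:ℤ) * L := by linarith
  have h1 : |h.eval (r d + d * n') - h.eval (r d + d * n)| ≤ (∑ i ∈ range (k+1), |h.coeff i|) * (k * (d * L)^(k-1) * (d * (n' - n))) := by
    rw [Polynomial.eval_eq_sum_range, Polynomial.eval_eq_sum_range, D.hdeg, sum_mul, ← sum_sub_distrib]
    refine (abs_sum_le_sum_abs _ _).trans (sum_le_sum fun i hi => ?_)
    rw [← mul_sub, abs_mul, abs_of_nonneg (sub_nonneg.2 (pow_le_pow_left₀ hx1.le hx2 i))]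
    apply mul_le_mul_of_nonneg_left _ (abs_nonneg _)
    have hik := mem_range.1 hi
    refine (pow_sub_pow_bd _ _ _ hx1.le hx2 hx3 i).trans ?_
    have e : (r d + d * n' - (r d + d * n) : ℤ) = d * (n' - n) := by ring
    rw [e]
    apply mul_le_mul_of_nonneg_right _ (mul_nonneg (by linarith) (by linarith))
    apply mul_le_mul (by exact_mod_cast (by omega : i ≤ k)) (pow_le_pow_right₀ hdL (by omega)) (by positivity) (by positivity)
  rw [← D.lam_eval d hd, ← D.lam_eval d hd, ← mul_sub, abs_mul, abs_of_pos hl] at h1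
  have h2 := (D.H_lead d hd).2
  have hLc : 1 ≤ h.leadingCoeff := D.hlead
  have hsum : (0:ℤ) ≤ ∑ i ∈ range (k+1), |h.coeff i| := sum_nonneg fun i _ => abs_nonneg _
  have hcast : (((∑ i ∈ range (k+1), (h.coeff i).natAbs + 1) * k : ℕ) : ℤ) = (∑ i ∈ range (k+1), |h.coeff i| + 1) * k := by
    push_cast; simp
  rw [hcast]
  refine le_of_mul_le_mul_left ?_ hl
  have hdk : (d:ℤ)^k = d * d^(k-1) := by rw [← pow_succ']; congr 1; have := D.hk; omega
  have hnn0 : (0:ℤ) ≤ n' - n := by linarith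
  have hT : (0:ℤ) ≤ k * (d * L)^(k-1) * (d * (n' - n)) := by positivity
  calc (lam d : ℤ) * |(H d).eval (n':ℤ) - (H d).eval (n:ℤ)| ≤ (∑ i ∈ range (k+1), |h.coeff i|) * (k * (d * L)^(k-1) * (d * (n' - n))) := h1
    _ ≤ (∑ i ∈ range (k+1), |h.coeff i| + 1) * (h.leadingCoeff * (k * (d * L)^(k-1) * (d * (n' - n)))) := by
        apply mul_le_mul (by linarith) _ hT (by linarith)
        exact le_mul_of_one_le_left hT hLc
    _ = (lam d : ℤ) * ((∑ i ∈ range (k+1), |h.coeff i| + 1) * k * (H d).coeff k * L^(k-1) * (n' - n)) := by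
        rw [mul_pow]; rw [hdk] at h2
        linear_combination -(∑ i ∈ range (k+1), |h.coeff i| + 1) * k * (L:ℤ)^(k-1) * (n' - n) * h2
end Dat

open Finset

theorem tay_eval (G : Polynomial ℤ) (θ : ℝ) (s x : ℤ) :
    (Polynomial.C θ * (Polynomial.taylor s G).map (Int.castRingHom ℝ)).eval (x:ℝ) = θ * ((G.eval (x + s) : ℤ) : ℝ) := by
  rw [Polynomial.eval_mul, Polynomial.eval_C]
  congr 1
  have := Polynomial.eval_intCast_map (Int.castRingHom ℝ) (Polynomial.taylor s G) x
  rw [this, Polynomial.taylor_eval]; simp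

theorem tay_deg (G : Polynomial ℤ) (θ : ℝ) (s : ℤ) :
    (Polynomial.C θ * (Polynomial.taylor s G).map (Int.castRingHom ℝ)).natDegree ≤ G.natDegree := by
  refine (Polynomial.natDegree_C_mul_le _ _).trans (Polynomial.natDegree_map_le.trans ?_)
  rw [Polynomial.natDegree_taylor]

theorem tay_coeff (G : Polynomial ℤ) (θ : ℝ) (s : ℤ) :
    (Polynomial.C θ * (Polynomial.taylor s G).map (Int.castRingHom ℝ)).coeff G.natDegree = θ * (G.coeff G.natDegree : ℤ) := by
  rw [Polynomial.coeff_C_mul, Polynomial.coeff_map]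
  congr 1
  have := Polynomial.coeff_taylor_natDegree s G
  rw [this]; simp

theorem le_pow_self' (X n : ℕ) (hX : 2 ≤ X) : n ≤ X ^ n := (Nat.lt_pow_self (by omega)).le

namespace Dat
variable {k : ℕ} {h : Polynomial ℤ} {z : ∀ (p : ℕ) [Fact p.Prime], ℤ_[p]} {lam : ℕ → ℕ}
    {r : ℕ → ℤ} {H : ℕ → Polynomial ℤ}

set_option maxHeartbeats 1000000 in
theorem weyl (D : Dat k h z lam r H) : ∃ E : ℕ, 1 ≤ E ∧ ∀ d : ℕ, 0 < d → ∀ X : ℕ, 2 ≤ X → ∀ M : ℕ, 1 ≤ M →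
    X ^ E * d ^ k ≤ M → ∀ θ : ℝ,
    (M:ℝ) ≤ X * ‖∑ n ∈ range M, ee (θ * (((H d).eval ((n+1:ℕ):ℤ) : ℤ):ℝ))‖ →
    ∃ q : ℕ, 1 ≤ q ∧ q ≤ X ^ E ∧ ∃ a : ℤ, IsCoprime a (q:ℤ) ∧
      |θ - a / q| * (((H d).coeff k : ℤ) * (M:ℝ)^k) ≤ X ^ E := by
  obtain ⟨E1, hE1⟩ := lead k D.hk
  obtain ⟨E2, hE2⟩ := complete_sum k
  obtain ⟨K, hK1, hK⟩ := D.H_lip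
  obtain ⟨D0, hD01, hD0⟩ := D.content
  obtain ⟨ah, hah⟩ : ∃ a : ℕ, (a:ℤ) = h.leadingCoeff := ⟨h.leadingCoeff.toNat, Int.toNat_of_nonneg D.hlead.le⟩
  refine ⟨(1 + 2 * E1 + 5 + K + k + ah) + (D0 + 2 * E2 * k), by omega, fun d hd X hX M hM hXM θ hθ => ?_⟩
  set G := H d with hG
  obtain ⟨hGd, -⟩ := D.H_lead d hd
  have hbp := D.b_pos d hd
  have hble := D.b_le d hd
  obtain ⟨b, hb⟩ : ∃ a : ℕ, (a:ℤ) = (H d).coeff k := ⟨((H d).coeff k).toNat, Int.toNat_of_nonneg hbp.le⟩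
  have hK' := hK d hd
  rw [← hG] at hGd hb
  rw [← hG, ← hb] at hbp hble hK'
  rw [← hb]
  have hb1 : 1 ≤ b := by exact_mod_cast hbp
  have hble' : b ≤ ah * d^k := by rw [← hah] at hble; exact_mod_cast hble
  have hX0 : (0:ℝ) < X := by exact_mod_cast (by omega : 0 < X)
  have hX1 : (1:ℝ) ≤ X := by exact_mod_cast (by omega : 1 ≤ X)
  have hM0 : (0:ℝ) < M := by exact_mod_cast hM
  have hb0 : (0:ℝ) < b := by exact_mod_cast hb1
  have hcast1 : ∀ n : ℕ, (Polynomial.C θ * (Polynomial.taylor 1 G).map (Int.castRingHom ℝ)).eval (n:ℝ) = θ * ((G.eval ((n+1:ℕ):ℤ) : ℤ) : ℝ) := by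
    intro n
    have := tay_eval G θ 1 n
    push_cast at this ⊢
    exact this
  obtain ⟨q1, hq1, hq1E, a1, ha1⟩ := hE1 X hX M hM (Polynomial.C θ * (Polynomial.taylor 1 G).map (Int.castRingHom ℝ))
    ((tay_deg G θ 1).trans hGd.le) (by simp only [hcast1]; exact hθ)
  have hc := tay_coeff G θ 1
  rw [hGd, ← hb] at hc
  rw [hc] at ha1
  have hq10 : (0:ℝ) < q1 := by exact_mod_cast hq1
  set B := q1 * b with hB
  have hB1 : 1 ≤ B := Nat.mul_pos hq1 hb1
  have hB0 : (0:ℝ) < B := by exact_mod_cast hB1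
  set θ0 : ℝ := a1 / B with hθ0
  set β := θ - θ0 with hβ
  have hβ1 : |β| * (b * (M:ℝ)^k) ≤ X^E1 := by
    have e : (q1:ℝ) * (θ * ((b:ℤ):ℝ)) - a1 = B * β := by
      rw [hβ, hθ0, hB]; push_cast; field_simp
    rw [e, abs_mul, abs_of_pos hB0] at ha1
    have : (b:ℝ) ≤ B := by rw [hB]; push_cast; nlinarith [show (1:ℝ) ≤ q1 by exact_mod_cast hq1]
    calc |β| * (b * (M:ℝ)^k) ≤ |β| * (B * (M:ℝ)^k) := by gcongr
      _ = B * |β| * (M:ℝ)^k := by ring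
      _ ≤ _ := ha1
  -- size of B
  have hBs : 2 * X * B * (9 * K * 2^k * X^E1) ≤ M := by
    have e1 : B ≤ X^E1 * (ah * d^k) := Nat.mul_le_mul hq1E hble'
    have e2 := le_pow_self' X K hX
    have e3 := le_pow_self' X ah hX
    have e4 : 2^k ≤ X^k := Nat.pow_le_pow_left hX k
    have e5 : 2^5 ≤ X^5 := Nat.pow_le_pow_left hX 5
    calc 2 * X * B * (9 * K * 2^k * X^E1) ≤ 2 * X * (X^E1 * (X^ah * d^k)) * (9 * X^K * X^k * X^E1) := by gcongr; exact e1.trans (by gcongr)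
      _ = 18 * (X^(1+2*E1+K+k+ah)) * d^k := by ring
      _ ≤ X^5 * (X^(1+2*E1+K+k+ah)) * d^k := by gcongr; omega
      _ = X^(1 + 2 * E1 + 5 + K + k + ah) * d^k := by ring
      _ ≤ X^((1 + 2 * E1 + 5 + K + k + ah) + (D0 + 2 * E2 * k)) * d^k := Nat.mul_le_mul_right _ (Nat.pow_le_pow_right (by omega) (by omega))
      _ ≤ M := hXM
  have hBM : B ≤ M := by
    refine le_trans ?_ hBs
    have : 1 ≤ 9 * K * 2^k * X^E1 := Nat.mul_pos (by positivity) (by positivity)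
    calc B = 1 * 1 * B * 1 := by ring
      _ ≤ 2 * X * B * (9 * K * 2^k * X^E1) := Nat.mul_le_mul (Nat.mul_le_mul_right _ (by omega)) this
  obtain ⟨n, hn, hblk⟩ := exists_block (fun n => ee (θ * ((G.eval ((n+1:ℕ):ℤ) : ℤ):ℝ))) (fun n => (norm_ee _).le) M B hM
  rw [mem_range] at hn
  have hrep : ‖∑ j ∈ range B, ee (θ * ((G.eval ((n+j+1:ℕ):ℤ) : ℤ):ℝ)) -
      ee (β * (G.eval ((n+1:ℕ):ℤ) : ℤ)) * ∑ j ∈ range B, ee (θ0 * ((G.eval ((n+j+1:ℕ):ℤ) : ℤ):ℝ))‖ * M ≤ 7 * K * 2^k * X^E1 * B^2 := by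
    rw [mul_sum, ← sum_sub_distrib]
    refine (mul_le_mul_of_nonneg_right (norm_sum_le _ _) hM0.le).trans ?_
    rw [sum_mul]
    have : ∀ j ∈ range B, ‖ee (θ * ((G.eval ((n+j+1:ℕ):ℤ) : ℤ):ℝ)) - ee (β * (G.eval ((n+1:ℕ):ℤ) : ℤ)) * ee (θ0 * ((G.eval ((n+j+1:ℕ):ℤ) : ℤ):ℝ))‖ * M ≤ 7 * K * 2^k * X^E1 * B := by
      intro j hj
      rw [mem_range] at hj
      rw [← ee_add]
      have f1 := norm_ee_sub_ee_le (θ * ((G.eval ((n+j+1:ℕ):ℤ) : ℤ):ℝ)) (β * (G.eval ((n+1:ℕ):ℤ) : ℤ) + θ0 * ((G.eval ((n+j+1:ℕ):ℤ) : ℤ):ℝ))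
      have f2 : θ * ((G.eval ((n+j+1:ℕ):ℤ) : ℤ):ℝ) - (β * (G.eval ((n+1:ℕ):ℤ) : ℤ) + θ0 * ((G.eval ((n+j+1:ℕ):ℤ) : ℤ):ℝ))
        = β * ((G.eval ((n+j+1:ℕ):ℤ) : ℤ) - (G.eval ((n+1:ℕ):ℤ) : ℤ) : ℝ) := by rw [hβ]; ring
      rw [f2, abs_mul] at f1
      have f3 := hK' (n+1) (n+j+1) (2*M) (by omega) (by omega) (by omega)
      have f4 : |((G.eval ((n+j+1:ℕ):ℤ) : ℤ) - (G.eval ((n+1:ℕ):ℤ) : ℤ) : ℝ)| ≤ K * b * (2*M)^(k-1) * j := by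
        have : ((n+j+1:ℕ):ℤ) - ((n+1:ℕ):ℤ) = j := by push_cast; ring
        rw [this] at f3
        exact_mod_cast f3
      have f5 : ((2:ℝ)*M)^(k-1) * M ≤ 2^k * M^k := by
        obtain ⟨k', hk'⟩ : ∃ k', k = k'+1 := ⟨k-1, by have := D.hk; omega⟩
        rw [hk', Nat.add_sub_cancel, mul_pow, pow_succ, pow_succ]
        have : (0:ℝ) ≤ 2^k' * M^k' * M := by positivity
        nlinarith
      calc _ ≤ 7 * (|β| * (K * b * (2*M)^(k-1) * j)) * M := by
            refine mul_le_mul_of_nonneg_right (f1.trans ?_) hM0.le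
            gcongr
        _ = 7 * K * (|β| * b) * j * ((2*M)^(k-1) * M) := by ring
        _ ≤ 7 * K * (|β| * b) * B * (2^k * M^k) := by gcongr
        _ = 7 * K * 2^k * (|β| * (b * M^k)) * B := by ring
        _ ≤ 7 * K * 2^k * X^E1 * B := by gcongr
    refine (sum_le_sum this).trans (le_of_eq ?_)
    rw [sum_const, card_range, nsmul_eq_mul]; ring
  have hcs : (B:ℝ) ≤ (X^2:ℕ) * ‖∑ j ∈ range B, ee (θ0 * ((G.eval ((n+j+1:ℕ):ℤ) : ℤ):ℝ))‖ := by
    set S := ‖∑ j ∈ range B, ee (θ0 * ((G.eval ((n+j+1:ℕ):ℤ) : ℤ):ℝ))‖ with hS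
    have g1 := norm_sub_norm_le (∑ j ∈ range B, ee (θ * ((G.eval ((n+j+1:ℕ):ℤ) : ℤ):ℝ))) (ee (β * (G.eval ((n+1:ℕ):ℤ) : ℤ)) * ∑ j ∈ range B, ee (θ0 * ((G.eval ((n+j+1:ℕ):ℤ) : ℤ):ℝ)))
    rw [norm_mul, norm_ee, one_mul, ← hS] at g1
    have g2 := mul_le_mul_of_nonneg_right g1 hM0.le
    have g3 := g2.trans hrep
    have g4 : (B:ℝ) * M ≤ X * (B * ‖∑ n ∈ range M, ee (θ * ((G.eval ((n+1:ℕ):ℤ) : ℤ):ℝ))‖) := by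
      calc (B:ℝ) * M ≤ B * (X * ‖∑ n ∈ range M, ee (θ * ((G.eval ((n+1:ℕ):ℤ) : ℤ):ℝ))‖) := by gcongr
        _ = _ := by ring
    have hBs' : 2 * X * B * (9 * K * 2^k * X^E1) ≤ (M:ℝ) := by exact_mod_cast hBs
    have hone : (1:ℝ) ≤ K * 2^k * X^E1 := by exact_mod_cast Nat.mul_pos (Nat.mul_pos hK1 (by positivity)) (by positivity)
    -- M*S ≥ B*S1 - 2B^2 - 7..B^2
    have g5 : (B:ℝ) * ‖∑ n ∈ range M, ee (θ * ((G.eval ((n+1:ℕ):ℤ) : ℤ):ℝ))‖ ≤ M * S + 9 * K * 2^k * X^E1 * B^2 := by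
      have : (2:ℝ) * B^2 ≤ 2 * (K * 2^k * X^E1) * B^2 := by nlinarith [sq_nonneg (B:ℝ)]
      linarith
    have g6 : (B:ℝ) * M ≤ X * (M * S) + B * M / 2 := by
      calc (B:ℝ) * M ≤ X * (M * S + 9 * K * 2^k * X^E1 * B^2) := g4.trans (by gcongr)
        _ = X * (M * S) + B * (2 * X * B * (9 * K * 2^k * X^E1)) / 2 := by ring
        _ ≤ _ := by gcongr
    have g7 : (B:ℝ) * M ≤ (2 * X * S) * M := by linarith
    have g8 := le_of_mul_le_mul_right g7 hM0
    push_cast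
    have : (2:ℝ) ≤ X := by exact_mod_cast hX
    have hS0 : 0 ≤ S := norm_nonneg _
    nlinarith [mul_nonneg hX0.le hS0]
  have hcast2 : ∀ x : ℤ, (Polynomial.C θ0 * (Polynomial.taylor ((n+1:ℕ):ℤ) G).map (Int.castRingHom ℝ)).eval (x:ℝ) = θ0 * ((G.eval (x + (n+1:ℕ)) : ℤ) : ℝ) := fun x => tay_eval G θ0 _ x
  obtain ⟨q2, hq2, hq2E, n0, hn0⟩ := hE2 (X^2) (by nlinarith) B hB1 (Polynomial.C θ0 * (Polynomial.taylor ((n+1:ℕ):ℤ) G).map (Int.castRingHom ℝ)) ((tay_deg G θ0 _).trans hGd.le)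
    (by
      intro x
      rw [hcast2, hcast2]
      have : (B:ℤ) ∣ G.eval (x + B + (n+1:ℕ)) - G.eval (x + (n+1:ℕ)) := by
        have := Polynomial.sub_dvd_eval_sub (x + B + (n+1:ℕ)) (x + (n+1:ℕ)) G
        have e : x + B + ((n+1:ℕ):ℤ) - (x + (n+1:ℕ)) = B := by ring
        rwa [e] at this
      obtain ⟨c, hc⟩ := this
      rw [mem_ZZ]
      refine ⟨a1 * c, ?_⟩
      rw [← mul_sub, ← Int.cast_sub, hc, hθ0]
      push_cast; field_simp)
    (by
      convert hcs using 3
      refine sum_congr rfl fun j _ => ?_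
      have := hcast2 j
      push_cast at this ⊢
      rw [this]
      congr 4; ring)
  have hB0' : (B:ℤ) ≠ 0 := by exact_mod_cast (by omega : B ≠ 0)
  have hgpos : 0 < Int.gcd a1 B := Int.gcd_pos_of_ne_zero_right _ hB0'
  obtain ⟨a0, ha0⟩ := Int.gcd_dvd_left a1 (B:ℤ)
  obtain ⟨B', hB'⟩ : Int.gcd a1 B ∣ B := by exact_mod_cast Int.gcd_dvd_right a1 (B:ℤ)
  set g := Int.gcd a1 B with hg
  have hB'1 : 1 ≤ B' := by
    rcases Nat.eq_zero_or_pos B' with h0 | h0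
    · rw [h0] at hB'; omega
    · exact h0
  have hcop : IsCoprime a0 (B':ℤ) := by
    have hg0 : (g:ℤ) ≠ 0 := by exact_mod_cast hgpos.ne'
    obtain ⟨u, v, huv⟩ : ∃ u v : ℤ, u * a1 + v * B = g := ⟨Int.gcdA a1 B, Int.gcdB a1 B, by rw [hg, Int.gcd_eq_gcd_ab]; ring⟩
    refine ⟨u, v, ?_⟩
    apply mul_left_cancel₀ hg0
    have : (B:ℤ) = g * B' := by exact_mod_cast hB'
    rw [mul_add, mul_one]
    calc (g:ℤ) * (u * a0) + g * (v * B') = u * (g * a0) + v * (g * B') := by ring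
      _ = _ := by rw [← ha0, ← this, huv]
  have hθ0' : θ0 = a0 / B' := by
    have e1 : (a1:ℝ) = g * a0 := by exact_mod_cast ha0
    have e2 : (B:ℝ) = g * B' := by exact_mod_cast hB'
    have : (g:ℝ) ≠ 0 := by exact_mod_cast hgpos.ne'
    rw [hθ0, e1, e2, mul_div_mul_left _ _ this]
  have hdv := hD0 d q2 hd hq2 (n0 + (n+1:ℕ)) B' (by
    intro x
    have := hn0 x
    rw [hcast2, hcast2, ← mul_sub, mem_ZZ] at this
    obtain ⟨c, hc⟩ := this
    have e : n0 + q2 * x + ((n+1:ℕ):ℤ) = n0 + (n+1:ℕ) + q2 * x := by ring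
    rw [e, hθ0'] at hc
    have hB'0 : (B':ℝ) ≠ 0 := by exact_mod_cast (by omega : B' ≠ 0)
    have hc' : (a0:ℝ) * (((G.eval (n0 + (n+1:ℕ) + q2 * x) : ℤ):ℝ) - (G.eval (n0 + (n+1:ℕ)) : ℤ)) = B' * c := by
      rw [← hc]; field_simp
    have hc'' : a0 * (G.eval (n0 + (n+1:ℕ) + q2 * x) - G.eval (n0 + (n+1:ℕ))) = B' * c := by exact_mod_cast hc'
    exact hcop.symm.dvd_of_dvd_mul_left ⟨c, hc''⟩)
  refine ⟨B', hB'1, ?_, a0, hcop, ?_⟩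
  · have := Nat.le_of_dvd (Nat.mul_pos hD01 (pow_pos hq2 k)) hdv
    calc B' ≤ D0 * q2^k := this
      _ ≤ X^D0 * ((X^2)^E2)^k := by gcongr; exact le_pow_self' X D0 hX
      _ = X^(D0 + 2 * E2 * k) := by rw [← pow_mul, ← pow_mul, ← pow_add]; ring
      _ ≤ _ := Nat.pow_le_pow_right (by omega) (by omega)
  · rw [← hθ0']
    have h9 : (X:ℝ)^E1 ≤ X ^ (1 + 2 * E1 + 5 + K + k + ah + (D0 + 2 * E2 * k)) := pow_le_pow_right₀ hX1 (by omega)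
    have h8 : |θ - θ0| * (((b:ℤ):ℝ) * (M:ℝ)^k) ≤ X^E1 := by exact_mod_cast hβ1
    exact h8.trans h9

end Dat

open Finset

theorem hyper_ineq (m : ℕ) (hm : 1 ≤ m) (u v t : ℝ) (hu : 0 ≤ u) (hv : 0 ≤ v) (ht : t^2 ≤ u * v) :
    (u + v + 2 * t)^m ≤ (u + 8^m * v)^m + 2 * m * u^(m-1) * t := by
  have h2t : |2 * t| ≤ u + v := by
    apply abs_le_of_sq_le_sq _ (by linarith)
    nlinarith [sq_nonneg (u - v)]
  obtain ⟨h2a, h2b⟩ := abs_le.1 h2t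
  induction m, hm using Nat.le_induction with
  | base => simp; linarith
  | succ m hm ih =>
    obtain ⟨m, rfl⟩ : ∃ m', m = m' + 1 := ⟨m - 1, by omega⟩
    simp only [Nat.add_sub_cancel] at ih ⊢
    set K : ℝ := 8^(m+1) with hK
    have hK1 : (1:ℝ) ≤ K := one_le_pow₀ (by norm_num)
    have hK8 : (8:ℝ)^(m+1+1) = 8 * K := by rw [hK]; ring
    rw [hK8]
    have hKv : 0 ≤ K * v := by positivity
    set Z := u + K * v with hZ
    have hZ0 : 0 ≤ Z := by linarith
    have huZ : u ≤ Z := by linarith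
    have huvZ : u + v ≤ Z := by nlinarith
    have hum : u^m ≤ Z^m := pow_le_pow_left₀ hu huZ m
    have hZm : 0 ≤ Z^m := by positivity
    have hum0 : 0 ≤ u^m := by positivity
    have hm0 : (0:ℝ) ≤ m := by positivity
    -- difference bound
    have e0 : ∀ n : ℕ, ∀ y : ℝ, 0 ≤ y → Z^(n+1) + (n+1) * y * Z^n ≤ (Z + y)^(n+1) := by
      intro n y hy
      induction n with
      | zero => simp
      | succ n ih =>
        have : (Z + y)^(n+1+1) = (Z+y)^(n+1) * (Z + y) := by ring
        rw [this]
        have i2 := mul_le_mul_of_nonneg_right ih (by linarith : 0 ≤ Z + y)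
        refine le_trans ?_ i2
        push_cast
        have : 0 ≤ (n+1) * y * Z^n * y := by positivity
        have e : (Z ^ (n + 1) + (n + 1) * y * Z ^ n) * (Z + y) = Z ^ (n + 1 + 1) + (n + 1 + 1) * y * Z ^ (n + 1) + (n+1) * y * Z^n * y := by ring
        linarith
    have e1 : ∀ n : ℕ, Z^(n+1) - u^(n+1) ≤ (n+1) * (K * v) * Z^n := by
      intro n
      induction n with
      | zero => simp [hZ]
      | succ n ih =>
        have h1 : u^(n+1) ≤ Z^(n+1) := pow_le_pow_left₀ hu huZ _
        have : Z^(n+1+1) - u^(n+1+1) = Z * (Z^(n+1) - u^(n+1)) + u^(n+1) * (K * v) := by rw [hZ]; ring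
        rw [this]
        have i2 := mul_le_mul_of_nonneg_left ih hZ0
        have i3 := mul_le_mul_of_nonneg_right h1 hKv
        push_cast
        have e : Z * ((n+1) * (K*v) * Z^n) = (n+1) * (K*v) * Z^(n+1) := by ring
        linarith
    have e2 := e0 (m+1) (7 * K * v) (by positivity)
    have e3 : Z + 7 * K * v = u + 8 * K * v := by rw [hZ]; ring
    rw [e3] at e2
    have hX0 : 0 ≤ u + v + 2 * t := by linarith
    have e4 := mul_le_mul_of_nonneg_left ih hX0
    have e5 : (u + v + 2 * t)^(m+1+1) = (u + v + 2*t) * (u + v + 2*t)^(m+1) := by ring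
    rw [e5]
    refine e4.trans (le_trans ?_ (add_le_add_left e2 _))
    -- pieces
    have p1 : 2 * t * (Z^(m+1) - u^(m+1)) ≤ (m+1) * (K*v) * Z^(m+1) := by
      have d0 : 0 ≤ Z^(m+1) - u^(m+1) := sub_nonneg.2 (pow_le_pow_left₀ hu huZ _)
      calc 2 * t * (Z^(m+1) - u^(m+1)) ≤ Z * (Z^(m+1) - u^(m+1)) := mul_le_mul_of_nonneg_right (by linarith) d0
        _ ≤ Z * ((m+1) * (K * v) * Z^m) := mul_le_mul_of_nonneg_left (e1 m) hZ0
        _ = _ := by ring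
    have p2 : u^m * v * (2 * t) ≤ v * Z^(m+1) := by
      calc u^m * v * (2*t) ≤ u^m * v * Z := mul_le_mul_of_nonneg_left (by linarith) (by positivity)
        _ ≤ Z^m * v * Z := by gcongr
        _ = _ := by ring
    have p3 : u^m * t^2 ≤ v * Z^(m+1) := by
      calc u^m * t^2 ≤ u^m * (u * v) := mul_le_mul_of_nonneg_left ht hum0
        _ = v * u^(m+1) := by ring
        _ ≤ _ := mul_le_mul_of_nonneg_left (pow_le_pow_left₀ hu huZ _) hv
    have p4 : (u + v) * Z^(m+1) ≤ Z^(m+1+1) - (K - 1) * v * Z^(m+1) := by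
      apply le_of_eq; rw [hZ]; ring
    have p2' := mul_le_mul_of_nonneg_left p2 (by positivity : (0:ℝ) ≤ (m+1))
    have p3' := mul_le_mul_of_nonneg_left p3 (by positivity : (0:ℝ) ≤ 4 * (m+1))
    have p5 : 0 ≤ v * Z^(m+1) := by positivity
    have p6 : v * Z^(m+1) ≤ K * v * Z^(m+1) := by nlinarith
    have p7 : (m:ℝ) * (v * Z^(m+1)) ≤ m * (K * v * Z^(m+1)) := mul_le_mul_of_nonneg_left p6 hm0
    have p8 : 0 ≤ (m:ℝ) * (K * v * Z^(m+1)) := by positivity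
    have p9 : 0 ≤ K * v * Z^(m+1) := by positivity
    push_cast
    have e : (u + v + 2 * t) * (Z ^ (m + 1) + 2 * (m + 1) * u ^ m * t) = (u+v) * Z^(m+1) + 2 * t * (Z^(m+1) - u^(m+1))
      + (m+1) * (u^m * v * (2*t)) + 4 * (m+1) * (u^m * t^2) + 2 * (m+1+1) * u^(m+1) * t := by ring
    rw [e]
    generalize hw : v * Z^(m+1) = w at *
    have e6 : K * v * Z^(m+1) = K * w := by rw [← hw]; ring
    have e7 : (m+1) * (K*v) * Z^(m+1) = (m+1) * (K * w) := by rw [← hw]; ring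
    have e8 : (K - 1) * v * Z^(m+1) = K * w - w := by rw [← hw]; ring
    have e9 : ((m:ℝ)+1+1) * (7 * K * v) * Z^(m+1) = 7 * (m * (K * w)) + 14 * (K * w) := by rw [← hw]; ring
    rw [e9]
    rw [e6] at p6 p7 p8 p9
    rw [e7] at p1
    rw [e8] at p4
    linarith

theorem sum_shift (W : ℕ) (f : ℤ → ℂ) (hf : ∀ y, f (y + W) = f y) (s : ℕ) :
    ∑ y ∈ range W, f ((y:ℤ) + s) = ∑ y ∈ range W, f y := by
  induction s with
  | zero => simp
  | succ s ih =>
    rw [← ih]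
    have h1 := sum_range_succ (fun y : ℕ => f ((y:ℤ) + s)) W
    have h2 := sum_range_succ' (fun y : ℕ => f ((y:ℤ) + s)) W
    rw [h1] at h2
    have e : f ((W:ℤ) + s) = f (((0:ℕ):ℤ) + s) := by rw [add_comm, hf]; simp
    rw [e] at h2
    rw [add_right_cancel h2]
    refine sum_congr rfl fun y _ => ?_
    push_cast; congr 1; ring

theorem sum_avg (W : ℕ) (f : ℤ → ℂ) (hf : ∀ y, f (y + W) = f y) (s n : ℕ) :
    (n:ℂ) * ∑ y ∈ range W, f y = ∑ y ∈ range W, ∑ j ∈ range n, f ((y:ℤ) + s * j) := by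
  rw [sum_comm]
  have : ∀ j ∈ range n, ∑ y ∈ range W, f ((y:ℤ) + s * j) = ∑ y ∈ range W, f y := by
    intro j _
    have := sum_shift W f hf (s*j)
    push_cast at this; exact this
  rw [sum_congr rfl this, sum_const, card_range, nsmul_eq_mul]

theorem per_mul {α : Type*} (f : ℤ → α) (V : ℕ) (hf : ∀ y, f (y + V) = f y) (y : ℤ) (j : ℕ) : f (y + V * j) = f y := by
  induction j with
  | zero => simp
  | succ j ih => rw [← ih, ← hf (y + V * j)]; push_cast; congr 1; ring

theorem per_dvd {α : Type*} (f : ℤ → α) (V W : ℕ) (hf : ∀ y, f (y + V) = f y) (hVW : V ∣ W) (y : ℤ) : f (y + W) = f y := by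
  obtain ⟨c, rfl⟩ := hVW
  have := per_mul f V hf y c
  push_cast; exact this

theorem sum_zero_of (V n : ℕ) (hn : 0 < n) (g b : ℤ → ℂ) (hg : ∀ y, g (y + V) = g y)
    (hbW : ∀ y, b (y + (V * n : ℕ)) = b y) (hb : ∀ y, ∑ j ∈ range n, b (y + V * j) = 0) :
    ∑ y ∈ range (V * n), g y * b y = 0 := by
  have h1 := sum_avg (V*n) (fun y => g y * b y) (fun y => by
    show g (y + (V*n:ℕ)) * b (y + (V*n:ℕ)) = _
    rw [hbW, per_dvd g V (V*n) hg (dvd_mul_right _ _)]) V n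
  have h2 : ∀ y ∈ range (V*n), ∑ j ∈ range n, g ((y:ℤ) + V * j) * b ((y:ℤ) + V * j) = 0 := by
    intro y _
    rw [sum_congr rfl (fun j _ => by rw [per_mul g V hg]), ← mul_sum, hb, mul_zero]
  rw [sum_eq_zero h2] at h1
  have : (n:ℂ) ≠ 0 := by exact_mod_cast hn.ne'
  exact (mul_eq_zero.1 h1).resolve_left this

noncomputable def PF (S : Finset ℕ) (F : ℕ → ℤ → ℂ) (P U : Finset ℕ) (y : ℤ) : ℂ :=
  ∑ q ∈ S with q.primeFactors ∩ P = U, F q y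

theorem PF_insert (S : Finset ℕ) (F : ℕ → ℤ → ℂ) (P U : Finset ℕ) (p : ℕ) (hp : p ∉ P) (hU : U ⊆ P) (y : ℤ) :
    PF S F P U y = PF S F (insert p P) U y + PF S F (insert p P) (insert p U) y := by
  unfold PF
  rw [sum_filter, sum_filter, sum_filter, ← sum_add_distrib]
  refine sum_congr rfl fun q _ => ?_
  have hpU : p ∉ U := fun h => hp (hU h)
  by_cases hq : p ∈ q.primeFactors
  · have e1 : q.primeFactors ∩ insert p P = insert p (q.primeFactors ∩ P) := by
      rw [inter_insert_of_mem hq]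
    have e2 : ¬ (insert p (q.primeFactors ∩ P) = U) := fun h => hpU (h ▸ mem_insert_self _ _)
    rw [e1, if_neg e2, zero_add]
    have e3 : insert p (q.primeFactors ∩ P) = insert p U ↔ q.primeFactors ∩ P = U := by
      constructor
      · intro h
        have hh := congrArg (fun s => s.erase p) h
        rwa [erase_insert (by simp [hp]), erase_insert hpU] at hh
      · intro h; rw [h]
    simp only [e3]
  · have e1 : q.primeFactors ∩ insert p P = q.primeFactors ∩ P := by
      rw [inter_insert_of_notMem hq]
    have e2 : ¬ (q.primeFactors ∩ P = insert p U) := fun h => by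
      have : p ∈ q.primeFactors ∩ P := h ▸ mem_insert_self _ _
      exact hp (mem_inter.1 this).2
    rw [e1, if_neg e2, add_zero]

noncomputable def Phi (S : Finset ℕ) (F : ℕ → ℤ → ℂ) (m W : ℕ) (P : Finset ℕ) : ℝ :=
  ∑ y ∈ range W, (∑ U ∈ P.powerset, (8:ℝ)^(m * #U) * ‖PF S F P U (y:ℤ)‖^2)^m

theorem norm_add_sq_c (a b : ℂ) : ‖a + b‖^2 = ‖a‖^2 + ‖b‖^2 + 2 * ((starRingEnd ℂ) a * b).re := by
  rw [← Complex.normSq_eq_norm_sq, ← Complex.normSq_eq_norm_sq, ← Complex.normSq_eq_norm_sq, Complex.normSq_add]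
  congr 2
  simp [Complex.mul_re, Complex.conj_re, Complex.conj_im]

theorem Phi_step (S : Finset ℕ) (F : ℕ → ℤ → ℂ) (m W : ℕ) (hm : 1 ≤ m) (P : Finset ℕ) (p : ℕ) (hp : p ∉ P)
    (V n : ℕ) (hn : 0 < n) (hW : W = V * n)
    (hFW : ∀ q ∈ S, ∀ y, F q (y + W) = F q y)
    (h1 : ∀ q ∈ S, p ∉ q.primeFactors → ∀ y, F q (y + V) = F q y)
    (h2 : ∀ q ∈ S, p ∈ q.primeFactors → ∀ y, ∑ j ∈ range n, F q (y + V * j) = 0) :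
    Phi S F m W P ≤ Phi S F m W (insert p P) := by
  set a : Finset ℕ → ℤ → ℂ := fun U y => PF S F (insert p P) U y with ha
  set b : Finset ℕ → ℤ → ℂ := fun U y => PF S F (insert p P) (insert p U) y with hb
  have haV : ∀ U ⊆ P, ∀ y, a U (y + V) = a U y := by
    intro U hU y
    refine sum_congr rfl fun q hq => h1 q (mem_filter.1 hq).1 (fun hpq => ?_) y
    have : p ∈ U := by
      rw [← (mem_filter.1 hq).2]; exact mem_inter.2 ⟨hpq, mem_insert_self _ _⟩
    exact hp (hU this)
  have hbW : ∀ U y, b U (y + (V * n : ℕ)) = b U y := by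
    intro U y
    refine sum_congr rfl fun q hq => ?_
    rw [← hW]; exact hFW q (mem_filter.1 hq).1 y
  have hb0 : ∀ U y, ∑ j ∈ range n, b U (y + V * j) = 0 := by
    intro U y
    simp only [hb, PF]
    rw [sum_comm]
    refine sum_eq_zero fun q hq => h2 q (mem_filter.1 hq).1 ?_ y
    have : p ∈ q.primeFactors ∩ insert p P := by rw [(mem_filter.1 hq).2]; exact mem_insert_self _ _
    exact (mem_inter.1 this).1
  set u : ℤ → ℝ := fun y => ∑ U ∈ P.powerset, (8:ℝ)^(m * #U) * ‖a U y‖^2 with hu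
  set v : ℤ → ℝ := fun y => ∑ U ∈ P.powerset, (8:ℝ)^(m * #U) * ‖b U y‖^2 with hv
  set t : ℤ → ℝ := fun y => ∑ U ∈ P.powerset, (8:ℝ)^(m * #U) * ((starRingEnd ℂ) (a U y) * b U y).re with ht
  have huV : ∀ y, u (y + V) = u y := by
    intro y
    refine sum_congr rfl fun U hU => ?_
    rw [haV U (mem_powerset.1 hU)]
  have hL : Phi S F m W P = ∑ y ∈ range W, (u y + v y + 2 * t y)^m := by
    refine sum_congr rfl fun y _ => ?_
    congr 1
    rw [hu, hv, ht]
    simp only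
    rw [mul_sum, ← sum_add_distrib, ← sum_add_distrib]
    refine sum_congr rfl fun U hU => ?_
    rw [PF_insert S F P U p hp (mem_powerset.1 hU), norm_add_sq_c]
    ring
  have hR : Phi S F m W (insert p P) = ∑ y ∈ range W, (u y + 8^m * v y)^m := by
    refine sum_congr rfl fun y _ => ?_
    congr 1
    rw [sum_powerset_insert hp]
    congr 1
    rw [hv]; simp only
    rw [mul_sum]
    refine sum_congr rfl fun U hU => ?_
    rw [card_insert_of_notMem (fun h => hp (mem_powerset.1 hU h)), mul_add, mul_one, pow_add]
    ring
  have htuv : ∀ y, (t y)^2 ≤ u y * v y := by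
    intro y
    have e1 : |t y| ≤ ∑ U ∈ P.powerset, ((Real.sqrt ((8:ℝ)^(m * #U))) * ‖a U y‖) * ((Real.sqrt ((8:ℝ)^(m * #U))) * ‖b U y‖) := by
      refine (abs_sum_le_sum_abs _ _).trans (sum_le_sum fun U _ => ?_)
      rw [abs_mul, abs_of_pos (by positivity : (0:ℝ) < 8^(m * #U))]
      have := Complex.abs_re_le_norm ((starRingEnd ℂ) (a U y) * b U y)
      rw [norm_mul, RCLike.norm_conj] at this
      have hs := Real.mul_self_sqrt (by positivity : (0:ℝ) ≤ 8^(m * #U))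
      calc (8:ℝ)^(m * #U) * |((starRingEnd ℂ) (a U y) * b U y).re| ≤ (8:ℝ)^(m * #U) * (‖a U y‖ * ‖b U y‖) := by gcongr
        _ = (Real.sqrt ((8:ℝ)^(m * #U)) * Real.sqrt ((8:ℝ)^(m * #U))) * (‖a U y‖ * ‖b U y‖) := by rw [hs]
        _ = _ := by ring
    have e2 := sum_mul_sq_le_sq_mul_sq P.powerset (fun U => (Real.sqrt ((8:ℝ)^(m * #U))) * ‖a U y‖) (fun U => (Real.sqrt ((8:ℝ)^(m * #U))) * ‖b U y‖)
    rw [← sq_abs]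
    refine (pow_le_pow_left₀ (abs_nonneg _) e1 2).trans (e2.trans (le_of_eq ?_))
    rw [hu, hv]
    congr 1
    all_goals
      refine sum_congr rfl fun U _ => ?_
      rw [mul_pow, Real.sq_sqrt (by positivity)]
  have hz : ∑ y ∈ range W, u y ^ (m-1) * t y = 0 := by
    have : ((∑ y ∈ range W, u y ^ (m-1) * t y : ℝ)) = (∑ U ∈ P.powerset, ((8:ℝ)^(m * #U) : ℂ) * ∑ y ∈ range W, (((u y ^ (m-1) : ℝ):ℂ) * (starRingEnd ℂ) (a U y)) * b U y).re := by
      rw [Complex.re_sum]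
      rw [ht]; simp only
      simp_rw [mul_sum]
      rw [sum_comm]
      refine sum_congr rfl fun U _ => ?_
      rw [Complex.re_sum]
      refine sum_congr rfl fun y _ => ?_
      have e : ((8:ℝ)^(m * #U) : ℂ) * ((((u y ^ (m-1) : ℝ):ℂ) * (starRingEnd ℂ) (a U y)) * b U y) = (((u y ^ (m-1) * (8:ℝ)^(m * #U) : ℝ)):ℂ) * ((starRingEnd ℂ) (a U y) * b U y) := by push_cast; ring
      rw [e, Complex.re_ofReal_mul]; ring
    rw [this]
    rw [sum_eq_zero, Complex.zero_re]
    intro U hU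
    rw [hW]
    rw [sum_zero_of V n hn (fun y => ((u y ^ (m-1) : ℝ):ℂ) * (starRingEnd ℂ) (a U y)) (b U) (fun y => by
      show ((u (y+V) ^ (m-1) : ℝ):ℂ) * (starRingEnd ℂ) (a U (y+V)) = _; rw [huV, haV U (mem_powerset.1 hU)]) (hbW U) (hb0 U), mul_zero]
  rw [hL, hR]
  have hfin : ∀ y ∈ range W, (u y + v y + 2 * t y)^m ≤ (u y + 8^m * v y)^m + 2 * m * (u y^(m-1) * t y) := by
    intro y _
    have := hyper_ineq m hm (u y) (v y) (t y) (sum_nonneg fun U _ => by positivity) (sum_nonneg fun U _ => by positivity) (htuv y)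
    linarith
  refine (sum_le_sum hfin).trans (le_of_eq ?_)
  rw [sum_add_distrib, ← mul_sum, hz, mul_zero, add_zero]

open Finset

theorem sum_inv_sq_le (N : ℕ) : (∑ e ∈ Icc 1 N, 1 / ((e:ℝ) + 1)^2 : ℝ) ≤ 1 := by
  have : (∑ e ∈ Icc 1 N, 1 / ((e:ℝ) + 1)^2 : ℝ) ≤ 1 - 1 / ((N:ℝ) + 1) := by
    induction N with
    | zero => simp
    | succ N ih =>
      rw [sum_Icc_succ_top (by omega)]
      push_cast
      have : 1 / ((N:ℝ) + 1 + 1)^2 ≤ 1 / (N+1) - 1 / (N + 1 + 1) := by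
        rw [div_sub_div _ _ (by positivity) (by positivity), div_le_div_iff₀ (by positivity) (by positivity)]
        nlinarith [show (0:ℝ) ≤ N by positivity]
      linarith
  have h2 : (0:ℝ) ≤ 1 / (N + 1) := by positivity
  linarith

theorem tau_sum (P : Finset ℕ) : ∀ S : Finset ℕ, (∀ q ∈ S, 0 < q) →
    ∑ q ∈ S with q.primeFactors = P, 1 / ((#q.divisors : ℝ))^2 ≤ 1 := by
  induction P using Finset.induction_on with
  | empty =>
    intro S hS
    have hsub : S.filter (fun q => q.primeFactors = ∅) ⊆ {1} := by
      intro q hq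
      rw [mem_filter] at hq
      have := hS q hq.1
      rcases Nat.primeFactors_eq_empty.1 hq.2 with h | h
      · omega
      · simp [h]
    refine (sum_le_sum_of_subset_of_nonneg hsub (fun _ _ _ => by positivity)).trans ?_
    simp
  | insert p P hp ih =>
    intro S hS
    by_cases hpp : p.Prime
    swap
    · rw [sum_eq_zero]; exact zero_le_one
      intro q hq
      have : p ∈ q.primeFactors := by rw [(mem_filter.1 hq).2]; exact mem_insert_self _ _
      exact absurd (Nat.prime_of_mem_primeFactors this) hpp
    set T := S.filter (fun q => q.primeFactors = insert p P) with hT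
    set S' := T.image (fun q => q / p ^ q.factorization p) with hS'
    have hS'pos : ∀ q ∈ S', 0 < q := by
      intro q hq
      obtain ⟨q0, hq0, rfl⟩ := mem_image.1 hq
      exact Nat.ordCompl_pos p (hS q0 (mem_filter.1 hq0).1).ne'
    have key := ih S' hS'pos
    have e1 : ∑ q ∈ T, 1 / ((#q.divisors : ℝ))^2 = ∑ q ∈ T, (fun x : ℕ × ℕ => 1 / ((x.1:ℝ)+1)^2 * (1 / ((#x.2.divisors : ℝ))^2)) (q.factorization p, q / p ^ q.factorization p) := by
      refine sum_congr rfl fun q hq => ?_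
      have hq0 := hS q (mem_filter.1 hq).1
      have h1 := Nat.ordProj_mul_ordCompl_eq_self q p
      have hc : Nat.Coprime (p ^ q.factorization p) (q / p ^ q.factorization p) := Nat.Coprime.pow_left _ (Nat.coprime_ordCompl hpp hq0.ne')
      have h2 := hc.card_divisors_mul
      rw [h1, Nat.divisors_prime_pow hpp, card_map, card_range] at h2
      simp only
      rw [h2]; push_cast
      rw [mul_pow]; field_simp
    have hinj : Set.InjOn (fun q : ℕ => (q.factorization p, q / p ^ q.factorization p)) T := by
      intro a _ b _ hab
      simp only [Prod.mk.injEq] at hab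
      rw [← Nat.ordProj_mul_ordCompl_eq_self a p, ← Nat.ordProj_mul_ordCompl_eq_self b p, hab.2, hab.1]
    rw [e1, ← sum_image (f := fun x : ℕ × ℕ => 1 / ((x.1:ℝ)+1)^2 * (1 / ((#x.2.divisors : ℝ))^2)) hinj]
    have hsub : T.image (fun q : ℕ => (q.factorization p, q / p ^ q.factorization p)) ⊆ Icc 1 (∑ q ∈ T, q) ×ˢ (S'.filter (fun q => q.primeFactors = P)) := by
      intro x hx
      obtain ⟨q, hq, rfl⟩ := mem_image.1 hx
      have hq0 := hS q (mem_filter.1 hq).1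
      have hpf := (mem_filter.1 hq).2
      have hpq : p ∈ q.primeFactors := by rw [hpf]; exact mem_insert_self _ _
      rw [mem_product, mem_Icc, mem_filter]
      refine ⟨⟨?_, ?_⟩, mem_image_of_mem _ hq, ?_⟩
      · exact hpp.factorization_pos_of_dvd hq0.ne' (Nat.dvd_of_mem_primeFactors hpq)
      · refine (Nat.factorization_lt p hq0.ne').le.trans (single_le_sum (f := fun q : ℕ => q) (fun _ _ => Nat.zero_le _) hq)
      · show (q / p ^ q.factorization p).primeFactors = P
        have h1 := Nat.ordProj_mul_ordCompl_eq_self q p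
        have hc : Nat.Coprime (p ^ q.factorization p) (q / p ^ q.factorization p) := Nat.Coprime.pow_left _ (Nat.coprime_ordCompl hpp hq0.ne')
        have h3 := hc.primeFactors_mul
        have hfp : q.factorization p ≠ 0 := (hpp.factorization_pos_of_dvd hq0.ne' (Nat.dvd_of_mem_primeFactors hpq)).ne'
        rw [h1, hpf, Nat.primeFactors_prime_pow hfp hpp] at h3
        have hn : p ∉ (q / p ^ q.factorization p).primeFactors := by
          intro h
          exact Nat.not_dvd_ordCompl hpp hq0.ne' (Nat.dvd_of_mem_primeFactors h)
        have h4 := congrArg (fun s => s.erase p) h3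
        simp only [singleton_union] at h4
        rw [erase_insert hp, erase_insert hn] at h4
        exact h4.symm
    refine (sum_le_sum_of_subset_of_nonneg hsub (fun _ _ _ => by positivity)).trans ?_
    rw [sum_product]
    simp only
    simp_rw [← mul_sum]
    rw [← sum_mul]
    exact mul_le_one₀ (sum_inv_sq_le _) (sum_nonneg fun _ _ => by positivity) key

theorem sqfun (S : Finset ℕ) (hS : ∀ q ∈ S, 0 < q) (F : ℕ → ℤ → ℂ) (m W : ℕ) (hm : 1 ≤ m)
    (hFW : ∀ q ∈ S, ∀ y, F q (y + W) = F q y)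
    (hp : ∀ p : ℕ, p.Prime → ∃ V n : ℕ, 0 < n ∧ W = V * n ∧
      (∀ q ∈ S, p ∉ q.primeFactors → ∀ y, F q (y + V) = F q y) ∧
      (∀ q ∈ S, p ∈ q.primeFactors → ∀ y, ∑ j ∈ range n, F q (y + V * j) = 0)) :
    ∑ y ∈ range W, ‖∑ q ∈ S, F q (y:ℤ)‖^(2*m) ≤
      ∑ y ∈ range W, (∑ q ∈ S, (8:ℝ)^(m * #q.primeFactors) * (#q.divisors : ℝ)^2 * ‖F q (y:ℤ)‖^2)^m := by
  have h0 : ∑ y ∈ range W, ‖∑ q ∈ S, F q (y:ℤ)‖^(2*m) = Phi S F m W ∅ := by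
    refine sum_congr rfl fun y _ => ?_
    simp [PF, pow_mul]
  have h1 : ∀ P : Finset ℕ, (∀ p ∈ P, p.Prime) → Phi S F m W ∅ ≤ Phi S F m W P := by
    intro P
    induction P using Finset.induction_on with
    | empty => intro _; exact le_rfl
    | insert p P hpP ih =>
      intro hP
      refine (ih fun q hq => hP q (mem_insert_of_mem hq)).trans ?_
      obtain ⟨V, n, hn, hW, a1, a2⟩ := hp p (hP p (mem_insert_self _ _))
      exact Phi_step S F m W hm P p hpP V n hn hW hFW a1 a2
  set P := S.biUnion (fun q => q.primeFactors) with hP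
  rw [h0]
  refine (h1 P ?_).trans ?_
  · intro p hpp
    obtain ⟨q, _, hq⟩ := mem_biUnion.1 hpp
    exact Nat.prime_of_mem_primeFactors hq
  refine sum_le_sum fun y _ => pow_le_pow_left₀ (sum_nonneg fun U _ => by positivity) ?_ m
  have hmaps : ∀ q ∈ S, q.primeFactors ∈ P.powerset := fun q hq => mem_powerset.2 (subset_biUnion_of_mem (fun q => q.primeFactors) hq)
  rw [← sum_fiberwise_of_maps_to hmaps]
  refine sum_le_sum fun U _ => ?_
  have e1 : PF S F P U y = ∑ q ∈ S with q.primeFactors = U, F q y := by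
    unfold PF
    refine sum_congr (filter_congr fun q hq => ?_) fun _ _ => rfl
    rw [inter_eq_left.2 (mem_powerset.1 (hmaps q hq))]
  rw [e1]
  have e2 : ‖∑ q ∈ S with q.primeFactors = U, F q y‖^2 ≤ ∑ q ∈ S with q.primeFactors = U, (#q.divisors : ℝ)^2 * ‖F q (y:ℤ)‖^2 := by
    have c1 := norm_sum_le (S.filter fun q => q.primeFactors = U) (fun q => F q y)
    have c2 := sum_mul_sq_le_sq_mul_sq (S.filter fun q => q.primeFactors = U) (fun q => 1 / (#q.divisors : ℝ)) (fun q => (#q.divisors : ℝ) * ‖F q (y:ℤ)‖)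
    have c3 : ∑ q ∈ S with q.primeFactors = U, 1 / (#q.divisors : ℝ) * ((#q.divisors : ℝ) * ‖F q (y:ℤ)‖) = ∑ q ∈ S with q.primeFactors = U, ‖F q (y:ℤ)‖ := by
      refine sum_congr rfl fun q hq => ?_
      have : (#q.divisors : ℝ) ≠ 0 := by
        have := hS q (mem_filter.1 hq).1
        exact_mod_cast (card_pos.2 ⟨1, Nat.one_mem_divisors.2 this.ne'⟩).ne'
      field_simp
    rw [c3] at c2
    refine (pow_le_pow_left₀ (norm_nonneg _) c1 2).trans (c2.trans ?_)
    simp only [div_pow, one_pow, mul_pow]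
    refine mul_le_of_le_one_left (sum_nonneg fun _ _ => by positivity) (tau_sum U S hS)
  calc _ ≤ (8:ℝ)^(m * #U) * ∑ q ∈ S with q.primeFactors = U, (#q.divisors : ℝ)^2 * ‖F q (y:ℤ)‖^2 := by gcongr
    _ = _ := by
      rw [mul_sum]
      refine sum_congr rfl fun q hq => ?_
      rw [(mem_filter.1 hq).2]; ring

theorem dvd_lcm_gcd {a b d : ℕ} (h : d ∣ Nat.lcm a b) (h0 : Nat.lcm a b ≠ 0) : d ∣ Nat.lcm (Nat.gcd d a) (Nat.gcd d b) := by
  have ha : a ≠ 0 := fun h => h0 (by simp [h])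
  have hb : b ≠ 0 := fun h => h0 (by simp [h])
  have hd : d ≠ 0 := fun hh => h0 (by rw [hh] at h; simpa using h)
  have h1 : Nat.gcd d a ≠ 0 := fun h => hd (Nat.gcd_eq_zero_iff.1 h).1
  have h2 : Nat.gcd d b ≠ 0 := fun h => hd (Nat.gcd_eq_zero_iff.1 h).1
  rw [← Nat.factorization_le_iff_dvd hd h0, Nat.factorization_lcm ha hb] at h
  rw [← Nat.factorization_le_iff_dvd hd (Nat.lcm_ne_zero h1 h2), Nat.factorization_lcm h1 h2, Nat.factorization_gcd hd ha, Nat.factorization_gcd hd hb]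
  intro p
  have := h p
  simp only [Finsupp.sup_apply, Finsupp.inf_apply] at this ⊢
  rw [← inf_sup_left]
  exact le_inf le_rfl this

theorem tau_mul_le (a b : ℕ) : #(Nat.lcm a b).divisors ≤ #a.divisors * #b.divisors := by
  rcases Nat.eq_zero_or_pos a with ha | ha
  · simp [ha]
  rcases Nat.eq_zero_or_pos b with hb | hb
  · simp [hb]
  have : (Nat.lcm a b).divisors ⊆ (a.divisors ×ˢ b.divisors).image (fun x => Nat.lcm x.1 x.2) := by
    intro d hd
    rw [Nat.mem_divisors] at hd
    rw [mem_image]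
    refine ⟨(Nat.gcd d a, Nat.gcd d b), by simp [Nat.mem_divisors, Nat.gcd_dvd_right, ha.ne', hb.ne'], ?_⟩
    simp only
    apply Nat.dvd_antisymm (Nat.lcm_dvd (Nat.gcd_dvd_left _ _) (Nat.gcd_dvd_left _ _))
    exact dvd_lcm_gcd hd.1 hd.2
  refine (card_le_card this).trans (card_image_le.trans ?_)
  rw [card_product]

theorem seqmom (S : Finset ℕ) (F : ℕ → ℤ → ℂ) (kap : ℕ → ℝ) (m W : ℕ) (B : ℝ) (hB : 0 ≤ B)
    (hkap : ∀ q, 0 ≤ kap q) (hSW : ∀ q ∈ S, q ∣ W) (hS : ∀ q ∈ S, 0 < q)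
    (hF : ∀ q ∈ S, ∀ y, F q (y + q) = F q y)
    (hone : ∀ R : ℕ, 0 < R → R ∣ W → ∀ f : ℤ → ℝ, (∀ y, 0 ≤ f y) → (∀ y, f (y + R) = f y) →
      ∑ q ∈ S, kap q * (#q.divisors : ℝ)^m * ∑ y ∈ range W, f y * ‖F q (y:ℤ)‖^2 ≤
        #R.divisors * B * ∑ y ∈ range W, f y) :
    ∑ y ∈ range W, (∑ q ∈ S, kap q * ‖F q (y:ℤ)‖^2)^m ≤ B^m * W := by
  have key : ∀ j ≤ m, ∀ R : ℕ, 0 < R → R ∣ W → ∀ f : ℤ → ℝ, (∀ y, 0 ≤ f y) → (∀ y, f (y + R) = f y) →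
      ∑ y ∈ range W, f y * (∑ q ∈ S, kap q * ‖F q (y:ℤ)‖^2)^j ≤ (#R.divisors : ℝ)^j * B^j * ∑ y ∈ range W, f y := by
    intro j
    induction j with
    | zero => intro _ R _ _ f _ _; simp
    | succ j ih =>
      intro hj R hR0 hR f hf0 hfR
      have e1 : ∑ y ∈ range W, f y * (∑ q ∈ S, kap q * ‖F q (y:ℤ)‖^2)^(j+1) =
          ∑ q ∈ S, kap q * ∑ y ∈ range W, (f y * ‖F q (y:ℤ)‖^2) * (∑ q ∈ S, kap q * ‖F q (y:ℤ)‖^2)^j := by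
        simp_rw [mul_sum]
        rw [sum_comm]
        refine sum_congr rfl fun y _ => ?_
        rw [pow_succ, mul_comm (_ ^ j), ← mul_assoc, mul_sum, sum_mul]
        refine sum_congr rfl fun q _ => by ring
      rw [e1]
      have e2 : ∀ q ∈ S, kap q * ∑ y ∈ range W, (f y * ‖F q (y:ℤ)‖^2) * (∑ q ∈ S, kap q * ‖F q (y:ℤ)‖^2)^j ≤
          (#R.divisors : ℝ)^j * B^j * (kap q * (#q.divisors : ℝ)^m * ∑ y ∈ range W, f y * ‖F q (y:ℤ)‖^2) := by
        intro q hq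
        have hq0 := hS q hq
        have i1 := ih (by omega) (Nat.lcm R q) (Nat.lcm_pos hR0 hq0) (Nat.lcm_dvd hR (hSW q hq)) (fun y => f y * ‖F q y‖^2)
          (fun y => mul_nonneg (hf0 y) (by positivity)) (fun y => by
            show f (y + _) * ‖F q (y + _)‖^2 = f y * ‖F q y‖^2
            rw [per_dvd f R _ hfR (Nat.dvd_lcm_left R q), per_dvd (F q) q _ (hF q hq) (Nat.dvd_lcm_right R q)])
        have hs0 : 0 ≤ ∑ y ∈ range W, f y * ‖F q (y:ℤ)‖^2 := sum_nonneg fun y _ => mul_nonneg (hf0 y) (by positivity)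
        have i2 : (#(Nat.lcm R q).divisors : ℝ)^j ≤ (#R.divisors : ℝ)^j * (#q.divisors : ℝ)^m := by
          have t1 : (#(Nat.lcm R q).divisors : ℝ) ≤ #R.divisors * #q.divisors := by exact_mod_cast tau_mul_le R q
          have t2 : (1:ℝ) ≤ #q.divisors := by exact_mod_cast card_pos.2 ⟨1, Nat.one_mem_divisors.2 hq0.ne'⟩
          calc (#(Nat.lcm R q).divisors : ℝ)^j ≤ (#R.divisors * #q.divisors : ℝ)^j := by gcongr
            _ = (#R.divisors : ℝ)^j * (#q.divisors : ℝ)^j := mul_pow _ _ _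
            _ ≤ _ := by gcongr; omega
        calc _ ≤ kap q * ((#(Nat.lcm R q).divisors : ℝ)^j * B^j * ∑ y ∈ range W, f y * ‖F q (y:ℤ)‖^2) := mul_le_mul_of_nonneg_left i1 (hkap q)
          _ ≤ kap q * (((#R.divisors : ℝ)^j * (#q.divisors : ℝ)^m) * B^j * ∑ y ∈ range W, f y * ‖F q (y:ℤ)‖^2) := by
            have := hkap q
            gcongr
          _ = _ := by ring
      refine (sum_le_sum e2).trans ?_
      rw [← mul_sum]
      calc _ ≤ (#R.divisors : ℝ)^j * B^j * (#R.divisors * B * ∑ y ∈ range W, f y) := by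
            have := hone R hR0 hR f hf0 hfR
            gcongr
        _ = _ := by ring
  have := key m le_rfl 1 one_pos (one_dvd _) (fun _ => 1) (fun _ => zero_le_one) (fun _ => rfl)
  simpa using this

open Finset

theorem ee_ne_one {φ : ℝ} (h : φ ∉ ZZ) : ee φ ≠ 1 := by
  intro h1
  unfold ee at h1
  rw [Complex.exp_eq_one_iff] at h1
  obtain ⟨n, hn⟩ := h1
  apply h
  rw [mem_ZZ]
  refine ⟨n, ?_⟩
  have hpi : (2 * Real.pi * Complex.I : ℂ) ≠ 0 := by simp [Real.pi_ne_zero]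
  have : (φ:ℂ) = n := by
    apply mul_right_cancel₀ hpi
    rw [← hn]; ring
  exact_mod_cast this

theorem sum_ee_zero (φ : ℝ) (n : ℕ) (hφ : φ ∉ ZZ) (hn : (n:ℝ) * φ ∈ ZZ) : ∑ j ∈ range n, ee (j * φ) = 0 := by
  have h1 : ∑ j ∈ range n, ee (j * φ) = ∑ j ∈ range n, ee φ ^ j := sum_congr rfl fun j _ => ee_nsmul φ j
  have h2 := geom_sum_mul (ee φ) n
  obtain ⟨c, hc⟩ := mem_ZZ.1 hn
  rw [← ee_nsmul, hc, ee_int, sub_self] at h2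
  rw [h1]
  exact (mul_eq_zero.1 h2).resolve_right (sub_ne_zero.2 (ee_ne_one hφ))

theorem ee_mem {φ : ℝ} (h : φ ∈ ZZ) : ee φ = 1 := by
  obtain ⟨n, rfl⟩ := mem_ZZ.1 h; exact ee_int n

theorem sum_ee_eq (φ : ℝ) (n : ℕ) (hn : (n:ℝ) * φ ∈ ZZ) [Decidable (φ ∈ ZZ)] : ∑ j ∈ range n, ee (j * φ) = if φ ∈ ZZ then (n:ℂ) else 0 := by
  split_ifs with h
  · rw [sum_congr rfl fun j _ => ee_mem (ZZ.mul_mem (nat_mem_ZZ j) h)]; simp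
  · exact sum_ee_zero φ n h hn

theorem freq_interval (φ : ℝ) (q D W : ℕ) (hq : 1 ≤ q) (hqD : q ≤ D) (hqW : q ∣ W) (hφ : (q:ℝ) * φ ∈ ZZ) (a : ℤ) (L : ℕ) :
    ‖(W:ℂ) * ∑ i ∈ range L, ee (φ * ((a + i : ℤ):ℝ)) - L * ∑ y ∈ range W, ee (φ * ((y:ℤ):ℝ))‖ ≤ W * D := by
  by_cases h : φ ∈ ZZ
  · rw [sum_congr rfl fun i _ => ee_mem (ZZ.mul_mem h (int_mem_ZZ _)), sum_congr rfl fun i _ => ee_mem (ZZ.mul_mem h (int_mem_ZZ _))]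
    simp only [sum_const, card_range, nsmul_eq_mul, mul_one]
    rw [mul_comm, sub_self, norm_zero]; positivity
  · have h2 : ∑ y ∈ range W, ee (φ * ((y:ℤ):ℝ)) = 0 := by
      have : (W:ℝ) * φ ∈ ZZ := by
        obtain ⟨c, rfl⟩ := hqW
        push_cast
        rw [mul_comm (q:ℝ), mul_assoc]
        exact ZZ.mul_mem (nat_mem_ZZ c) hφ
      rw [← sum_ee_zero φ W h this]
      refine sum_congr rfl fun y _ => ?_
      push_cast; rw [mul_comm]
    rw [h2, mul_zero, sub_zero, norm_mul, Complex.norm_natCast]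
    gcongr
    set δ := φ - round φ with hδ
    have hδ2 : |δ| ≤ 1/2 := abs_sub_round φ
    have hsum : ∑ i ∈ range L, ee (φ * ((a + i : ℤ):ℝ)) = ∑ i ∈ range L, ee (δ * i + φ * a) := by
      refine sum_congr rfl fun i _ => ee_of_sub_mem ?_
      have : φ * ((a + i : ℤ):ℝ) - (δ * i + φ * a) = (((round φ) * i : ℤ) : ℝ) := by rw [hδ]; push_cast; ring
      rw [this]; exact int_mem_ZZ _
    have hg := geom_ee δ (φ * a) L hδ2
    rw [← hsum] at hg
    have hq0 : (0:ℝ) < q := by exact_mod_cast hq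
    have hδq : 1 ≤ q * |δ| := by
      have : (q:ℝ) * δ ∈ ZZ := by
        rw [hδ, mul_sub]; exact ZZ.sub_mem hφ (ZZ.mul_mem (nat_mem_ZZ q) (int_mem_ZZ _))
      obtain ⟨c, hc⟩ := mem_ZZ.1 this
      have hc0 : c ≠ 0 := by
        intro h0
        rw [h0, Int.cast_zero] at hc
        have : δ = 0 := (mul_eq_zero.1 hc).resolve_left hq0.ne'
        apply h; rw [mem_ZZ]; exact ⟨round φ, by linarith⟩
      have : (1:ℝ) ≤ |(c:ℝ)| := by exact_mod_cast Int.one_le_abs hc0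
      rwa [← hc, abs_mul, abs_of_pos hq0] at this
    set Z := ‖∑ i ∈ range L, ee (φ * ((a + i : ℤ):ℝ))‖
    have hZ : 0 ≤ Z := norm_nonneg _
    have : Z * (q * |δ|) * 2 ≤ q := by nlinarith
    have h3 : Z ≤ Z * (q * |δ|) := le_mul_of_one_le_right hZ hδq
    have h4 : (q:ℝ) ≤ D := by exact_mod_cast hqD
    linarith

def TP (W D : ℕ) (S : ℝ) (f : ℤ → ℂ) : Prop :=
  ∃ (ι : Type) (_ : Fintype ι) (β : ι → ℂ) (φ : ι → ℝ),
    (∀ i, ∃ q : ℕ, 1 ≤ q ∧ q ≤ D ∧ q ∣ W ∧ (q:ℝ) * φ i ∈ ZZ) ∧ ∑ i, ‖β i‖ ≤ S ∧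
    ∀ y : ℤ, f y = ∑ i, β i * ee (φ i * y)

theorem TP.mul {W D D' : ℕ} {S S' : ℝ} {f g : ℤ → ℂ} (hf : TP W D S f) (hg : TP W D' S' g) :
    TP W (D * D') (S * S') (fun y => f y * g y) := by
  obtain ⟨ι, _, β, φ, h1, h2, h3⟩ := hf
  obtain ⟨ι', _, β', φ', h1', h2', h3'⟩ := hg
  refine ⟨ι × ι', inferInstance, fun x => β x.1 * β' x.2, fun x => φ x.1 + φ' x.2, ?_, ?_, ?_⟩
  · intro x
    obtain ⟨q, a1, a2, a3, a4⟩ := h1 x.1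
    obtain ⟨q', b1, b2, b3, b4⟩ := h1' x.2
    refine ⟨Nat.lcm q q', Nat.lcm_pos a1 b1, ?_, Nat.lcm_dvd a3 b3, ?_⟩
    · exact (Nat.le_of_dvd (Nat.mul_pos a1 b1) (Nat.lcm_dvd_mul q q')).trans (Nat.mul_le_mul a2 b2)
    · obtain ⟨c, hc⟩ := Nat.dvd_lcm_left q q'
      obtain ⟨c', hc'⟩ := Nat.dvd_lcm_right q q'
      rw [mul_add]
      refine ZZ.add_mem ?_ ?_
      · rw [hc]; push_cast; rw [mul_comm (q:ℝ), mul_assoc]; exact ZZ.mul_mem (nat_mem_ZZ _) a4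
      · rw [hc']; push_cast; rw [mul_comm (q':ℝ), mul_assoc]; exact ZZ.mul_mem (nat_mem_ZZ _) b4
  · simp only [norm_mul]
    rw [← univ_product_univ, sum_product]
    simp only
    rw [← sum_mul_sum]
    exact mul_le_mul h2 h2' (sum_nonneg fun _ _ => norm_nonneg _) ((sum_nonneg fun _ _ => norm_nonneg _).trans h2)
  · intro y
    simp only
    rw [h3, h3', ← univ_product_univ, sum_product, sum_mul_sum]
    refine sum_congr rfl fun i _ => sum_congr rfl fun j _ => ?_
    rw [add_mul, ee_add]; ring

theorem TP.conj {W D : ℕ} {S : ℝ} {f : ℤ → ℂ} (hf : TP W D S f) : TP W D S (fun y => (starRingEnd ℂ) (f y)) := by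
  obtain ⟨ι, _, β, φ, h1, h2, h3⟩ := hf
  refine ⟨ι, inferInstance, fun x => (starRingEnd ℂ) (β x), fun x => -φ x, ?_, ?_, ?_⟩
  · intro x
    obtain ⟨q, a1, a2, a3, a4⟩ := h1 x
    exact ⟨q, a1, a2, a3, by rw [mul_neg]; exact ZZ.neg_mem a4⟩
  · simpa using h2
  · intro y
    simp only
    rw [h3, map_sum]
    refine sum_congr rfl fun i _ => ?_
    rw [map_mul, neg_mul, ee_neg]

theorem TP.pow {W D : ℕ} {S : ℝ} {f : ℤ → ℂ} (hf : TP W D S f) (m : ℕ) : TP W (D^m) (S^m) (fun y => f y ^ m) := by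
  induction m with
  | zero =>
    refine ⟨Unit, inferInstance, fun _ => 1, fun _ => 0, fun _ => ⟨1, le_rfl, by simp, one_dvd _, by simp⟩, by simp, fun y => by simp [ee_zero]⟩
  | succ m ih =>
    simp only [pow_succ]
    exact ih.mul hf

theorem TP.interval {W D : ℕ} {S : ℝ} {f : ℤ → ℂ} (hf : TP W D S f) (a : ℤ) (L : ℕ) :
    ‖(W:ℂ) * ∑ i ∈ range L, f (a + i) - L * ∑ y ∈ range W, f y‖ ≤ W * D * S := by
  obtain ⟨ι, _, β, φ, h1, h2, h3⟩ := hf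
  have e : (W:ℂ) * ∑ i ∈ range L, f (a + i) - L * ∑ y ∈ range W, f y =
      ∑ i, β i * ((W:ℂ) * ∑ l ∈ range L, ee (φ i * ((a + l : ℤ):ℝ)) - L * ∑ y ∈ range W, ee (φ i * ((y:ℤ):ℝ))) := by
    simp only [h3]
    rw [sum_comm, sum_comm (s := range W), mul_sum, mul_sum, ← sum_sub_distrib]
    refine sum_congr rfl fun i _ => ?_
    rw [← mul_sum, ← mul_sum]; ring
  rw [e]
  refine (norm_sum_le _ _).trans ?_
  calc _ ≤ ∑ i, ‖β i‖ * ((W:ℝ) * D) := by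
        refine sum_le_sum fun i _ => ?_
        rw [norm_mul]
        obtain ⟨q, a1, a2, a3, a4⟩ := h1 i
        exact mul_le_mul_of_nonneg_left (freq_interval (φ i) q D W a1 a2 a3 a4 a L) (norm_nonneg _)
    _ = W * D * ∑ i, ‖β i‖ := by rw [← sum_mul]; ring
    _ ≤ _ := by gcongr

theorem interval_moment {W D : ℕ} {S : ℝ} {F : ℤ → ℂ} (hF : TP W D S F) (a : ℤ) (L m : ℕ) :
    (W:ℝ) * ∑ i ∈ range L, ‖F (a + i)‖^(2*m) ≤ L * ∑ y ∈ range W, ‖F y‖^(2*m) + W * (D * S)^(2*m) := by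
  have h := ((hF.pow m).mul (hF.conj.pow m)).interval a L
  have e : ∀ y, F y ^ m * (starRingEnd ℂ) (F y) ^ m = ((‖F y‖^(2*m) : ℝ) : ℂ) := by
    intro y
    rw [← mul_pow, Complex.mul_conj, Complex.normSq_eq_norm_sq, pow_mul]; push_cast; rfl
  simp only [e] at h
  have e2 : (W:ℂ) * ∑ i ∈ range L, ((‖F (a + i)‖^(2*m) : ℝ) : ℂ) - L * ∑ y ∈ range W, ((‖F y‖^(2*m) : ℝ) : ℂ) =
    (((W:ℝ) * ∑ i ∈ range L, ‖F (a + i)‖^(2*m) - L * ∑ y ∈ range W, ‖F y‖^(2*m) : ℝ) : ℂ) := by push_cast; rfl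
  rw [e2, Complex.norm_real] at h
  have h2 := (le_abs_self _).trans h
  have e3 : (W:ℝ) * ((D^m * D^m : ℕ):ℝ) * (S^m * S^m) = W * (D * S)^(2*m) := by
    push_cast; rw [two_mul, pow_add, mul_pow]; ring
  rw [e3] at h2
  linarith

open Finset

def cop (q : ℕ) : Finset ℕ := (range q).filter (fun c => Nat.Coprime c q)

noncomputable def al (A : Finset ℤ) (w : ℝ) (r : ℕ) (x : ℤ) (q c : ℕ) : ℂ :=
  ((r * w : ℝ) : ℂ) * ∑ z ∈ A with (r:ℤ) ∣ z - x, ee (-((c:ℝ) * (((z - x) / r : ℤ) : ℝ) / q))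

noncomputable def tt (A : Finset ℤ) (w : ℝ) (r : ℕ) (x : ℤ) (q : ℕ) : ℝ := ∑ c ∈ cop q, ‖al A w r x q c‖^2

noncomputable def FF (A : Finset ℤ) (w : ℝ) (r : ℕ) (x : ℤ) (q : ℕ) (y : ℤ) : ℂ :=
  ∑ c ∈ cop q, al A w r x q c * ee ((c:ℝ) * (y:ℝ) / q)

theorem FF_per (A : Finset ℤ) (w : ℝ) (r : ℕ) (x : ℤ) (q : ℕ) (hq : 0 < q) (y : ℤ) :
    FF A w r x q (y + q) = FF A w r x q y := by
  refine sum_congr rfl fun c _ => ?_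
  congr 1
  apply ee_of_sub_mem
  have hq0 : (q:ℝ) ≠ 0 := by exact_mod_cast hq.ne'
  have : (c:ℝ) * ((y + q : ℤ):ℝ) / q - c * (y:ℝ) / q = c := by push_cast; field_simp; ring
  rw [this]; exact nat_mem_ZZ c

theorem FF_prime (A : Finset ℤ) (w : ℝ) (r : ℕ) (x : ℤ) (q : ℕ) (hq : 0 < q) (p : ℕ) (hp : p.Prime) (hpq : p ∣ q)
    (V n : ℕ) (hV : ¬ p ∣ V) (hqW : q ∣ V * n) (y : ℤ) :
    ∑ j ∈ range n, FF A w r x q (y + V * j) = 0 := by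
  unfold FF
  rw [sum_comm]
  refine sum_eq_zero fun c hc => ?_
  have hq0 : (q:ℝ) ≠ 0 := by exact_mod_cast hq.ne'
  have hcop := (mem_filter.1 hc).2
  rw [← mul_sum]
  have e : ∑ j ∈ range n, ee ((c:ℝ) * ((y + V * j : ℤ):ℝ) / q) = ee (c * (y:ℝ) / q) * ∑ j ∈ range n, ee (j * ((c:ℝ) * V / q)) := by
    rw [mul_sum]
    refine sum_congr rfl fun j _ => ?_
    rw [← ee_add]; congr 1; push_cast; field_simp
  rw [e, sum_ee_zero, mul_zero, mul_zero]
  · intro h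
    obtain ⟨k, hk⟩ := mem_ZZ.1 h
    have h1 : (c:ℝ) * V = k * q := by rw [← hk]; field_simp
    have h2 : (c:ℤ) * V = k * q := by exact_mod_cast h1
    have h3 : (p:ℤ) ∣ c * V := by rw [h2]; exact Dvd.dvd.mul_left (by exact_mod_cast hpq) _
    have h4 : p ∣ c * V := by exact_mod_cast h3
    rcases hp.dvd_mul.1 h4 with h5 | h5
    · have := Nat.dvd_gcd h5 hpq
      rw [hcop] at this
      exact hp.one_lt.ne' (Nat.dvd_one.1 this)
    · exact hV h5
  · obtain ⟨k, hk⟩ := hqW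
    have h1 : (V:ℝ) * n = q * k := by exact_mod_cast hk
    have : (n:ℝ) * ((c:ℝ) * V / q) = ((c * k : ℕ) : ℝ) := by
      push_cast
      rw [mul_div_assoc', div_eq_iff hq0]
      linear_combination (c:ℝ) * h1
    rw [this]; exact nat_mem_ZZ _

theorem mod_iff (q R a a' : ℕ) (hq : 0 < q) :
    (((a:ℝ) - a') * R / q ∈ ZZ) ↔ a % (q / Nat.gcd R q) = a' % (q / Nat.gcd R q) := by
  have hq0 : (q:ℝ) ≠ 0 := by exact_mod_cast hq.ne'
  have h1 : (((a:ℝ) - a') * R / q ∈ ZZ) ↔ (q:ℤ) ∣ ((a':ℤ) - a) * R := by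
    rw [mem_ZZ]
    constructor
    · rintro ⟨k, hk⟩
      rw [div_eq_iff hq0] at hk
      have : ((a:ℤ) - a') * R = k * q := by exact_mod_cast hk
      exact ⟨-k, by linear_combination -this⟩
    · rintro ⟨k, hk⟩
      refine ⟨-k, ?_⟩
      have : ((a':ℝ) - a) * R = q * k := by exact_mod_cast hk
      rw [div_eq_iff hq0]; push_cast; linear_combination -this
  rw [h1]
  have h2 : (q:ℤ) ∣ ((a':ℤ) - a) * R ↔ a * R ≡ a' * R [MOD q] := by
    rw [Nat.modEq_iff_dvd]; push_cast; rw [sub_mul]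
  rw [h2]
  constructor
  · intro h
    have := Nat.ModEq.cancel_right_div_gcd hq h
    rw [Nat.gcd_comm] at this
    exact this
  · intro h
    have h3 : a ≡ a' [MOD q / Nat.gcd R q] := h
    have h4 := h3.mul_right' (Nat.gcd R q)
    rw [Nat.div_mul_cancel (Nat.gcd_dvd_right _ _)] at h4
    obtain ⟨t, ht⟩ := Nat.gcd_dvd_left R q
    have h5 := h4.mul_right t
    rwa [mul_assoc, mul_assoc, ← ht] at h5

theorem parseval_shift (q R : ℕ) (hq : 0 < q) (T : Finset ℕ) (γ : ℕ → ℂ) :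
    ∑ j ∈ range q, ‖∑ a ∈ T, γ a * ee ((a:ℝ) * (R * j) / q)‖^2 =
      q * ∑ c ∈ range (q / Nat.gcd R q), ‖∑ a ∈ T with a % (q / Nat.gcd R q) = c, γ a‖^2 := by
  classical
  have hq0 : (q:ℝ) ≠ 0 := by exact_mod_cast hq.ne'
  set q' := q / Nat.gcd R q with hq'
  have hq'0 : 0 < q' := Nat.div_pos (Nat.le_of_dvd hq (Nat.gcd_dvd_right R q)) (Nat.gcd_pos_of_pos_right R hq)
  have hL : ((∑ j ∈ range q, ‖∑ a ∈ T, γ a * ee ((a:ℝ) * (R * j) / q)‖^2 : ℝ) : ℂ) =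
      ∑ a ∈ T, ∑ a' ∈ T, γ a * (starRingEnd ℂ) (γ a') * (if a % q' = a' % q' then (q:ℂ) else 0) := by
    have e1 : ∀ j ∈ range q, ((‖∑ a ∈ T, γ a * ee ((a:ℝ) * (R * j) / q)‖^2 : ℝ) : ℂ) =
        ∑ a ∈ T, ∑ a' ∈ T, γ a * (starRingEnd ℂ) (γ a') * ee (j * (((a:ℝ) - a') * R / q)) := by
      intro j _
      rw [Complex.ofReal_pow, ← Complex.mul_conj', map_sum, sum_mul_sum]
      refine sum_congr rfl fun a _ => sum_congr rfl fun a' _ => ?_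
      rw [map_mul, ← ee_neg]
      have : ee (j * (((a:ℝ) - a') * R / q)) = ee ((a:ℝ) * (R * j) / q) * ee (-((a':ℝ) * (R * j) / q)) := by
        rw [← ee_add]; congr 1; field_simp; ring
      rw [this]; ring
    rw [Complex.ofReal_sum, sum_congr rfl e1, sum_comm]
    refine sum_congr rfl fun a _ => ?_
    rw [sum_comm]
    refine sum_congr rfl fun a' _ => ?_
    rw [← mul_sum]
    congr 1
    rw [sum_ee_eq]
    · simp only [mod_iff q R a a' hq]; rfl
    · have : (q:ℝ) * (((a:ℝ) - a') * R / q) = ((((a:ℤ) - a') * R : ℤ) : ℝ) := by push_cast; field_simp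
      rw [this]; exact int_mem_ZZ _
  have hR : ((q * ∑ c ∈ range q', ‖∑ a ∈ T with a % q' = c, γ a‖^2 : ℝ) : ℂ) =
      ∑ a ∈ T, ∑ a' ∈ T, γ a * (starRingEnd ℂ) (γ a') * (if a % q' = a' % q' then (q:ℂ) else 0) := by
    push_cast
    have e1 : ∀ c ∈ range q', ((‖∑ a ∈ T with a % q' = c, γ a‖:ℝ):ℂ)^2 = ∑ a ∈ T with a % q' = c, ∑ a' ∈ T, γ a * (starRingEnd ℂ) (γ a') * (if a % q' = a' % q' then 1 else 0) := by
      intro c _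
      rw [← Complex.mul_conj', map_sum, sum_mul_sum]
      refine sum_congr rfl fun a ha => ?_
      rw [sum_filter]
      refine sum_congr rfl fun a' _ => ?_
      rw [(mem_filter.1 ha).2]
      by_cases h : a' % q' = c
      · simp [h]
      · have h' : ¬ (c = a' % q') := fun hh => h hh.symm
        simp [h, h']
    rw [sum_congr rfl e1, sum_fiberwise_of_maps_to (g := fun a => a % q') (fun a _ => mem_range.2 (Nat.mod_lt a hq'0)), mul_sum]
    refine sum_congr rfl fun a _ => ?_
    rw [mul_sum]
    refine sum_congr rfl fun a' _ => ?_
    split_ifs <;> ring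
  have := hL.trans hR.symm
  exact_mod_cast this

noncomputable def ci (s q c : ℕ) : ℕ := (c * ((s : ZMod q)⁻¹).val) % q

theorem ci_spec (s q c : ℕ) (hq : 0 < q) (hs : s.Coprime q) : s * ci s q c ≡ c [MOD q] := by
  have : NeZero q := ⟨hq.ne'⟩
  rw [← ZMod.natCast_eq_natCast_iff]
  unfold ci
  push_cast
  rw [ZMod.natCast_mod]
  push_cast
  rw [ZMod.natCast_zmod_val, mul_left_comm, ZMod.coe_mul_inv_eq_one s hs, mul_one]

theorem ci_mem (s q c : ℕ) (hq : 0 < q) (hs : s.Coprime q) (hc : c ∈ cop q) : ci s q c ∈ cop q := by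
  rw [cop, mem_filter, mem_range] at hc ⊢
  refine ⟨Nat.mod_lt _ hq, ?_⟩
  have h1 := (ci_spec s q c hq hs).gcd_eq
  have h2 : Nat.Coprime (s * ci s q c) q := by rw [Nat.Coprime, h1]; exact hc.2
  exact h2.coprime_mul_left

theorem ci_inj (s q : ℕ) (hq : 0 < q) (hs : s.Coprime q) : Set.InjOn (ci s q) (cop q) := by
  intro a ha b hb hab
  have h1 := (ci_spec s q a hq hs).symm
  rw [hab] at h1
  have h2 := h1.trans (ci_spec s q b hq hs)
  have ha' := mem_range.1 (mem_filter.1 ha).1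
  have hb' := mem_range.1 (mem_filter.1 hb).1
  exact Nat.ModEq.eq_of_lt_of_lt h2 ha' hb'

theorem ram (q' v c : ℕ) (hq' : 0 < q') (hv : 0 < v) (hc : c ∈ cop q') (U : ℤ) :
    ∑ a ∈ cop (v * q') with a % q' = c, ee (-((a:ℝ) * U / ((v * q' : ℕ):ℝ))) =
    ∑ s ∈ v.divisors with s.Coprime q', (ArithmeticFunction.moebius s : ℂ) *
      (if ((v / s : ℕ):ℤ) ∣ U then ((v / s : ℕ):ℂ) * ee (-((ci s q' c : ℝ) * ((U / ((v/s:ℕ):ℤ) : ℤ) : ℝ) / q')) else 0) := by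
  classical
  have hc1 := mem_range.1 (mem_filter.1 hc).1
  have hc2 := (mem_filter.1 hc).2
  have hcopa : ∀ a : ℕ, a % q' = c → a.Coprime q' := by
    intro a ha
    rw [Nat.Coprime, ← Nat.mod_add_div a q', ha, Nat.gcd_add_mul_left_left]; exact hc2
  have e1 : ∑ a ∈ cop (v * q') with a % q' = c, ee (-((a:ℝ) * U / ((v * q' : ℕ):ℝ))) =
      ∑ a ∈ range (v * q') with a % q' = c, ∑ s ∈ v.divisors, if s ∣ a then (ArithmeticFunction.moebius s : ℂ) * ee (-((a:ℝ) * U / ((v * q' : ℕ):ℝ))) else 0 := by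
    rw [cop, filter_filter, sum_filter, sum_filter]
    refine sum_congr rfl fun a _ => ?_
    by_cases ha : a % q' = c
    · rw [if_pos ha]
      have hco := hcopa a ha
      have hmu : ∑ s ∈ v.divisors, (if s ∣ a then (ArithmeticFunction.moebius s : ℂ) else 0) = if a.Coprime v then 1 else 0 := by
        rw [← sum_filter]
        have : v.divisors.filter (fun s => s ∣ a) = (Nat.gcd a v).divisors := by
          ext s
          simp only [mem_filter, Nat.mem_divisors, Nat.dvd_gcd_iff]
          constructor
          · rintro ⟨⟨h1, h2⟩, h3⟩; exact ⟨⟨h3, h1⟩, (Nat.gcd_pos_of_pos_right a hv).ne'⟩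
          · rintro ⟨⟨h3, h1⟩, _⟩; exact ⟨⟨h1, hv.ne'⟩, h3⟩
        rw [this]
        have h2 : ∑ s ∈ (Nat.gcd a v).divisors, ArithmeticFunction.moebius s = if Nat.gcd a v = 1 then 1 else 0 := by
          rw [← ArithmeticFunction.coe_zeta_mul_apply, ArithmeticFunction.coe_zeta_mul_moebius, ArithmeticFunction.one_apply]
        rw [← Int.cast_sum, h2]
        unfold Nat.Coprime
        split_ifs <;> simp
      have hiff : a.Coprime (v * q') ↔ a.Coprime v := by
        rw [Nat.coprime_mul_iff_right]; exact ⟨fun h => h.1, fun h => ⟨h, hco⟩⟩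
      have e3 : ∑ s ∈ v.divisors, (if s ∣ a then (ArithmeticFunction.moebius s : ℂ) * ee (-((a:ℝ) * U / ((v * q' : ℕ):ℝ))) else 0) = (∑ s ∈ v.divisors, (if s ∣ a then (ArithmeticFunction.moebius s : ℂ) else 0)) * ee (-((a:ℝ) * U / ((v * q' : ℕ):ℝ))) := by
        rw [sum_mul]; refine sum_congr rfl fun s _ => ?_
        split_ifs <;> simp
      rw [e3, hmu]
      simp only [hiff, ha, and_true]
      split_ifs <;> simp
    · rw [if_neg ha, if_neg (fun h => ha h.2)]
  rw [e1, sum_comm, sum_filter]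
  refine sum_congr rfl fun s hs => ?_
  have hsv := (Nat.mem_divisors.1 hs).1
  have hs0 : 0 < s := Nat.pos_of_dvd_of_pos hsv hv
  obtain ⟨n, hn⟩ := hsv
  have hn0 : 0 < n := Nat.pos_of_ne_zero (by rintro rfl; omega)
  have hvs : v / s = n := by rw [hn, Nat.mul_div_cancel_left _ hs0]
  rw [← sum_filter, filter_filter]
  have hs0' : (s:ℝ) ≠ 0 := by exact_mod_cast hs0.ne'
  have hn0' : (n:ℝ) ≠ 0 := by exact_mod_cast hn0.ne'
  have hq0' : (q':ℝ) ≠ 0 := by exact_mod_cast hq'.ne'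
  by_cases hcs : s.Coprime q'
  · rw [if_pos hcs, ← mul_sum, hvs]
    congr 1
    have hci : ci s q' c < q' := Nat.mod_lt _ hq'
    have key : ∑ a ∈ range (v * q') with (a % q' = c ∧ s ∣ a), ee (-((a:ℝ) * U / ((v * q' : ℕ):ℝ))) =
        ee (-((ci s q' c:ℝ) * U / (n * q'))) * ∑ i ∈ range n, ee (i * (-((U:ℝ) / n))) := by
      rw [mul_sum]
      symm
      refine sum_bij (fun i _ => s * (ci s q' c + q' * i)) ?_ ?_ ?_ ?_
      · intro i hi
        rw [mem_range] at hi
        rw [mem_filter, mem_range]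
        refine ⟨?_, ?_, dvd_mul_right _ _⟩
        · rw [hn, mul_assoc]
          apply Nat.mul_lt_mul_of_pos_left _ hs0
          nlinarith
        · have h1 := ci_spec s q' c hq' hcs
          have h2 : s * (ci s q' c + q' * i) = s * ci s q' c + q' * (s * i) := by ring
          rw [h2, Nat.add_mul_mod_self_left, h1, Nat.mod_eq_of_lt hc1]
      · intro i _ j _ hij
        have := Nat.eq_of_mul_eq_mul_left hs0 hij
        exact Nat.eq_of_mul_eq_mul_left hq' (by omega)
      · intro a ha
        rw [mem_filter, mem_range] at ha
        obtain ⟨h1, h2, b, rfl⟩ := ha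
        have h3 : s * b ≡ s * ci s q' c [MOD q'] := by
          refine Nat.ModEq.trans ?_ (ci_spec s q' c hq' hcs).symm
          rw [Nat.ModEq, h2, Nat.mod_eq_of_lt hc1]
        have h4 : b ≡ ci s q' c [MOD q'] := Nat.ModEq.cancel_left_of_coprime (by rw [Nat.gcd_comm]; exact hcs) h3
        have h5 : b % q' = ci s q' c := by rw [h4, Nat.mod_eq_of_lt hci]
        have h6 : b < n * q' := by
          rw [hn, mul_assoc] at h1
          exact Nat.lt_of_mul_lt_mul_left h1
        refine ⟨b / q', mem_range.2 (by rwa [Nat.div_lt_iff_lt_mul hq']), ?_⟩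
        rw [← h5, Nat.mod_add_div]
      · intro i _
        rw [← ee_add]; congr 1
        rw [hn]; push_cast; field_simp; ring
    rw [key, sum_ee_eq]
    swap
    · have : (n:ℝ) * (-((U:ℝ) / n)) = ((-U : ℤ):ℝ) := by push_cast; field_simp
      rw [this]; exact int_mem_ZZ _
    by_cases hd : (n:ℤ) ∣ U
    · obtain ⟨U', hU'⟩ := hd
      have hdiv : U / (n:ℤ) = U' := by rw [hU', Int.mul_ediv_cancel_left _ (by exact_mod_cast hn0.ne')]
      have hz : -((U:ℝ) / n) ∈ ZZ := by
        rw [hU', mem_ZZ]; exact ⟨-U', by push_cast; field_simp⟩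
      have hd2 : (n:ℤ) ∣ U := ⟨U', hU'⟩
      rw [if_pos hz, if_pos hd2, hdiv, mul_comm, hU']
      congr 3; push_cast; field_simp
    · have hz : ¬ -((U:ℝ) / n) ∈ ZZ := by
        intro h
        obtain ⟨t, ht⟩ := mem_ZZ.1 h
        apply hd
        refine ⟨-t, ?_⟩
        have : (U:ℝ) = n * (-t) := by rw [← ht]; field_simp
        exact_mod_cast this
      rw [if_neg hd, if_neg hz, mul_zero]
  · rw [if_neg hcs, sum_eq_zero]
    intro a ha
    exfalso
    obtain ⟨_, h1, h2⟩ := mem_filter.1 ha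
    exact hcs (Nat.Coprime.coprime_dvd_left h2 (hcopa a h1))

open Finset

theorem beta_eq (A : Finset ℤ) (w : ℝ) (r : ℕ) (hr : 0 < r) (x : ℤ) (q' v c : ℕ) (hq' : 0 < q') (hv : 0 < v)
    (hc : c ∈ cop q') (y : ℤ) :
    ∑ a ∈ cop (v * q') with a % q' = c, al A w r x (v * q') a * ee ((a:ℝ) * (y:ℝ) / ((v * q' : ℕ):ℝ)) =
    ∑ s ∈ v.divisors with s.Coprime q', (ArithmeticFunction.moebius s : ℂ) * al A w (r * (v / s)) (x + r * y) q' (ci s q' c) := by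
  have hr0 : (r:ℤ) ≠ 0 := by exact_mod_cast hr.ne'
  have e1 : ∑ a ∈ cop (v * q') with a % q' = c, al A w r x (v * q') a * ee ((a:ℝ) * (y:ℝ) / ((v * q' : ℕ):ℝ)) =
      ((r * w : ℝ) : ℂ) * ∑ z ∈ A with (r:ℤ) ∣ z - x, ∑ a ∈ cop (v * q') with a % q' = c,
        ee (-((a:ℝ) * (((z - x) / r - y : ℤ) : ℝ) / ((v * q' : ℕ):ℝ))) := by
    rw [sum_comm, mul_sum]
    refine sum_congr rfl fun a _ => ?_
    rw [al, mul_assoc, sum_mul]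
    congr 1
    refine sum_congr rfl fun z _ => ?_
    rw [← ee_add]; congr 1; push_cast; ring
  rw [e1, sum_congr rfl (fun z _ => ram q' v c hq' hv hc _), sum_comm, mul_sum]
  refine sum_congr rfl fun s hs => ?_
  have hsv := (Nat.mem_divisors.1 (mem_filter.1 hs).1).1
  have hn0 : 0 < v / s := Nat.div_pos (Nat.le_of_dvd hv hsv) (Nat.pos_of_dvd_of_pos hsv hv)
  generalize v / s = n at *
  rw [← mul_sum, al, ← sum_filter, filter_filter, mul_left_comm]
  congr 1
  have hn : (n:ℤ) ≠ 0 := by exact_mod_cast hn0.ne'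
  have hset : (A.filter fun z => (r:ℤ) ∣ z - x ∧ (n:ℤ) ∣ (z - x) / r - y) = A.filter fun z => ((r * n : ℕ):ℤ) ∣ z - (x + r * y) := by
    apply filter_congr
    intro z _
    push_cast
    constructor
    · rintro ⟨⟨u, hu⟩, h2⟩
      rw [hu, Int.mul_ediv_cancel_left _ hr0] at h2
      have : z - (x + r * y) = r * (u - y) := by linear_combination hu
      rw [this]; exact mul_dvd_mul_left _ h2
    · rintro ⟨u, hu⟩
      have h1 : z - x = r * (n * u + y) := by linear_combination hu
      refine ⟨⟨_, h1⟩, ?_⟩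
      rw [h1, Int.mul_ediv_cancel_left _ hr0]
      exact ⟨u, by ring⟩
  rw [hset, ← mul_sum, ← mul_assoc]
  have hrn : ((r * w : ℝ):ℂ) * (n:ℂ) = ((((r * n : ℕ):ℝ) * w : ℝ) : ℂ) := by push_cast; ring
  rw [hrn]
  congr 1
  refine sum_congr rfl fun z hz => ?_
  obtain ⟨u, hu⟩ := (mem_filter.1 hz).2
  have hu' : z - (x + r * y) = r * (n * u) := by rw [hu]; push_cast; ring
  have h1 : z - x = r * (n * u + y) := by linear_combination hu'
  rw [h1, Int.mul_ediv_cancel_left _ hr0, hu, Int.mul_ediv_cancel_left _ (by push_cast; exact mul_ne_zero hr0 hn)]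
  rw [show (n:ℤ) * u + y - y = n * u by ring, Int.mul_ediv_cancel_left _ hn]

theorem sum_avg_real (W : ℕ) (f : ℤ → ℝ) (hf : ∀ y, f (y + W) = f y) (s n : ℕ) :
    (n:ℝ) * ∑ y ∈ range W, f y = ∑ y ∈ range W, ∑ j ∈ range n, f (y + s * j) := by
  have := sum_avg W (fun y => (f y : ℂ)) (fun y => by rw [hf]) s n
  exact_mod_cast this

theorem inner_bd (A : Finset ℤ) (w : ℝ) (r : ℕ) (hr : 0 < r) (x : ℤ) (q R : ℕ) (hq : 0 < q) (y : ℤ) :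
    ∑ j ∈ range q, ‖FF A w r x q (y + R * j)‖^2 ≤ q * (#(Nat.gcd R q).divisors *
      ∑ s ∈ (Nat.gcd R q).divisors, tt A w (r * (Nat.gcd R q / s)) (x + r * y) (q / Nat.gcd R q)) := by
  have hv : 0 < Nat.gcd R q := Nat.gcd_pos_of_pos_right R hq
  have hvq : Nat.gcd R q * (q / Nat.gcd R q) = q := Nat.mul_div_cancel' (Nat.gcd_dvd_right R q)
  have hq'0 : 0 < q / Nat.gcd R q := Nat.div_pos (Nat.le_of_dvd hq (Nat.gcd_dvd_right R q)) hv
  have hq0 : (q:ℝ) ≠ 0 := by exact_mod_cast hq.ne'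
  have e1 : ∀ j : ℕ, FF A w r x q (y + R * j) = ∑ a ∈ cop q, (al A w r x q a * ee ((a:ℝ) * (y:ℝ) / q)) * ee ((a:ℝ) * (R * j) / q) := by
    intro j
    refine sum_congr rfl fun a _ => ?_
    rw [mul_assoc, ← ee_add]; congr 2; push_cast; ring
  simp only [e1]
  rw [parseval_shift q R hq (cop q) (fun a => al A w r x q a * ee ((a:ℝ) * (y:ℝ) / q))]
  refine mul_le_mul_of_nonneg_left ?_ (Nat.cast_nonneg q)
  generalize hq'e : q / Nat.gcd R q = q' at *
  generalize Nat.gcd R q = v at *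
  subst hvq
  have e2 : ∑ c ∈ range q', ‖∑ a ∈ cop (v * q') with a % q' = c, al A w r x (v * q') a * ee ((a:ℝ) * (y:ℝ) / ((v * q' : ℕ):ℝ))‖^2 =
      ∑ c ∈ cop q', ‖∑ s ∈ v.divisors with s.Coprime q', (ArithmeticFunction.moebius s : ℂ) * al A w (r * (v / s)) (x + r * y) q' (ci s q' c)‖^2 := by
    rw [show cop q' = (range q').filter (fun c => Nat.Coprime c q') from rfl, sum_filter]
    refine sum_congr rfl fun c hc => ?_
    split_ifs with hcc
    · rw [beta_eq A w r hr x q' v c hq'0 hv (mem_filter.2 ⟨hc, hcc⟩) y]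
    · rw [sum_eq_zero]
      · simp
      · intro a ha
        exfalso
        obtain ⟨h1, h2⟩ := mem_filter.1 ha
        have h3 := (mem_filter.1 h1).2
        have h4 : a.Coprime q' := (Nat.coprime_mul_iff_right.1 h3).2
        apply hcc
        rw [← h2, Nat.Coprime, ← h4, Nat.ModEq.gcd_eq (Nat.mod_modEq a q')]
  rw [e2]
  have e3 : ∀ c ∈ cop q', ‖∑ s ∈ v.divisors with s.Coprime q', (ArithmeticFunction.moebius s : ℂ) * al A w (r * (v / s)) (x + r * y) q' (ci s q' c)‖^2
      ≤ #v.divisors * ∑ s ∈ v.divisors with s.Coprime q', ‖al A w (r * (v / s)) (x + r * y) q' (ci s q' c)‖^2 := by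
    intro c _
    have h1 : ‖∑ s ∈ v.divisors with s.Coprime q', (ArithmeticFunction.moebius s : ℂ) * al A w (r * (v / s)) (x + r * y) q' (ci s q' c)‖ ≤
        ∑ s ∈ v.divisors with s.Coprime q', ‖al A w (r * (v / s)) (x + r * y) q' (ci s q' c)‖ := by
      refine (norm_sum_le _ _).trans (sum_le_sum fun s _ => ?_)
      rw [norm_mul]
      refine mul_le_of_le_one_left (norm_nonneg _) ?_
      have := ArithmeticFunction.abs_moebius_le_one (n := s)
      rw [Complex.norm_intCast]
      exact_mod_cast this
    refine (pow_le_pow_left₀ (norm_nonneg _) h1 2).trans ?_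
    refine sq_sum_le_card_mul_sum_sq.trans ?_
    refine mul_le_mul_of_nonneg_right ?_ (sum_nonneg fun _ _ => by positivity)
    exact_mod_cast card_filter_le _ _
  refine (sum_le_sum e3).trans ?_
  rw [← mul_sum, sum_comm]
  refine mul_le_mul_of_nonneg_left ?_ (Nat.cast_nonneg _)
  refine le_trans (sum_le_sum (g := fun s => tt A w (r * (v / s)) (x + r * y) q') fun s hs => ?_) (sum_le_sum_of_subset_of_nonneg (filter_subset _ _) fun _ _ _ => sum_nonneg fun _ _ => by positivity)
  have hs' := (mem_filter.1 hs).2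
  rw [tt, ← sum_image (f := fun c => ‖al A w (r * (v / s)) (x + r * y) q' c‖^2) (ci_inj s q' hq'0 hs')]
  refine sum_le_sum_of_subset_of_nonneg ?_ fun _ _ _ => by positivity
  intro c hc
  obtain ⟨c', hc', rfl⟩ := mem_image.1 hc
  exact ci_mem s q' c' hq'0 hs' hc'

theorem single (A : Finset ℤ) (w : ℝ) (r : ℕ) (hr : 0 < r) (x : ℤ) (q R W : ℕ) (hq : 0 < q) (hqW : q ∣ W)
    (hRW : R ∣ W) (f : ℤ → ℝ) (hf0 : ∀ y, 0 ≤ f y) (hf : ∀ y, f (y + R) = f y) :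
    ∑ y ∈ range W, f y * ‖FF A w r x q y‖^2 ≤ ∑ y ∈ range W, f y * (#(Nat.gcd R q).divisors *
      ∑ s ∈ (Nat.gcd R q).divisors, tt A w (r * (Nat.gcd R q / s)) (x + r * y) (q / Nat.gcd R q)) := by
  have hq0 : (0:ℝ) < q := by exact_mod_cast hq
  have hfj : ∀ (y : ℤ) (j : ℕ), f (y + R * j) = f y := by
    intro y j
    induction j with
    | zero => simp
    | succ j ih => rw [← ih, ← hf (y + R * j)]; congr 1; push_cast; ring
  have hper : ∀ y : ℤ, f (y + W) * ‖FF A w r x q (y + W)‖^2 = f y * ‖FF A w r x q y‖^2 := by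
    intro y
    obtain ⟨n, hn⟩ := hqW
    obtain ⟨n', hn'⟩ := hRW
    have h1 : f (y + W) = f y := by rw [hn']; push_cast; exact hfj y n'
    have h2 : FF A w r x q (y + W) = FF A w r x q y := by
      rw [hn]; push_cast
      exact per_mul (FF A w r x q) q (FF_per A w r x q hq) y n
    rw [h1, h2]
  have h := sum_avg_real W (fun y => f y * ‖FF A w r x q y‖^2) hper R q
  have h2 : ∑ y ∈ range W, ∑ j ∈ range q, f ((y:ℤ) + R * j) * ‖FF A w r x q (y + R * j)‖^2 ≤ q * ∑ y ∈ range W, f y * (#(Nat.gcd R q).divisors *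
      ∑ s ∈ (Nat.gcd R q).divisors, tt A w (r * (Nat.gcd R q / s)) (x + r * y) (q / Nat.gcd R q)) := by
    rw [mul_sum]
    refine sum_le_sum fun y _ => ?_
    simp only [hfj]
    rw [← mul_sum, mul_left_comm]
    exact mul_le_mul_of_nonneg_left (inner_bd A w r hr x q R hq y) (hf0 y)
  rw [← h] at h2
  exact le_of_mul_le_mul_left h2 hq0

open Finset

noncomputable def TT (A : Finset ℤ) (w : ℝ) (om : ℕ → ℝ) (Q r : ℕ) (x : ℤ) : ℝ := ∑ q ∈ Icc 1 (Q / r), om q * tt A w r x q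

theorem tt_nonneg (A : Finset ℤ) (w : ℝ) (r : ℕ) (x : ℤ) (q : ℕ) : 0 ≤ tt A w r x q := sum_nonneg fun _ _ => by positivity

theorem hone_bd (A : Finset ℤ) (w : ℝ) (om : ℕ → ℝ) (Q m r : ℕ) (x : ℤ) (hr : 0 < r) (Y Ts : ℝ) (hTs : 0 ≤ Ts)
    (hom0 : ∀ q, 0 ≤ om q) (hom1 : ∀ q, 0 < q → om q ≤ 1) (homm : ∀ a b, om (a * b) = om a * om b)
    (kap : ℕ → ℝ) (hkap : ∀ q, 0 ≤ kap q) (hY0 : 0 ≤ Y)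
    (hY : ∀ q, 1 ≤ q → q ≤ Q → kap q * (#q.divisors : ℝ)^m * (#q.divisors : ℝ)^2 * om q ≤ Y)
    (hT : ∀ r, 1 ≤ r → r ≤ Q → ∀ x, TT A w om Q r x ≤ Ts)
    (W : ℕ) (hW : ∀ q ∈ Icc 1 (Q / r), q ∣ W) (R : ℕ) (hR : 0 < R) (hRW : R ∣ W) (f : ℤ → ℝ) (hf0 : ∀ y, 0 ≤ f y)
    (hf : ∀ y, f (y + R) = f y) :
    ∑ q ∈ Icc 1 (Q / r), kap q * (#q.divisors : ℝ)^m * ∑ y ∈ range W, f y * ‖(om q : ℂ) * FF A w r x q (y:ℤ)‖^2 ≤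
        #R.divisors * (Y * Ts) * ∑ y ∈ range W, f y := by
  classical
  have h1 : ∀ q ∈ Icc 1 (Q / r), kap q * (#q.divisors : ℝ)^m * ∑ y ∈ range W, f y * ‖(om q : ℂ) * FF A w r x q (y:ℤ)‖^2 ≤
      ∑ y ∈ range W, f y * (Y * ((#(Nat.gcd R q).divisors : ℝ)⁻¹ * ∑ s ∈ (Nat.gcd R q).divisors, om (q / Nat.gcd R q) * tt A w (r * (Nat.gcd R q / s)) (x + r * y) (q / Nat.gcd R q))) := by
    intro q hq
    have hq1 := (mem_Icc.1 hq).1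
    have hqQ := (mem_Icc.1 hq).2.trans (Nat.div_le_self Q r)
    have hs := single A w r hr x q R W hq1 (hW q hq) hRW f hf0 hf
    have e1 : ∑ y ∈ range W, f y * ‖(om q : ℂ) * FF A w r x q (y:ℤ)‖^2 = om q ^ 2 * ∑ y ∈ range W, f y * ‖FF A w r x q (y:ℤ)‖^2 := by
      rw [mul_sum]; refine sum_congr rfl fun y _ => ?_
      rw [norm_mul, Complex.norm_real, Real.norm_of_nonneg (hom0 q)]; ring
    rw [e1]
    have hc0 : 0 ≤ kap q * (#q.divisors : ℝ)^m := mul_nonneg (hkap q) (by positivity)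
    have h2 : kap q * (#q.divisors : ℝ)^m * (om q ^ 2 * ∑ y ∈ range W, f y * ‖FF A w r x q (y:ℤ)‖^2) ≤
        kap q * (#q.divisors : ℝ)^m * (om q ^ 2 * ∑ y ∈ range W, f y * (#(Nat.gcd R q).divisors *
      ∑ s ∈ (Nat.gcd R q).divisors, tt A w (r * (Nat.gcd R q / s)) (x + r * y) (q / Nat.gcd R q))) :=
      mul_le_mul_of_nonneg_left (mul_le_mul_of_nonneg_left hs (by positivity)) hc0
    refine h2.trans ?_
    rw [← mul_assoc, mul_sum]
    refine sum_le_sum fun y _ => ?_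
    rw [mul_left_comm]
    refine mul_le_mul_of_nonneg_left ?_ (hf0 y)
    rw [← mul_sum, ← mul_assoc, ← mul_assoc, ← mul_assoc, ]
    refine mul_le_mul_of_nonneg_right ?_ (sum_nonneg fun _ _ => tt_nonneg _ _ _ _ _)
    have hv : 0 < Nat.gcd R q := Nat.gcd_pos_of_pos_left q hR
    have hvq : Nat.gcd R q * (q / Nat.gcd R q) = q := Nat.mul_div_cancel' (Nat.gcd_dvd_right R q)
    have hq'0 : 0 < q / Nat.gcd R q := Nat.div_pos (Nat.le_of_dvd hq1 (Nat.gcd_dvd_right R q)) hv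
    have hτ : (#(Nat.gcd R q).divisors : ℝ) ≤ #q.divisors := by
      exact_mod_cast card_le_card (Nat.divisors_subset_of_dvd (by omega) (Nat.gcd_dvd_right R q))
    have hτ0 : 0 < (#(Nat.gcd R q).divisors : ℝ) := by exact_mod_cast card_pos.2 (Nat.nonempty_divisors.2 hv.ne')
    have homq : om q ≤ om (q / Nat.gcd R q) := by
      have := homm (Nat.gcd R q) (q / Nat.gcd R q)
      rw [hvq] at this; rw [this]
      exact mul_le_of_le_one_left (hom0 _) (hom1 _ hv)
    rw [mul_assoc Y, mul_comm Y, mul_assoc, mul_comm _ (om _)]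
    have h3 := hY q hq1 hqQ
    have h4 : kap q * (#q.divisors : ℝ)^m * om q ^ 2 * (#(Nat.gcd R q).divisors : ℝ) ≤ (om q * (#(Nat.gcd R q).divisors : ℝ)⁻¹) * (kap q * (#q.divisors : ℝ)^m * (#q.divisors : ℝ)^2 * om q) := by
      have h5 : (#(Nat.gcd R q).divisors : ℝ) ≤ (#(Nat.gcd R q).divisors : ℝ)⁻¹ * (#q.divisors : ℝ)^2 := by
        rw [inv_mul_eq_div, le_div_iff₀ hτ0]; nlinarith
      calc kap q * (#q.divisors : ℝ)^m * om q ^ 2 * (#(Nat.gcd R q).divisors : ℝ) ≤ kap q * (#q.divisors : ℝ)^m * om q ^ 2 * ((#(Nat.gcd R q).divisors : ℝ)⁻¹ * (#q.divisors : ℝ)^2) :=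
            mul_le_mul_of_nonneg_left h5 (mul_nonneg hc0 (by positivity))
        _ = _ := by ring
    refine (le_of_eq (by ring)).trans (h4.trans ?_)
    calc _ ≤ (om q * (#(Nat.gcd R q).divisors : ℝ)⁻¹) * Y := mul_le_mul_of_nonneg_left h3 (mul_nonneg (hom0 q) (by positivity))
      _ ≤ (om (q / Nat.gcd R q) * (#(Nat.gcd R q).divisors : ℝ)⁻¹) * Y := by gcongr
      _ = _ := by ring
  refine (sum_le_sum h1).trans ?_
  rw [sum_comm, mul_sum]
  refine sum_le_sum fun y _ => ?_
  rw [← mul_sum, mul_comm (_ * _) (f y)]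
  refine mul_le_mul_of_nonneg_left ?_ (hf0 y)
  rw [← mul_sum, mul_left_comm]
  refine mul_le_mul_of_nonneg_left ?_ hY0
  rw [← sum_fiberwise_of_maps_to (s := Icc 1 (Q / r)) (t := R.divisors) (g := fun q => Nat.gcd R q)
    (fun q _ => Nat.mem_divisors.2 ⟨Nat.gcd_dvd_left R q, hR.ne'⟩)]
  rw [show (#R.divisors : ℝ) * Ts = ∑ _v ∈ R.divisors, Ts by rw [sum_const, nsmul_eq_mul]]
  refine sum_le_sum fun v hv => ?_
  have hvR := (Nat.mem_divisors.1 hv).1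
  have hv0 : 0 < v := Nat.pos_of_dvd_of_pos hvR hR
  have hτ0 : 0 < (#v.divisors : ℝ) := by exact_mod_cast card_pos.2 (Nat.nonempty_divisors.2 hv0.ne')
  have e2 : ∑ q ∈ Icc 1 (Q / r) with Nat.gcd R q = v, ((#(Nat.gcd R q).divisors : ℝ)⁻¹ * ∑ s ∈ (Nat.gcd R q).divisors, om (q / Nat.gcd R q) * tt A w (r * (Nat.gcd R q / s)) (x + r * y) (q / Nat.gcd R q)) =
      (#v.divisors : ℝ)⁻¹ * ∑ s ∈ v.divisors, ∑ q ∈ Icc 1 (Q / r) with Nat.gcd R q = v, om (q / v) * tt A w (r * (v / s)) (x + r * y) (q / v) := by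
    rw [sum_comm, mul_sum]
    refine sum_congr rfl fun q hq => ?_
    rw [(mem_filter.1 hq).2]
  rw [e2, inv_mul_le_iff₀ hτ0, show (#v.divisors : ℝ) * Ts = ∑ _v ∈ v.divisors, Ts by rw [sum_const, nsmul_eq_mul]]
  refine sum_le_sum fun s hs => ?_
  have hsv := (Nat.mem_divisors.1 hs).1
  have hs0 : 0 < s := Nat.pos_of_dvd_of_pos hsv hv0
  have hn0 : 0 < v / s := Nat.div_pos (Nat.le_of_dvd hv0 hsv) hs0
  by_cases hrv : r * (v / s) ≤ Q
  · refine le_trans ?_ (hT (r * (v / s)) (Nat.mul_pos hr hn0) hrv (x + r * y))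
    rw [TT]
    have hinj : Set.InjOn (fun q => q / v) ((Icc 1 (Q / r)).filter fun q => Nat.gcd R q = v) := by
      intro a ha b hb hab
      have ha' := (mem_filter.1 ha).2
      have hb' := (mem_filter.1 hb).2
      have h1 : v ∣ a := ha' ▸ Nat.gcd_dvd_right R a
      have h2 : v ∣ b := hb' ▸ Nat.gcd_dvd_right R b
      rw [← Nat.mul_div_cancel' h1, ← Nat.mul_div_cancel' h2]
      exact congrArg (v * ·) hab
    rw [← sum_image (f := fun q => om q * tt A w (r * (v / s)) (x + r * y) q) hinj]
    refine sum_le_sum_of_subset_of_nonneg ?_ fun _ _ _ => mul_nonneg (hom0 _) (tt_nonneg _ _ _ _ _)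
    intro q' hq'
    obtain ⟨q, hq, rfl⟩ := mem_image.1 hq'
    obtain ⟨hq1, hq2⟩ := mem_filter.1 hq
    obtain ⟨h3, h4⟩ := mem_Icc.1 hq1
    have h5 : v ∣ q := hq2 ▸ Nat.gcd_dvd_right R q
    rw [mem_Icc]
    refine ⟨Nat.div_pos (Nat.le_of_dvd h3 h5) hv0, ?_⟩
    rw [Nat.le_div_iff_mul_le (Nat.mul_pos hr hn0)]
    calc q / v * (r * (v / s)) ≤ q / v * (r * v) := by gcongr; exact Nat.div_le_self v s
      _ = (q / v * v) * r := by ring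
      _ = q * r := by rw [Nat.div_mul_cancel h5]
      _ ≤ Q / r * r := by gcongr
      _ ≤ Q := Nat.div_mul_le_self Q r
  · rw [sum_eq_zero]
    · exact hTs
    · intro q hq
      exfalso
      obtain ⟨hq1, hq2⟩ := mem_filter.1 hq
      obtain ⟨h3, h4⟩ := mem_Icc.1 hq1
      have h5 : v ∣ q := hq2 ▸ Nat.gcd_dvd_right R q
      apply hrv
      calc r * (v / s) ≤ r * q := by gcongr; exact (Nat.div_le_self v s).trans (Nat.le_of_dvd h3 h5)
        _ ≤ r * (Q / r) := by gcongr
        _ ≤ Q := Nat.mul_div_le Q r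

theorem mean_moment (A : Finset ℤ) (w : ℝ) (om : ℕ → ℝ) (Q m r : ℕ) (hm : 1 ≤ m) (x : ℤ) (hr : 0 < r) (Y Ts : ℝ) (hTs : 0 ≤ Ts)
    (hom0 : ∀ q, 0 ≤ om q) (hom1 : ∀ q, 0 < q → om q ≤ 1) (homm : ∀ a b, om (a * b) = om a * om b)
    (hY0 : 0 ≤ Y)
    (hY : ∀ q, 1 ≤ q → q ≤ Q → (8:ℝ)^(m * #q.primeFactors) * (#q.divisors : ℝ)^2 * (#q.divisors : ℝ)^m * (#q.divisors : ℝ)^2 * om q ≤ Y)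
    (hT : ∀ r, 1 ≤ r → r ≤ Q → ∀ x, TT A w om Q r x ≤ Ts) :
    ∑ y ∈ range Q.factorial, ‖∑ q ∈ Icc 1 (Q / r), (om q : ℂ) * FF A w r x q (y:ℤ)‖^(2*m) ≤ (Y * Ts)^m * Q.factorial := by
  have hW0 := Nat.factorial_pos Q
  have hS : ∀ q ∈ Icc 1 (Q / r), 0 < q := fun q hq => (mem_Icc.1 hq).1
  have hSW : ∀ q ∈ Icc 1 (Q / r), q ∣ Q.factorial := fun q hq =>
    Nat.dvd_factorial (hS q hq) ((mem_Icc.1 hq).2.trans (Nat.div_le_self Q r))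
  have hper : ∀ q ∈ Icc 1 (Q / r), ∀ y, (om q : ℂ) * FF A w r x q (y + q) = (om q : ℂ) * FF A w r x q y := fun q hq y => by
    rw [FF_per A w r x q (hS q hq)]
  have hperd : ∀ q ∈ Icc 1 (Q / r), ∀ V : ℕ, q ∣ V → ∀ y, (om q : ℂ) * FF A w r x q (y + V) = (om q : ℂ) * FF A w r x q y := by
    intro q hq V ⟨n, hn⟩ y
    rw [hn]; push_cast
    rw [per_mul (FF A w r x q) q (FF_per A w r x q (hS q hq)) y n]
  refine (sqfun (Icc 1 (Q / r)) hS (fun q y => (om q : ℂ) * FF A w r x q y) m Q.factorial hm (fun q hq y => hperd q hq _ (hSW q hq) y) ?_).trans ?_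
  · intro p hp
    have hnp : ¬ p ∣ ordCompl[p] Q.factorial := Nat.not_dvd_ordCompl hp hW0.ne'
    refine ⟨ordCompl[p] Q.factorial, ordProj[p] Q.factorial, Nat.ordProj_pos _ _, ?_, ?_, ?_⟩
    · rw [mul_comm]; exact (Nat.ordProj_mul_ordCompl_eq_self _ _).symm
    · intro q hq hpq
      have hpq' : ¬ p ∣ q := fun h => hpq (Nat.mem_primeFactors.2 ⟨hp, h, (hS q hq).ne'⟩)
      refine hperd q hq _ ?_
      have h1 : q ∣ ordProj[p] Q.factorial * ordCompl[p] Q.factorial := by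
        rw [Nat.ordProj_mul_ordCompl_eq_self]; exact hSW q hq
      refine Nat.Coprime.dvd_of_dvd_mul_left ?_ h1
      exact (Nat.Coprime.pow_left _ ((Nat.Prime.coprime_iff_not_dvd hp).2 hpq')).symm
    · intro q hq hpq y
      rw [← mul_sum, FF_prime A w r x q (hS q hq) p hp (Nat.dvd_of_mem_primeFactors hpq) _ _ hnp _ y, mul_zero]
      rw [mul_comm, Nat.ordProj_mul_ordCompl_eq_self]; exact hSW q hq
  · refine seqmom (Icc 1 (Q / r)) (fun q y => (om q : ℂ) * FF A w r x q y) _ m Q.factorial (Y * Ts) (mul_nonneg hY0 hTs) (fun q => by positivity) hSW hS hper ?_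
    intro R hR hRW f hf0 hf
    exact hone_bd A w om Q m r x hr Y Ts hTs hom0 hom1 homm (fun q => (8:ℝ)^(m * #q.primeFactors) * (#q.divisors : ℝ)^2) (fun q => by positivity) hY0 hY hT _ hSW R hR hRW f hf0 hf

open Finset

theorem al_norm_le (A : Finset ℤ) (w : ℝ) (hw : 0 ≤ w) (r : ℕ) (x : ℤ) (q c : ℕ) :
    ‖al A w r x q c‖ ≤ r * w * #{z ∈ A | (r:ℤ) ∣ z - x} := by
  rw [al, norm_mul, Complex.norm_real, Real.norm_of_nonneg (by positivity)]
  refine mul_le_mul_of_nonneg_left ?_ (by positivity)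
  refine (norm_sum_le _ _).trans ?_
  simp [norm_ee]

theorem TT_eq (A : Finset ℤ) (w : ℝ) (om : ℕ → ℝ) (Q r : ℕ) (x : ℤ) :
    ((TT A w om Q r x : ℝ) : ℂ) = ((r * w : ℝ) : ℂ) * ∑ z ∈ A with (r:ℤ) ∣ z - x,
      ∑ q ∈ Icc 1 (Q / r), (om q : ℂ) * FF A w r x q ((z - x) / r) := by
  rw [TT, sum_comm, mul_sum, Complex.ofReal_sum]
  refine sum_congr rfl fun q _ => ?_
  rw [← mul_sum, mul_left_comm, Complex.ofReal_mul]
  congr 1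
  rw [tt, Complex.ofReal_sum]
  simp only [FF]
  rw [sum_comm, mul_sum]
  refine sum_congr rfl fun c _ => ?_
  rw [Complex.ofReal_pow, ← Complex.mul_conj', ← mul_sum, mul_left_comm]
  congr 1
  rw [al, map_mul, Complex.conj_ofReal, map_sum]
  congr 1
  refine sum_congr rfl fun z _ => ?_
  rw [← ee_neg, neg_neg]

theorem TP_F (A : Finset ℤ) (w : ℝ) (hw : 0 ≤ w) (om : ℕ → ℝ) (Q r : ℕ) (x : ℤ)
    (hom0 : ∀ q, 0 ≤ om q) (hom1 : ∀ q, 0 < q → om q ≤ 1)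
    (hreg : r * w * #{z ∈ A | (r:ℤ) ∣ z - x} ≤ 2) :
    TP Q.factorial Q (2 * (Q:ℝ)^2) (fun y => ∑ q ∈ Icc 1 (Q / r), (om q : ℂ) * FF A w r x q y) := by
  classical
  refine ⟨((Icc 1 (Q / r)).sigma cop : Finset (Σ _ : ℕ, ℕ)), inferInstance,
    fun i => (om i.1.1 : ℂ) * al A w r x i.1.1 i.1.2, fun i => (i.1.2 : ℝ) / i.1.1, ?_, ?_, ?_⟩
  · rintro ⟨⟨q, c⟩, hi⟩
    have hq := (mem_sigma.1 hi).1
    have hq1 := (mem_Icc.1 hq).1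
    have hq2 := (mem_Icc.1 hq).2.trans (Nat.div_le_self Q r)
    refine ⟨q, hq1, hq2, Nat.dvd_factorial hq1 hq2, ?_⟩
    have hq0 : (q:ℝ) ≠ 0 := by exact_mod_cast (Nat.pos_of_ne_zero (by simp only at hq1; omega)).ne'
    have : (q:ℝ) * ((c:ℝ) / q) = (c:ℝ) := by field_simp
    simp only [this]; exact nat_mem_ZZ c
  · rw [Finset.sum_coe_sort ((Icc 1 (Q / r)).sigma cop) (fun i => ‖(om i.1 : ℂ) * al A w r x i.1 i.2‖), sum_sigma]
    have h1 : ∀ q ∈ Icc 1 (Q / r), ∑ c ∈ cop q, ‖(om q : ℂ) * al A w r x q c‖ ≤ Q * 2 := by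
      intro q hq
      have hq1 := (mem_Icc.1 hq).1
      have hq2 := (mem_Icc.1 hq).2.trans (Nat.div_le_self Q r)
      have h2 : ∀ c ∈ cop q, ‖(om q : ℂ) * al A w r x q c‖ ≤ 2 := by
        intro c _
        rw [norm_mul, Complex.norm_real, Real.norm_of_nonneg (hom0 q)]
        have := (al_norm_le A w hw r x q c).trans hreg
        calc om q * ‖al A w r x q c‖ ≤ 1 * ‖al A w r x q c‖ := by gcongr; exact hom1 q hq1
          _ ≤ 2 := by rw [one_mul]; exact this
      refine (sum_le_sum h2).trans ?_
      rw [sum_const, nsmul_eq_mul]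
      gcongr
      have : #(cop q) ≤ q := by
        have := card_filter_le (range q) (fun c => Nat.Coprime c q)
        rwa [card_range] at this
      exact_mod_cast this.trans hq2
    refine (sum_le_sum h1).trans ?_
    rw [sum_const, nsmul_eq_mul, Nat.card_Icc, Nat.add_sub_cancel]
    have : ((Q / r : ℕ):ℝ) ≤ Q := by exact_mod_cast Nat.div_le_self Q r
    nlinarith [(Nat.cast_nonneg Q : (0:ℝ) ≤ Q)]
  · intro y
    rw [Finset.sum_coe_sort ((Icc 1 (Q / r)).sigma cop) (fun i => (om i.1 : ℂ) * al A w r x i.1 i.2 * ee ((i.2:ℝ) / i.1 * y)), sum_sigma]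
    refine sum_congr rfl fun q _ => ?_
    rw [FF, mul_sum]
    refine sum_congr rfl fun c _ => ?_
    rw [mul_assoc]; congr 3; ring

theorem T_bound (A : Finset ℤ) (t : ℤ) (N' Q m : ℕ) (σ Y Ts : ℝ) (om : ℕ → ℝ) (hm : 1 ≤ m) (hσ0 : 0 < σ) 
    (hA : ∀ z ∈ A, t ≤ z ∧ z < t + N')
    (hreg : ∀ r : ℕ, 1 ≤ r → r ≤ Q → ∀ x : ℤ, (#{z ∈ A | (r:ℤ) ∣ z - x} : ℝ) * r ≤ 2 * σ * N')
    (hN : Q * (2 * Q^3)^(2*m) ≤ N') (hTs : 1 ≤ Ts)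
    (hom0 : ∀ q, 0 ≤ om q) (hom1 : ∀ q, 0 < q → om q ≤ 1) (homm : ∀ a b, om (a * b) = om a * om b)
    (hY1 : 1 ≤ Y)
    (hY : ∀ q, 1 ≤ q → q ≤ Q → (8:ℝ)^(m * #q.primeFactors) * (#q.divisors : ℝ)^2 * (#q.divisors : ℝ)^m * (#q.divisors : ℝ)^2 * om q ≤ Y)
    (hT : ∀ r, 1 ≤ r → r ≤ Q → ∀ x, TT A (1/(σ*N')) om Q r x ≤ Ts) (r : ℕ) (hr1 : 1 ≤ r) (hrQ : r ≤ Q) (x : ℤ) :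
    TT A (1/(σ*N')) om Q r x ^ (2*m) ≤ 2 * 4^m * (Y * Ts)^m / σ := by
  have hQ1 : 1 ≤ Q := hr1.trans hrQ
  have h1p : 1 ≤ (2 * Q^3)^(2*m) := Nat.one_le_pow _ _ (by positivity)
  have hQN : Q ≤ N' := le_trans (by nlinarith) hN
  have hN0 : 0 < (N':ℝ) := by exact_mod_cast (hQ1.trans hQN)
  set w := 1 / (σ * N') with hw
  have hw0 : 0 < w := by positivity
  have hr0 : (0:ℝ) < r := by exact_mod_cast hr1
  have hwN : w * N' = 1 / σ := by rw [hw]; field_simp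
  have hreg' : r * w * #{z ∈ A | (r:ℤ) ∣ z - x} ≤ 2 := by
    have := hreg r hr1 hrQ x
    calc r * w * #{z ∈ A | (r:ℤ) ∣ z - x} = w * (#{z ∈ A | (r:ℤ) ∣ z - x} * r) := by ring
      _ ≤ w * (2 * σ * N') := by gcongr
      _ = 2 := by rw [hw]; field_simp
  set F : ℤ → ℂ := fun y => ∑ q ∈ Icc 1 (Q / r), (om q : ℂ) * FF A w r x q y with hF
  have hTP : TP Q.factorial Q (2 * (Q:ℝ)^2) F := TP_F A w hw0.le om Q r x hom0 hom1 hreg'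
  have hmean := mean_moment A w om Q m r hm x hr1 Y Ts (by linarith) hom0 hom1 homm (by linarith) hY hT
  set a : ℤ := (t - x) / r with ha
  set L : ℕ := N' / r + 2 with hL
  have him := interval_moment hTP a L m
  have hW0 : (0:ℝ) < Q.factorial := by exact_mod_cast Nat.factorial_pos Q
  have hI : ∑ i ∈ range L, ‖F (a + i)‖^(2*m) ≤ L * (Y * Ts)^m + (Q * (2 * (Q:ℝ)^2))^(2*m) := by
    have h3 : (Q.factorial:ℝ) * ∑ i ∈ range L, ‖F (a + i)‖^(2*m) ≤ Q.factorial * (L * (Y * Ts)^m + (Q * (2 * (Q:ℝ)^2))^(2*m)) := by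
      refine him.trans ?_
      have : (L:ℝ) * ∑ y ∈ range Q.factorial, ‖F y‖^(2*m) ≤ L * ((Y * Ts)^m * Q.factorial) := by gcongr
      linarith
    exact le_of_mul_le_mul_left h3 hW0
  set A' := A.filter (fun z => (r:ℤ) ∣ z - x) with hA'
  have hinj : Set.InjOn (fun z : ℤ => (z - x) / (r:ℤ)) A' := by
    intro u hu v hv huv
    have h1 := (mem_filter.1 hu).2
    have h2 := (mem_filter.1 hv).2
    have h3 : u - x = v - x := by
      rw [← Int.mul_ediv_cancel' h1, ← Int.mul_ediv_cancel' h2]; exact congrArg ((r:ℤ) * ·) huv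
    linarith
  have hr0z : (0:ℤ) < r := by exact_mod_cast hr1
  have hsum : ∑ z ∈ A', ‖F ((z - x) / r)‖^(2*m) ≤ ∑ i ∈ range L, ‖F (a + i)‖^(2*m) := by
    have hinj2 : Set.InjOn (fun i : ℕ => a + (i:ℤ)) (range L) := by
      intro i _ j _ hij
      simpa using hij
    rw [← sum_image (f := fun y => ‖F y‖^(2*m)) hinj, ← sum_image (f := fun y => ‖F y‖^(2*m)) hinj2]
    refine sum_le_sum_of_subset_of_nonneg ?_ fun _ _ _ => by positivity
    intro y hy
    obtain ⟨z, hz, rfl⟩ := mem_image.1 hy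
    obtain ⟨hzA, hzd⟩ := mem_filter.1 hz
    obtain ⟨hz1, hz2⟩ := hA z hzA
    have h1 : a ≤ (z - x) / r := Int.ediv_le_ediv hr0z (by linarith)
    have h2 : (z - x) / r < a + L := by
      have h3 : z - x < (a + L) * r := by
        have h4 : t - x < (a + 1) * r := by rw [ha]; exact Int.lt_ediv_add_one_mul_self (t - x) hr0z
        have h5 : (N':ℤ) < ((N' / r : ℕ) + 1) * r := by
          have := Nat.lt_div_mul_add (a := N') hr1
          have h6 : N' < (N' / r + 1) * r := by linarith
          exact_mod_cast h6
        rw [hL]; push_cast; push_cast at h5; nlinarith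
      exact Int.ediv_lt_of_lt_mul hr0z h3
    refine mem_image.2 ⟨((z - x) / r - a).toNat, ?_, ?_⟩
    · rw [mem_range]; omega
    · omega
  have hnorm : TT A w om Q r x ≤ r * w * ∑ z ∈ A', ‖F ((z - x) / r)‖ := by
    have h1 := TT_eq A w om Q r x
    have h2 : |TT A w om Q r x| ≤ r * w * ∑ z ∈ A', ‖F ((z - x) / r)‖ := by
      rw [← Real.norm_eq_abs, ← Complex.norm_real, h1, norm_mul, Complex.norm_real, Real.norm_of_nonneg (by positivity)]
      gcongr
      exact norm_sum_le _ _
    exact (le_abs_self _).trans h2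
  have hT0 : 0 ≤ TT A w om Q r x := sum_nonneg fun q _ => mul_nonneg (hom0 q) (tt_nonneg _ _ _ _ _)
  have hpm : (∑ z ∈ A', ‖F ((z - x) / r)‖)^(2*m) ≤ (#A' : ℝ)^(2*m-1) * ∑ z ∈ A', ‖F ((z - x) / r)‖^(2*m) := by
    have h := pow_sum_div_card_le_sum_pow (s := A') (f := fun z => ‖F ((z - x) / r)‖) (n := 2*m-1) (fun _ _ => norm_nonneg _)
    rw [show 2*m-1+1 = 2*m by omega] at h
    by_cases hc : (#A' : ℝ) = 0
    · have : A' = ∅ := by rw [← card_eq_zero]; exact_mod_cast hc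
      rw [this]; rw [sum_empty, zero_pow (by omega)]; positivity
    · have hc' : 0 < (#A' : ℝ) := lt_of_le_of_ne (Nat.cast_nonneg _) (Ne.symm hc)
      rw [div_le_iff₀ (by positivity)] at h
      linarith
  have hLb : (L:ℝ) ≤ 3 * N' / r := by
    have h1 : ((N' / r : ℕ):ℝ) ≤ N' / r := Nat.cast_div_le
    have h2 : (1:ℝ) ≤ N' / r := by rw [le_div_iff₀ hr0, one_mul]; exact_mod_cast hrQ.trans hQN
    rw [hL]; push_cast
    rw [mul_div_assoc]; linarith
  have hrN : (r:ℝ) * (Q * (2 * (Q:ℝ)^2))^(2*m) ≤ N' := by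
    have h1 : (r:ℝ) ≤ Q := by exact_mod_cast hrQ
    have h2 : (Q:ℝ) * (2 * (Q:ℝ)^3)^(2*m) ≤ N' := by exact_mod_cast hN
    calc (r:ℝ) * (Q * (2 * (Q:ℝ)^2))^(2*m) ≤ Q * (Q * (2 * (Q:ℝ)^2))^(2*m) := by gcongr
      _ = Q * (2 * (Q:ℝ)^3)^(2*m) := by ring_nf
      _ ≤ N' := h2
  have hYT : 1 ≤ (Y * Ts)^m := one_le_pow₀ (by nlinarith)
  calc TT A w om Q r x ^ (2*m) ≤ (r * w * ∑ z ∈ A', ‖F ((z - x) / r)‖)^(2*m) := pow_le_pow_left₀ hT0 hnorm _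
    _ = (r * w)^(2*m) * (∑ z ∈ A', ‖F ((z - x) / r)‖)^(2*m) := mul_pow _ _ _
    _ ≤ (r * w)^(2*m) * ((#A' : ℝ)^(2*m-1) * ∑ z ∈ A', ‖F ((z - x) / r)‖^(2*m)) := by gcongr
    _ = (r * w * #A')^(2*m-1) * (r * w * ∑ z ∈ A', ‖F ((z - x) / r)‖^(2*m)) := by
        obtain ⟨j, hj⟩ : ∃ j, 2 * m = j + 1 := ⟨2*m-1, by omega⟩
        rw [hj, Nat.add_sub_cancel]; ring
    _ ≤ 2^(2*m-1) * (r * w * (L * (Y * Ts)^m + (Q * (2 * (Q:ℝ)^2))^(2*m))) := by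
        gcongr
        exact hsum.trans hI
    _ ≤ 2^(2*m-1) * (4 * (Y * Ts)^m / σ) := by
        gcongr
        have h1 : r * w * (L * (Y * Ts)^m) ≤ 3 / σ * (Y * Ts)^m := by
          have : r * w * L ≤ 3 / σ := by
            calc r * w * L ≤ r * w * (3 * N' / r) := by gcongr
              _ = 3 * (w * N') := by field_simp
              _ = 3 / σ := by rw [hwN]; ring
          calc _ = r * w * L * (Y * Ts)^m := by ring
            _ ≤ _ := by gcongr
        have h2 : r * w * (Q * (2 * (Q:ℝ)^2))^(2*m) ≤ 1 / σ * (Y * Ts)^m := by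
          calc r * w * (Q * (2 * (Q:ℝ)^2))^(2*m) = w * (r * (Q * (2 * (Q:ℝ)^2))^(2*m)) := by ring
            _ ≤ w * N' := by gcongr
            _ = 1 / σ * 1 := by rw [hwN, mul_one]
            _ ≤ 1 / σ * (Y * Ts)^m := by gcongr
        calc _ = r * w * (L * (Y * Ts)^m) + r * w * (Q * (2 * (Q:ℝ)^2))^(2*m) := by ring
          _ ≤ 3 / σ * (Y * Ts)^m + 1 / σ * (Y * Ts)^m := add_le_add h1 h2
          _ = _ := by ring
    _ = 2 * 4^m * (Y * Ts)^m / σ := by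
        have : (4:ℝ)^m = 2^(2*m) := by rw [pow_mul]; norm_num
        obtain ⟨j, hj⟩ : ∃ j, 2 * m = j + 1 := ⟨2*m-1, by omega⟩
        rw [this, hj, Nat.add_sub_cancel]; ring

theorem partE (A : Finset ℤ) (t : ℤ) (N' Q m : ℕ) (σ Y : ℝ) (om : ℕ → ℝ) (hm : 1 ≤ m) (hQ1 : 1 ≤ Q) (hσ0 : 0 < σ) (hσ1 : σ ≤ 1)
    (hA : ∀ z ∈ A, t ≤ z ∧ z < t + N')
    (hreg : ∀ r : ℕ, 1 ≤ r → r ≤ Q → ∀ x : ℤ, (#{z ∈ A | (r:ℤ) ∣ z - x} : ℝ) * r ≤ 2 * σ * N')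
    (hN : Q * (2 * Q^3)^(2*m) ≤ N')
    (hom0 : ∀ q, 0 ≤ om q) (hom1 : ∀ q, 0 < q → om q ≤ 1) (homm : ∀ a b, om (a * b) = om a * om b)
    (hY1 : 1 ≤ Y)
    (hY : ∀ q, 1 ≤ q → q ≤ Q → (8:ℝ)^(m * #q.primeFactors) * (#q.divisors : ℝ)^2 * (#q.divisors : ℝ)^m * (#q.divisors : ℝ)^2 * om q ≤ Y) :
    (∑ q ∈ Icc 1 Q, om q * tt A (1/(σ*N')) 1 0 q)^m ≤ (8 * Y)^m / σ := by
  set w := 1 / (σ * N') with hw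
  set B : Set ℝ := {T | T = 1 ∨ ∃ r : ℕ, 1 ≤ r ∧ r ≤ Q ∧ ∃ x : ℤ, T = TT A w om Q r x} with hB
  have hN0 : 0 < (N':ℝ) := by
    have : 1 ≤ Q * (2 * Q^3)^(2*m) := Nat.one_le_iff_ne_zero.2 (by positivity)
    exact_mod_cast this.trans hN
  have hw0 : 0 < w := by positivity
  have hbd : BddAbove B := by
    refine ⟨1 + Q * (Q * 4), ?_⟩
    rintro T (rfl | ⟨r, hr1, hrQ, x, rfl⟩)
    · have : (0:ℝ) ≤ Q * (Q * 4) := by positivity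
      linarith
    · have hreg' : r * w * #{z ∈ A | (r:ℤ) ∣ z - x} ≤ 2 := by
        have := hreg r hr1 hrQ x
        calc r * w * #{z ∈ A | (r:ℤ) ∣ z - x} = w * (#{z ∈ A | (r:ℤ) ∣ z - x} * r) := by ring
          _ ≤ w * (2 * σ * N') := by gcongr
          _ = 2 := by rw [hw]; field_simp
      have h1 : TT A w om Q r x ≤ ∑ q ∈ Icc 1 (Q / r), (Q * 4 : ℝ) := by
        refine sum_le_sum fun q hq => ?_
        have hq1 := (mem_Icc.1 hq).1
        have hq2 := (mem_Icc.1 hq).2.trans (Nat.div_le_self Q r)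
        have h2 : tt A w r x q ≤ Q * 4 := by
          have h3 : tt A w r x q ≤ ∑ c ∈ cop q, (4:ℝ) := by
            refine sum_le_sum fun c _ => ?_
            have := (al_norm_le A w hw0.le r x q c).trans hreg'
            nlinarith [norm_nonneg (al A w r x q c)]
          refine h3.trans ?_
          rw [sum_const, nsmul_eq_mul]
          gcongr
          have : #(cop q) ≤ q := by
            have := card_filter_le (range q) (fun c => Nat.Coprime c q)
            rwa [card_range] at this
          exact this.trans hq2
        calc om q * tt A w r x q ≤ 1 * tt A w r x q := by
              refine mul_le_mul_of_nonneg_right (hom1 q hq1) (tt_nonneg _ _ _ _ _)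
          _ ≤ _ := by rw [one_mul]; exact h2
      refine h1.trans ?_
      rw [sum_const, nsmul_eq_mul, Nat.card_Icc, Nat.add_sub_cancel]
      have : ((Q / r : ℕ):ℝ) ≤ Q := by exact_mod_cast Nat.div_le_self Q r
      have h5 : ((Q / r : ℕ):ℝ) * (Q * 4) ≤ Q * (Q * 4) := by gcongr
      linarith
  set Ts := sSup B with hTsdef
  have hne : B.Nonempty := ⟨1, Or.inl rfl⟩
  have hTs1 : 1 ≤ Ts := le_csSup hbd (Or.inl rfl)
  have hTall : ∀ r, 1 ≤ r → r ≤ Q → ∀ x, TT A w om Q r x ≤ Ts := fun r h1 h2 x => le_csSup hbd (Or.inr ⟨r, h1, h2, x, rfl⟩)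
  set Bd := 2 * 4^m * (Y * Ts)^m / σ with hBd
  have hYT : 1 ≤ (Y * Ts)^m := one_le_pow₀ (by nlinarith)
  have h4m : (1:ℝ) ≤ 4^m := one_le_pow₀ (by norm_num)
  have hBd1 : 1 ≤ Bd := by
    rw [hBd, le_div_iff₀ hσ0]; nlinarith
  have hup : Ts ≤ Bd ^ ((1:ℝ) / (2*m : ℕ)) := by
    refine csSup_le hne ?_
    have key : ∀ T : ℝ, 0 ≤ T → T^(2*m) ≤ Bd → T ≤ Bd ^ ((1:ℝ) / (2*m : ℕ)) := by
      intro T hT0 hT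
      have := Real.rpow_le_rpow (by positivity) hT (by positivity : (0:ℝ) ≤ (1:ℝ) / (2*m : ℕ))
      rwa [one_div, Real.pow_rpow_inv_natCast hT0 (by omega), ← one_div] at this
    rintro T (rfl | ⟨r, hr1, hrQ, x, rfl⟩)
    · exact key 1 zero_le_one (by simpa using hBd1)
    · refine key _ (sum_nonneg fun q _ => mul_nonneg (hom0 q) (tt_nonneg _ _ _ _ _)) ?_
      exact T_bound A t N' Q m σ Y Ts om hm hσ0 hA hreg hN hTs1 hom0 hom1 homm hY1 hY hTall r hr1 hrQ x
  have hpow : Ts^(2*m) ≤ Bd := by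
    have := pow_le_pow_left₀ (by linarith) hup (2*m)
    rwa [one_div, Real.rpow_inv_natCast_pow (by linarith) (by omega)] at this
  have hfin : Ts^m ≤ (8 * Y)^m / σ := by
    have h1 : Ts^m * Ts^m ≤ (2 * 4^m * Y^m / σ) * Ts^m := by
      calc Ts^m * Ts^m = Ts^(2*m) := by rw [two_mul, pow_add]
        _ ≤ Bd := hpow
        _ = _ := by rw [hBd, mul_pow]; ring
    have h2 := le_of_mul_le_mul_right h1 (by positivity)
    refine h2.trans ?_
    rw [mul_pow]
    gcongr
    calc (2:ℝ) * 4^m ≤ 2^m * 4^m := by gcongr; exact le_self_pow₀ (by norm_num) (by omega)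
      _ = 8^m := by rw [← mul_pow]; norm_num
  have h1 := hTall 1 le_rfl hQ1 0
  rw [TT, Nat.div_one] at h1
  refine (pow_le_pow_left₀ (sum_nonneg fun q _ => mul_nonneg (hom0 q) (tt_nonneg _ _ _ _ _)) h1 m).trans hfin

open Finset

theorem tau_local_small (J : ℕ) (hJ : 1 ≤ J) (η : ℝ) (hη : 0 < η) (hη1 : η ≤ 1) (p e : ℕ) (hp : 2 ≤ p) :
    ((e:ℝ) + 1)^J ≤ (2 * J / η)^J * ((p:ℝ)^e)^η := by
  have hJ0 : (0:ℝ) < J := by exact_mod_cast hJ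
  have hJ1 : (1:ℝ) ≤ J := by exact_mod_cast hJ
  have h1 : (e:ℝ) + 1 ≤ (2 * J / η) * (2:ℝ)^(e * η / J) := by
    have h2 : 1 + e * η / J / 2 ≤ (2:ℝ)^(e * η / J) := by
      rw [Real.rpow_def_of_pos (by norm_num)]
      have h3 := Real.add_one_le_exp (Real.log 2 * (e * η / J))
      have h4 := Real.log_two_gt_d9
      have h5 : 0 ≤ e * η / J := by positivity
      nlinarith
    have h6 : 1 ≤ 2 * J / η := by rw [le_div_iff₀ hη]; linarith
    calc (e:ℝ) + 1 ≤ (2 * J / η) * (1 + e * η / J / 2) := by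
          have : (2 * J / η) * (1 + e * η / J / 2) = 2 * J / η + e := by field_simp
          rw [this]; linarith
      _ ≤ _ := by gcongr
  calc ((e:ℝ) + 1)^J ≤ ((2 * J / η) * (2:ℝ)^(e * η / J))^J := by gcongr
    _ = (2 * J / η)^J * ((2:ℝ)^e)^η := by
        rw [mul_pow, ← Real.rpow_natCast ((2:ℝ)^(e * η / J)), ← Real.rpow_mul (by norm_num), ← Real.rpow_natCast 2 e, ← Real.rpow_mul (by norm_num)]
        congr 2; field_simp
    _ ≤ _ := by
        gcongr
        exact_mod_cast hp

theorem tau_local_big (J : ℕ) (η : ℝ) (hη : 0 < η) (p e : ℕ) (hp : (2:ℝ)^((J:ℝ)/η) ≤ p) :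
    ((e:ℝ) + 1)^J ≤ ((p:ℝ)^e)^η := by
  have h1 : (e:ℝ) + 1 ≤ 2^e := by
    have := Nat.lt_two_pow_self (n := e)
    exact_mod_cast this
  calc ((e:ℝ) + 1)^J ≤ ((2:ℝ)^e)^J := by gcongr
    _ = (((2:ℝ)^((J:ℝ)/η))^e)^η := by
        rw [← Real.rpow_natCast ((2:ℝ)^e), ← Real.rpow_natCast 2 e, ← Real.rpow_mul (by norm_num), ← Real.rpow_natCast _ e, ← Real.rpow_mul (by positivity), ← Real.rpow_mul (by positivity)]
        congr 1; field_simp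
    _ ≤ _ := by gcongr

theorem tau_bound (J : ℕ) (hJ : 1 ≤ J) (η : ℝ) (hη : 0 < η) (hη1 : η ≤ 1) (Z : ℕ) (hZ : (2:ℝ)^((J:ℝ)/η) ≤ Z) (q : ℕ) (hq : 1 ≤ q) :
    (#q.divisors : ℝ)^J ≤ (2 * J / η)^(J * Z) * (q:ℝ)^η := by
  have hJ1 : (1:ℝ) ≤ J := by exact_mod_cast hJ
  have hD : 1 ≤ 2 * J / η := by rw [le_div_iff₀ hη]; linarith
  rw [Nat.card_divisors (by omega)]
  push_cast
  rw [← prod_pow]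
  have hq' : (q:ℝ)^η = ∏ p ∈ q.primeFactors, ((p:ℝ)^(q.factorization p))^η := by
    conv_lhs => rw [← Nat.prod_factorization_pow_eq_self (n := q) (by omega)]
    rw [Finsupp.prod, Nat.support_factorization]
    push_cast
    rw [Real.finsetProd_rpow _ _ (fun p _ => by positivity)]
  have h1 : ∀ p ∈ q.primeFactors, ((q.factorization p : ℝ) + 1)^J ≤ (if p < Z then (2 * J / η)^J else 1) * ((p:ℝ)^(q.factorization p))^η := by
    intro p hp
    split_ifs with hpZ
    · exact tau_local_small J hJ η hη hη1 p _ (Nat.prime_of_mem_primeFactors hp).two_le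
    · rw [one_mul]
      refine tau_local_big J η hη p _ (hZ.trans ?_)
      exact_mod_cast not_lt.1 hpZ
  refine (prod_le_prod (fun p _ => by positivity) h1).trans ?_
  rw [prod_mul_distrib, ← hq']
  refine mul_le_mul_of_nonneg_right ?_ (by positivity)
  rw [← prod_filter, prod_const, ← pow_mul]
  refine pow_le_pow_right₀ hD ?_
  gcongr
  have : q.primeFactors.filter (fun p => p < Z) ⊆ range Z := fun p hp => mem_range.2 (mem_filter.1 hp).2
  simpa using card_le_card this

theorem two_pow_omega_le (q : ℕ) (hq : 1 ≤ q) : 2 ^ #q.primeFactors ≤ #q.divisors := by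
  rw [Nat.card_divisors (by omega), ← prod_const]
  refine prod_le_prod' fun p hp => ?_
  have := (Nat.prime_of_mem_primeFactors hp).factorization_pos_of_dvd (by omega) (Nat.dvd_of_mem_primeFactors hp)
  omega

theorem partE_Y (m : ℕ) (hm : 1 ≤ m) (η : ℝ) (hη : 0 < η) (hη1 : η ≤ 1) (Z : ℕ) (hZ : (2:ℝ)^(((8 * m : ℕ):ℝ)/η) ≤ Z) (q : ℕ) (hq : 1 ≤ q) :
    (8:ℝ)^(m * #q.primeFactors) * (#q.divisors : ℝ)^2 * (#q.divisors : ℝ)^m * (#q.divisors : ℝ)^2 * (q:ℝ)^(-η) ≤ (2 * (8 * m : ℕ) / η)^(8 * m * Z) := by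
  have h := tau_bound (8 * m) (by omega) η hη hη1 Z hZ q hq
  have hq0 : (0:ℝ) < q := by exact_mod_cast hq
  have hτ : (1:ℝ) ≤ #q.divisors := by
    exact_mod_cast Nat.one_le_iff_ne_zero.2 (card_pos.2 (Nat.nonempty_divisors.2 (by omega))).ne'
  have h8 : (8:ℝ)^(m * #q.primeFactors) ≤ (#q.divisors : ℝ)^(3 * m) := by
    have h2 : ((2:ℝ) ^ #q.primeFactors) ≤ #q.divisors := by exact_mod_cast two_pow_omega_le q hq
    calc (8:ℝ)^(m * #q.primeFactors) = ((2:ℝ) ^ #q.primeFactors)^(3 * m) := by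
          rw [← pow_mul, show (8:ℝ) = 2^3 by norm_num, ← pow_mul]; congr 1; ring
      _ ≤ _ := by gcongr
  rw [Real.rpow_neg hq0.le, ← div_eq_mul_inv, div_le_iff₀ (by positivity)]
  refine le_trans ?_ h
  calc _ ≤ (#q.divisors : ℝ)^(3 * m) * (#q.divisors : ℝ)^2 * (#q.divisors : ℝ)^m * (#q.divisors : ℝ)^2 := by gcongr
    _ = (#q.divisors : ℝ)^(3 * m + 2 + m + 2) := by ring
    _ ≤ _ := pow_le_pow_right₀ hτ (by omega)

open Finset

noncomputable def fA (A : Finset ℤ) (σ : ℝ) (x : ℤ) : ℝ := (if x ∈ A then 1 else 0) - σ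

theorem lam_one (A : Finset ℤ) (N : ℕ) (σ : ℝ) (hσ0 : 0 ≤ σ) (hσ : (#A : ℝ) = σ * N) (hAN : A ⊆ Icc 1 (N:ℤ)) (h : ℤ) (B : ℕ)
    (hB : |h| ≤ B) (hfree : ∀ a ∈ A, ∀ b ∈ A, a - b = h → a = b)
    (he1 : (#{a ∈ A | a ≤ (B:ℤ)} : ℝ) ≤ 2 * σ * B) (he2 : (#{a ∈ A | (N:ℤ) - B < a} : ℝ) ≤ 2 * σ * B) :
    ∑ x ∈ Icc 1 (N:ℤ), ∑ y ∈ Icc 1 (N:ℤ), (if y - x = h then fA A σ x * fA A σ y else 0) ≤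
      (if h = 0 then σ * N else 0) - σ^2 * N + 8 * σ^2 * B := by
  set I := Icc 1 (N:ℤ) with hI
  have hcI : (#I : ℝ) = N := by rw [hI, Int.card_Icc]; simp
  have hB' := abs_le.1 hB
  -- four pieces
  have e : ∑ x ∈ I, ∑ y ∈ I, (if y - x = h then fA A σ x * fA A σ y else 0) =
      (∑ x ∈ I, ∑ y ∈ I, if y - x = h then (if x ∈ A then (1:ℝ) else 0) * (if y ∈ A then 1 else 0) else 0)
      - σ * (∑ x ∈ I, ∑ y ∈ I, if y - x = h then (if x ∈ A then (1:ℝ) else 0) else 0)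
      - σ * (∑ x ∈ I, ∑ y ∈ I, if y - x = h then (if y ∈ A then (1:ℝ) else 0) else 0)
      + σ^2 * (∑ x ∈ I, ∑ y ∈ I, if y - x = h then (1:ℝ) else 0) := by
    simp only [mul_sum, ← sum_sub_distrib, ← sum_add_distrib]
    refine sum_congr rfl fun x _ => sum_congr rfl fun y _ => ?_
    unfold fA
    split_ifs <;> ring
  have p1 : (∑ x ∈ I, ∑ y ∈ I, if y - x = h then (if x ∈ A then (1:ℝ) else 0) * (if y ∈ A then 1 else 0) else 0) ≤ if h = 0 then σ * N else 0 := by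
    by_cases hh : h = 0
    · rw [if_pos hh, ← hσ]
      have : ∀ x ∈ I, (∑ y ∈ I, if y - x = h then (if x ∈ A then (1:ℝ) else 0) * (if y ∈ A then 1 else 0) else 0) ≤ if x ∈ A then 1 else 0 := by
        intro x hx
        have h2 : ∀ y ∈ I, (if y - x = h then (if x ∈ A then (1:ℝ) else 0) * (if y ∈ A then 1 else 0) else 0) = if y = x then (if x ∈ A then (1:ℝ) else 0) else 0 := by
          intro y _
          by_cases hyx : y = x
          · subst hyx; simp [hh]
          · rw [if_neg (fun h3 => hyx (by rw [hh] at h3; linarith)), if_neg hyx]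
        rw [sum_congr rfl h2, sum_ite_eq' I x, if_pos hx]
      refine (sum_le_sum this).trans ?_
      rw [← sum_filter, sum_const, nsmul_eq_mul, mul_one]
      exact_mod_cast card_le_card fun x hx => (mem_filter.1 hx).2
    · rw [if_neg hh]
      refine le_of_eq (sum_eq_zero fun x _ => sum_eq_zero fun y _ => ?_)
      split_ifs with h1 h2 h3 <;> try simp
      have := hfree y h3 x h2 h1
      apply hh; rw [← h1, this]; ring
  have p4 : (∑ x ∈ I, ∑ y ∈ I, if y - x = h then (1:ℝ) else 0) ≤ N := by
    rw [← hcI, card_eq_sum_ones]; push_cast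
    refine sum_le_sum fun x _ => ?_
    have : ∀ y ∈ I, (if y - x = h then (1:ℝ) else 0) = if y = x + h then 1 else 0 := by
      intro y _; congr 1; apply propext; constructor <;> intro <;> linarith
    rw [sum_congr rfl this, sum_ite_eq']
    split_ifs <;> norm_num
  have cover : ∀ T : Finset ℤ, (∀ a ∈ A, a ∈ T ∨ a ≤ (B:ℤ) ∨ (N:ℤ) - B < a) → σ * N - 4 * σ * B ≤ #(A ∩ T) := by
    intro T hT
    have h1 : A ⊆ (A ∩ T) ∪ ((A.filter fun a => a ≤ (B:ℤ)) ∪ (A.filter fun a => (N:ℤ) - B < a)) := by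
      intro a ha
      simp only [mem_union, mem_inter, mem_filter]
      rcases hT a ha with h | h | h <;> tauto
    have h2 := (card_le_card h1).trans ((card_union_le _ _).trans (Nat.add_le_add_left (card_union_le _ _) _))
    have h3 : (#A : ℝ) ≤ #(A ∩ T) + (#{a ∈ A | a ≤ (B:ℤ)} + #{a ∈ A | (N:ℤ) - B < a}) := by exact_mod_cast h2
    rw [hσ] at h3; linarith
  have p2 : σ * N - 4 * σ * B ≤ (∑ x ∈ I, ∑ y ∈ I, if y - x = h then (if x ∈ A then (1:ℝ) else 0) else 0) := by
    have e2 : (∑ x ∈ I, ∑ y ∈ I, if y - x = h then (if x ∈ A then (1:ℝ) else 0) else 0) = #(A ∩ I.filter (fun x => x + h ∈ I)) := by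
      rw [← filter_mem_eq_inter, card_eq_sum_ones]; push_cast
      have : ∀ x ∈ I, (∑ y ∈ I, if y - x = h then (if x ∈ A then (1:ℝ) else 0) else 0) = if x ∈ A ∧ x + h ∈ I then 1 else 0 := by
        intro x _
        have h5 : ∀ y ∈ I, (if y - x = h then (if x ∈ A then (1:ℝ) else 0) else 0) = if y = x + h then (if x ∈ A then (1:ℝ) else 0) else 0 := by
          intro y _; congr 1; apply propext; constructor <;> intro <;> linarith
        rw [sum_congr rfl h5, sum_ite_eq']
        by_cases h6 : x + h ∈ I <;> by_cases h7 : x ∈ A <;> simp [h6, h7]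
      rw [sum_congr rfl this, ← sum_filter]
      refine sum_congr ?_ fun _ _ => rfl
      ext x; simp only [mem_filter]
      constructor
      · rintro ⟨h1, h2, h3⟩; exact ⟨h2, h1, h3⟩
      · rintro ⟨h1, h2, h3⟩; exact ⟨h2, h1, h3⟩
    rw [e2]
    refine cover _ fun a ha => ?_
    have haI := hAN ha
    by_contra hcon
    push Not at hcon
    obtain ⟨h1, h2, h3⟩ := hcon
    apply h1
    rw [mem_filter]
    refine ⟨haI, ?_⟩
    rw [hI, mem_Icc] at haI ⊢
    constructor <;> linarith [hB'.1, hB'.2]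
  have p3 : σ * N - 4 * σ * B ≤ (∑ x ∈ I, ∑ y ∈ I, if y - x = h then (if y ∈ A then (1:ℝ) else 0) else 0) := by
    have e2 : (∑ x ∈ I, ∑ y ∈ I, if y - x = h then (if y ∈ A then (1:ℝ) else 0) else 0) = #(A ∩ I.filter (fun x => x - h ∈ I)) := by
      rw [← filter_mem_eq_inter, card_eq_sum_ones, sum_comm]; push_cast
      have : ∀ y ∈ I, (∑ x ∈ I, if y - x = h then (if y ∈ A then (1:ℝ) else 0) else 0) = if y ∈ A ∧ y - h ∈ I then 1 else 0 := by
        intro y _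
        have h5 : ∀ x ∈ I, (if y - x = h then (if y ∈ A then (1:ℝ) else 0) else 0) = if x = y - h then (if y ∈ A then (1:ℝ) else 0) else 0 := by
          intro x _; congr 1; apply propext; constructor <;> intro <;> linarith
        rw [sum_congr rfl h5, sum_ite_eq']
        by_cases h6 : y - h ∈ I <;> by_cases h7 : y ∈ A <;> simp [h6, h7]
      rw [sum_congr rfl this, ← sum_filter]
      refine sum_congr ?_ fun _ _ => rfl
      ext x; simp only [mem_filter]
      constructor
      · rintro ⟨h1, h2, h3⟩; exact ⟨h2, h1, h3⟩
      · rintro ⟨h1, h2, h3⟩; exact ⟨h2, h1, h3⟩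
    rw [e2]
    refine cover _ fun a ha => ?_
    have haI := hAN ha
    by_contra hcon
    push Not at hcon
    obtain ⟨h1, h2, h3⟩ := hcon
    apply h1
    rw [mem_filter]
    refine ⟨haI, ?_⟩
    rw [hI, mem_Icc] at haI ⊢
    constructor <;> linarith [hB'.1, hB'.2]
  rw [e]
  have q2 := mul_le_mul_of_nonneg_left p2 hσ0
  have q3 := mul_le_mul_of_nonneg_left p3 hσ0
  have q4 := mul_le_mul_of_nonneg_left p4 (sq_nonneg σ)
  nlinarith

theorem lam_neg (A : Finset ℤ) (N M k' : ℕ) (σ : ℝ) (hσ0 : 0 ≤ σ) (hσ : (#A : ℝ) = σ * N) (hAN : A ⊆ Icc 1 (N:ℤ))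
    (Hn : ℕ → ℤ) (B : ℕ)
    (hB : ∀ n < M, |Hn n| ≤ B) (hfree : ∀ a ∈ A, ∀ b ∈ A, ∀ n < M, a - b = Hn n → a = b)
    (hz : #{n ∈ range M | Hn n = 0} ≤ k') (hk : (4:ℝ) * k' ≤ σ * M) (hBN : 32 * B ≤ N)
    (he1 : (#{a ∈ A | a ≤ (B:ℤ)} : ℝ) ≤ 2 * σ * B) (he2 : (#{a ∈ A | (N:ℤ) - B < a} : ℝ) ≤ 2 * σ * B) :
    ∑ n ∈ range M, ∑ x ∈ Icc 1 (N:ℤ), ∑ y ∈ Icc 1 (N:ℤ), (if y - x = Hn n then fA A σ x * fA A σ y else 0) ≤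
      - (σ^2 * M * N / 2) := by
  have h1 : ∀ n ∈ range M, ∑ x ∈ Icc 1 (N:ℤ), ∑ y ∈ Icc 1 (N:ℤ), (if y - x = Hn n then fA A σ x * fA A σ y else 0) ≤
      (if Hn n = 0 then σ * N else 0) - 3 / 4 * (σ^2 * N) := by
    intro n hn
    have hn' := mem_range.1 hn
    have h2 := lam_one A N σ hσ0 hσ hAN (Hn n) B (hB n hn') (fun a ha b hb => hfree a ha b hb n hn') he1 he2
    have h3 : (32:ℝ) * B ≤ N := by exact_mod_cast hBN
    have h4 := mul_le_mul_of_nonneg_left h3 (sq_nonneg σ)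
    linarith
  refine (sum_le_sum h1).trans ?_
  rw [sum_sub_distrib, ← sum_filter, sum_const, sum_const, card_range, nsmul_eq_mul, nsmul_eq_mul]
  have h2 : (#{n ∈ range M | Hn n = 0} : ℝ) ≤ k' := by exact_mod_cast hz
  have h3 : (0:ℝ) ≤ σ * N := by positivity
  have h4 := mul_le_mul_of_nonneg_right h2 h3
  have h5 := mul_le_mul_of_nonneg_right hk h3
  nlinarith

open Finset

theorem orth (N1 : ℕ) (hN : 0 < N1) (u : ℤ) : ∑ j ∈ range N1, ee ((j:ℝ) / N1 * u) = if (N1:ℤ) ∣ u then (N1:ℂ) else 0 := by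
  classical
  have h0 : (N1:ℝ) ≠ 0 := by exact_mod_cast hN.ne'
  have h1 : ∀ j ∈ range N1, ee ((j:ℝ) / N1 * u) = ee (j * ((u:ℝ) / N1)) := fun j _ => by congr 1; ring
  rw [sum_congr rfl h1, sum_ee_eq]
  · have : ((u:ℝ) / N1 ∈ ZZ) ↔ (N1:ℤ) ∣ u := by
      rw [mem_ZZ]
      constructor
      · rintro ⟨t, ht⟩
        rw [div_eq_iff h0] at ht
        refine ⟨t, ?_⟩
        have : (u:ℝ) = N1 * t := by rw [ht]; ring
        exact_mod_cast this
      · rintro ⟨t, rfl⟩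
        exact ⟨t, by push_cast; field_simp⟩
    simp only [this]
  · rw [mul_div_cancel₀ _ h0]; exact int_mem_ZZ u

theorem normSq_expand (S : Finset ℤ) (g : ℤ → ℂ) (θ : ℝ) :
    ((‖∑ s ∈ S, g s * ee (θ * s)‖^2 : ℝ) : ℂ) = ∑ x ∈ S, ∑ y ∈ S, g x * (starRingEnd ℂ) (g y) * ee (θ * ((x - y : ℤ):ℝ)) := by
  rw [Complex.ofReal_pow, ← Complex.mul_conj', map_sum, sum_mul_sum]
  refine sum_congr rfl fun x _ => sum_congr rfl fun y _ => ?_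
  rw [map_mul]
  have : ee (θ * ((x - y : ℤ):ℝ)) = ee (θ * x) * (starRingEnd ℂ) (ee (θ * y)) := by
    rw [← ee_sub]; congr 1; push_cast; ring
  rw [this]; ring

theorem corr (N1 : ℕ) (hN : 0 < N1) (S : Finset ℤ) (g : ℤ → ℂ) (h : ℤ) (hS : ∀ x ∈ S, ∀ y ∈ S, |x - y + h| < N1) :
    ∑ j ∈ range N1, ((‖∑ s ∈ S, g s * ee ((j:ℝ) / N1 * s)‖^2 : ℝ) : ℂ) * ee ((j:ℝ) / N1 * h) =
      N1 * ∑ x ∈ S, ∑ y ∈ S, (if y - x = h then g x * (starRingEnd ℂ) (g y) else 0) := by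
  simp only [normSq_expand, sum_mul]
  rw [sum_comm, mul_sum]
  refine sum_congr rfl fun x hx => ?_
  rw [sum_comm, mul_sum]
  refine sum_congr rfl fun y hy => ?_
  have h1 : ∀ j ∈ range N1, g x * (starRingEnd ℂ) (g y) * ee ((j:ℝ) / N1 * ((x - y : ℤ):ℝ)) * ee ((j:ℝ) / N1 * h) =
      g x * (starRingEnd ℂ) (g y) * ee ((j:ℝ) / N1 * ((x - y + h : ℤ):ℝ)) := by
    intro j _
    rw [mul_assoc, ← ee_add]; congr 2; push_cast; ring
  rw [sum_congr rfl h1, ← mul_sum, orth N1 hN]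
  have h2 : (N1:ℤ) ∣ x - y + h ↔ y - x = h := by
    constructor
    · intro hd
      have := Int.eq_zero_of_abs_lt_dvd hd (hS x hx y hy)
      linarith
    · intro hd
      rw [← hd]; simp
  simp only [h2]
  split_ifs <;> ring

theorem parsevalZ (N1 : ℕ) (hN : 0 < N1) (S : Finset ℤ) (g : ℤ → ℂ) (hS : ∀ x ∈ S, ∀ y ∈ S, |x - y| < N1) :
    ∑ j ∈ range N1, ‖∑ s ∈ S, g s * ee ((j:ℝ) / N1 * s)‖^2 = N1 * ∑ s ∈ S, ‖g s‖^2 := by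
  have h := corr N1 hN S g 0 (by simpa using hS)
  have e1 : ∀ x ∈ S, ∑ y ∈ S, (if y - x = 0 then g x * (starRingEnd ℂ) (g y) else 0) = ((‖g x‖^2 : ℝ) : ℂ) := by
    intro x hx
    have : ∀ y ∈ S, (if y - x = 0 then g x * (starRingEnd ℂ) (g y) else 0) = if y = x then ((‖g x‖^2 : ℝ) : ℂ) else 0 := by
      intro y _
      by_cases hyx : y = x
      · subst hyx; rw [if_pos (sub_self _), if_pos rfl, Complex.mul_conj']; push_cast; rfl
      · rw [if_neg (sub_ne_zero.2 hyx), if_neg hyx]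
    rw [sum_congr rfl this, sum_ite_eq', if_pos hx]
  rw [sum_congr rfl e1] at h
  simp only [Int.cast_zero, mul_zero, ee_zero, mul_one] at h
  exact_mod_cast h

noncomputable def fh (A : Finset ℤ) (σ : ℝ) (N : ℕ) (θ : ℝ) : ℂ := ∑ x ∈ Icc 1 (N:ℤ), (fA A σ x : ℂ) * ee (θ * x)

theorem abs_icc (N : ℕ) (x y : ℤ) (hx : x ∈ Icc 1 (N:ℤ)) (hy : y ∈ Icc 1 (N:ℤ)) : |x - y| < N := by
  rw [mem_Icc] at hx hy
  rw [abs_lt]; constructor <;> linarith [hx.1, hx.2, hy.1, hy.2]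

theorem mass (A : Finset ℤ) (N M : ℕ) (hN : 0 < N) (σ : ℝ) (hσ0 : 0 ≤ σ) (hσ : (#A : ℝ) = σ * N) (hAN : A ⊆ Icc 1 (N:ℤ))
    (Hn : ℕ → ℤ) (hB : ∀ n < M, |Hn n| ≤ N)
    (hneg : ∑ n ∈ range M, ∑ x ∈ Icc 1 (N:ℤ), ∑ y ∈ Icc 1 (N:ℤ), (if y - x = Hn n then fA A σ x * fA A σ y else 0) ≤
      - (σ^2 * M * N / 2)) :
    (2 * N : ℕ) * (σ^2 * M * N / 4) ≤ ∑ j ∈ (range (2 * N)).filter (fun j : ℕ => σ * M < 4 * ‖∑ n ∈ range M, ee ((j:ℝ) / (2 * N : ℕ) * Hn n)‖),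
      ‖fh A σ N ((j:ℝ) / (2 * N : ℕ))‖^2 * ‖∑ n ∈ range M, ee ((j:ℝ) / (2 * N : ℕ) * Hn n)‖ := by
  have hN1 : 0 < 2 * N := by omega
  have hN1' : (0:ℝ) < (2 * N : ℕ) := by exact_mod_cast hN1
  set N1 := 2 * N with hN1d
  have e1 : ∑ j ∈ range N1, ((‖fh A σ N ((j:ℝ) / N1)‖^2 : ℝ) : ℂ) * ∑ n ∈ range M, ee ((j:ℝ) / N1 * Hn n) =
      ((N1 * ∑ n ∈ range M, ∑ x ∈ Icc 1 (N:ℤ), ∑ y ∈ Icc 1 (N:ℤ), (if y - x = Hn n then fA A σ x * fA A σ y else 0) : ℝ) : ℂ) := by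
    simp only [mul_sum]
    rw [sum_comm]
    push_cast
    refine sum_congr rfl fun n hn => ?_
    have := corr N1 hN1 (Icc 1 (N:ℤ)) (fun x => (fA A σ x : ℂ)) (Hn n) (by
      intro x hx y hy
      have h1 := abs_icc N x y hx hy
      have h2 := hB n (mem_range.1 hn)
      have h3 := abs_add_le (x - y) (Hn n)
      rw [hN1d]; push_cast; linarith)
    unfold fh
    push_cast at this
    rw [this, mul_sum]
    refine sum_congr rfl fun x _ => ?_
    rw [mul_sum]
    refine sum_congr rfl fun y _ => ?_
    split_ifs
    · rw [Complex.conj_ofReal, Complex.ofReal_mul]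
    · simp
  have h1 : N1 * (σ^2 * M * N / 2) ≤ ∑ j ∈ range N1, ‖fh A σ N ((j:ℝ) / N1)‖^2 * ‖∑ n ∈ range M, ee ((j:ℝ) / N1 * Hn n)‖ := by
    have h2 : ‖∑ j ∈ range N1, ((‖fh A σ N ((j:ℝ) / N1)‖^2 : ℝ) : ℂ) * ∑ n ∈ range M, ee ((j:ℝ) / N1 * Hn n)‖ ≤
        ∑ j ∈ range N1, ‖fh A σ N ((j:ℝ) / N1)‖^2 * ‖∑ n ∈ range M, ee ((j:ℝ) / N1 * Hn n)‖ := by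
      refine (norm_sum_le _ _).trans (le_of_eq (sum_congr rfl fun j _ => ?_))
      rw [norm_mul, Complex.norm_real, Real.norm_of_nonneg (by positivity)]
    refine le_trans ?_ h2
    rw [e1, Complex.norm_real, Real.norm_eq_abs]
    refine le_trans ?_ (neg_le_abs _)
    rw [← mul_neg]
    refine mul_le_mul_of_nonneg_left (by linarith) hN1'.le
  have hpar : ∑ j ∈ range N1, ‖fh A σ N ((j:ℝ) / N1)‖^2 ≤ N1 * (σ * N) := by
    have := parsevalZ N1 hN1 (Icc 1 (N:ℤ)) (fun x => (fA A σ x : ℂ)) (fun x hx y hy => by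
      have := abs_icc N x y hx hy; rw [hN1d]; push_cast; linarith)
    unfold fh
    rw [this]
    refine mul_le_mul_of_nonneg_left ?_ hN1'.le
    have h3 : ∀ x ∈ Icc 1 (N:ℤ), ‖(fA A σ x : ℂ)‖^2 = (1 - 2 * σ) * (if x ∈ A then 1 else 0) + σ^2 := by
      intro x _
      rw [Complex.norm_real, Real.norm_eq_abs, sq_abs, fA]
      split_ifs <;> ring
    rw [sum_congr rfl h3, sum_add_distrib, ← mul_sum, ← sum_filter, sum_const, sum_const, filter_mem_eq_inter, inter_eq_right.2 hAN,
      Int.card_Icc]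
    simp only [nsmul_eq_mul, mul_one, hσ]
    have : (((N:ℤ) + 1 - 1).toNat : ℝ) = N := by simp
    rw [this]
    have : 0 ≤ σ^2 * N := by positivity
    nlinarith
  rw [← sum_filter_add_sum_filter_not (range N1) (fun j : ℕ => σ * M < 4 * ‖∑ n ∈ range M, ee ((j:ℝ) / N1 * Hn n)‖)] at h1
  have hsmall : ∑ j ∈ (range N1).filter (fun j : ℕ => ¬ σ * M < 4 * ‖∑ n ∈ range M, ee ((j:ℝ) / N1 * Hn n)‖),
      ‖fh A σ N ((j:ℝ) / N1)‖^2 * ‖∑ n ∈ range M, ee ((j:ℝ) / N1 * Hn n)‖ ≤ N1 * (σ^2 * M * N / 4) := by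
    calc _ ≤ ∑ j ∈ (range N1).filter (fun j : ℕ => ¬ σ * M < 4 * ‖∑ n ∈ range M, ee ((j:ℝ) / N1 * Hn n)‖), ‖fh A σ N ((j:ℝ) / N1)‖^2 * (σ * M / 4) := by
          refine sum_le_sum fun j hj => ?_
          have := not_lt.1 (mem_filter.1 hj).2
          refine mul_le_mul_of_nonneg_left (by linarith) (by positivity)
      _ ≤ ∑ j ∈ range N1, ‖fh A σ N ((j:ℝ) / N1)‖^2 * (σ * M / 4) :=
          sum_le_sum_of_subset_of_nonneg (filter_subset _ _) fun _ _ _ => by positivity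
      _ ≤ N1 * (σ * N) * (σ * M / 4) := by rw [← sum_mul]; gcongr
      _ = _ := by ring
  linarith

open Finset

noncomputable def WW (A : Finset ℤ) (σ : ℝ) (N N' : ℕ) (α : ℝ) (s : ℤ) : ℂ :=
  ∑ x ∈ (Icc 1 (N:ℤ)).filter (fun x => s - N' < x ∧ x ≤ s), (fA A σ x : ℂ) * ee (α * x)

theorem WW_shift (A : Finset ℤ) (σ : ℝ) (N N' : ℕ) (α : ℝ) (n : ℤ) (s : ℤ) : WW A σ N N' (α + n) s = WW A σ N N' α s := by
  unfold WW
  refine sum_congr rfl fun x _ => ?_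
  congr 1
  refine ee_of_sub_mem ?_
  have : (α + n) * (x:ℝ) - α * x = ((n * x : ℤ) : ℝ) := by push_cast; ring
  rw [this]; exact int_mem_ZZ _

theorem ker_big (N' : ℕ) (β : ℝ) (hβ : |β| * N' ≤ 1/14) : (N':ℝ)/2 ≤ ‖∑ i ∈ range N', ee (β * i)‖ := by
  have h1 : ‖∑ i ∈ range N', (ee (β * i) - 1)‖ ≤ ∑ i ∈ range N', (1/2:ℝ) := by
    refine norm_sum_le_of_le _ fun i hi => ?_
    refine (norm_ee_sub_one_le _).trans ?_
    rw [abs_mul, Nat.abs_cast]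
    have : (i:ℝ) ≤ N' := by exact_mod_cast (mem_range.1 hi).le
    have : |β| * i ≤ |β| * N' := by gcongr
    linarith
  rw [sum_sub_distrib] at h1
  simp only [sum_const, card_range, nsmul_eq_mul, mul_one] at h1
  have h2 := norm_sub_norm_le (N':ℂ) (∑ i ∈ range N', ee (β * i))
  rw [norm_sub_rev, Complex.norm_natCast] at h2
  linarith

theorem win_id (A : Finset ℤ) (σ : ℝ) (N N' : ℕ) (θ α : ℝ) :
    fh A σ N θ * ∑ i ∈ range N', ee ((θ - α) * i) =
      ∑ s ∈ Icc 1 ((N:ℤ) + N'), (ee (-(α * s)) * WW A σ N N' α s) * ee (θ * s) := by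
  unfold fh WW
  rw [sum_mul]
  simp only [mul_sum, sum_mul, sum_filter]
  rw [sum_comm (s := Icc 1 ((N:ℤ) + N'))]
  refine sum_congr rfl fun x hx => ?_
  rw [mem_Icc] at hx
  simp only [mul_ite, ite_mul, mul_zero, zero_mul]
  rw [← sum_filter]
  refine sum_bij (fun i _ => x + (i:ℤ)) ?_ ?_ ?_ ?_
  · intro i hi
    have := mem_range.1 hi
    rw [mem_filter, mem_Icc]; omega
  · intro i _ j _ hij
    have : x + (i:ℤ) = x + j := hij
    omega
  · intro s hs
    rw [mem_filter, mem_Icc] at hs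
    exact ⟨(s - x).toNat, by rw [mem_range]; omega, by omega⟩
  · intro i _
    have : ee (θ * x) * ee ((θ - α) * i) = ee (-(α * ((x + (i:ℤ) : ℤ):ℝ))) * ee (α * x) * ee (θ * ((x + (i:ℤ) : ℤ):ℝ)) := by
      rw [← ee_add, ← ee_add, ← ee_add]; congr 1; push_cast; ring
    rw [mul_assoc, this]; ring

theorem win_one (A : Finset ℤ) (σ : ℝ) (N N' : ℕ) (θ α : ℝ) (n : ℤ) (hβ : |θ - α - n| * N' ≤ 1/14) :
    (N'/2)^2 * ‖fh A σ N θ‖^2 ≤ ‖∑ s ∈ Icc 1 ((N:ℤ) + N'), (ee (-(α * s)) * WW A σ N N' α s) * ee (θ * s)‖^2 := by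
  have h1 := win_id A σ N N' θ (α + n)
  have h2 : ∑ s ∈ Icc 1 ((N:ℤ) + N'), (ee (-((α + n) * s)) * WW A σ N N' (α + n) s) * ee (θ * s) =
      ∑ s ∈ Icc 1 ((N:ℤ) + N'), (ee (-(α * s)) * WW A σ N N' α s) * ee (θ * s) := by
    refine sum_congr rfl fun s _ => ?_
    rw [WW_shift]
    congr 2
    refine ee_of_sub_mem ?_
    have : -((α + n) * (s:ℝ)) - -(α * s) = ((-(n * s) : ℤ) : ℝ) := by push_cast; ring
    rw [this]; exact int_mem_ZZ _
  rw [h2] at h1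
  rw [← h1, norm_mul, mul_pow, mul_comm]
  have h3 := ker_big N' (θ - (α + n)) (by rwa [← sub_sub])
  gcongr

theorem winsum (A : Finset ℤ) (σ δ : ℝ) (N N' M Q : ℕ) (hN : 0 < N) (hN' : N' ≤ N) (hM : 0 < M) (Sj : ℕ → ℝ) (hSj : ∀ j, 0 ≤ Sj j)
    (hmass : (2 * N : ℕ) * (σ^2 * M * N / 4) ≤ ∑ j ∈ (range (2 * N)).filter (fun j : ℕ => σ * M < 4 * Sj j),
      ‖fh A σ N ((j:ℝ) / (2 * N : ℕ))‖^2 * Sj j)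
    (hj : ∀ j < 2 * N, σ * M < 4 * Sj j → ∃ q : ℕ, 1 ≤ q ∧ q ≤ Q ∧ ∃ a ∈ cop q, ∃ n : ℤ,
      |(j:ℝ) / (2 * N : ℕ) - (a:ℝ)/q - n| * N' ≤ 1/14 ∧ Sj j ≤ 2 * M * (q:ℝ)^(-δ)) :
    σ^2 * N * N'^2 / 32 ≤ ∑ q ∈ Icc 1 Q, (q:ℝ)^(-δ) * ∑ a ∈ cop q, ∑ s ∈ Icc 1 ((N:ℤ) + N'), ‖WW A σ N N' ((a:ℝ)/q) s‖^2 := by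
  set N1 := 2 * N with hN1d
  have hN1 : 0 < N1 := by omega
  set U : ℕ → ℕ → ℕ → ℝ := fun j q a => ‖∑ s ∈ Icc 1 ((N:ℤ) + N'), (ee (-((a:ℝ)/q * s)) * WW A σ N N' ((a:ℝ)/q) s) * ee ((j:ℝ) / N1 * s)‖^2 with hU
  have hU0 : ∀ j q a, 0 ≤ U j q a := fun j q a => by positivity
  have h1 : ∀ j ∈ (range N1).filter (fun j : ℕ => σ * M < 4 * Sj j), ((N':ℝ)/2)^2 * (‖fh A σ N ((j:ℝ) / N1)‖^2 * Sj j) ≤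
      ∑ q ∈ Icc 1 Q, ∑ a ∈ cop q, 2 * M * (q:ℝ)^(-δ) * U j q a := by
    intro j hjm
    rw [mem_filter, mem_range] at hjm
    obtain ⟨q, hq1, hqQ, a, ha, n, hb, hs⟩ := hj j hjm.1 hjm.2
    have h2 := win_one A σ N N' _ _ n hb
    have hq0 : (0:ℝ) < q := by exact_mod_cast hq1
    calc ((N':ℝ)/2)^2 * (‖fh A σ N ((j:ℝ) / N1)‖^2 * Sj j) = (((N':ℝ)/2)^2 * ‖fh A σ N ((j:ℝ) / N1)‖^2) * Sj j := by ring
      _ ≤ U j q a * (2 * M * (q:ℝ)^(-δ)) := by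
          refine mul_le_mul h2 hs (hSj j) (hU0 _ _ _)
      _ = 2 * M * (q:ℝ)^(-δ) * U j q a := by ring
      _ ≤ ∑ a ∈ cop q, 2 * M * (q:ℝ)^(-δ) * U j q a :=
          single_le_sum (f := fun a => 2 * M * (q:ℝ)^(-δ) * U j q a) (fun a _ => by have := hU0 j q a; positivity) ha
      _ ≤ _ := single_le_sum (f := fun q => ∑ a ∈ cop q, 2 * M * (q:ℝ)^(-δ) * U j q a)
          (fun q _ => sum_nonneg fun a _ => by have := hU0 j q a; positivity) (mem_Icc.2 ⟨hq1, hqQ⟩)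
  have h3 : ((N':ℝ)/2)^2 * (N1 * (σ^2 * M * N / 4)) ≤ ∑ j ∈ range N1, ∑ q ∈ Icc 1 Q, ∑ a ∈ cop q, 2 * M * (q:ℝ)^(-δ) * U j q a := by
    calc _ ≤ ((N':ℝ)/2)^2 * ∑ j ∈ (range N1).filter (fun j : ℕ => σ * M < 4 * Sj j), ‖fh A σ N ((j:ℝ) / N1)‖^2 * Sj j := by gcongr
      _ ≤ ∑ j ∈ (range N1).filter (fun j : ℕ => σ * M < 4 * Sj j), ∑ q ∈ Icc 1 Q, ∑ a ∈ cop q, 2 * M * (q:ℝ)^(-δ) * U j q a := by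
          rw [mul_sum]; exact sum_le_sum h1
      _ ≤ _ := sum_le_sum_of_subset_of_nonneg (filter_subset _ _) fun j _ _ =>
          sum_nonneg fun q _ => sum_nonneg fun a _ => by have := hU0 j q a; positivity
  have h4 : ∑ j ∈ range N1, ∑ q ∈ Icc 1 Q, ∑ a ∈ cop q, 2 * M * (q:ℝ)^(-δ) * U j q a =
      (2 * M * N1) * ∑ q ∈ Icc 1 Q, (q:ℝ)^(-δ) * ∑ a ∈ cop q, ∑ s ∈ Icc 1 ((N:ℤ) + N'), ‖WW A σ N N' ((a:ℝ)/q) s‖^2 := by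
    rw [sum_comm, mul_sum]
    refine sum_congr rfl fun q _ => ?_
    rw [sum_comm, mul_sum, mul_sum]
    refine sum_congr rfl fun a _ => ?_
    rw [← mul_sum]
    have := parsevalZ N1 hN1 (Icc 1 ((N:ℤ) + N')) (fun s => ee (-((a:ℝ)/q * s)) * WW A σ N N' ((a:ℝ)/q) s) (by
      intro x hx y hy
      rw [mem_Icc] at hx hy
      rw [hN1d, abs_lt]; push_cast; constructor <;> linarith [hx.1, hx.2, hy.1, hy.2, (by exact_mod_cast hN' : (N':ℤ) ≤ N)])
    rw [hU]
    simp only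
    rw [this]
    simp only [norm_mul, norm_ee, one_mul]
    ring
  rw [h4] at h3
  have hM' : (0:ℝ) < M := by exact_mod_cast hM
  have hN1' : (0:ℝ) < N1 := by exact_mod_cast hN1
  refine le_of_mul_le_mul_left ?_ (by positivity : (0:ℝ) < 2 * M * N1)
  refine le_trans (le_of_eq ?_) h3
  ring

open Finset

theorem cls_size (q : ℕ) (hq : 1 ≤ q) (a b c : ℤ) (hab : a ≤ b) (hc0 : 0 ≤ c) (hcq : c < q) :
    ((#{x ∈ Ioc a b | x % q = c} : ℕ) : ℤ) = (b - c) / q - (a - c) / q ∧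
    ∀ A : Finset ℤ, #{x ∈ A | (a < x ∧ x ≤ b) ∧ x % q = c} =
      #{x ∈ Icc 1 ((#{x ∈ Ioc a b | x % q = c} : ℕ) : ℤ) | (c + q * ((a - c) / q)) + q * x ∈ A} := by
  have hq0 : (0:ℤ) < q := by exact_mod_cast hq
  have key : ∀ t : ℤ, (a < c + q * t ∧ c + q * t ≤ b) ↔ ((a - c) / q < t ∧ t ≤ (b - c) / q) := by
    intro t
    rw [Int.ediv_lt_iff_lt_mul hq0, Int.le_ediv_iff_mul_le hq0]
    constructor <;> rintro ⟨h1, h2⟩ <;> constructor <;> linarith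
  have hmod : ∀ t : ℤ, (c + q * t) % q = c := by
    intro t
    rw [Int.add_mul_emod_self_left, Int.emod_eq_of_lt hc0 hcq]
  have hle : (a - c) / q ≤ (b - c) / q := Int.ediv_le_ediv hq0 (by linarith)
  have h1 : ((#{x ∈ Ioc a b | x % q = c} : ℕ) : ℤ) = (b - c) / q - (a - c) / q := by
    have : #{x ∈ Ioc a b | x % q = c} = #(Ioc ((a - c) / q) ((b - c) / q)) := by
      symm
      refine card_bij (fun t _ => c + q * t) ?_ ?_ ?_
      · intro t ht
        rw [mem_Ioc] at ht
        rw [mem_filter, mem_Ioc]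
        exact ⟨(key t).2 ht, hmod t⟩
      · intro t _ t' _ h
        have : (q:ℤ) * t = q * t' := by linarith
        exact mul_left_cancel₀ hq0.ne' this
      · intro x hx
        rw [mem_filter, mem_Ioc] at hx
        have e : c + q * (x / q) = x := by rw [← hx.2]; exact Int.emod_add_mul_ediv x q
        exact ⟨x / q, by rw [mem_Ioc, ← key, e]; exact hx.1, e⟩
    rw [this, Int.card_Ioc, Int.toNat_of_nonneg (by linarith)]
  refine ⟨h1, fun A => ?_⟩
  rw [h1]
  symm
  refine card_bij (fun t _ => (c + q * ((a - c) / q)) + q * t) ?_ ?_ ?_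
  · intro t ht
    rw [mem_filter, mem_Icc] at ht
    have e : (c + q * ((a - c) / q)) + q * t = c + q * ((a - c) / q + t) := by ring
    rw [mem_filter]
    refine ⟨ht.2, ?_⟩
    rw [e]
    refine ⟨(key _).2 ⟨by linarith [ht.1.1], by linarith [ht.1.2]⟩, hmod _⟩
  · intro t _ t' _ h
    have : (q:ℤ) * t = q * t' := by linarith
    exact mul_left_cancel₀ hq0.ne' this
  · intro x hx
    rw [mem_filter] at hx
    have e : c + q * (x / q) = x := by rw [← hx.2.2]; exact Int.emod_add_mul_ediv x q
    have e2 : (c + q * ((a - c) / q)) + q * (x / q - (a - c) / q) = x := by rw [← e] ; rw [e]; linarith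
    refine ⟨x / q - (a - c) / q, ?_, e2⟩
    have h3 := (key (x / q)).1 (by rw [e]; exact hx.2.1)
    rw [mem_filter, mem_Icc, e2]
    exact ⟨⟨by linarith [h3.1], by linarith [h3.2]⟩, hx.1⟩

theorem cls_bds (q : ℕ) (hq : 1 ≤ q) (s : ℤ) (N' L0 : ℕ) (c : ℤ) (hc0 : 0 ≤ c) (hcq : c < q) (hN' : q * (L0 + 1) ≤ N') :
    L0 ≤ #{x ∈ Ioc (s - N') s | x % q = c} ∧ (#{x ∈ Ioc (s - N') s | x % q = c} : ℝ) * q ≤ 2 * N' := by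
  have h := (cls_size q hq (s - N') s c (by linarith) hc0 hcq).1
  have hq0 : (0:ℤ) < q := by exact_mod_cast hq
  have h1 := Int.emod_add_mul_ediv (s - c) q
  have h2 := Int.emod_add_mul_ediv (s - N' - c) q
  have h3 := Int.emod_lt_of_pos (s - c) hq0
  have h4 := Int.emod_lt_of_pos (s - N' - c) hq0
  have h5 := Int.emod_nonneg (s - c) hq0.ne'
  have h6 := Int.emod_nonneg (s - N' - c) hq0.ne'
  set L := #{x ∈ Ioc (s - N') s | x % q = c}
  have hq' : (q:ℤ) * (L0 + 1) ≤ N' := by exact_mod_cast hN'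
  have h7 : (q:ℤ) * L = q * ((s - c) / q) - q * ((s - N' - c) / q) := by rw [h]; ring
  constructor
  · by_contra hlt
    push Not at hlt
    have : (q:ℤ) * (L + 1) ≤ q * L0 := mul_le_mul_of_nonneg_left (by exact_mod_cast hlt) hq0.le
    nlinarith
  · have : (L:ℤ) * q ≤ 2 * N' := by nlinarith [mul_nonneg hq0.le (Int.natCast_nonneg L0)]
    exact_mod_cast this

noncomputable def Dc (A : Finset ℤ) (σ : ℝ) (N N' q : ℕ) (s c : ℤ) : ℝ :=
  ∑ x ∈ ((Icc 1 (N:ℤ)).filter (fun x => s - N' < x ∧ x ≤ s)).filter (fun x => x % q = c), fA A σ x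

theorem mapsmod (q : ℕ) (hq : 1 ≤ q) (S : Finset ℤ) : ∀ x ∈ S, x % q ∈ Ico (0:ℤ) q := by
  intro x _
  have hq0 : (0:ℤ) < q := by exact_mod_cast hq
  rw [mem_Ico]; exact ⟨Int.emod_nonneg _ hq0.ne', Int.emod_lt_of_pos _ hq0⟩

theorem WW_Dc (A : Finset ℤ) (σ : ℝ) (N N' q : ℕ) (hq : 1 ≤ q) (a : ℕ) (s : ℤ) :
    WW A σ N N' ((a:ℝ)/q) s = ∑ c ∈ Ico (0:ℤ) q, (Dc A σ N N' q s c : ℂ) * ee ((a:ℝ)/q * c) := by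
  unfold WW
  rw [← sum_fiberwise_of_maps_to (mapsmod q hq _)]
  refine sum_congr rfl fun c _ => ?_
  unfold Dc
  push_cast
  rw [sum_mul]
  refine sum_congr rfl fun x hx => ?_
  have hx2 := (mem_filter.1 hx).2
  congr 1
  refine ee_of_sub_mem ?_
  have e : x - c = q * (x / q) := by rw [← hx2]; linarith [Int.emod_add_mul_ediv x q]
  have e' : (x:ℝ) - c = q * ((x / q : ℤ):ℝ) := by exact_mod_cast e
  have hq0 : (q:ℝ) ≠ 0 := by positivity
  have : (a:ℝ)/q * x - (a:ℝ)/q * c = ((a * (x / q) : ℤ) : ℝ) := by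
    rw [← mul_sub, e']; push_cast; field_simp
  rw [this]; exact int_mem_ZZ _

theorem Vq_le (A : Finset ℤ) (σ : ℝ) (N N' q : ℕ) (hq : 1 ≤ q) (s : ℤ) :
    ∑ a ∈ cop q, ‖WW A σ N N' ((a:ℝ)/q) s‖^2 ≤ q * ∑ c ∈ Ico (0:ℤ) q, (Dc A σ N N' q s c)^2 := by
  calc _ ≤ ∑ a ∈ range q, ‖WW A σ N N' ((a:ℝ)/q) s‖^2 :=
        sum_le_sum_of_subset_of_nonneg (filter_subset _ _) fun _ _ _ => by positivity
    _ = _ := by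
      rw [sum_congr rfl fun a _ => by rw [WW_Dc A σ N N' q hq a s]]
      rw [parsevalZ q (by omega)]
      · simp
      · intro x hx y hy
        rw [mem_Ico] at hx hy
        rw [abs_lt]; constructor <;> linarith [hx.1, hx.2, hy.1, hy.2]

theorem sumD_zero (A : Finset ℤ) (σ : ℝ) (N N' q : ℕ) (hq : 1 ≤ q) (hσ : (#A : ℝ) = σ * N) (hAN : A ⊆ Icc 1 (N:ℤ)) :
    ∑ s ∈ Icc 1 ((N:ℤ) + N'), ∑ c ∈ Ico (0:ℤ) q, Dc A σ N N' q s c = 0 := by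
  have h1 : ∀ s ∈ Icc 1 ((N:ℤ) + N'), ∑ c ∈ Ico (0:ℤ) q, Dc A σ N N' q s c = ∑ x ∈ Icc 1 (N:ℤ), if s - N' < x ∧ x ≤ s then fA A σ x else 0 := by
    intro s _
    unfold Dc
    rw [sum_fiberwise_of_maps_to (mapsmod q hq _), sum_filter]
  rw [sum_congr rfl h1, sum_comm]
  have h2 : ∀ x ∈ Icc 1 (N:ℤ), (∑ s ∈ Icc 1 ((N:ℤ) + N'), if s - N' < x ∧ x ≤ s then fA A σ x else 0) = N' * fA A σ x := by
    intro x hx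
    rw [mem_Icc] at hx
    rw [← sum_filter, sum_const, nsmul_eq_mul]
    congr 2
    have : (Icc 1 ((N:ℤ) + N')).filter (fun s => s - N' < x ∧ x ≤ s) = Ico x (x + N') := by
      ext s; rw [mem_filter, mem_Icc, mem_Ico]; constructor <;> intro h <;> omega
    rw [this, Int.card_Ico]; simp
  rw [sum_congr rfl h2, ← mul_sum]
  have h3 : ∑ x ∈ Icc 1 (N:ℤ), fA A σ x = 0 := by
    unfold fA
    rw [sum_sub_distrib, ← sum_filter, sum_const, sum_const, filter_mem_eq_inter, inter_eq_right.2 hAN, Int.card_Icc]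
    simp [hσ]; ring
  rw [h3, mul_zero]

theorem Dc_bds (A : Finset ℤ) (σ ν1 : ℝ) (N N' q L0 : ℕ) (hq : 1 ≤ q) (hσ0 : 0 ≤ σ) (hν0 : 0 ≤ ν1) (hν1 : ν1 ≤ 1) (hAN : A ⊆ Icc 1 (N:ℤ))
    (hNI : ∀ u : ℤ, ∀ L : ℕ, L0 ≤ L → (#{x ∈ Icc 1 (L:ℤ) | u + q * x ∈ A} : ℝ) ≤ (1 + ν1) * σ * L)
    (hN' : q * (L0 + 1) ≤ N') (s c : ℤ) (hc0 : 0 ≤ c) (hcq : c < q) :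
    |Dc A σ N N' q s c| ≤ 4 * σ * N' / q ∧
    max (Dc A σ N N' q s c) 0 ≤ (if (N':ℤ) ≤ s ∧ s ≤ N then ν1 else 2) * σ * #{x ∈ Ioc (s - N') s | x % q = c} := by
  obtain ⟨hL0, hL2⟩ := cls_bds q hq s N' L0 c hc0 hcq hN'
  have h2 := (cls_size q hq (s - N') s c (by linarith) hc0 hcq).2 A
  set L := #{x ∈ Ioc (s - N') s | x % q = c} with hLdef
  have h3 := hNI (c + q * ((s - N' - c) / q)) L hL0
  rw [← h2] at h3
  set P := ((Icc 1 (N:ℤ)).filter (fun x => s - N' < x ∧ x ≤ s)).filter (fun x => x % q = c) with hP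
  have hD : Dc A σ N N' q s c = (#{x ∈ A | (s - N' < x ∧ x ≤ s) ∧ x % q = c} : ℝ) - σ * #P := by
    unfold Dc fA
    rw [sum_sub_distrib, ← sum_filter, sum_const, sum_const]
    have : P.filter (fun x => x ∈ A) = {x ∈ A | (s - N' < x ∧ x ≤ s) ∧ x % q = c} := by
      ext x
      simp only [hP, mem_filter]
      constructor
      · rintro ⟨⟨⟨_, h1⟩, h2⟩, h3⟩; exact ⟨h3, h1, h2⟩
      · rintro ⟨h3, h1, h2⟩; exact ⟨⟨⟨hAN h3, h1⟩, h2⟩, h3⟩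
    rw [this, ← hP]; simp [mul_comm]
  have hPL : (#P : ℝ) ≤ L := by
    have : P ⊆ {x ∈ Ioc (s - N') s | x % q = c} := by
      intro x hx
      simp only [hP, mem_filter] at hx
      rw [mem_filter, mem_Ioc]; exact ⟨hx.1.2, hx.2⟩
    exact_mod_cast card_le_card this
  have hq0 : (0:ℝ) < q := by exact_mod_cast hq
  have hL2' : (L:ℝ) ≤ 2 * N' / q := by rw [le_div_iff₀ hq0]; exact hL2
  have hA0 : (0:ℝ) ≤ (#{x ∈ A | (s - N' < x ∧ x ≤ s) ∧ x % q = c} : ℝ) := by positivity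
  have hσP : 0 ≤ σ * #P := by positivity
  have hσPL : σ * #P ≤ σ * L := by gcongr
  have hσL : σ * L ≤ 2 * σ * N' / q := by
    calc σ * L ≤ σ * (2 * N' / q) := by gcongr
      _ = _ := by ring
  have hs0 : 0 ≤ σ * L := by positivity
  have e4 : 4 * σ * N' / q = 2 * (2 * σ * N' / q) := by ring
  have hv : (1 + ν1) * σ * L ≤ 2 * (σ * L) := by nlinarith
  constructor
  · rw [hD, abs_le, e4]; constructor <;> linarith
  · rw [hD]
    split_ifs with hs
    · have : P = {x ∈ Ioc (s - N') s | x % q = c} := by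
        ext x
        simp only [hP, mem_filter, mem_Icc, mem_Ioc]
        constructor
        · rintro ⟨⟨_, h1⟩, h2⟩; exact ⟨h1, h2⟩
        · rintro ⟨h1, h2⟩; refine ⟨⟨⟨?_, ?_⟩, h1⟩, h2⟩ <;> omega
      rw [this, ← hLdef]
      refine max_le ?_ ?_
      · nlinarith
      · have := mul_nonneg hν0 hs0; linarith
    · refine max_le ?_ ?_ <;> linarith

theorem Vq_small (A : Finset ℤ) (σ ν1 : ℝ) (N N' q L0 : ℕ) (hq : 1 ≤ q) (hσ0 : 0 ≤ σ) (hν0 : 0 ≤ ν1) (hν1 : ν1 ≤ 1)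
    (hσ : (#A : ℝ) = σ * N) (hAN : A ⊆ Icc 1 (N:ℤ))
    (hNI : ∀ u : ℤ, ∀ L : ℕ, L0 ≤ L → (#{x ∈ Icc 1 (L:ℤ) | u + q * x ∈ A} : ℝ) ≤ (1 + ν1) * σ * L)
    (hN' : q * (L0 + 1) ≤ N') :
    ∑ a ∈ cop q, ∑ s ∈ Icc 1 ((N:ℤ) + N'), ‖WW A σ N N' ((a:ℝ)/q) s‖^2 ≤ 8 * σ^2 * N'^2 * (ν1 * N + 4 * N') := by
  have hq0 : (0:ℝ) < q := by exact_mod_cast hq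
  set D := Dc A σ N N' q with hDd
  have hb := fun s c h1 h2 => Dc_bds A σ ν1 N N' q L0 hq hσ0 hν0 hν1 hAN hNI hN' s c h1 h2
  rw [sum_comm]
  have hz := sumD_zero A σ N N' q hq hσ hAN
  have hpos : ∑ s ∈ Icc 1 ((N:ℤ) + N'), ∑ c ∈ Ico (0:ℤ) q, max (D s c) 0 ≤ σ * N' * (ν1 * N + 4 * N') := by
    have h1 : ∀ s ∈ Icc 1 ((N:ℤ) + N'), ∑ c ∈ Ico (0:ℤ) q, max (D s c) 0 ≤ (if (N':ℤ) ≤ s ∧ s ≤ N then ν1 else 2) * σ * N' := by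
      intro s _
      calc _ ≤ ∑ c ∈ Ico (0:ℤ) q, (if (N':ℤ) ≤ s ∧ s ≤ N then ν1 else 2) * σ * (#{x ∈ Ioc (s - N') s | x % q = c} : ℝ) :=
            sum_le_sum fun c hc => (hb s c (mem_Ico.1 hc).1 (mem_Ico.1 hc).2).2
        _ = _ := by
          rw [← mul_sum]
          congr 1
          rw [← Nat.cast_sum, ← card_eq_sum_card_fiberwise (mapsmod q hq _), Int.card_Ioc]
          simp
    refine (sum_le_sum h1).trans ?_
    rw [← sum_mul, ← sum_mul]
    have h2 : ∑ s ∈ Icc 1 ((N:ℤ) + N'), (if (N':ℤ) ≤ s ∧ s ≤ N then ν1 else 2) ≤ ν1 * N + 4 * N' := by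
      rw [sum_ite, sum_const, sum_const, nsmul_eq_mul, nsmul_eq_mul]
      have c1 : (#{s ∈ Icc 1 ((N:ℤ) + N') | (N':ℤ) ≤ s ∧ s ≤ N} : ℝ) ≤ N := by
        have : #{s ∈ Icc 1 ((N:ℤ) + N') | (N':ℤ) ≤ s ∧ s ≤ N} ≤ #(Icc 1 (N:ℤ)) := card_le_card (by
          intro s; rw [mem_filter, mem_Icc, mem_Icc]; omega)
        rw [Int.card_Icc] at this
        exact_mod_cast (by simpa using this)
      have c2 : (#{s ∈ Icc 1 ((N:ℤ) + N') | ¬ ((N':ℤ) ≤ s ∧ s ≤ N)} : ℝ) ≤ N' + N' := by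
        have : #{s ∈ Icc 1 ((N:ℤ) + N') | ¬ ((N':ℤ) ≤ s ∧ s ≤ N)} ≤ #(Icc 1 (N':ℤ) ∪ Ioc (N:ℤ) (N + N')) := card_le_card (by
          intro s; rw [mem_filter, mem_union, mem_Icc, mem_Icc, mem_Ioc]; omega)
        have := this.trans (card_union_le _ _)
        rw [Int.card_Icc, Int.card_Ioc] at this
        exact_mod_cast (by simpa using this)
      nlinarith
    calc _ ≤ (ν1 * N + 4 * N') * σ * N' := by gcongr
      _ = _ := by ring
  have habs : ∑ s ∈ Icc 1 ((N:ℤ) + N'), ∑ c ∈ Ico (0:ℤ) q, |D s c| ≤ 2 * (σ * N' * (ν1 * N + 4 * N')) := by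
    have : ∀ y : ℝ, |y| = 2 * max y 0 - y := by
      intro y
      rcases le_total 0 y with h | h
      · rw [abs_of_nonneg h, max_eq_left h]; ring
      · rw [abs_of_nonpos h, max_eq_right h]; ring
    simp only [this, sum_sub_distrib, ← mul_sum]
    rw [hz]; linarith
  calc _ ≤ ∑ s ∈ Icc 1 ((N:ℤ) + N'), (q:ℝ) * ∑ c ∈ Ico (0:ℤ) q, (D s c)^2 := sum_le_sum fun s _ => Vq_le A σ N N' q hq s
    _ ≤ ∑ s ∈ Icc 1 ((N:ℤ) + N'), (q:ℝ) * ∑ c ∈ Ico (0:ℤ) q, (4 * σ * N' / q) * |D s c| := by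
        refine sum_le_sum fun s _ => mul_le_mul_of_nonneg_left (sum_le_sum fun c hc => ?_) hq0.le
        rw [← sq_abs, sq]
        exact mul_le_mul_of_nonneg_right (hb s c (mem_Ico.1 hc).1 (mem_Ico.1 hc).2).1 (abs_nonneg _)
    _ = (4 * σ * N') * ∑ s ∈ Icc 1 ((N:ℤ) + N'), ∑ c ∈ Ico (0:ℤ) q, |D s c| := by
        rw [mul_sum]
        refine sum_congr rfl fun s _ => ?_
        rw [← mul_sum, ← mul_assoc]
        congr 1
        field_simp
    _ ≤ (4 * σ * N') * (2 * (σ * N' * (ν1 * N + 4 * N'))) := by gcongr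
    _ = _ := by ring

open Finset

theorem int_sum_le (q a : ℕ) (hq : 2 ≤ q) (ha : a ∈ cop q) (lo hi : ℤ) : ‖∑ x ∈ Icc lo hi, ee ((a:ℝ)/q * x)‖ ≤ q := by
  have hq0 : (0:ℝ) < q := by positivity
  set δ : ℝ := (a:ℝ)/q - round ((a:ℝ)/q) with hδ
  have hδ1 : |δ| ≤ 1/2 := abs_sub_round _
  have hδ2 : 1 / (q:ℝ) ≤ |δ| := by
    have h1 : δ = ((a - q * round ((a:ℝ)/q) : ℤ) : ℝ) / q := by
      rw [hδ]; push_cast; field_simp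
    rw [h1, abs_div, abs_of_pos hq0]
    gcongr
    rw [← Int.cast_abs]
    have h2 : (a:ℤ) - q * round ((a:ℝ)/q) ≠ 0 := by
      intro h0
      have hd : (q:ℤ) ∣ a := ⟨round ((a:ℝ)/q), by linarith⟩
      have hd' : q ∣ a := by exact_mod_cast hd
      have hc := (mem_filter.1 ha).2
      have : q ∣ 1 := by rw [← hc.gcd_eq_one]; exact Nat.dvd_gcd hd' dvd_rfl
      have := Nat.dvd_one.1 this
      omega
    exact_mod_cast Int.one_le_abs h2
  have h3 : ∑ x ∈ Icc lo hi, ee ((a:ℝ)/q * x) = ∑ n ∈ range (hi + 1 - lo).toNat, ee (δ * n + δ * lo) := by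
    symm
    refine sum_bij (fun n _ => lo + (n:ℤ)) ?_ ?_ ?_ ?_
    · intro n hn
      rw [mem_range] at hn
      rw [mem_Icc]; omega
    · intro i _ j _ hij
      have : lo + (i:ℤ) = lo + j := hij
      omega
    · intro x hx
      rw [mem_Icc] at hx
      exact ⟨(x - lo).toNat, by rw [mem_range]; omega, by omega⟩
    · intro n _
      refine ee_of_sub_mem ?_
      have : δ * n + δ * lo - (a:ℝ)/q * ((lo + (n:ℤ) : ℤ):ℝ) = ((-(round ((a:ℝ)/q) * (lo + n)) : ℤ) : ℝ) := by
        rw [hδ]; push_cast; ring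
      rw [this]; exact int_mem_ZZ _
  rw [h3]
  have h4 := geom_ee δ (δ * lo) (hi + 1 - lo).toNat hδ1
  set S := ‖∑ n ∈ range (hi + 1 - lo).toNat, ee (δ * n + δ * lo)‖ with hS
  have hS0 : 0 ≤ S := norm_nonneg _
  have h5 : S * (2 * (1/q)) ≤ 1 := le_trans (by gcongr) h4
  have h6 : S * (2 * (1/q)) = 2 * S / q := by ring
  rw [h6, div_le_one hq0] at h5
  linarith

theorem al_norm (B : Finset ℤ) (w : ℝ) (hw : 0 ≤ w) (q c : ℕ) : ‖al B w 1 0 q c‖ = w * ‖∑ z ∈ B, ee ((c:ℝ)/q * z)‖ := by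
  unfold al
  have h1 : ∑ z ∈ B with ((1:ℕ):ℤ) ∣ z - 0, ee (-((c:ℝ) * (((z - 0) / (1:ℕ) : ℤ) : ℝ) / q)) = (starRingEnd ℂ) (∑ z ∈ B, ee ((c:ℝ)/q * z)) := by
    rw [filter_true_of_mem (by intro z _; simp), map_sum]
    refine sum_congr rfl fun z _ => ?_
    rw [← ee_neg]; congr 1; simp; ring
  rw [h1, norm_mul, RCLike.norm_conj, Complex.norm_real, Nat.cast_one, one_mul, Real.norm_of_nonneg hw]

theorem WW_split (A : Finset ℤ) (σ : ℝ) (hσ0 : 0 ≤ σ) (N N' q a : ℕ) (hq : 2 ≤ q) (ha : a ∈ cop q) (s : ℤ) (hAN : A ⊆ Icc 1 (N:ℤ)) :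
    ‖WW A σ N N' ((a:ℝ)/q) s‖^2 ≤ 2 * ‖∑ z ∈ A with s - N' < z ∧ z ≤ s, ee ((a:ℝ)/q * z)‖^2 + 2 * σ^2 * q^2 := by
  have h1 : WW A σ N N' ((a:ℝ)/q) s = ∑ z ∈ A with s - N' < z ∧ z ≤ s, ee ((a:ℝ)/q * z) -
      σ * ∑ x ∈ Icc (max 1 (s - N' + 1)) (min (N:ℤ) s), ee ((a:ℝ)/q * x) := by
    unfold WW fA
    have e : (Icc 1 (N:ℤ)).filter (fun x => s - N' < x ∧ x ≤ s) = Icc (max 1 (s - N' + 1)) (min (N:ℤ) s) := by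
      ext x; simp only [mem_filter, mem_Icc, max_le_iff, le_min_iff]; omega
    push_cast
    simp only [sub_mul, sum_sub_distrib, ← mul_sum]
    rw [← e]
    congr 1
    simp only [apply_ite (Complex.ofReal), Complex.ofReal_one, Complex.ofReal_zero, ite_mul, one_mul, zero_mul]
    rw [← sum_filter]
    refine sum_congr ?_ fun _ _ => rfl
    ext x
    simp only [mem_filter]
    constructor
    · rintro ⟨⟨_, h1⟩, h2⟩; exact ⟨h2, h1⟩
    · rintro ⟨h1, h2⟩; exact ⟨⟨hAN h1, h2⟩, h1⟩
  set P := ∑ z ∈ A with s - N' < z ∧ z ≤ s, ee ((a:ℝ)/q * z) with hP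
  have h2 := int_sum_le q a hq ha (max 1 (s - N' + 1)) (min (N:ℤ) s)
  set R := ∑ x ∈ Icc (max 1 (s - N' + 1)) (min (N:ℤ) s), ee ((a:ℝ)/q * x) with hR
  have h3 : ‖WW A σ N N' ((a:ℝ)/q) s‖ ≤ ‖P‖ + σ * q := by
    rw [h1]
    refine (norm_sub_le _ _).trans ?_
    rw [norm_mul, Complex.norm_real, Real.norm_of_nonneg hσ0]
    gcongr
  calc _ ≤ (‖P‖ + σ * q)^2 := by gcongr
    _ ≤ _ := by nlinarith [sq_nonneg (‖P‖ - σ * q)]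

theorem core_large (A : Finset ℤ) (σ δ T : ℝ) (hσ0 : 0 < σ) (N N' Q0 Q : ℕ) (hN' : 0 < N') (hNN : N' ≤ N) (hQ0 : 1 ≤ Q0)
    (hδ : 0 < δ) (hAN : A ⊆ Icc 1 (N:ℤ)) (hT0 : 0 ≤ T)
    (hT : ∀ s : ℤ, ∑ q ∈ Icc 1 Q, (q:ℝ)^(-(δ/2)) * tt (A.filter (fun z => s - N' < z ∧ z ≤ s)) (1/(σ*N')) 1 0 q ≤ T) :
    ∑ q ∈ Ioc Q0 Q, (q:ℝ)^(-δ) * ∑ a ∈ cop q, ∑ s ∈ Icc 1 ((N:ℤ) + N'), ‖WW A σ N N' ((a:ℝ)/q) s‖^2 ≤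
      4 * N * σ^2 * Q^4 + 4 * N * σ^2 * N'^2 * ((Q0:ℝ)^(-(δ/2)) * T) := by
  have hN'0 : (0:ℝ) < N' := by exact_mod_cast hN'
  have hNN' : (N':ℝ) ≤ N := by exact_mod_cast hNN
  have e1 : ∑ q ∈ Ioc Q0 Q, (q:ℝ)^(-δ) * ∑ a ∈ cop q, ∑ s ∈ Icc 1 ((N:ℤ) + N'), ‖WW A σ N N' ((a:ℝ)/q) s‖^2 =
      ∑ s ∈ Icc 1 ((N:ℤ) + N'), ∑ q ∈ Ioc Q0 Q, (q:ℝ)^(-δ) * ∑ a ∈ cop q, ‖WW A σ N N' ((a:ℝ)/q) s‖^2 := by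
    rw [sum_comm]
    refine sum_congr rfl fun q _ => ?_
    rw [← mul_sum, sum_comm]
  have h1 : ∀ s ∈ Icc 1 ((N:ℤ) + N'), ∑ q ∈ Ioc Q0 Q, (q:ℝ)^(-δ) * ∑ a ∈ cop q, ‖WW A σ N N' ((a:ℝ)/q) s‖^2 ≤
      2 * σ^2 * Q^4 + 2 * σ^2 * N'^2 * ((Q0:ℝ)^(-(δ/2)) * T) := by
    intro s _
    have hq1 : ∀ q ∈ Ioc Q0 Q, (q:ℝ)^(-δ) * ∑ a ∈ cop q, ‖WW A σ N N' ((a:ℝ)/q) s‖^2 ≤ 2 * σ^2 * Q^3 +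
        2 * σ^2 * N'^2 * ((Q0:ℝ)^(-(δ/2)) * ((q:ℝ)^(-(δ/2)) * tt (A.filter (fun z => s - N' < z ∧ z ≤ s)) (1/(σ*N')) 1 0 q)) := by
      intro q hq
      rw [mem_Ioc] at hq
      have hq2 : 2 ≤ q := by omega
      have hqQ : (q:ℝ) ≤ Q := by exact_mod_cast hq.2
      have hq0 : (1:ℝ) ≤ q := by exact_mod_cast (by omega : 1 ≤ q)
      have hQ00 : (0:ℝ) < Q0 := by exact_mod_cast hQ0
      have hle1 : (q:ℝ)^(-δ) ≤ 1 := Real.rpow_le_one_of_one_le_of_nonpos hq0 (by linarith)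
      have hfac : (q:ℝ)^(-δ) ≤ (Q0:ℝ)^(-(δ/2)) * (q:ℝ)^(-(δ/2)) := by
        have : (q:ℝ)^(-δ) = (q:ℝ)^(-(δ/2)) * (q:ℝ)^(-(δ/2)) := by
          rw [← Real.rpow_add (by linarith)]; congr 1; ring
        rw [this]
        refine mul_le_mul_of_nonneg_right ?_ (by positivity)
        refine Real.rpow_le_rpow_of_nonpos hQ00 (by exact_mod_cast hq.1.le) (by linarith)
      have hcop : (#(cop q) : ℝ) ≤ q := by
        have : #(cop q) ≤ q := (card_filter_le _ _).trans (by rw [card_range])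
        exact_mod_cast this
      have hs1 : ∑ a ∈ cop q, ‖WW A σ N N' ((a:ℝ)/q) s‖^2 ≤ 2 * σ^2 * Q^3 + 2 * σ^2 * N'^2 * tt (A.filter (fun z => s - N' < z ∧ z ≤ s)) (1/(σ*N')) 1 0 q := by
        calc _ ≤ ∑ a ∈ cop q, (2 * σ^2 * N'^2 * ‖al (A.filter (fun z => s - N' < z ∧ z ≤ s)) (1/(σ*N')) 1 0 q a‖^2 + 2 * σ^2 * q^2) := by
              refine sum_le_sum fun a ha => (WW_split A σ hσ0.le N N' q a hq2 ha s hAN).trans (le_of_eq ?_)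
              rw [al_norm _ _ (by positivity)]
              field_simp
          _ = 2 * σ^2 * N'^2 * tt (A.filter (fun z => s - N' < z ∧ z ≤ s)) (1/(σ*N')) 1 0 q + #(cop q) * (2 * σ^2 * q^2) := by
              rw [sum_add_distrib, ← mul_sum, sum_const, nsmul_eq_mul]; rfl
          _ ≤ 2 * σ^2 * N'^2 * tt (A.filter (fun z => s - N' < z ∧ z ≤ s)) (1/(σ*N')) 1 0 q + Q * (2 * σ^2 * Q^2) := by
              have : (#(cop q) : ℝ) ≤ Q := hcop.trans hqQ
              gcongr
          _ = _ := by ring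
      have htt : 0 ≤ tt (A.filter (fun z => s - N' < z ∧ z ≤ s)) (1/(σ*N')) 1 0 q := tt_nonneg _ _ _ _ _
      calc _ ≤ (q:ℝ)^(-δ) * (2 * σ^2 * Q^3 + 2 * σ^2 * N'^2 * tt (A.filter (fun z => s - N' < z ∧ z ≤ s)) (1/(σ*N')) 1 0 q) := by gcongr
        _ = (q:ℝ)^(-δ) * (2 * σ^2 * Q^3) + (q:ℝ)^(-δ) * (2 * σ^2 * N'^2 * tt (A.filter (fun z => s - N' < z ∧ z ≤ s)) (1/(σ*N')) 1 0 q) := by ring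
        _ ≤ 1 * (2 * σ^2 * Q^3) + ((Q0:ℝ)^(-(δ/2)) * (q:ℝ)^(-(δ/2))) * (2 * σ^2 * N'^2 * tt (A.filter (fun z => s - N' < z ∧ z ≤ s)) (1/(σ*N')) 1 0 q) := by gcongr
        _ = _ := by ring
    refine (sum_le_sum hq1).trans ?_
    rw [sum_add_distrib, sum_const, nsmul_eq_mul, ← mul_sum, ← mul_sum]
    have hc : (#(Ioc Q0 Q) : ℝ) ≤ Q := by
      rw [Nat.card_Ioc]; exact_mod_cast Nat.sub_le _ _
    have hsub : ∑ q ∈ Ioc Q0 Q, (q:ℝ)^(-(δ/2)) * tt (A.filter (fun z => s - N' < z ∧ z ≤ s)) (1/(σ*N')) 1 0 q ≤ T := by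
      refine le_trans (sum_le_sum_of_subset_of_nonneg ?_ fun q _ _ => ?_) (hT s)
      · intro q; rw [mem_Ioc, mem_Icc]; omega
      · have := tt_nonneg (A.filter (fun z => s - N' < z ∧ z ≤ s)) (1/(σ*N')) 1 0 q; positivity
    calc _ ≤ (Q:ℝ) * (2 * σ^2 * Q^3) + 2 * σ^2 * N'^2 * ((Q0:ℝ)^(-(δ/2)) * T) := by gcongr
      _ = _ := by ring
  rw [e1]
  refine (sum_le_sum h1).trans ?_
  rw [sum_const, nsmul_eq_mul, Int.card_Icc]
  have : ((((N:ℤ) + N' + 1 - 1).toNat : ℕ) : ℝ) = N + N' := by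
    rw [add_sub_cancel_right]; exact_mod_cast Int.toNat_natCast (N + N')
  rw [this]
  have hpos : 0 ≤ 2 * σ^2 * Q^4 + 2 * σ^2 * N'^2 * ((Q0:ℝ)^(-(δ/2)) * T) := by positivity
  calc _ ≤ (2 * N : ℝ) * (2 * σ^2 * Q^4 + 2 * σ^2 * N'^2 * ((Q0:ℝ)^(-(δ/2)) * T)) := by
        gcongr; linarith
    _ = _ := by ring

theorem cls_reg (A : Finset ℤ) (σ ν1 : ℝ) (N' q L0 : ℕ) (hq : 1 ≤ q) (hσ0 : 0 ≤ σ) (hν0 : 0 ≤ ν1) (hν1 : ν1 ≤ 1/3)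
    (hNI : ∀ u : ℤ, ∀ L : ℕ, L0 ≤ L → (#{x ∈ Icc 1 (L:ℤ) | u + q * x ∈ A} : ℝ) ≤ (1 + ν1) * σ * L)
    (hL0 : 1 ≤ L0) (hN' : q * (L0 + 1) ≤ N') (s x : ℤ) :
    (#{z ∈ A.filter (fun z => s - N' < z ∧ z ≤ s) | (q:ℤ) ∣ z - x} : ℝ) * q ≤ 2 * σ * N' := by
  have hq0 : (0:ℤ) < q := by exact_mod_cast hq
  have hq0' : (0:ℝ) < q := by exact_mod_cast hq
  set c := x % q with hc
  have hc0 : 0 ≤ c := Int.emod_nonneg _ hq0.ne'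
  have hcq : c < q := Int.emod_lt_of_pos _ hq0
  have e1 : {z ∈ A.filter (fun z => s - N' < z ∧ z ≤ s) | (q:ℤ) ∣ z - x} = {z ∈ A | (s - N' < z ∧ z ≤ s) ∧ z % q = c} := by
    rw [filter_filter]
    refine filter_congr fun z _ => ?_
    rw [Int.dvd_iff_emod_eq_zero, Int.emod_eq_emod_iff_emod_sub_eq_zero.symm]
  obtain ⟨h1, -⟩ := cls_bds q hq s N' L0 c hc0 hcq hN'
  obtain ⟨h2, h3⟩ := cls_size q hq (s - N') s c (by linarith) hc0 hcq
  have h4 := h3 A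
  set L := #{x ∈ Ioc (s - N') s | x % q = c}
  have h5 := hNI (c + q * ((s - N' - c) / q)) L h1
  rw [e1, h4]
  have g1 := Int.emod_add_mul_ediv (s - c) q
  have g2 := Int.emod_add_mul_ediv (s - N' - c) q
  have g3 := Int.emod_lt_of_pos (s - c) hq0
  have g4 := Int.emod_lt_of_pos (s - N' - c) hq0
  have g5 := Int.emod_nonneg (s - c) hq0.ne'
  have g6 := Int.emod_nonneg (s - N' - c) hq0.ne'
  have h7 : (q:ℤ) * L = q * ((s - c) / q) - q * ((s - N' - c) / q) := by rw [h2]; ring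
  have h8 : (q:ℤ) * L ≤ N' + q := by linarith
  have h8' : (q:ℝ) * L ≤ N' + q := by exact_mod_cast h8
  have h9 : (q:ℝ) * 2 ≤ N' := by
    have : q * 2 ≤ N' := le_trans (Nat.mul_le_mul_left _ (by omega)) hN'
    exact_mod_cast this
  calc _ ≤ (1 + ν1) * σ * L * q := by gcongr
    _ = (1 + ν1) * (σ * (q * L)) := by ring
    _ ≤ (4/3) * (σ * (q * L)) := mul_le_mul_of_nonneg_right (by linarith) (by positivity)
    _ ≤ (4/3) * (σ * (3/2 * N')) := by
        have : (q:ℝ) * L ≤ 3/2 * N' := by linarith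
        exact mul_le_mul_of_nonneg_left (mul_le_mul_of_nonneg_left this hσ0) (by norm_num)
    _ = _ := by ring

theorem T_from_partE (A : Finset ℤ) (σ ν1 η Y : ℝ) (N' Q L0 m : ℕ) (hm : 1 ≤ m) (hQ1 : 1 ≤ Q) (hσ0 : 0 < σ) (hσ1 : σ ≤ 1) (hν0 : 0 ≤ ν1) (hν1 : ν1 ≤ 1/3)
    (hNI : ∀ q : ℕ, 1 ≤ q → q ≤ Q → ∀ u : ℤ, ∀ L : ℕ, L0 ≤ L → (#{x ∈ Icc 1 (L:ℤ) | u + q * x ∈ A} : ℝ) ≤ (1 + ν1) * σ * L)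
    (hL0 : 1 ≤ L0) (hN' : Q * (L0 + 1) ≤ N') (hN2 : Q*(2*Q^3)^(2*m) ≤ N') (hη : 0 < η) (hY1 : 1 ≤ Y)
    (hY : ∀ q : ℕ, 1 ≤ q → q ≤ Q → (8:ℝ)^(m*#q.primeFactors)*(#q.divisors:ℝ)^2*(#q.divisors:ℝ)^m*(#q.divisors:ℝ)^2*(q:ℝ)^(-η) ≤ Y) (s : ℤ) :
    ∑ q ∈ Icc 1 Q, (q:ℝ)^(-η) * tt (A.filter (fun z => s - N' < z ∧ z ≤ s)) (1/(σ*N')) 1 0 q ≤ 8 * Y * σ^(-(1/(m:ℝ))) := by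
  have h := partE (A.filter (fun z => s - N' < z ∧ z ≤ s)) (s - N' + 1) N' Q m σ Y (fun q => (q:ℝ)^(-η)) hm hQ1 hσ0 hσ1 (by
      intro z hz
      have := (mem_filter.1 hz).2
      constructor <;> linarith [this.1, this.2]) (by
      intro r hr1 hrQ x
      exact cls_reg A σ ν1 N' r L0 hr1 hσ0.le hν0 hν1 (hNI r hr1 hrQ) hL0 (le_trans (Nat.mul_le_mul_right _ hrQ) hN') s x)
    hN2 (by intro q; positivity) (by
      intro q hq
      exact Real.rpow_le_one_of_one_le_of_nonpos (by exact_mod_cast hq) (by linarith)) (by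
      intro a b
      push_cast
      rw [Real.mul_rpow (by positivity) (by positivity)]) hY1 hY
  have hm0 : (m:ℝ) ≠ 0 := by positivity
  refine le_of_pow_le_pow_left₀ (by omega : m ≠ 0) (by positivity) (h.trans (le_of_eq ?_))
  rw [mul_pow (8 * Y) (σ ^ (-(1/(m:ℝ)))) m, ← Real.rpow_natCast (σ ^ (-(1/(m:ℝ)))), ← Real.rpow_mul hσ0.le]
  have : -(1 / (m:ℝ)) * m = -1 := by field_simp
  rw [this, Real.rpow_neg_one, div_eq_mul_inv]

open Finset

theorem poly_zeros (P : Polynomial ℤ) (hP : P ≠ 0) (M : ℕ) : #{n ∈ range M | P.eval ((n + 1 : ℕ):ℤ) = 0} ≤ P.natDegree := by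
  refine le_trans ?_ (Polynomial.card_roots' P)
  refine le_trans ?_ (Multiset.toFinset_card_le _)
  refine card_le_card_of_injOn (fun n => ((n + 1 : ℕ):ℤ)) ?_ ?_
  · intro n hn
    rw [mem_coe, mem_filter] at hn
    rw [mem_coe, Multiset.mem_toFinset, Polynomial.mem_roots hP]
    exact hn.2
  · intro a _ b _ h
    have : ((a + 1 : ℕ):ℤ) = ((b + 1 : ℕ):ℤ) := h
    omega

theorem one_major {k : ℕ} {h : Polynomial ℤ} {z : ∀ (p : ℕ) [Fact p.Prime], ℤ_[p]} {lam : ℕ → ℕ} {r : ℕ → ℤ} {H : ℕ → Polynomial ℤ}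
    (D : Dat k h z lam r H) (E : ℕ) (hE : 1 ≤ E) (d : ℕ) (hd : 0 < d) (M N' X : ℕ) (σ θ : ℝ) (hM : 1 ≤ M) (hσ0 : 0 < σ)
    (hweyl : ∀ X, 2 ≤ X → X^E*d^k ≤ M → (M:ℝ) ≤ X*‖∑ n ∈ range M, ee (θ*(((H d).eval ((n+1:ℕ):ℤ):ℤ):ℝ))‖ →
      ∃ q : ℕ, 1 ≤ q ∧ q ≤ X^E ∧ ∃ a : ℤ, IsCoprime a (q:ℤ) ∧ |θ - a/q| * (((H d).coeff k:ℤ)*(M:ℝ)^k) ≤ X^E)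
    (hX : 2 ≤ X) (hX4 : 4 / σ ≤ X) (hXM : X^E * d^k ≤ M)
    (hN' : 14 * (X:ℝ)^E * N' ≤ ((H d).coeff k : ℤ) * (M:ℝ)^k)
    (hbig : σ * M < 4 * ‖∑ n ∈ range M, ee (θ*(((H d).eval ((n+1:ℕ):ℤ):ℤ):ℝ))‖) :
    ∃ q : ℕ, 1 ≤ q ∧ q ≤ X^E ∧ ∃ a ∈ cop q, ∃ n : ℤ, |θ - (a:ℝ)/q - n| * N' ≤ 1/14 ∧
      ‖∑ n ∈ range M, ee (θ*(((H d).eval ((n+1:ℕ):ℤ):ℤ):ℝ))‖ ≤ 2 * M * (q:ℝ)^(-(1/(E:ℝ))) := by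
  set S := ‖∑ n ∈ range M, ee (θ*(((H d).eval ((n+1:ℕ):ℤ):ℤ):ℝ))‖ with hS
  have hM0 : (0:ℝ) < M := by exact_mod_cast hM
  have hS0 : 0 < S := by have : 0 < σ * M := by positivity
                         linarith
  have hSM : S ≤ M := by
    rw [hS]
    refine (norm_sum_le _ _).trans ?_
    simp [norm_ee]
  have hy1 : 1 ≤ M / S := by rw [le_div_iff₀ hS0]; linarith
  set Xj := max 2 ⌈(M:ℝ)/S⌉₊ with hXj
  have hXj2 : (Xj:ℝ) ≤ 2 * (M/S) := by
    rw [hXj]; push_cast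
    refine max_le (by linarith) ?_
    have := Nat.ceil_lt_add_one (by linarith : 0 ≤ (M:ℝ)/S)
    linarith
  have hXjX : Xj ≤ X := by
    refine max_le hX (Nat.ceil_le.2 ?_)
    refine le_trans ?_ hX4
    rw [div_le_div_iff₀ hS0 hσ0]; linarith
  have hXE : Xj^E ≤ X^E := Nat.pow_le_pow_left hXjX E
  obtain ⟨q, hq1, hqX, a, hac, hb⟩ := hweyl Xj (le_max_left _ _) (le_trans (Nat.mul_le_mul_right _ hXE) hXM) (by
    have : (M:ℝ)/S ≤ Xj := le_trans (Nat.le_ceil _) (by exact_mod_cast le_max_right _ _)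
    rwa [div_le_iff₀ hS0] at this)
  have hq0 : (0:ℤ) < q := by exact_mod_cast hq1
  have hq0' : (0:ℝ) < q := by exact_mod_cast hq1
  have hm0 := Int.emod_nonneg a hq0.ne'
  have hmq := Int.emod_lt_of_pos a hq0
  have hdm := Int.emod_add_mul_ediv a q
  have hcast : (((a % q).toNat : ℕ) : ℤ) = a % q := Int.toNat_of_nonneg hm0
  refine ⟨q, hq1, hqX.trans hXE, (a % q).toNat, ?_, a / q, ?_, ?_⟩
  · unfold cop
    rw [mem_filter, mem_range]
    refine ⟨by omega, ?_⟩
    rw [← Nat.isCoprime_iff_coprime, hcast]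
    have : a % q = a + q * (-(a / q)) := by linarith
    rw [this]
    exact hac.add_mul_left_left _
  · have e : (((a % q).toNat : ℕ) : ℝ) / q + (a / q : ℤ) = a / q := by
      have h1 : (((a % q).toNat : ℕ) : ℝ) + q * ((a / q : ℤ):ℝ) = a := by
        have : (((a % q).toNat : ℕ) : ℤ) + q * (a / q) = a := by rw [hcast]; exact hdm
        exact_mod_cast this
      rw [← h1]; field_simp
    rw [sub_sub, e]
    have hbpos : (0:ℝ) < ((H d).coeff k : ℤ) := by exact_mod_cast D.b_pos d hd
    set G := (((H d).coeff k : ℤ):ℝ) * (M:ℝ)^k with hG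
    have hG0 : 0 < G := by positivity
    have hXER : (Xj:ℝ)^E ≤ (X:ℝ)^E := by exact_mod_cast hXE
    have hX0 : (0:ℝ) < (X:ℝ)^E := by positivity
    have h2 : |θ - a/q| * G ≤ (X:ℝ)^E := hb.trans hXER
    refine le_of_mul_le_mul_right ?_ (by positivity : (0:ℝ) < 14 * (X:ℝ)^E)
    calc |θ - a/q| * N' * (14 * (X:ℝ)^E) = |θ - a/q| * (14 * (X:ℝ)^E * N') := by ring
      _ ≤ |θ - a/q| * G := by gcongr
      _ ≤ _ := by linarith
  · have hE0 : (0:ℝ) < E := by exact_mod_cast hE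
    have h3 : (q:ℝ)^(1/(E:ℝ)) ≤ Xj := by
      have : (q:ℝ) ≤ (Xj:ℝ)^(E:ℝ) := by rw [Real.rpow_natCast]; exact_mod_cast hqX
      calc (q:ℝ)^(1/(E:ℝ)) ≤ ((Xj:ℝ)^(E:ℝ))^(1/(E:ℝ)) := Real.rpow_le_rpow hq0'.le this (by positivity)
        _ = Xj := by rw [← Real.rpow_mul (by positivity), mul_one_div_cancel hE0.ne', Real.rpow_one]
    have h4 : (0:ℝ) < (q:ℝ)^(1/(E:ℝ)) := by positivity
    rw [Real.rpow_neg hq0'.le, ← div_eq_mul_inv, le_div_iff₀ h4]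
    have h5 := h3.trans hXj2
    rw [mul_div_assoc', le_div_iff₀ hS0] at h5
    linarith

theorem Dat.core {k : ℕ} {h : Polynomial ℤ} {z : ∀ (p : ℕ) [Fact p.Prime], ℤ_[p]} {lam : ℕ → ℕ} {r : ℕ → ℤ} {H : ℕ → Polynomial ℤ}
    (D : Dat k h z lam r H) : ∃ E K : ℕ, 1 ≤ E ∧ 1 ≤ K ∧ ∀ (d N M N' Q0 X L0 b : ℕ) (σ ν1 T : ℝ) (A : Finset ℤ),
      0 < d → A ⊆ Icc 1 (N:ℤ) → (#A : ℝ) = σ * N → 0 < σ →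
      (∀ a ∈ A, ∀ b ∈ A, a ≠ b → ∀ n : ℕ, 0 < n → a - b ≠ (H d).eval (n:ℤ)) →
      2 ≤ X → 4 / σ ≤ X → X^E * d^k ≤ M → 1 ≤ M → (b:ℤ) = (H d).coeff k → 32 * (K * b * M^k) ≤ N →
      14 * X^E * N' ≤ b * M^k → 4 * (k:ℝ) ≤ σ * M → 0 ≤ ν1 → ν1 ≤ 1/3 → 1 ≤ L0 → X^E * (L0 + 1) ≤ N' → 1 ≤ Q0 → 0 ≤ T →
      (∀ q : ℕ, 1 ≤ q → q ≤ X^E → ∀ u : ℤ, ∀ L : ℕ, L0 ≤ L → (#{x ∈ Icc 1 (L:ℤ) | u + q * x ∈ A} : ℝ) ≤ (1 + ν1) * σ * L) →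
      (Q0 < X^E → ∀ s : ℤ, ∑ q ∈ Icc 1 (X^E), (q:ℝ)^(-((1/(E:ℝ))/2)) * tt (A.filter (fun z => s - N' < z ∧ z ≤ s)) (1/(σ*N')) 1 0 q ≤ T) →
      1/32 ≤ 8 * Q0 * (ν1 + 4 * N' / N) + 4 * (X^E : ℕ)^4 / (N':ℝ)^2 + 4 * ((Q0:ℝ)^(-((1/(E:ℝ))/2)) * T) := by
  obtain ⟨E, hE, hweyl⟩ := D.weyl
  obtain ⟨K, hK, hsize⟩ := D.H_size
  refine ⟨E, K, hE, hK, ?_⟩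
  intro d N M N' Q0 X L0 b σ ν1 T A hd hAN hσ hσ0 hfree hX hX4 hXM hM hb hKN hN' hkM hν0 hν1 hL0 hQL hQ0 hT0 hNI hT
  set Q := X^E with hQ
  have hQ1 : 1 ≤ Q := Nat.one_le_pow _ _ (by omega)
  set B := K * b * M^k with hB
  have hb1 : 1 ≤ b := by
    have := D.b_pos d hd
    rw [← hb] at this; exact_mod_cast this
  have hbM1 : b * M^k ≤ B := by rw [hB]; nlinarith [Nat.zero_le (b * M^k)]
  have hN'B : 14 * N' ≤ B := le_trans (by nlinarith [Nat.zero_le N']) (hN'.trans hbM1)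
  have hN'1 : 1 ≤ N' := le_trans (by nlinarith) hQL
  have hN'L : L0 ≤ N' := le_trans (by nlinarith) hQL
  have hLB : L0 ≤ B := by omega
  have hNN : N' ≤ N := by omega
  have hN0 : 0 < N := by omega
  have hBN : B ≤ N := by omega
  set Hn : ℕ → ℤ := fun n => (H d).eval ((n+1:ℕ):ℤ) with hHn
  have hHB : ∀ n < M, |Hn n| ≤ B := by
    intro n hn
    refine (hsize d hd (n+1) (by omega)).trans ?_
    rw [← hb, hB]
    have : (n+1)^k ≤ M^k := Nat.pow_le_pow_left (by omega) k
    have : K * b * (n+1)^k ≤ K * b * M^k := Nat.mul_le_mul_left _ this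
    exact_mod_cast this
  have hHd0 : H d ≠ 0 := by
    intro h0
    have := D.b_pos d hd
    rw [h0] at this; simp at this
  have hzeros : #{n ∈ range M | Hn n = 0} ≤ k := by
    have := poly_zeros (H d) hHd0 M
    rwa [(D.H_lead d hd).1] at this
  have h1ni := fun u L hL => hNI 1 le_rfl hQ1 u L hL
  have hv2 : (1 + ν1) * σ * B ≤ 2 * σ * B := by
    have : (0:ℝ) ≤ σ * B := by positivity
    nlinarith
  have he1 : (#{a ∈ A | a ≤ (B:ℤ)} : ℝ) ≤ 2 * σ * B := by
    refine le_trans ?_ ((h1ni 0 B hLB).trans hv2)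
    have : #{a ∈ A | a ≤ (B:ℤ)} ≤ #{x ∈ Icc 1 (B:ℤ) | (0:ℤ) + ((1:ℕ):ℤ) * x ∈ A} := card_le_card (by
      intro x hx
      rw [mem_filter] at hx
      have := mem_Icc.1 (hAN hx.1)
      rw [mem_filter, mem_Icc]
      exact ⟨⟨this.1, hx.2⟩, by simpa using hx.1⟩)
    exact_mod_cast this
  have he2 : (#{a ∈ A | (N:ℤ) - B < a} : ℝ) ≤ 2 * σ * B := by
    refine le_trans ?_ ((h1ni ((N:ℤ) - B) B hLB).trans hv2)
    have : #{a ∈ A | (N:ℤ) - B < a} ≤ #{x ∈ Icc 1 (B:ℤ) | ((N:ℤ) - B) + ((1:ℕ):ℤ) * x ∈ A} := by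
      refine card_le_card_of_injOn (fun a => a - (N - B)) ?_ ?_
      · intro x hx
        rw [mem_coe, mem_filter] at hx
        have := mem_Icc.1 (hAN hx.1)
        rw [mem_coe, mem_filter, mem_Icc]
        exact ⟨⟨by linarith [hx.2], by linarith⟩, by simpa using hx.1⟩
      · intro a _ b _ h
        have : a - ((N:ℤ) - B) = b - (N - B) := h
        linarith
    exact_mod_cast this
  have hneg := lam_neg A N M k σ hσ0.le hσ hAN Hn B hHB (by
      intro a ha c hc n _ hac
      by_contra hne
      exact hfree a ha c hc hne (n+1) (by omega) hac) hzeros hkM (by exact_mod_cast hKN) he1 he2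
  have hmass := mass A N M hN0 σ hσ0.le hσ hAN Hn (fun n hn => (hHB n hn).trans (by exact_mod_cast hBN)) hneg
  have hwin := winsum A σ (1/(E:ℝ)) N N' M Q hN0 hNN hM (fun j => ‖∑ n ∈ range M, ee ((j:ℝ) / (2 * N : ℕ) * Hn n)‖)
    (fun j => norm_nonneg _) hmass (by
      intro j _ hj
      refine one_major D E hE d hd M N' X σ ((j:ℝ) / (2 * N : ℕ)) hM hσ0 (fun X hX hXM hX3 => hweyl d hd X hX M hM hXM _ hX3) hX hX4 hXM ?_ hj
      rw [← hb]
      exact_mod_cast hN')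
  have hE0 : (0:ℝ) < E := by exact_mod_cast hE
  set V : ℕ → ℝ := fun q => ∑ a ∈ cop q, ∑ s ∈ Icc 1 ((N:ℤ) + N'), ‖WW A σ N N' ((a:ℝ)/q) s‖^2 with hV
  have hV0 : ∀ q, 0 ≤ V q := fun q => sum_nonneg fun a _ => sum_nonneg fun s _ => by positivity
  have hsplit : ∑ q ∈ Icc 1 Q, (q:ℝ)^(-(1/(E:ℝ))) * V q ≤ ∑ q ∈ Icc 1 (min Q0 Q), (q:ℝ)^(-(1/(E:ℝ))) * V q +
      ∑ q ∈ Ioc Q0 Q, (q:ℝ)^(-(1/(E:ℝ))) * V q := by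
    rw [← sum_union]
    · refine sum_le_sum_of_subset_of_nonneg ?_ fun q _ _ => mul_nonneg (by positivity) (hV0 q)
      intro q; rw [mem_union, mem_Icc, mem_Icc, mem_Ioc, le_min_iff]; omega
    · rw [disjoint_left]; intro q; rw [mem_Icc, mem_Ioc, le_min_iff]; omega
  have hsm : ∑ q ∈ Icc 1 (min Q0 Q), (q:ℝ)^(-(1/(E:ℝ))) * V q ≤ Q0 * (8 * σ^2 * N'^2 * (ν1 * N + 4 * N')) := by
    have h0 : 0 ≤ 8 * σ^2 * N'^2 * (ν1 * N + 4 * N') := by positivity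
    calc _ ≤ ∑ q ∈ Icc 1 (min Q0 Q), 8 * σ^2 * N'^2 * (ν1 * N + 4 * N') := by
          refine sum_le_sum fun q hq => ?_
          rw [mem_Icc, le_min_iff] at hq
          have h1 : (q:ℝ)^(-(1/(E:ℝ))) ≤ 1 := Real.rpow_le_one_of_one_le_of_nonpos (by exact_mod_cast hq.1)
            (by have : 0 ≤ 1/(E:ℝ) := by positivity
                linarith)
          have h2 := Vq_small A σ ν1 N N' q L0 hq.1 hσ0.le hν0 (by linarith) hσ hAN (hNI q hq.1 hq.2.2)
            (le_trans (Nat.mul_le_mul_right _ hq.2.2) hQL)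
          calc _ ≤ 1 * V q := mul_le_mul_of_nonneg_right h1 (hV0 q)
            _ ≤ _ := by rw [one_mul]; exact h2
      _ = (min Q0 Q : ℕ) * (8 * σ^2 * N'^2 * (ν1 * N + 4 * N')) := by rw [sum_const, Nat.card_Icc, nsmul_eq_mul]; simp
      _ ≤ _ := mul_le_mul_of_nonneg_right (by exact_mod_cast min_le_left _ _) h0
  have hlg : ∑ q ∈ Ioc Q0 Q, (q:ℝ)^(-(1/(E:ℝ))) * V q ≤ 4 * N * σ^2 * Q^4 + 4 * N * σ^2 * N'^2 * ((Q0:ℝ)^(-((1/(E:ℝ))/2)) * T) := by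
    by_cases hc : Q0 < Q
    · exact core_large A σ (1/(E:ℝ)) T hσ0 N N' Q0 Q (by omega) hNN hQ0 (by positivity) hAN hT0 (hT hc)
    · rw [Ioc_eq_empty hc, sum_empty]; positivity
  have hN0' : (0:ℝ) < N := by exact_mod_cast hN0
  have hN'0 : (0:ℝ) < N' := by exact_mod_cast hN'1
  refine le_of_mul_le_mul_left ?_ (by positivity : 0 < σ^2 * N * (N':ℝ)^2)
  calc σ^2 * N * (N':ℝ)^2 * (1/32) = σ^2 * N * N'^2 / 32 := by ring
    _ ≤ _ := hwin.trans (hsplit.trans (add_le_add hsm hlg))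
    _ = _ := by field_simp; ring

open Finset

def FreeZ (P : Polynomial ℤ) (B : Finset ℤ) : Prop := ∀ a ∈ B, ∀ b ∈ B, a ≠ b → ∀ n : ℕ, 0 < n → a - b ≠ P.eval (n:ℤ)

theorem NI_of (A : Finset ℤ) (σ ν1 : ℝ) (r w L1 : ℕ) (hw : 1 ≤ w)
    (hni : ∀ u : ℤ, ∀ L : ℕ, L1 ≤ L → (#{x ∈ Icc 1 (L:ℤ) | u + ((r * w : ℕ):ℤ) * x ∈ A} : ℝ) ≤ (1 + ν1) * σ * L)
    (u : ℤ) (L : ℕ) (hL : w * (L1 + 1) ≤ L) :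
    (#{x ∈ Icc 1 (L:ℤ) | u + (r:ℤ) * x ∈ A} : ℝ) ≤ (1 + ν1) * σ * L := by
  set A' := {x ∈ Icc 1 (L:ℤ) | u + (r:ℤ) * x ∈ A} with hA'
  rw [card_eq_sum_card_fiberwise (mapsmod w hw A')]
  have hLs : (L:ℝ) = ∑ c ∈ Ico (0:ℤ) w, (#{x ∈ Ioc ((L:ℤ) - L) L | x % w = c} : ℝ) := by
    rw [← Nat.cast_sum, ← card_eq_sum_card_fiberwise (mapsmod w hw _), Int.card_Ioc]; simp
  push_cast
  rw [hLs, mul_sum]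
  refine sum_le_sum fun c hc => ?_
  rw [mem_Ico] at hc
  have h1 := (cls_bds w hw L L L1 c hc.1 hc.2 hL).1
  have h2 := (cls_size w hw ((L:ℤ) - L) L c (by linarith) hc.1 hc.2).2 A'
  set Lc := #{x ∈ Ioc ((L:ℤ) - L) L | x % w = c}
  have h3 := hni (u + r * (c + w * (((L:ℤ) - L - c) / w))) Lc h1
  refine le_trans ?_ h3
  have h4 : {x ∈ A' | x % w = c} = {x ∈ A' | ((L:ℤ) - L < x ∧ x ≤ L) ∧ x % w = c} := by
    refine filter_congr fun x hx => ?_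
    rw [hA', mem_filter, mem_Icc] at hx
    constructor
    · intro h; exact ⟨⟨by linarith [hx.1.1], hx.1.2⟩, h⟩
    · intro h; exact h.2
  rw [h4, h2]
  have : #{x ∈ Icc 1 (Lc:ℤ) | c + w * (((L:ℤ) - L - c) / w) + w * x ∈ A'} ≤
      #{x ∈ Icc 1 (Lc:ℤ) | u + r * (c + w * (((L:ℤ) - L - c) / w)) + ((r * w : ℕ):ℤ) * x ∈ A} := by
    refine card_le_card fun x hx => ?_
    rw [mem_filter] at hx ⊢
    refine ⟨hx.1, ?_⟩
    have h5 := (mem_filter.1 hx.2).2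
    convert h5 using 1
    push_cast; ring
  exact_mod_cast this

theorem exists_M (k c N : ℕ) (hc : 1 ≤ c) (hk : 0 < k) (hN : c ≤ N) : ∃ M : ℕ, 1 ≤ M ∧ c * M^k ≤ N ∧ N < c * (M+1)^k := by
  have hex : ∃ m : ℕ, N < c * (m+1)^k := by
    refine ⟨N, ?_⟩
    calc N < N + 1 := by omega
      _ ≤ (N+1)^k := Nat.le_self_pow (by omega) _
      _ ≤ c * (N+1)^k := Nat.le_mul_of_pos_left _ hc
  classical
  have h1 := Nat.find_spec hex
  have h2 : 1 ≤ Nat.find hex := by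
    by_contra h0
    have : Nat.find hex = 0 := by omega
    rw [this] at h1; simp at h1; omega
  refine ⟨Nat.find hex, h2, ?_, h1⟩
  have h3 := Nat.find_min hex (m := Nat.find hex - 1) (by omega)
  push Not at h3
  rwa [Nat.sub_add_cancel h2] at h3

theorem Dat.free_of {k : ℕ} {h : Polynomial ℤ} {z : ∀ (p : ℕ) [Fact p.Prime], ℤ_[p]} {lam : ℕ → ℕ} {r : ℕ → ℤ} {H : ℕ → Polynomial ℤ}
    (D : Dat k h z lam r H) (d q : ℕ) (hd : 0 < d) (hq : 0 < q) (A : Finset ℤ) (hA : FreeZ (H d) A) (u : ℤ) (L : ℕ) :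
    FreeZ (H (q * d)) {x ∈ Icc 1 (L:ℤ) | u + (lam q : ℤ) * x ∈ A} := by
  intro a ha b hb hab n hn he
  rw [mem_filter] at ha hb
  obtain ⟨m, hm, hm2⟩ := D.descent q d hq hd n hn
  have hl : (0:ℤ) < lam q := by exact_mod_cast (D.lam_props q hq).1
  refine hA _ ha.2 _ hb.2 ?_ m hm ?_
  · intro h0
    have : (lam q : ℤ) * a = lam q * b := by linarith
    exact hab (mul_left_cancel₀ hl.ne' this)
  · rw [hm2, ← he]; ring

theorem Dat.dich {k : ℕ} {h : Polynomial ℤ} {z : ∀ (p : ℕ) [Fact p.Prime], ℤ_[p]} {lam : ℕ → ℕ} {r : ℕ → ℤ} {H : ℕ → Polynomial ℤ}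
    (D : Dat k h z lam r H) : ∃ E C0 : ℕ, 1 ≤ E ∧ 1 ≤ C0 ∧ ∀ (d N N' Q0 X L1 : ℕ) (σ ν1 T : ℝ) (A : Finset ℤ),
      0 < d → A ⊆ Icc 1 (N:ℤ) → (#A : ℝ) = σ * N → 0 < σ → FreeZ (H d) A →
      2 ≤ X → 4 / σ ≤ X → C0 * X^(E*k) * d^(2*k^2) ≤ N → C0 * X^E * N' ≤ N → 0 ≤ ν1 → ν1 ≤ 1/3 →
      X^E * ((X^E)^k * (L1 + 1) + 1) ≤ N' → 1 ≤ Q0 → 0 ≤ T →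
      (Q0 < X^E → σ ≤ 1 ∧ ∃ m : ℕ, ∃ Y : ℝ, 1 ≤ m ∧ X^E*(2*(X^E)^3)^(2*m) ≤ N' ∧ 1 ≤ Y ∧ 8 * Y * σ^(-(1/(m:ℝ))) ≤ T ∧
        ∀ q : ℕ, 1 ≤ q → q ≤ X^E → (8:ℝ)^(m*#q.primeFactors)*(#q.divisors:ℝ)^2*(#q.divisors:ℝ)^m*(#q.divisors:ℝ)^2*(q:ℝ)^(-((1/(E:ℝ))/2)) ≤ Y) →
      (∃ q : ℕ, 1 ≤ q ∧ q ≤ X^E ∧ ∃ L : ℕ, L1 ≤ L ∧ ∃ B ⊆ Icc 1 (L:ℤ), FreeZ (H (q * d)) B ∧ (1 + ν1) * σ * L < #B) ∨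
      1/32 ≤ 8 * Q0 * (ν1 + 4 * N' / N) + 4 * (X^E : ℕ)^4 / (N':ℝ)^2 + 4 * ((Q0:ℝ)^(-((1/(E:ℝ))/2)) * T) := by
  obtain ⟨E, K, hE, hK, hcore⟩ := D.core
  set lc := h.leadingCoeff.toNat with hlc
  have hlc0 : (lc:ℤ) = h.leadingCoeff := Int.toNat_of_nonneg D.hlead.le
  have hlc1 : 1 ≤ lc := by have := D.hlead; omega
  have hk := D.hk
  refine ⟨E, 32 * K * lc * (4*k)^k + 14 * 32 * K * 2^k, hE, ?_, ?_⟩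
  · have : 1 ≤ 14 * 32 * K * 2^k := Nat.one_le_iff_ne_zero.2 (by positivity)
    omega
  intro d N N' Q0 X L1 σ ν1 T A hd hAN hσ hσ0 hfree hX hX4 hc1 hc2 hν0 hν1 hL hQ0 hT0 hT
  by_contra hcon
  push Not at hcon
  obtain ⟨hninc, hbd⟩ := hcon
  set Q := X^E with hQ
  have hQ1 : 1 ≤ Q := Nat.one_le_pow _ _ (by omega)
  have hXQ : X ≤ Q := Nat.le_self_pow (by omega) _
  obtain ⟨b, hb⟩ : ∃ b : ℕ, (b:ℤ) = (H d).coeff k := ⟨((H d).coeff k).toNat, Int.toNat_of_nonneg (D.b_pos d hd).le⟩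
  have hb1 : 1 ≤ b := by have := D.b_pos d hd; omega
  have hble : b ≤ lc * d^k := by
    have := D.b_le d hd
    rw [← hb, ← hlc0] at this; exact_mod_cast this
  have hdk : d^k * (d^k)^k ≤ d^(2*k^2) := by
    rw [← pow_mul, ← pow_add]
    exact Nat.pow_le_pow_right hd (by nlinarith)
  have hmain : 32 * K * b * (4 * k * Q * d^k)^k ≤ N := by
    calc 32 * K * b * (4 * k * Q * d^k)^k ≤ 32 * K * (lc * d^k) * (4 * k * Q * d^k)^k := by gcongr
      _ = (32 * K * lc * (4*k)^k) * Q^k * (d^k * (d^k)^k) := by rw [mul_pow, mul_pow]; ring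
      _ ≤ (32 * K * lc * (4*k)^k + 14 * 32 * K * 2^k) * Q^k * d^(2*k^2) := by gcongr; omega
      _ ≤ N := by rw [hQ, ← pow_mul]; exact hc1
  have hWk : 1 ≤ (4 * k * Q * d^k)^k := Nat.one_le_iff_ne_zero.2 (by positivity)
  obtain ⟨M, hM1, hM2, hM3⟩ := exists_M k (32 * K * b) N (Nat.one_le_iff_ne_zero.2 (by positivity)) hk
    (le_trans (Nat.le_mul_of_pos_right _ hWk) hmain)
  have hMW : 4 * k * Q * d^k ≤ M := by
    by_contra hlt
    push Not at hlt
    have h1 : (M+1)^k ≤ (4 * k * Q * d^k)^k := Nat.pow_le_pow_left (by omega) k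
    have h2 : 32 * K * b * (M+1)^k ≤ 32 * K * b * (4 * k * Q * d^k)^k := Nat.mul_le_mul_left _ h1
    omega
  have hdk1 : 1 ≤ d^k := Nat.one_le_pow _ _ hd
  have hXM : Q * d^k ≤ M := by
    refine le_trans ?_ hMW
    have : 1 ≤ 4 * k := by omega
    calc Q * d^k = 1 * (Q * d^k) := by ring
      _ ≤ 4 * k * (Q * d^k) := Nat.mul_le_mul_right _ this
      _ = _ := by ring
  have hkM : 4 * (k:ℝ) ≤ σ * M := by
    have h1 : k * X ≤ M := by
      refine le_trans ?_ hMW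
      calc k * X ≤ k * Q := Nat.mul_le_mul_left _ hXQ
        _ ≤ (k * Q) * (4 * d^k) := Nat.le_mul_of_pos_right _ (by omega)
        _ = _ := by ring
    have h1' : (k:ℝ) * X ≤ M := by exact_mod_cast h1
    rw [div_le_iff₀ hσ0] at hX4
    calc 4 * (k:ℝ) ≤ k * (X * σ) := by nlinarith [(Nat.cast_nonneg k : (0:ℝ) ≤ k)]
      _ = σ * (k * X) := by ring
      _ ≤ _ := by gcongr
  have hN'M : 14 * Q * N' ≤ b * M^k := by
    have h1 : (M+1)^k ≤ 2^k * M^k := by rw [← mul_pow]; exact Nat.pow_le_pow_left (by omega) k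
    have h2 : N < 32 * K * 2^k * (b * M^k) := by
      calc N < 32 * K * b * (M+1)^k := hM3
        _ ≤ 32 * K * b * (2^k * M^k) := Nat.mul_le_mul_left _ h1
        _ = _ := by ring
    have h3 : 32 * K * 2^k * (14 * Q * N') ≤ N := by
      refine le_trans ?_ hc2
      calc 32 * K * 2^k * (14 * Q * N') = 14 * 32 * K * 2^k * Q * N' := by ring
        _ ≤ _ := by gcongr; omega
    exact (Nat.lt_of_mul_lt_mul_left (h3.trans_lt h2)).le
  set L0 := Q^k * (L1 + 1) with hL0
  have hQk : 1 ≤ Q^k := Nat.one_le_pow _ _ hQ1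
  have hL01 : 1 ≤ L0 := Nat.one_le_iff_ne_zero.2 (by positivity)
  have hNI : ∀ q : ℕ, 1 ≤ q → q ≤ Q → ∀ u : ℤ, ∀ L : ℕ, L0 ≤ L → (#{x ∈ Icc 1 (L:ℤ) | u + q * x ∈ A} : ℝ) ≤ (1 + ν1) * σ * L := by
    intro q hq1 hqQ u L hLL
    obtain ⟨l1, ⟨w, hw⟩, l3⟩ := D.lam_props q hq1
    have hw1 : 1 ≤ w := by
      rcases Nat.eq_zero_or_pos w with h0 | h0
      · rw [h0] at hw; omega
      · exact h0
    have hwQ : w ≤ Q^k := by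
      have h1 : lam q ≤ q^k := D.lam_le q hq1
      have h2 : q^k ≤ Q^k := Nat.pow_le_pow_left hqQ k
      have h3 : w ≤ lam q := by rw [hw]; exact Nat.le_mul_of_pos_left _ hq1
      omega
    refine NI_of A σ ν1 q w L1 hw1 ?_ u L (le_trans (Nat.mul_le_mul_right _ hwQ) hLL)
    intro u L hL1
    rw [← hw]
    exact hninc q hq1 hqQ L hL1 _ (filter_subset _ _) (D.free_of d q hd hq1 A hfree u L)
  have := hcore d N M N' Q0 X L0 b σ ν1 T A hd hAN hσ hσ0 hfree hX hX4 hXM hM1 hb (by rw [← mul_assoc, ← mul_assoc]; exact hM2) hN'M hkM hν0 hν1 hL01 hL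
    hQ0 hT0 hNI (by
      intro hQQ s
      obtain ⟨hσ1, m, Y, hm, hQm, hY1, hYT, hY⟩ := hT hQQ
      exact (T_from_partE A σ ν1 _ Y N' Q L0 m hm hQ1 hσ0 hσ1 hν0 hν1 hNI hL01 hL hQm (by positivity) hY1 hY s).trans hYT)
  linarith

open Finset

theorem hc1_of (a d K N k : ℕ) (h1 : a^4 * K ≤ N^3) (h2 : d^(8*k^2) ≤ K * N) : a * d^(2*k^2) ≤ N := by
  have h3 : (a * d^(2*k^2))^4 ≤ N^4 := by
    calc (a * d^(2*k^2))^4 = a^4 * d^(8*k^2) := by rw [mul_pow, ← pow_mul]; congr 2; ring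
      _ ≤ a^4 * (K * N) := by gcongr
      _ = (a^4 * K) * N := by ring
      _ ≤ N^3 * N := by gcongr
      _ = N^4 := by ring
  exact le_of_pow_le_pow_left₀ (by norm_num) (Nat.zero_le _) h3

set_option maxHeartbeats 600000 in
theorem Dat.iter {k : ℕ} {h : Polynomial ℤ} {z : ∀ (p : ℕ) [Fact p.Prime], ℤ_[p]} {lam : ℕ → ℕ} {r : ℕ → ℤ} {H : ℕ → Polynomial ℤ}
    (D : Dat k h z lam r H) : ∃ ν0 : ℝ, 0 < ν0 ∧ ∀ s t : ℝ, 1/3 ≤ t → s ≤ (1 + ν0) * t →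
      (∀ K1 : ℕ, ∃ N0 : ℕ, ∀ N : ℕ, N0 ≤ N → ∀ d : ℕ, 0 < d → d^(8*k^2) ≤ K1 * N → ∀ A : Finset ℤ, A ⊆ Icc 1 (N:ℤ) → FreeZ (H d) A → (#A:ℝ) < s * N) →
      (∀ K1 : ℕ, ∃ N0 : ℕ, ∀ N : ℕ, N0 ≤ N → ∀ d : ℕ, 0 < d → d^(8*k^2) ≤ K1 * N → ∀ A : Finset ℤ, A ⊆ Icc 1 (N:ℤ) → FreeZ (H d) A → (#A:ℝ) < t * N) := by
  obtain ⟨E, C0, hE, hC0, hd⟩ := D.dich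
  obtain ⟨Q, hQ⟩ : ∃ Q : ℕ, Q = 12^E := ⟨_, rfl⟩
  have hQ1 : 1 ≤ Q := hQ ▸ Nat.one_le_pow _ _ (by norm_num)
  have hQR : (1:ℝ) ≤ Q := by exact_mod_cast hQ1
  refine ⟨1/(2000*Q), by positivity, ?_⟩
  intro s t hs hst hP K1
  set ν0 : ℝ := 1/(2000*Q) with hν0
  have hν : 0 < ν0 := by positivity
  obtain ⟨c1, hc1⟩ : ∃ c : ℕ, c = C0 * 20000 * Q := ⟨_, rfl⟩
  have hc1p : 0 < c1 := by rw [hc1]; positivity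
  obtain ⟨M0, hM0⟩ := hP (Q^(8*k^2) * K1 * (16 * c1 * Q^(k+1)))
  refine ⟨2 * c1 * (100*Q^2 + 4*Q^(k+1)*(M0+1)) + (C0*Q^k)^4*K1 + 1, ?_⟩
  intro N hN d hd0 hdN A hA hF
  by_contra hcon
  push Not at hcon
  have hN1 : 1 ≤ N := by omega
  have hNR : (1:ℝ) ≤ N := by exact_mod_cast hN1
  set σ : ℝ := (#A:ℝ)/N with hσ
  have hσs : t ≤ σ := by rw [hσ, le_div_iff₀ (by linarith)]; exact hcon
  have hσ0 : 0 < σ := by linarith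
  have hσe : (#A:ℝ) = σ * N := by rw [hσ]; field_simp
  obtain ⟨N', hN'⟩ : ∃ n : ℕ, n = N / c1 := ⟨_, rfl⟩
  have hQk : 1 ≤ Q^(k+1) := Nat.one_le_pow _ _ hQ1
  have e1 : 100*Q^2 + 4*Q^(k+1)*(M0+1) ≤ N' := by
    rw [hN', Nat.le_div_iff_mul_le hc1p]
    linarith [Nat.zero_le ((C0*Q^k)^4*K1), Nat.zero_le (c1*(100*Q^2 + 4*Q^(k+1)*(M0+1)))]
  have e2 : c1 * N' ≤ N := by rw [hN']; exact Nat.mul_div_le N c1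
  have e3 : N < c1 * (N' + 1) := by rw [hN']; exact Nat.lt_mul_div_succ N hc1p
  obtain ⟨L1, hL1⟩ : ∃ n : ℕ, n = N' / (4*Q^(k+1)) := ⟨_, rfl⟩
  have f0 : 0 < 4*Q^(k+1) := by positivity
  have f1 : M0 + 1 ≤ L1 := by
    rw [hL1, Nat.le_div_iff_mul_le f0]; linarith [Nat.zero_le (Q^2)]
  have f2 : 4*Q^(k+1) * L1 ≤ N' := by rw [hL1]; exact Nat.mul_div_le _ _
  have f3 : N' < 4*Q^(k+1) * (L1+1) := by rw [hL1]; exact Nat.lt_mul_div_succ _ f0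
  have hL : Q * (Q^k * (L1+1) + 1) ≤ N' := by
    have g1 : Q * (Q^k * (L1+1) + 1) = Q^(k+1) * (L1+1) + Q := by ring
    have g2 : Q ≤ Q^(k+1) := Nat.le_self_pow (by omega) _
    rw [g1]; linarith [Nat.mul_le_mul_left (Q^(k+1)) (show 1 ≤ L1 by omega)]
  have hNc : N ≤ (16 * c1 * Q^(k+1)) * L1 := by
    have g1 : N' + 1 ≤ 2 * N' := by linarith [Nat.zero_le (Q^2), Nat.zero_le (Q^(k+1)*M0)]
    have g2 : L1 + 1 ≤ 2 * L1 := by omega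
    calc N ≤ c1 * (N'+1) := e3.le
      _ ≤ c1 * (2 * N') := by gcongr
      _ ≤ c1 * (2 * (4*Q^(k+1) * (2*L1))) := by
        have : N' ≤ 4*Q^(k+1) * (2*L1) := f3.le.trans (by gcongr)
        gcongr
      _ = _ := by ring
  have hXc : C0 * 12^(E*k) * d^(2*k^2) ≤ N := by
    refine hc1_of _ d K1 N k ?_ hdN
    rw [pow_mul, ← hQ]
    calc (C0*Q^k)^4*K1 ≤ N := by omega
      _ ≤ N^3 := Nat.le_self_pow (by norm_num) _
  have hres := hd d N N' Q 12 L1 σ ν0 0 A hd0 hA hσe hσ0 hF (by norm_num)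
    (by rw [div_le_iff₀ hσ0]; push_cast; linarith) hXc
    (by rw [← hQ]; refine le_trans ?_ e2; rw [hc1]; linarith [Nat.zero_le (C0*Q*N')]) hν.le
    (by rw [hν0, div_le_div_iff₀ (by positivity) (by norm_num)]; linarith) (by rw [← hQ]; exact hL) hQ1 le_rfl
    (by rw [← hQ]; intro hh; omega)
  rw [← hQ] at hres
  rcases hres with ⟨q, hq1, hq2, L, hL2, B, hB, hBF, hBc⟩ | hbad
  · have hdN2 : (q*d)^(8*k^2) ≤ (Q^(8*k^2) * K1 * (16 * c1 * Q^(k+1))) * L := by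
      calc (q*d)^(8*k^2) = q^(8*k^2) * d^(8*k^2) := mul_pow _ _ _
        _ ≤ Q^(8*k^2) * (K1 * N) := Nat.mul_le_mul (Nat.pow_le_pow_left hq2 _) hdN
        _ ≤ Q^(8*k^2) * (K1 * ((16 * c1 * Q^(k+1)) * L)) := by
          exact Nat.mul_le_mul_left _ (Nat.mul_le_mul_left _ (hNc.trans (Nat.mul_le_mul_left _ hL2)))
        _ = _ := by ring
    have h1 := hM0 L (by omega) (q*d) (by positivity) hdN2 B hB hBF
    have h2 : s ≤ (1+ν0)*σ := by
      refine hst.trans ?_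
      gcongr
    have : s * L ≤ (1+ν0)*σ*L := by gcongr
    linarith
  · have e2R : (c1:ℝ) * N' ≤ N := by exact_mod_cast e2
    have hN'R : 100*(Q:ℝ)^2 ≤ N' := by
      have : 100*Q^2 ≤ N' := by linarith [Nat.zero_le (4*Q^(k+1)*(M0+1))]
      exact_mod_cast this
    have hN'p : (0:ℝ) < N' := by linarith [one_le_pow₀ hQR (n := 2)]
    have g1 : 8 * (Q:ℝ) * ν0 = 1/250 := by rw [hν0]; field_simp; norm_num
    have g2 : 8 * (Q:ℝ) * (4 * N' / N) ≤ 1/250 := by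
      rw [← mul_div_assoc, div_le_iff₀ (by linarith)]
      have : (20000:ℝ) * Q ≤ c1 := by
        have : 20000 * Q ≤ c1 := by rw [hc1]; linarith [Nat.mul_le_mul_right Q hC0]
        exact_mod_cast this
      linarith [mul_le_mul_of_nonneg_right this hN'p.le]
    have g3 : 4 * (Q:ℝ)^4 / (N':ℝ)^2 ≤ 1/250 := by
      rw [div_le_iff₀ (by positivity)]
      have : (100*(Q:ℝ)^2)^2 ≤ (N':ℝ)^2 := by gcongr
      linarith [sq_nonneg ((Q:ℝ)^2)]
    have : 8 * (Q:ℝ) * (ν0 + 4 * N' / N) = 8 * Q * ν0 + 8 * Q * (4 * N' / N) := by ring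
    rw [this] at hbad
    simp only [mul_zero, add_zero] at hbad
    linarith

theorem Dat.big {k : ℕ} {h : Polynomial ℤ} {z : ∀ (p : ℕ) [Fact p.Prime], ℤ_[p]} {lam : ℕ → ℕ} {r : ℕ → ℤ} {H : ℕ → Polynomial ℤ}
    (D : Dat k h z lam r H) : ∃ N0 : ℕ, ∀ N : ℕ, N0 ≤ N → ∀ d : ℕ, 0 < d → d^(8*k^2) ≤ N → ∀ A : Finset ℤ, A ⊆ Icc 1 (N:ℤ) → FreeZ (H d) A → (#A:ℝ) < Real.exp (-1) * N := by
  obtain ⟨ν0, hν, hst⟩ := D.iter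
  have he : (1:ℝ)/3 ≤ Real.exp (-1) := by
    rw [Real.exp_neg, ← one_div]
    apply one_div_le_one_div_of_le (Real.exp_pos _)
    linarith [Real.exp_one_lt_d9]
  have key : ∀ n : ℕ, (∀ K1 : ℕ, ∃ N0 : ℕ, ∀ N : ℕ, N0 ≤ N → ∀ d : ℕ, 0 < d → d^(8*k^2) ≤ K1 * N → ∀ A : Finset ℤ, A ⊆ Icc 1 (N:ℤ) → FreeZ (H d) A → (#A:ℝ) < (max (Real.exp (-1)) (2/(1+ν0)^n)) * N) := by
    intro n
    induction n with
    | zero =>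
      intro K1
      refine ⟨1, fun N hN d _ _ A hA _ => ?_⟩
      have h1 := card_le_card hA
      rw [Int.card_Icc] at h1
      have h2 : #A ≤ N := by omega
      have h3 : (#A:ℝ) ≤ N := by exact_mod_cast h2
      have h4 : (1:ℝ) ≤ N := by exact_mod_cast hN
      have h5 : (2:ℝ) ≤ max (Real.exp (-1)) (2/(1+ν0)^0) := by simp
      nlinarith
    | succ n ih =>
      refine hst _ _ (he.trans (le_max_left _ _)) ?_ ih
      refine max_le ?_ ?_
      · have : Real.exp (-1) ≤ max (Real.exp (-1)) (2/(1+ν0)^(n+1)) := le_max_left _ _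
        nlinarith [Real.exp_pos (-1)]
      · have : 2/(1+ν0)^(n+1) ≤ max (Real.exp (-1)) (2/(1+ν0)^(n+1)) := le_max_right _ _
        calc 2/(1+ν0)^n = (1+ν0) * (2/(1+ν0)^(n+1)) := by field_simp; ring
          _ ≤ _ := by gcongr
  obtain ⟨n, hn⟩ := pow_unbounded_of_one_lt 6 (show 1 < 1 + ν0 by linarith)
  obtain ⟨N0, hN0⟩ := key n 1
  refine ⟨N0, fun N hN d h1 h2 A h3 h4 => ?_⟩
  have := hN0 N hN d h1 (by simpa using h2) A h3 h4
  rwa [max_eq_left] at this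
  refine le_trans ?_ he
  rw [div_le_iff₀ (by positivity)]; linarith

open Finset

theorem ev_params (E C0 k : ℕ) (hE : 1 ≤ E) (hC0 : 1 ≤ C0) : ∃ u0 : ℝ, ∀ u : ℝ, u0 ≤ u →
    3 ≤ u ∧ 1 ≤ Real.log u ∧
    Real.log (2*C0^2) + u/2 + (8*(Real.log u + 1) + 2*k + 5) * (3*E*(u*Real.log u)) ≤ Real.exp u ∧
    256*E*Real.exp (16*E)*(Real.log u + 1)^2 * Real.exp (Real.log u/2) ≤ u/(40*E) ∧
    32 * Real.exp (-(3*u/(40*E))) ≤ 1/500 ∧ 80 * Real.exp (-(u/4)) ≤ 1/500 := by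
  have hER : (1:ℝ) ≤ E := by exact_mod_cast hE
  have hCR : (1:ℝ) ≤ C0 := by exact_mod_cast hC0
  set W : ℝ := 48*4*256*40*E^2*Real.exp (16*E) with hW
  set K : ℝ := 24*(Real.log (2*C0^2) + 1 + (21+2*k)*3*E) with hK
  have hlc : 0 ≤ Real.log (2*C0^2) := Real.log_nonneg (by nlinarith)
  have hk0 : (0:ℝ) ≤ k := Nat.cast_nonneg k
  refine ⟨Real.exp W + K + 1000000*E, fun u hu => ?_⟩
  have hWp : 0 < W := by positivity
  have hKp : 24 ≤ K := by
    have : 0 ≤ (21+2*(k:ℝ))*3*E := by positivity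
    rw [hK]; linarith
  have hexpW := Real.exp_pos W
  have hu1 : 1000000*E ≤ u := by linarith
  have hu3 : 3 ≤ u := by linarith
  have huW : W ≤ Real.log u := by
    rw [Real.le_log_iff_exp_le (by linarith)]; linarith
  have huK : K ≤ u := by linarith
  have hexp16 : 1 ≤ Real.exp (16*(E:ℝ)) := Real.one_le_exp (by positivity)
  have hW1 : 1 ≤ W := by
    rw [hW]; nlinarith [mul_le_mul hexp16 (one_le_pow₀ hER (n := 2)) zero_le_one (by linarith)]
  set w := Real.log u with hw
  have hw1 : 1 ≤ w := by linarith
  have hwu : w ≤ u := by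
    have := Real.log_le_sub_one_of_pos (show 0 < u by linarith); linarith
  have huexp : u = Real.exp w := by rw [hw, Real.exp_log (by linarith)]
  refine ⟨hu3, hw1, ?_, ?_, ?_, ?_⟩
  · have h4 := Real.pow_div_factorial_le_exp u (by linarith) 4
    have h4' : u^4/24 ≤ Real.exp u := by simpa [Nat.factorial] using h4
    refine le_trans ?_ h4'
    have h1 : u * w ≤ u^2 := by nlinarith
    have h2 : 8*(w+1)+2*k+5 ≤ (21+2*k)*u := by nlinarith
    have h3 : (8*(w+1)+2*k+5) * (3*E*(u*w)) ≤ ((21+2*k)*u) * (3*E*u^2) := by gcongr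
    have h5 : u ≤ u^3 := le_self_pow₀ (by linarith) (by norm_num)
    have h6 : 1 ≤ u^3 := by linarith
    have h7 : K * u^3 ≤ u * u^3 := by gcongr
    rw [hK] at h7
    have h8 : Real.log (2*C0^2) * 1 ≤ Real.log (2*C0^2) * u^3 := by gcongr
    nlinarith
  · have h1 := Real.pow_div_factorial_le_exp (w/2) (by linarith) 3
    have h1' : w^3/48 ≤ Real.exp (w/2) := by
      refine le_trans (le_of_eq ?_) h1
      simp [Nat.factorial]; ring
    have h2 : (w+1)^2 ≤ 4*w^2 := by nlinarith
    have h3 : W * (w^2) ≤ w * w^2 := by gcongr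
    have h4 : 256*E*Real.exp (16*E)*(w+1)^2*(40*E) ≤ Real.exp (w/2) := by
      calc 256*E*Real.exp (16*E)*(w+1)^2*(40*E) ≤ 256*E*Real.exp (16*E)*(4*w^2)*(40*E) := by gcongr
        _ = W * w^2 / 48 := by rw [hW]; ring
        _ ≤ w^3/48 := by linarith
        _ ≤ _ := h1'
    rw [le_div_iff₀ (by positivity)]
    calc 256*E*Real.exp (16*E)*(w+1)^2*Real.exp (w/2)*(40*E) = (256*E*Real.exp (16*E)*(w+1)^2*(40*E)) * Real.exp (w/2) := by ring
      _ ≤ Real.exp (w/2) * Real.exp (w/2) := by gcongr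
      _ = u := by rw [← Real.exp_add, huexp]; ring_nf
  · rw [Real.exp_neg, ← div_eq_mul_inv, div_le_div_iff₀ (Real.exp_pos _) (by norm_num)]
    have := Real.add_one_le_exp (3*u/(40*E))
    have h2 : 16000 ≤ 3*u/(40*E) := by rw [le_div_iff₀ (by positivity)]; linarith
    linarith
  · rw [Real.exp_neg, ← div_eq_mul_inv, div_le_div_iff₀ (Real.exp_pos _) (by norm_num)]
    have := Real.add_one_le_exp (u/4)
    linarith

open Finset

theorem Y_bound (E m : ℕ) (u w : ℝ) (hE : 1 ≤ E) (hm1 : 1 ≤ m) (hw : 1 ≤ w) (hm : (m:ℝ) ≤ w/(32*E) + 1)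
    (hc : 256*E*Real.exp (16*E)*(w + 1)^2 * Real.exp (w/2) ≤ u/(40*E)) :
    (2 * ((8*m : ℕ):ℝ) / ((1/(E:ℝ))/2))^(8*m*2^(16*m*E)) ≤ Real.exp (u/(40*E)) := by
  have hER : (1:ℝ) ≤ E := by exact_mod_cast hE
  have hmR : (1:ℝ) ≤ m := by exact_mod_cast hm1
  have hb : 2 * ((8*m : ℕ):ℝ) / ((1/(E:ℝ))/2) = 32*m*E := by push_cast; field_simp; norm_num
  rw [hb]
  have h1 : (32*m*E:ℝ) ≤ Real.exp (32*m*E) := by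
    have := Real.add_one_le_exp (32*m*E:ℝ); linarith
  have h2 : ((2:ℝ)^(16*m*E)) ≤ Real.exp (16*E) * Real.exp (w/2) := by
    calc ((2:ℝ)^(16*m*E)) ≤ (Real.exp 1)^(16*m*E) := by
          gcongr; linarith [Real.exp_one_gt_d9]
      _ = Real.exp (16*m*E) := by rw [← Real.exp_nat_mul]; push_cast; ring_nf
      _ ≤ Real.exp (16*E + w/2) := by
          apply Real.exp_le_exp.2
          calc (16*m*E:ℝ) ≤ 16*(w/(32*E)+1)*E := by gcongr
            _ = 16*E + w/2 := by field_simp; ring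
      _ = _ := Real.exp_add _ _
  have h3 : (m:ℝ) ≤ w + 1 := by
    have : w/(32*E) ≤ w := div_le_self (by linarith) (by linarith)
    linarith
  calc (32*m*E:ℝ)^(8*m*2^(16*m*E)) ≤ (Real.exp (32*m*E))^(8*m*2^(16*m*E)) := by gcongr
    _ = Real.exp (256*E*m^2*(2:ℝ)^(16*m*E)) := by rw [← Real.exp_nat_mul]; push_cast; ring_nf
    _ ≤ Real.exp (u/(40*E)) := by
        apply Real.exp_le_exp.2
        refine le_trans ?_ hc
        calc 256*E*m^2*(2:ℝ)^(16*m*E) ≤ 256*E*(w+1)^2*(Real.exp (16*E) * Real.exp (w/2)) := by gcongr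
          _ = _ := by ring

/-- all the size conditions from one inequality -/
theorem sizes (C0 Q k m N : ℕ) (R : ℝ) (hC0 : 1 ≤ C0) (hQ : 8 ≤ Q) (hm : 1 ≤ m) (hR : 1 ≤ R)
    (hbig : 2*C0^2*R*(Q:ℝ)^(8*m+2*k+5) ≤ N) :
    ∃ N' L1 : ℕ, C0 * Q * N' ≤ N ∧ (N':ℝ)/N ≤ 1/R ∧ Q * (Q^k * (L1+1)+1) ≤ N' ∧ Q*(2*Q^3)^(2*m) ≤ N' ∧
      4*(Q:ℝ)^4/(N':ℝ)^2 ≤ 1/500 ∧ 0 < L1 ∧ (1/(16*C0)) * N / R / (Q:ℝ)^(k+2) ≤ L1 ∧ (C0*Q^k)^4 ≤ N^3 := by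
  have hCR : (1:ℝ) ≤ C0 := by exact_mod_cast hC0
  have hQR : (8:ℝ) ≤ Q := by exact_mod_cast hQ
  have hQ1 : (1:ℝ) ≤ Q := by linarith
  have hpow : (1:ℝ) ≤ (Q:ℝ)^(8*m+2*k+5) := one_le_pow₀ hQ1
  have hN : (1:ℝ) ≤ N := by
    refine le_trans ?_ hbig
    have : (1:ℝ) ≤ C0^2 := one_le_pow₀ hCR
    have h2 : (1:ℝ) ≤ C0^2*R := one_le_mul_of_one_le_of_one_le this hR
    have h3 := one_le_mul_of_one_le_of_one_le h2 hpow
    nlinarith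
  set x : ℝ := N/(C0*Q*R) with hx
  have hx0 : 0 < C0*Q*R := by positivity
  have hxb : 2*(Q:ℝ)^(8*m+k+4) ≤ x := by
    rw [hx, le_div_iff₀ hx0]
    refine le_trans ?_ hbig
    calc 2*(Q:ℝ)^(8*m+k+4) * (C0*Q*R) = 2*C0*R*(Q:ℝ)^(8*m+k+5) := by ring
      _ ≤ 2*C0^2*R*(Q:ℝ)^(8*m+2*k+5) := by
        have h1 : (Q:ℝ)^(8*m+k+5) ≤ (Q:ℝ)^(8*m+2*k+5) := pow_le_pow_right₀ hQ1 (by omega)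
        have h2 : (C0:ℝ) ≤ C0^2 := le_self_pow₀ hCR (by norm_num)
        gcongr
  have hP1 : (1:ℝ) ≤ (Q:ℝ)^(8*m+k+4) := one_le_pow₀ hQ1
  obtain ⟨N', hN'⟩ : ∃ n : ℕ, n = ⌊x⌋₊ := ⟨_, rfl⟩
  have hxp : 0 ≤ x := by linarith
  have a1 : (N':ℝ) ≤ x := by rw [hN']; exact Nat.floor_le hxp
  have a2 : x < N' + 1 := by rw [hN']; exact Nat.lt_floor_add_one x
  have a3 : x/2 ≤ N' := by linarith
  have a4 : (Q:ℝ)^(8*m+k+4) ≤ N' := by linarith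
  have a4' : Q^(8*m+k+4) ≤ N' := by exact_mod_cast a4
  have hf : 0 < 4*Q^(k+1) := by positivity
  obtain ⟨L1, hL1⟩ : ∃ n : ℕ, n = N'/(4*Q^(k+1)) := ⟨_, rfl⟩
  have f2 : 4*Q^(k+1) * L1 ≤ N' := by rw [hL1]; exact Nat.mul_div_le _ _
  have f3 : N' < 4*Q^(k+1) * (L1+1) := by rw [hL1]; exact Nat.lt_mul_div_succ _ hf
  have f4 : 4*Q^(k+1) ≤ N' := by
    refine le_trans ?_ a4'
    calc 4*Q^(k+1) ≤ Q * Q^(k+1) := by gcongr; omega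
      _ = Q^(k+2) := by ring
      _ ≤ _ := Nat.pow_le_pow_right (by omega) (by omega)
  have f1 : 1 ≤ L1 := by
    rw [hL1, Nat.le_div_iff_mul_le hf]; omega
  have hxR : x * (C0*Q*R) = N := by rw [hx]; field_simp
  have hR1 : x * (C0*Q) * R = N := by rw [← hxR]; ring
  refine ⟨N', L1, ?_, ?_, ?_, ?_, ?_, f1, ?_, ?_⟩
  · have : (C0:ℝ)*Q*N' ≤ N := by
      calc (C0:ℝ)*Q*N' ≤ C0*Q*x := by gcongr
        _ = (x*(C0*Q))*1 := by ring
        _ ≤ (x*(C0*Q))*R := by gcongr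
        _ = N := hR1
    exact_mod_cast this
  · rw [div_le_div_iff₀ (by linarith) (by linarith), ← hR1]
    have : (1:ℝ) ≤ C0*Q := one_le_mul_of_one_le_of_one_le hCR hQ1
    calc N' * R ≤ x * R := by gcongr
      _ = 1 * (x * 1 * R) := by ring
      _ ≤ 1 * (x * (C0*Q) * R) := by gcongr
  · have g1 : Q * (Q^k * (L1+1) + 1) = Q^(k+1) * L1 + Q^(k+1) + Q := by ring
    have g2 : Q ≤ Q^(k+1) := Nat.le_self_pow (by omega) _
    have g3 : Q^(k+1) * 1 ≤ Q^(k+1) * L1 := Nat.mul_le_mul_left _ f1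
    rw [g1]
    have g4 : 4*Q^(k+1)*L1 = 4*(Q^(k+1)*L1) := by ring
    omega
  · refine le_trans ?_ a4'
    calc Q*(2*Q^3)^(2*m) ≤ Q*(Q*Q^3)^(2*m) := by gcongr; omega
      _ = Q^(8*m+1) := by
        rw [show Q*Q^3 = Q^4 by ring, ← pow_mul, ← pow_succ']; congr 1; ring
      _ ≤ _ := Nat.pow_le_pow_right (by omega) (by omega)
  · have hN'0 : (0:ℝ) < N' := by linarith
    rw [div_le_iff₀ (by positivity)]
    have h1 : (Q:ℝ)^4 ≤ N' := le_trans (pow_le_pow_right₀ hQ1 (by omega)) a4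
    have h2 : (Q:ℝ)^8 ≤ (N':ℝ)^2 := by
      calc (Q:ℝ)^8 = ((Q:ℝ)^4)^2 := by ring
        _ ≤ _ := by gcongr
    have h3 : (8:ℝ)^4 * (Q:ℝ)^4 ≤ (Q:ℝ)^8 := by
      calc (8:ℝ)^4 * (Q:ℝ)^4 ≤ (Q:ℝ)^4 * (Q:ℝ)^4 := by gcongr
        _ = _ := by ring
    have : (0:ℝ) ≤ (Q:ℝ)^4 := by positivity
    linarith
  · have g2 : (N':ℝ) ≤ 8*(Q:ℝ)^(k+1)*L1 := by
      have : N' ≤ 8*Q^(k+1)*L1 := by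
        refine f3.le.trans ?_
        calc 4*Q^(k+1)*(L1+1) ≤ 4*Q^(k+1)*(L1+L1) := by gcongr
          _ = _ := by ring
      exact_mod_cast this
    rw [div_div, div_le_iff₀ (by positivity), ← hR1]
    have h5 : (1/(16*(C0:ℝ))) * (x * (C0*Q) * R) = (x/2) * (Q*R/8) := by field_simp; ring
    rw [h5]
    calc (x/2) * (Q*R/8) ≤ (8*(Q:ℝ)^(k+1)*L1) * (Q*R/8) := by
          have := a3.trans g2
          gcongr
      _ = _ := by ring
  · have h1 : (C0:ℝ)^2*(Q:ℝ)^(2*k) ≤ N := by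
      refine le_trans ?_ hbig
      have h1 : (Q:ℝ)^(2*k) ≤ (Q:ℝ)^(8*m+2*k+5) := pow_le_pow_right₀ hQ1 (by omega)
      calc (C0:ℝ)^2*(Q:ℝ)^(2*k) = 1 * C0^2*1*(Q:ℝ)^(2*k) := by ring
        _ ≤ 2*C0^2*R*(Q:ℝ)^(8*m+2*k+5) := by gcongr; norm_num
    have h2 : (C0*Q^k)^2 ≤ N := by
      have : C0^2*Q^(2*k) ≤ N := by exact_mod_cast h1
      calc (C0*Q^k)^2 = C0^2*Q^(2*k) := by ring
        _ ≤ _ := this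
    have hN1 : 1 ≤ N := by exact_mod_cast hN
    calc (C0*Q^k)^4 = ((C0*Q^k)^2)^2 := by ring
      _ ≤ N^2 := by gcongr
      _ ≤ N^3 := Nat.pow_le_pow_right hN1 (by norm_num)

open Finset

set_option maxHeartbeats 1000000 in
theorem Dat.small {k : ℕ} {h : Polynomial ℤ} {z : ∀ (p : ℕ) [Fact p.Prime], ℤ_[p]} {lam : ℕ → ℕ} {r : ℕ → ℤ} {H : ℕ → Polynomial ℤ}
    (D : Dat k h z lam r H) : ∃ E C0 : ℕ, 1 ≤ E ∧ 1 ≤ C0 ∧ ∃ u0 : ℝ, ∀ (N d : ℕ) (u t : ℝ) (A : Finset ℤ), u0 ≤ u → (N:ℝ) = Real.exp (Real.exp u) →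
      0 < d → d^(8*k^2) ≤ N → A ⊆ Icc 1 (N:ℤ) → FreeZ (H d) A → (#A:ℝ) = Real.exp (-t) * N → 1 < t → t ≤ 1/(1280*E^2) * (u * Real.log u) →
      ∃ q : ℕ, 1 ≤ q ∧ (q:ℝ) ≤ Real.exp (3*E*t) ∧ ∃ L : ℕ, 0 < L ∧ (1/(16*C0)) * N / Real.exp (u/2) * Real.exp (-(3*E*t*(k+2))) ≤ L ∧
        ∃ B ⊆ Icc 1 (L:ℤ), FreeZ (H (q * d)) B ∧ (1 + Real.exp (-(u/2))/73) * Real.exp (-t) * L < #B := by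
  obtain ⟨E, C0, hE, hC0, hd⟩ := D.dich
  obtain ⟨u0, hu0⟩ := ev_params E C0 k hE hC0
  have hER : (1:ℝ) ≤ E := by exact_mod_cast hE
  have hCR : (1:ℝ) ≤ C0 := by exact_mod_cast hC0
  refine ⟨E, C0, hE, hC0, u0, ?_⟩
  intro N d u t A hu hN hd0 hdN hA hF hcard ht1 ht
  obtain ⟨hu3, hw1, p1, p2, p3, p4⟩ := hu0 u hu
  set w := Real.log u with hw
  set X := ⌈4 / Real.exp (-t)⌉₊ with hX
  have hXe : 4 / Real.exp (-t) = 4 * Real.exp t := by rw [Real.exp_neg]; simp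
  have het : Real.exp 1 ≤ Real.exp t := Real.exp_le_exp.2 ht1.le
  have he1 := Real.exp_one_gt_d9
  have hX4 : 4 / Real.exp (-t) ≤ X := Nat.le_ceil _
  have hX5 : (X:ℝ) ≤ Real.exp (3*t) := by
    have h1 : (X:ℝ) < 4 / Real.exp (-t) + 1 := Nat.ceil_lt_add_one (by positivity)
    rw [hXe] at h1
    have h2 : Real.exp (3*t) = Real.exp t * Real.exp t * Real.exp t := by
      rw [← Real.exp_add, ← Real.exp_add]; ring_nf
    have h3 : 5 ≤ Real.exp t * Real.exp t := by exact le_trans (by norm_num) (mul_le_mul (show (5/2:ℝ) ≤ Real.exp t by linarith) (show (5/2:ℝ) ≤ Real.exp t by linarith) (by norm_num) (Real.exp_pos t).le)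
    have h4 := mul_le_mul_of_nonneg_right h3 (Real.exp_pos t).le
    rw [h2]; linarith
  have hX8 : 8 ≤ X := by
    have : (8:ℝ) ≤ X := by rw [hXe] at hX4; linarith
    exact_mod_cast this
  obtain ⟨Q, hQ⟩ : ∃ Q : ℕ, Q = X^E := ⟨_, rfl⟩
  have hXQ : X ≤ Q := hQ ▸ Nat.le_self_pow (by omega) _
  have hQb : (Q:ℝ) ≤ Real.exp (3*E*t) := by
    rw [hQ]; push_cast
    calc (X:ℝ)^E ≤ (Real.exp (3*t))^E := by gcongr
      _ = _ := by rw [← Real.exp_nat_mul]; ring_nf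
  obtain ⟨m, hm⟩ : ∃ m : ℕ, m = ⌈w/(32*E)⌉₊ := ⟨_, rfl⟩
  have hm0 : w/(32*E) ≤ m := by rw [hm]; exact Nat.le_ceil _
  have hwp : 0 < w/(32*E) := by positivity
  have hm1 : 1 ≤ m := by rw [hm]; exact Nat.ceil_pos.2 hwp
  have hmR : (1:ℝ) ≤ m := by exact_mod_cast hm1
  have hm2 : (m:ℝ) ≤ w/(32*E) + 1 := by rw [hm]; exact (Nat.ceil_lt_add_one hwp.le).le
  have hm3 : (m:ℝ) ≤ w + 1 := by
    have : w/(32*E) ≤ w := div_le_self (by linarith) (by linarith)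
    linarith
  have hk0 : (0:ℝ) ≤ k := Nat.cast_nonneg k
  have huw : 0 < u * w := by positivity
  have htuw : t ≤ u * w := by
    refine ht.trans ?_
    have : 1/(1280*(E:ℝ)^2) ≤ 1 := by
      rw [div_le_one (by positivity)]
      linarith [one_le_pow₀ hER (n := 2)]
    exact mul_le_of_le_one_left huw.le this
  have hNp : (0:ℝ) < N := by rw [hN]; exact Real.exp_pos _
  have hbig : 2*(C0:ℝ)^2*Real.exp (u/2)*(Q:ℝ)^(8*m+2*k+5) ≤ N := by
    have h1 : 2*(C0:ℝ)^2 = Real.exp (Real.log (2*C0^2)) := by rw [Real.exp_log (by positivity)]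
    have h2 : (Q:ℝ)^(8*m+2*k+5) ≤ Real.exp ((8*(w+1)+2*k+5) * (3*E*(u*w))) := by
      calc (Q:ℝ)^(8*m+2*k+5) ≤ (Real.exp (3*E*t))^(8*m+2*k+5) := by gcongr
        _ = Real.exp ((8*m+2*k+5)*(3*E*t)) := by rw [← Real.exp_nat_mul]; push_cast; ring_nf
        _ ≤ _ := by
          apply Real.exp_le_exp.2
          gcongr
    rw [h1, hN]
    calc _ ≤ Real.exp (Real.log (2*C0^2)) * Real.exp (u/2) * Real.exp ((8*(w+1)+2*k+5) * (3*E*(u*w))) := by gcongr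
      _ ≤ _ := by
        rw [← Real.exp_add, ← Real.exp_add]
        exact Real.exp_le_exp.2 p1
  obtain ⟨N', L1, s1, s2, s3, s4, s5, s6, s7, s8⟩ := sizes C0 Q k m N (Real.exp (u/2)) hC0 (by omega) hm1
    (Real.one_le_exp (by linarith)) hbig
  obtain ⟨Y, hY⟩ : ∃ Y : ℝ, Y = (2 * ((8*m : ℕ):ℝ) / ((1/(E:ℝ))/2))^(8*m*2^(16*m*E)) := ⟨_, rfl⟩
  have hYb : Y ≤ Real.exp (u/(40*E)) := hY ▸ Y_bound E m u w hE hm1 hw1 hm2 p2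
  have hY1 : 1 ≤ Y := by
    rw [hY]; apply one_le_pow₀
    have hb : 2 * ((8*m : ℕ):ℝ) / ((1/(E:ℝ))/2) = 32*(m*E) := by push_cast; field_simp; norm_num
    rw [hb]; linarith [one_le_mul_of_one_le_of_one_le hmR hER]
  have hsig : Real.exp (-t) ^ (-(1/(m:ℝ))) ≤ Real.exp (u/(40*E)) := by
    rw [← Real.exp_mul]
    apply Real.exp_le_exp.2
    have : -t * (-(1/(m:ℝ))) = t / m := by ring
    rw [this, div_le_iff₀ (by linarith)]
    refine ht.trans ?_
    calc 1/(1280*(E:ℝ)^2) * (u*w) = u/(40*E) * (w/(32*E)) := by field_simp; norm_num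
      _ ≤ _ := by gcongr
  obtain ⟨Q0, hQ0⟩ : ∃ n : ℕ, n = ⌈Real.exp (u/4)⌉₊ := ⟨_, rfl⟩
  have hQ0a : Real.exp (u/4) ≤ Q0 := by rw [hQ0]; exact Nat.le_ceil _
  have hQ0b : (Q0:ℝ) ≤ 2*Real.exp (u/4) := by
    have h1 : (Q0:ℝ) < Real.exp (u/4) + 1 := by rw [hQ0]; exact Nat.ceil_lt_add_one (Real.exp_pos _).le
    have h2 : 1 ≤ Real.exp (u/4) := Real.one_le_exp (by linarith)
    linarith
  have hQ01 : 1 ≤ Q0 := by rw [hQ0]; exact Nat.ceil_pos.2 (Real.exp_pos _)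
  have hresT : (Q0:ℝ)^(-((1/(E:ℝ))/2)) ≤ Real.exp (-(u/(8*E))) := by
    calc (Q0:ℝ)^(-((1/(E:ℝ))/2)) ≤ (Real.exp (u/4))^(-((1/(E:ℝ))/2)) := by
          apply Real.rpow_le_rpow_of_nonpos (Real.exp_pos _) hQ0a
          have : 0 < (1/(E:ℝ))/2 := by positivity
          linarith
      _ = _ := by rw [← Real.exp_mul]; congr 1; field_simp; norm_num
  have hres := hd d N N' Q0 X L1 (Real.exp (-t)) (Real.exp (-(u/2))/73) (8*Y*Real.exp (-t) ^ (-(1/(m:ℝ)))) A hd0 hA hcard (Real.exp_pos _) hF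
    (by omega) hX4
    (hc1_of _ d 1 N k (by rw [pow_mul, ← hQ, mul_one]; exact s8) (by simpa using hdN))
    (by rw [← hQ]; exact s1) (by positivity)
    (by have : Real.exp (-(u/2)) ≤ 1 := Real.exp_le_one_iff.2 (by linarith)
        linarith)
    (by rw [← hQ]; exact s3) hQ01 (by positivity)
    (by
      intro _
      refine ⟨Real.exp_le_one_iff.2 (by linarith), m, Y, hm1, by rw [← hQ]; exact s4, hY1, le_rfl, ?_⟩
      intro q hq1 _
      rw [hY]; refine partE_Y m hm1 ((1/(E:ℝ))/2) (by positivity) ?_ (2^(16*m*E)) ?_ q hq1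
      · have : 1/(E:ℝ) ≤ 1 := by rw [div_le_one (by positivity)]; exact hER
        linarith
      · have : ((8*m:ℕ):ℝ)/((1/(E:ℝ))/2) = ((16*m*E:ℕ):ℝ) := by push_cast; field_simp; norm_num
        rw [this, Real.rpow_natCast]; push_cast; exact le_rfl)
  rw [← hQ] at hres
  rcases hres with ⟨q, hq1, hq2, L, hL, B, hB, hBF, hBc⟩ | hbad
  · refine ⟨q, hq1, le_trans (by exact_mod_cast hq2) hQb, L, by omega, ?_, B, hB, hBF, hBc⟩
    have hLR : (L1:ℝ) ≤ L := by exact_mod_cast hL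
    refine le_trans ?_ (s7.trans hLR)
    rw [div_eq_mul_inv _ ((Q:ℝ)^(k+2))]
    gcongr
    have hQp : (0:ℝ) < Q := by
      have : 0 < Q := by omega
      exact_mod_cast this
    rw [Real.exp_neg]
    gcongr
    calc (Q:ℝ)^(k+2) ≤ (Real.exp (3*E*t))^(k+2) := by gcongr
      _ = _ := by rw [← Real.exp_nat_mul]; push_cast; ring_nf
  · exfalso
    have hexp2 : Real.exp (u/4) * Real.exp (-(u/2)) = Real.exp (-(u/4)) := by
      rw [← Real.exp_add]; ring_nf
    have g1 : 8 * (Q0:ℝ) * (Real.exp (-(u/2))/73 + 4 * N' / N) ≤ 1/500 := by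
      have h1 : 4 * (N':ℝ) / N ≤ 4 * Real.exp (-(u/2)) := by
        rw [mul_div_assoc, Real.exp_neg, ← one_div]; linarith
      have h2 := Real.exp_pos (-(u/2))
      calc 8 * (Q0:ℝ) * (Real.exp (-(u/2))/73 + 4 * N' / N) ≤ 8 * (2*Real.exp (u/4)) * (5 * Real.exp (-(u/2))) := by
            gcongr; linarith
        _ = 80 * (Real.exp (u/4) * Real.exp (-(u/2))) := by ring
        _ ≤ _ := by rw [hexp2]; exact p4
    have g3 : 4 * ((Q0:ℝ)^(-((1/(E:ℝ))/2)) * (8*Y*Real.exp (-t) ^ (-(1/(m:ℝ))))) ≤ 1/500 := by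
      calc 4 * ((Q0:ℝ)^(-((1/(E:ℝ))/2)) * (8*Y*Real.exp (-t) ^ (-(1/(m:ℝ)))))
          ≤ 4 * (Real.exp (-(u/(8*E))) * (8*Real.exp (u/(40*E))*Real.exp (u/(40*E)))) := by gcongr
        _ = 32 * (Real.exp (-(u/(8*E))) * (Real.exp (u/(40*E))*Real.exp (u/(40*E)))) := by ring
        _ = 32 * Real.exp (-(3*u/(40*E))) := by
          rw [← Real.exp_add, ← Real.exp_add]; congr 2; field_simp; norm_num
        _ ≤ _ := p3
    linarith

open Finset

theorem d_pow_le (d N k : ℕ) (hk : 0 < k) (hN : 1 ≤ N) (hd : (d : ℝ) ≤ (N : ℝ) ^ ((1 : ℝ) / ((2 : ℝ) ^ (k + 2) * (k : ℝ) ^ 2))) : d^(8*k^2) ≤ N := by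
  have hkR : (0:ℝ) < k := by exact_mod_cast hk
  have hNR : (1:ℝ) ≤ N := by exact_mod_cast hN
  have : (d:ℝ)^(8*k^2) ≤ N := by
    calc (d:ℝ)^(8*k^2) ≤ ((N : ℝ) ^ ((1 : ℝ) / ((2 : ℝ) ^ (k + 2) * (k : ℝ) ^ 2)))^(8*k^2) := by gcongr
      _ = (N:ℝ)^(8/(2:ℝ)^(k+2)) := by
        rw [← Real.rpow_natCast, ← Real.rpow_mul (by linarith)]
        congr 1; push_cast; field_simp
      _ ≤ (N:ℝ)^(1:ℝ) := by
        apply Real.rpow_le_rpow_of_exponent_le hNR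
        rw [div_le_one (by positivity)]
        calc (8:ℝ) = 2^3 := by norm_num
          _ ≤ 2^(k+2) := pow_le_pow_right₀ (by norm_num) (by omega)
      _ = N := Real.rpow_one _
  exact_mod_cast this

theorem stmt19
    (k : ℕ) (hk : 0 < k)
    (h : Polynomial ℤ) (hdeg : h.natDegree = k) (hlead : 0 < h.leadingCoeff)
    (hint : ∀ q : ℕ, 0 < q → ∃ n : ℤ, (q : ℤ) ∣ h.eval n)
    (z : ∀ (p : ℕ) [Fact p.Prime], ℤ_[p])
    (hz : ∀ (p : ℕ) [Fact p.Prime], Polynomial.aeval (z p) h = 0)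
    (lam : ℕ → ℕ) (hlam1 : lam 1 = 1)
    (hlamMul : ∀ a b : ℕ, lam (a * b) = lam a * lam b)
    (hlamP : ∀ (p : ℕ) [Fact p.Prime],
      lam p = p ^ Polynomial.rootMultiplicity (z p) (h.map (algebraMap ℤ ℤ_[p])))
    (r : ℕ → ℤ)
    (hr : ∀ d : ℕ, 0 < d → -(d : ℤ) < r d ∧ r d ≤ 0)
    (hrz : ∀ d : ℕ, 0 < d → ∀ (p : ℕ) [Fact p.Prime], ∀ α : ℕ, p ^ α ∣ d →
      (p : ℤ_[p]) ^ α ∣ (z p - (r d : ℤ_[p])))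
    (H : ℕ → Polynomial ℤ)
    (hH : ∀ d : ℕ, 0 < d →
      Polynomial.C (lam d : ℤ) * H d =
        h.comp (Polynomial.C (r d) + Polynomial.C (d : ℤ) * Polynomial.X))
    :
    ∃ c C ε : ℝ, 0 < c ∧ 1 ≤ C ∧ 0 < ε ∧ ∃ N₀ : ℕ, ∀ N : ℕ, N₀ ≤ N → ∀ d : ℕ, 0 < d →
      (d : ℝ) ≤ (N : ℝ) ^ ((1 : ℝ) / ((2 : ℝ) ^ (k + 2) * (k : ℝ) ^ 2)) →
      ∀ A : Finset ℕ, A ⊆ Finset.Icc 1 N →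
        (∀ a ∈ A, ∀ b ∈ A, a ≠ b →
          ∀ n : ℕ, 0 < n → (a : ℤ) - (b : ℤ) ≠ (H d).eval (n : ℤ)) →
        let σ : ℝ := (A.card : ℝ) / N
        σ ≥ Real.log N ^ (-(ε * Real.log (Real.log (Real.log N)))) →
        let ν : ℝ := Real.log N ^ (-(1 : ℝ) / 2) *
          Real.exp (-c * Real.log (1 / σ) / Real.log (Real.log (1 / σ)))
        ∃ Nst : ℕ, 0 < Nst ∧
          (Nst : ℝ) ≥ c * σ ^ (C : ℝ) * N / Real.log N ^ ((1 : ℝ) / 2) ∧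
          ∃ q : ℕ, 1 ≤ q ∧ (q : ℝ) ≤ C * σ ^ (-(C : ℝ)) ∧
          ∃ Ast : Finset ℕ, Ast ⊆ Finset.Icc 1 Nst ∧
            (∀ a ∈ Ast, ∀ b ∈ Ast, a ≠ b →
              ∀ n : ℕ, 0 < n → (a : ℤ) - (b : ℤ) ≠ (H (q * d)).eval (n : ℤ)) ∧
            (Ast.card : ℝ) / Nst ≥ (1 + ν / 73) * σ := by
  have D : Dat k h z lam r H := ⟨hk, hdeg, hlead, hz, hlam1, hlamMul, hlamP, hr, hrz, hH⟩
  obtain ⟨E, C0, hE, hC0, u0, hsm⟩ := D.small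
  obtain ⟨N1, hN1⟩ := D.big
  have hER : (1:ℝ) ≤ E := by exact_mod_cast hE
  have hCR : (1:ℝ) ≤ C0 := by exact_mod_cast hC0
  have hkR : (1:ℝ) ≤ k := by exact_mod_cast hk
  refine ⟨1/(16*C0), 3*E*(k+2), 1/(1280*E^2), by positivity, by nlinarith, by positivity,
    max N1 ⌈Real.exp (Real.exp (max u0 1))⌉₊, ?_⟩
  intro N hN d hd0 hd A hA hF σ hσ ν
  have hNb : Real.exp (Real.exp (max u0 1)) ≤ N := Nat.ceil_le.1 ((le_max_right _ _).trans hN)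
  have hNp : (0:ℝ) < N := (Real.exp_pos _).trans_le hNb
  have hNn : 1 ≤ N := by exact_mod_cast hNp
  have hℓ : Real.exp (max u0 1) ≤ Real.log N := (Real.le_log_iff_exp_le hNp).2 hNb
  have hℓp : 0 < Real.log N := (Real.exp_pos _).trans_le hℓ
  have hu : max u0 1 ≤ Real.log (Real.log N) := (Real.le_log_iff_exp_le hℓp).2 hℓ
  obtain ⟨u, hue⟩ : ∃ u, u = Real.log (Real.log N) := ⟨_, rfl⟩
  rw [← hue] at hu hσ
  have hlogN : Real.log N = Real.exp u := by rw [hue, Real.exp_log hℓp]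
  have hNe : (N:ℝ) = Real.exp (Real.exp u) := by rw [← hlogN, Real.exp_log hNp]
  have hdN := d_pow_le d N k hk hNn hd
  set A' : Finset ℤ := A.map Nat.castEmbedding with hA'
  have hcardA : #A' = #A := card_map _
  have hA's : A' ⊆ Icc 1 (N:ℤ) := by
    intro x hx
    rw [hA', mem_map] at hx
    obtain ⟨a, ha, rfl⟩ := hx
    have := mem_Icc.1 (hA ha)
    simp only [Nat.castEmbedding_apply, mem_Icc]
    omega
  have hA'F : FreeZ (H d) A' := by
    intro a ha b hb hab n hn
    rw [hA', mem_map] at ha hb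
    obtain ⟨a, ha, rfl⟩ := ha
    obtain ⟨b, hb, rfl⟩ := hb
    refine hF a ha b hb ?_ n hn
    rintro rfl; exact hab rfl
  have hbig := hN1 N ((le_max_left _ _).trans hN) d hd0 hdN A' hA's hA'F
  rw [hcardA] at hbig
  have hσl : σ < Real.exp (-1) := by
    show (#A:ℝ)/N < _
    rw [div_lt_iff₀ hNp]; exact hbig
  have hσp : 0 < σ := by
    refine lt_of_lt_of_le ?_ hσ
    exact Real.rpow_pos_of_pos hℓp _
  obtain ⟨t, ht⟩ : ∃ t, t = -Real.log σ := ⟨_, rfl⟩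
  have hσt : σ = Real.exp (-t) := by rw [ht, neg_neg, Real.exp_log hσp]
  have ht1 : 1 < t := by
    rw [hσt, Real.exp_lt_exp] at hσl; linarith
  have htu : t ≤ 1/(1280*E^2) * (u * Real.log u) := by
    rw [hlogN, ← Real.exp_mul, hσt, ge_iff_le, Real.exp_le_exp] at hσ
    nlinarith
  have hcA : (#A':ℝ) = Real.exp (-t) * N := by
    rw [hcardA, ← hσt]; show (#A:ℝ) = #A/N * N; exact (div_mul_cancel₀ _ hNp.ne').symm
  obtain ⟨q, hq1, hq2, L, hL0, hL, B, hB, hBF, hBc⟩ := hsm N d u t A' ((le_max_left _ _).trans hu) hNe hd0 hdN hA's hA'F hcA ht1 htu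
  refine ⟨L, hL0, ?_, q, hq1, ?_, (Icc 1 L).filter (fun n : ℕ => (n:ℤ) ∈ B), filter_subset _ _, ?_, ?_⟩
  · rw [hσt, ← Real.exp_mul, hlogN, ← Real.exp_mul]
    refine le_trans (le_of_eq ?_) hL
    rw [show u * (1/2) = u/2 by ring, show -t * (3*E*(k+2)) = -(3*E*t*(k+2)) by ring]
    ring
  · rw [hσt, ← Real.exp_mul, show -t * -(3*E*((k:ℝ)+2)) = 3*E*t + 3*E*t*(k+1) by ring, Real.exp_add]
    have h1 : 1 ≤ Real.exp (3*E*t*(k+1)) := Real.one_le_exp (by positivity)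
    have h2 : (1:ℝ) ≤ 3*E*(k+2) := by nlinarith
    refine hq2.trans ?_
    have h3 := one_le_mul_of_one_le_of_one_le h2 h1
    have h4 := mul_le_mul_of_nonneg_left h3 (Real.exp_pos (3*E*t)).le
    linarith
  · intro a ha b hb hab n hn
    exact hBF _ (mem_filter.1 ha).2 _ (mem_filter.1 hb).2 (by exact_mod_cast hab) n hn
  · have hcB : #B = #((Icc 1 L).filter (fun n : ℕ => (n:ℤ) ∈ B)) := by
      have : B = ((Icc 1 L).filter (fun n : ℕ => (n:ℤ) ∈ B)).map Nat.castEmbedding := by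
        ext x
        rw [mem_map]
        constructor
        · intro hx
          have := mem_Icc.1 (hB hx)
          have h2 : ((x.toNat:ℕ):ℤ) = x := Int.toNat_of_nonneg (by omega)
          refine ⟨x.toNat, ?_, h2⟩
          rw [mem_filter, mem_Icc]
          refine ⟨by omega, ?_⟩
          rw [h2]; exact hx
        · rintro ⟨a, ha, rfl⟩
          exact (mem_filter.1 ha).2
      conv_lhs => rw [this]
      exact card_map _
    rw [← hcB, ge_iff_le, le_div_iff₀ (by exact_mod_cast hL0)]
    refine le_trans ?_ hBc.le
    rw [← hσt]
    have hν : ν ≤ Real.exp (-(u/2)) := by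
      show Real.log N ^ (-(1 : ℝ) / 2) * Real.exp (-(1/(16*C0)) * Real.log (1 / σ) / Real.log (Real.log (1 / σ))) ≤ _
      have e1 : Real.log (1/σ) = t := by rw [one_div, Real.log_inv, ht]
      rw [e1, hlogN, ← Real.exp_mul, ← Real.exp_add]
      apply Real.exp_le_exp.2
      have e2 : 0 < Real.log t := Real.log_pos ht1
      have e3 : 0 ≤ (1/(16*(C0:ℝ))) * t / Real.log t := by positivity
      have e4 : -(1/(16*(C0:ℝ))) * t / Real.log t = -((1/(16*(C0:ℝ))) * t / Real.log t) := by ring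
      rw [e4]; linarith
    have hL0R : (0:ℝ) ≤ L := Nat.cast_nonneg L
    refine mul_le_mul_of_nonneg_right (mul_le_mul_of_nonneg_right ?_ hσp.le) hL0R
    linarith
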